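/- Let n ≥ 3 be an integer and let F_n denote the n-th Fibonacci number. Then the set of integer solutions (x, y) of the Thue equation x·(x − F_n·y)·(x − 2^n·y) − y³ = ±1 (i.e., the left-hand side equals 1 or −1) is exactly {(1,0), (−1,0), (0,1), (0,−1), (F_n,1), (−F_n,−1), (2^n,1), (−2^n,−1)}. -/

import Mathlib

/-- Taylor expansion of an entire function with entire remainder. -/
lemma exists_entire_taylor_remainder {f : ℂ → ℂ} (hf : Differentiable ℂ f) (a : ℂ) (n : ℕ) :
    ∃ q : ℂ → ℂ, Differentiable ℂ q ∧ ∀ z, f z =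
      ∑ s ∈ Finset.range n, iteratedDeriv s f a / (s.factorial : ℂ) * (z - a) ^ s
        + q z * (z - a) ^ n := by
  have key : ∀ n : ℕ, Differentiable ℂ ((Function.swap dslope a)^[n] f) ∧ ∀ z, f z =
      ∑ s ∈ Finset.range n, iteratedDeriv s f a / (s.factorial : ℂ) * (z - a) ^ s
        + ((Function.swap dslope a)^[n] f) z * (z - a) ^ n := by
    intro n
    induction n with
    | zero => exact ⟨by simpa using hf, by simp⟩
    | succ n ih =>
      obtain ⟨hd, he⟩ := ih
      have hval : ((Function.swap dslope a)^[n] f) a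
          = iteratedDeriv n f a / (n.factorial : ℂ) := by
        have h1 := (hf.analyticAt a).hasFPowerSeriesAt
        have h2 := h1.has_fpower_series_iterate_dslope_fslope n
        rw [← h2.coeff_zero 1, ← FormalMultilinearSeries.coeff,
          FormalMultilinearSeries.coeff_iterate_fslope]
        simp [FormalMultilinearSeries.coeff_ofScalars]
      rw [Function.iterate_succ_apply']
      refine ⟨?_, fun z => ?_⟩
      · have := (Complex.differentiableOn_dslope (f := (Function.swap dslope a)^[n] f)
          (s := Set.univ) (c := a) Filter.univ_mem).2 hd.differentiableOn
        exact differentiableOn_univ.1 this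
      · rw [Finset.sum_range_succ, ← hval]
        have h3 := sub_smul_dslope ((Function.swap dslope a)^[n] f) a z
        simp only [smul_eq_mul] at h3
        have h4 := he z
        simp only [Function.swap] at *
        rw [h4]
        linear_combination (-(z - a) ^ n) * h3
  exact ⟨_, key n⟩

lemma norm_taylor_sum_le {c : ℕ → ℂ} {ε ρ : ℝ} {k : ℕ} (hρ : 1 ≤ ρ)
    (hc : ∀ s ≤ k, ‖c s‖ ≤ ε) {w : ℂ} (hw : ‖w‖ ≤ 2 * ρ) :
    ‖∑ s ∈ Finset.range (k + 1), c s / (s.factorial : ℂ) * w ^ s‖ ≤ 3 * ε * (4 * ρ) ^ k := by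
  have hε : 0 ≤ ε := (norm_nonneg _).trans (hc 0 (Nat.zero_le _))
  calc ‖∑ s ∈ Finset.range (k + 1), c s / (s.factorial : ℂ) * w ^ s‖
      ≤ ∑ s ∈ Finset.range (k + 1), ε * (2 * ρ) ^ k * (1 / (s.factorial : ℝ)) := by
        refine (norm_sum_le _ _).trans (Finset.sum_le_sum fun s hs => ?_)
        have hs' : s ≤ k := Nat.lt_succ_iff.1 (Finset.mem_range.1 hs)
        rw [norm_mul, norm_div, norm_pow, Complex.norm_natCast]
        have h1 : ‖w‖ ^ s ≤ (2 * ρ) ^ k :=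
          (pow_le_pow_left₀ (norm_nonneg _) hw s).trans (pow_le_pow_right₀ (by linarith) hs')
        have h2 : ‖c s‖ / (s.factorial : ℝ) ≤ ε / s.factorial := by
          gcongr; exact hc s hs'
        calc _ ≤ ε / s.factorial * (2 * ρ) ^ k := by gcongr
          _ = _ := by ring
    _ = ε * (2 * ρ) ^ k * ∑ s ∈ Finset.range (k + 1), (1 / (s.factorial : ℝ)) := by
        rw [Finset.mul_sum]
    _ ≤ ε * (4 * ρ) ^ k * 3 := by
        have h3 : ∑ s ∈ Finset.range (k + 1), (1 / (s.factorial : ℝ)) ≤ 3 := by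
          have := Real.sum_le_exp_of_nonneg (x := 1) zero_le_one (k + 1)
          simp only [one_pow] at this
          exact this.trans (by linarith [Real.exp_one_lt_d9])
        gcongr
        norm_num
    _ = _ := by ring

/-- Hermite interpolation at the points `0, 1, 2, …`, each repeated `μ` times. -/
lemma exists_hermite_interpolation {f : ℂ → ℂ} (hf : Differentiable ℂ f) {μ h : ℕ}
    {ε ρ : ℝ} (hρ : 1 ≤ ρ) (hh : (h : ℝ) ≤ ρ)
    (hε : ∀ l < h, ∀ k < μ, ‖iteratedDeriv k f (l : ℂ)‖ ≤ ε) (k : ℕ) :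
    ∀ i, i + k < μ * h → ∃ p q : ℂ → ℂ, Differentiable ℂ p ∧ Differentiable ℂ q ∧
      (∀ z, f z = p z + q z * ∏ m ∈ Finset.range (k + 1), (z - (((i + m) / μ : ℕ) : ℂ))) ∧
      ∀ z, ‖z‖ ≤ ρ → ‖p z‖ ≤ 3 * ε * (4 * ρ) ^ k := by
  have hnode : ∀ m, m < μ * h → m / μ < h := fun m hm =>
    Nat.div_lt_of_lt_mul hm
  have hdist : ∀ m, m < μ * h → ∀ z : ℂ, ‖z‖ ≤ ρ → ‖z - ((m / μ : ℕ) : ℂ)‖ ≤ 2 * ρ := by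
    intro m hm z hz
    have h1 : ((m / μ : ℕ) : ℝ) ≤ h := by exact_mod_cast (hnode m hm).le
    calc _ ≤ ‖z‖ + ‖((m / μ : ℕ) : ℂ)‖ := norm_sub_le _ _
      _ ≤ _ := by rw [Complex.norm_natCast]; linarith
  have base : ∀ k i, i + k < μ * h → i / μ = (i + k) / μ →
      ∃ p q : ℂ → ℂ, Differentiable ℂ p ∧ Differentiable ℂ q ∧
      (∀ z, f z = p z + q z * ∏ m ∈ Finset.range (k + 1), (z - (((i + m) / μ : ℕ) : ℂ))) ∧
      ∀ z, ‖z‖ ≤ ρ → ‖p z‖ ≤ 3 * ε * (4 * ρ) ^ k := by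
    intro k i hik hE
    have hμ : 0 < μ := Nat.pos_of_mul_pos_right (by omega : 0 < μ * h)
    have hkμ : k < μ := by
      have h1 := Nat.div_add_mod i μ
      have h2 := Nat.div_add_mod (i + k) μ
      have h3 := Nat.mod_lt (i + k) hμ
      rw [hE] at h1
      omega
    obtain ⟨q, hq, hfq⟩ := exists_entire_taylor_remainder hf ((i / μ : ℕ) : ℂ) (k + 1)
    refine ⟨fun z => ∑ s ∈ Finset.range (k + 1), iteratedDeriv s f ((i / μ : ℕ) : ℂ) /
      (s.factorial : ℂ) * (z - ((i / μ : ℕ) : ℂ)) ^ s, q, by fun_prop, hq, fun z => ?_, ?_⟩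
    · have : ∏ m ∈ Finset.range (k + 1), (z - (((i + m) / μ : ℕ) : ℂ))
          = (z - ((i / μ : ℕ) : ℂ)) ^ (k + 1) := by
        rw [Finset.prod_congr rfl (g := fun _ => (z - ((i / μ : ℕ) : ℂ)))]
        · simp
        · intro m hm
          have hm' : m ≤ k := Nat.lt_succ_iff.1 (Finset.mem_range.1 hm)
          have h1 : i / μ ≤ (i + m) / μ := Nat.div_le_div_right (by omega)
          have h2 : (i + m) / μ ≤ (i + k) / μ := Nat.div_le_div_right (by omega)
          rw [show (i + m) / μ = i / μ by omega]
      rw [this]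
      exact hfq z
    · intro z hz
      exact norm_taylor_sum_le hρ
        (fun s hs => hε _ (hnode i (by omega)) s (by omega)) (hdist i (by omega) z hz)
  induction k with
  | zero => intro i hi; exact base 0 i hi rfl
  | succ k ih =>
    intro i hi
    by_cases hE : i / μ = (i + (k + 1)) / μ
    · exact base (k + 1) i hi hE
    have hlt : i / μ + 1 ≤ (i + (k + 1)) / μ := by
      have := Nat.div_le_div_right (c := μ) (show i ≤ i + (k + 1) by omega)
      omega
    set xi : ℂ := ((i / μ : ℕ) : ℂ) with hxi
    set xj : ℂ := (((i + (k + 1)) / μ : ℕ) : ℂ) with hxj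
    have hgap : 1 ≤ ‖xj - xi‖ := by
      have : xj - xi = (((i + (k + 1)) / μ - i / μ : ℕ) : ℂ) := by
        rw [hxi, hxj, Nat.cast_sub (by omega)]
      rw [this, Complex.norm_natCast]
      exact_mod_cast (by omega : 1 ≤ (i + (k + 1)) / μ - i / μ)
    have hne : xj - xi ≠ 0 := by
      intro h0; rw [h0, norm_zero] at hgap; linarith
    obtain ⟨p1, q1, hp1, hq1, hf1, hb1⟩ := ih (i + 1) (by omega)
    obtain ⟨p2, q2, hp2, hq2, hf2, hb2⟩ := ih i (by omega)
    refine ⟨fun z => ((z - xi) * p1 z - (z - xj) * p2 z) / (xj - xi),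
      fun z => (q1 z - q2 z) / (xj - xi), by fun_prop, by fun_prop, fun z => ?_, fun z hz => ?_⟩
    · have e1 : ∏ m ∈ Finset.range (k + 1 + 1), (z - (((i + m) / μ : ℕ) : ℂ))
          = (∏ m ∈ Finset.range (k + 1), (z - (((i + m) / μ : ℕ) : ℂ))) * (z - xj) := by
        rw [Finset.prod_range_succ]
      have e2 : ∏ m ∈ Finset.range (k + 1 + 1), (z - (((i + m) / μ : ℕ) : ℂ))
          = (∏ m ∈ Finset.range (k + 1), (z - (((i + 1 + m) / μ : ℕ) : ℂ))) * (z - xi) := by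
        rw [Finset.prod_range_succ', add_zero]
        congr 1
        refine Finset.prod_congr rfl fun m _ => ?_
        rw [show i + (m + 1) = i + 1 + m by ring]
      have h1 := hf1 z
      have h2 := hf2 z
      rw [div_mul_eq_mul_div, ← add_div, eq_div_iff hne]
      linear_combination (z - xi) * h1 - (z - xj) * h2 - q1 z * e2 + q2 z * e1
    · rw [norm_div]
      refine (div_le_self (norm_nonneg _) hgap).trans ?_
      have d1 := hdist i (by omega) z hz
      have d2 := hdist (i + (k + 1)) hi z hz
      have b1 := hb1 z hz
      have b2 := hb2 z hz
      calc _ ≤ ‖z - xi‖ * ‖p1 z‖ + ‖z - xj‖ * ‖p2 z‖ := by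
            refine (norm_sub_le _ _).trans ?_
            rw [norm_mul, norm_mul]
        _ ≤ 2 * ρ * (3 * ε * (4 * ρ) ^ k) + 2 * ρ * (3 * ε * (4 * ρ) ^ k) := by
            gcongr
        _ = _ := by ring

/-- Schwarz-type estimate: an entire function with small derivatives at `0, 1, …, h - 1`
is small on a disc. -/
theorem norm_le_of_small_derivatives {f : ℂ → ℂ} (hf : Differentiable ℂ f) {μ h : ℕ}
    (hμ : 0 < μ) (hh0 : 0 < h) {ε W C : ℝ} (hh : (h : ℝ) ≤ W)
    (hε : ∀ l < h, ∀ k < μ, ‖iteratedDeriv k f (l : ℂ)‖ ≤ ε)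
    (hC : ∀ z, ‖z‖ ≤ 7 * W → ‖f z‖ ≤ C) {z : ℂ} (hz : ‖z‖ ≤ W) :
    ‖f z‖ ≤ 6 * ε * (28 * W) ^ (μ * h) + C / 3 ^ (μ * h) := by
  have hε0 : 0 ≤ ε := (norm_nonneg _).trans (hε 0 hh0 0 hμ)
  have hW1 : 1 ≤ W := le_trans (by exact_mod_cast hh0) hh
  have hT : 0 < μ * h := Nat.mul_pos hμ hh0
  obtain ⟨p, q, hp, hq, hfpq, hpb⟩ := exists_hermite_interpolation hf (ρ := 7 * W)
    (by linarith) (by linarith) hε (μ * h - 1) 0 (by omega)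
  rw [Nat.sub_add_cancel hT] at hfpq
  set T := μ * h with hTdef
  set P : ℂ → ℂ := fun z => ∏ m ∈ Finset.range T, (z - (((0 + m) / μ : ℕ) : ℂ)) with hP
  have hnode : ∀ m ∈ Finset.range T, (((0 + m) / μ : ℕ) : ℝ) ≤ W := by
    intro m hm
    have : (0 + m) / μ < h := by
      rw [zero_add]; exact Nat.div_lt_of_lt_mul (Finset.mem_range.1 hm)
    exact le_trans (by exact_mod_cast this.le) hh
  have hPup : ∀ z : ℂ, ‖z‖ ≤ W → ‖P z‖ ≤ (2 * W) ^ T := by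
    intro z hz
    rw [hP, norm_prod]
    calc _ ≤ ∏ m ∈ Finset.range T, (2 * W) := by
          refine Finset.prod_le_prod (fun _ _ => norm_nonneg _) fun m hm => ?_
          refine (norm_sub_le _ _).trans ?_
          rw [Complex.norm_natCast]; linarith [hnode m hm]
      _ = _ := by simp
  have hPlow : ∀ z : ℂ, ‖z‖ = 7 * W → (6 * W) ^ T ≤ ‖P z‖ := by
    intro z hz
    rw [hP, norm_prod]
    calc (6 * W) ^ T = ∏ m ∈ Finset.range T, (6 * W) := by simp
      _ ≤ _ := by
          refine Finset.prod_le_prod (fun _ _ => by linarith) fun m hm => ?_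
          refine le_trans ?_ (norm_sub_norm_le _ _)
          rw [Complex.norm_natCast]; linarith [hnode m hm]
  set e : ℝ := 3 * ε * (4 * (7 * W)) ^ (T - 1) with he
  have hele : e ≤ 3 * ε * (28 * W) ^ T := by
    rw [he, show 4 * (7 * W) = 28 * W by ring]
    gcongr
    · linarith
    · omega
  have he0 : 0 ≤ e := by positivity
  have hqb : ∀ z : ℂ, ‖z‖ ≤ 7 * W → ‖q z‖ ≤ (C + e) / (6 * W) ^ T := by
    intro z hz
    have hfr : ∀ w ∈ frontier (Metric.ball (0 : ℂ) (7 * W)), ‖q w‖ ≤ (C + e) / (6 * W) ^ T := by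
      intro w hw
      rw [frontier_ball _ (by positivity : 7 * W ≠ 0), mem_sphere_zero_iff_norm] at hw
      rw [le_div_iff₀ (by positivity)]
      calc ‖q w‖ * (6 * W) ^ T ≤ ‖q w‖ * ‖P w‖ := by gcongr; exact hPlow w hw
        _ = ‖f w - p w‖ := by rw [← norm_mul, hfpq w]; congr 1; ring
        _ ≤ ‖f w‖ + ‖p w‖ := norm_sub_le _ _
        _ ≤ C + e := add_le_add (hC w hw.le) (hpb w hw.le)
    refine Complex.norm_le_of_forall_mem_frontier_norm_le (U := Metric.ball (0 : ℂ) (7 * W))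
      Metric.isBounded_ball hq.diffContOnCl hfr ?_
    rw [closure_ball _ (by positivity : 7 * W ≠ 0)]
    simpa using hz
  have hz7 : ‖z‖ ≤ 7 * W := by linarith
  have hC0 : 0 ≤ C := (norm_nonneg _).trans (hC z hz7)
  calc ‖f z‖ ≤ ‖p z‖ + ‖q z‖ * ‖P z‖ := by
        rw [hfpq z, ← norm_mul]; exact norm_add_le _ _
    _ ≤ e + (C + e) / (6 * W) ^ T * (2 * W) ^ T := by
        gcongr
        · exact hpb z hz7
        · exact hqb z hz7
        · exact hPup z hz
    _ = e + (C + e) / 3 ^ T := by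
        rw [show (6 * W) ^ T = 3 ^ T * (2 * W) ^ T by rw [← mul_pow]; ring]
        field_simp
    _ ≤ e + (C / 3 ^ T + e) := by
        rw [add_div]
        gcongr
        exact div_le_self he0 (one_le_pow₀ (by norm_num))
    _ ≤ _ := by linarith

/-- Pigeonhole principle for real linear forms in integer unknowns. -/
theorem exists_int_vector_small_forms {E I : Type*} [Fintype E] [Fintype I] (a : E → I → ℝ)
    {G : ℝ} (ha : ∀ e i, |a e i| ≤ G)
    (hEI : 2 * Fintype.card E < Fintype.card I) {H : ℕ} (hH1 : 1 ≤ H)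
    (hH : 4 * Fintype.card I * G ≤ H) :
    ∃ p : I → ℤ, p ≠ 0 ∧ (∀ i, |p i| ≤ H) ∧ ∀ e, |∑ i, a e i * p i| < 1 / 2 := by
  classical
  let form : (I → Fin (H + 1)) → E → ℝ := fun p e => ∑ i, a e i * ((p i : ℕ) : ℝ)
  set N : ℝ := Fintype.card I * G * H with hN
  have hform : ∀ p e, |form p e| ≤ N := by
    intro p e
    calc |form p e| ≤ ∑ i, |a e i * ((p i : ℕ) : ℝ)| := Finset.abs_sum_le_sum_abs _ _
      _ ≤ ∑ _i : I, G * H := by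
          refine Finset.sum_le_sum fun i _ => ?_
          rw [abs_mul, Nat.abs_cast]
          have h1 : ((p i : ℕ) : ℝ) ≤ H := by exact_mod_cast Nat.lt_succ_iff.1 (p i).2
          have h2 : 0 ≤ G := (abs_nonneg _).trans (ha e i)
          exact mul_le_mul (ha e i) h1 (Nat.cast_nonneg _) h2
      _ = N := by simp [hN]; ring
  have hN4 : 4 * N ≤ (H : ℝ) ^ 2 := by
    have : (0 : ℝ) ≤ H := Nat.cast_nonneg _
    rw [hN]; nlinarith
  have hcell : ∀ p e, ⌊2 * form p e + 2 * N⌋₊ < H ^ 2 + 1 := by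
    intro p e
    have h1 := abs_le.1 (hform p e)
    refine (Nat.floor_lt (by linarith)).2 ?_
    push_cast
    linarith
  let cell : (I → Fin (H + 1)) → (E → Fin (H ^ 2 + 1)) := fun p e => ⟨_, hcell p e⟩
  have hcard : Fintype.card (E → Fin (H ^ 2 + 1)) < Fintype.card (I → Fin (H + 1)) := by
    simp only [Fintype.card_fun, Fintype.card_fin]
    calc (H ^ 2 + 1) ^ Fintype.card E ≤ ((H + 1) ^ 2) ^ Fintype.card E := by
          gcongr; nlinarith
      _ = (H + 1) ^ (2 * Fintype.card E) := by rw [pow_mul]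
      _ < (H + 1) ^ Fintype.card I := Nat.pow_lt_pow_right (by omega) hEI
  obtain ⟨p, p', hne, heq⟩ := Fintype.exists_ne_map_eq_of_card_lt cell hcard
  refine ⟨fun i => (p i : ℤ) - (p' i : ℤ), ?_, fun i => ?_, fun e => ?_⟩
  · intro h0
    apply hne
    funext i
    have := congrFun h0 i
    simp only [Pi.zero_apply, sub_eq_zero] at this
    exact Fin.ext (by exact_mod_cast this)
  · have h1 := (p i).2
    have h2 := (p' i).2
    simp only [abs_le]; constructor <;> omega
  · have h1 : ∑ i, a e i * (((p i : ℤ) - (p' i : ℤ) : ℤ) : ℝ) = form p e - form p' e := by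
      simp only [form, ← Finset.sum_sub_distrib]
      refine Finset.sum_congr rfl fun i _ => ?_
      push_cast; ring
    rw [h1]
    have h2 : ⌊2 * form p e + 2 * N⌋₊ = ⌊2 * form p' e + 2 * N⌋₊ := by
      have := congrFun heq e
      simpa [cell, Fin.ext_iff] using this
    have b1 := abs_le.1 (hform p e)
    have b2 := abs_le.1 (hform p' e)
    have f1 := Nat.floor_le (show 0 ≤ 2 * form p e + 2 * N by linarith)
    have f2 := Nat.lt_floor_add_one (2 * form p e + 2 * N)
    have f3 := Nat.floor_le (show 0 ≤ 2 * form p' e + 2 * N by linarith)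
    have f4 := Nat.lt_floor_add_one (2 * form p' e + 2 * N)
    rw [h2] at f1 f2
    rw [abs_lt]; constructor <;> linarith

section

open Finset

/-- The numerical data of a linear form `b 0 * l 0 + b 1 * l 1 + b 2 * l 2` in three logarithms,
where `exp (l i)` is the quotient of the images of `N i` and `D i` under the complex place `σ k₀`
of a ring in which nonzero elements satisfy Liouville's inequality. -/
structure LogFormData (R ι : Type) [CommRing R] [Fintype ι] where
  σ : ι → R →+* ℂ
  k₀ : ι
  liouville : ∀ x : R, x ≠ 0 → 1 ≤ ∏ k, ‖σ k x‖
  N : Fin 3 → R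
  D : Fin 3 → R
  h : ℝ
  one_le_h : 1 ≤ h
  norm_N : ∀ k i, ‖σ k (N i)‖ ≤ Real.exp h
  norm_D : ∀ k i, ‖σ k (D i)‖ ≤ Real.exp h
  D_ne : ∀ i, σ k₀ (D i) ≠ 0
  l : Fin 3 → ℝ
  abs_l : ∀ i, |l i| ≤ h
  N_eq : ∀ i, σ k₀ (N i) = Real.exp (l i) * σ k₀ (D i)
  b : Fin 3 → ℤ
  b_ne : b 2 ≠ 0
  H : ℕ
  one_le_H : 1 ≤ H
  abs_b : ∀ i, |b i| ≤ H

namespace LogFormData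

variable {R ι : Type} [CommRing R] [Fintype ι] (S : LogFormData R ι) {L : ℕ}

/-- The linear form itself. -/
def form : ℝ := S.b 0 * S.l 0 + S.b 1 * S.l 1 + S.b 2 * S.l 2

/-- The exponent `∑ λᵢ lᵢ`. -/
def expo (v : Fin 3 → Fin (L + 1)) : ℝ := ∑ i, ((v i : ℕ) : ℝ) * S.l i

/-- The integers coming from eliminating `l 2`. -/
def coef (v : Fin 3 → Fin (L + 1)) (i : Fin 3) : ℤ := S.b 2 * (v i : ℕ) - S.b i * (v 2 : ℕ)

/-- The monomials in the coefficients `coef`. -/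
def weight (m : ℕ × ℕ) (v : Fin 3 → Fin (L + 1)) : ℤ := S.coef v 0 ^ m.1 * S.coef v 1 ^ m.2

/-- The exponent with `l 2` eliminated. -/
noncomputable def freq (v : Fin 3 → Fin (L + 1)) : ℝ :=
  S.coef v 0 * (S.l 0 / S.b 2) + S.coef v 1 * (S.l 1 / S.b 2)

/-- The algebraic monomials. -/
def mono (v : Fin 3 → Fin (L + 1)) : R := ∏ i, S.N i ^ (v i : ℕ) * S.D i ^ (L - (v i : ℕ))

/-- The algebraic values of the auxiliary function. -/
def algVal (p : (Fin 3 → Fin (L + 1)) → ℤ) (m : ℕ × ℕ) (x : ℕ) : R :=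
  ∑ v, ((p v * S.weight m v : ℤ) : R) * S.mono v ^ x

/-- The auxiliary function and its formal derivatives. -/
noncomputable def aux (p : (Fin 3 → Fin (L + 1)) → ℤ) (m : ℕ × ℕ) (z : ℂ) : ℂ :=
  ∑ v, ((p v * S.weight m v : ℤ) : ℂ) * Complex.exp (S.freq v * z)

lemma one_le_abs_b : 1 ≤ |(S.b 2 : ℝ)| := by
  exact_mod_cast Int.one_le_abs S.b_ne

lemma freq_sub_expo (v : Fin 3 → Fin (L + 1)) :
    S.freq v - S.expo v = -((v 2 : ℕ) : ℝ) * S.form / S.b 2 := by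
  have hb : (S.b 2 : ℝ) ≠ 0 := by exact_mod_cast S.b_ne
  simp only [freq, expo, coef, form, Fin.sum_univ_three]
  push_cast
  field_simp
  ring

lemma val_le (v : Fin 3 → Fin (L + 1)) (i : Fin 3) : ((v i : ℕ) : ℝ) ≤ L := by
  exact_mod_cast Nat.lt_succ_iff.1 (v i).2

lemma h_nonneg : 0 ≤ S.h := zero_le_one.trans S.one_le_h

lemma abs_expo_le (v : Fin 3 → Fin (L + 1)) : |S.expo v| ≤ 3 * L * S.h := by
  calc |S.expo v| ≤ ∑ i, |((v i : ℕ) : ℝ) * S.l i| := abs_sum_le_sum_abs _ _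
    _ ≤ ∑ _i : Fin 3, (L : ℝ) * S.h := by
        refine sum_le_sum fun i _ => ?_
        rw [abs_mul, Nat.abs_cast]
        exact mul_le_mul (val_le v i) (S.abs_l i) (abs_nonneg _) (Nat.cast_nonneg _)
    _ = _ := by simp; ring

lemma abs_freq_sub_expo_le (v : Fin 3 → Fin (L + 1)) :
    |S.freq v - S.expo v| ≤ L * |S.form| := by
  rw [freq_sub_expo, abs_div, abs_mul, abs_neg, Nat.abs_cast]
  refine (div_le_self (by positivity) S.one_le_abs_b).trans ?_
  gcongr
  exact Nat.lt_succ_iff.1 (v 2).2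

lemma abs_coef_le (v : Fin 3 → Fin (L + 1)) (i : Fin 3) : |(S.coef v i : ℝ)| ≤ 2 * L * S.H := by
  have hb : ∀ j, |(S.b j : ℝ)| ≤ S.H := fun j => by exact_mod_cast S.abs_b j
  simp only [coef]
  push_cast
  calc |(S.b 2 : ℝ) * (v i : ℕ) - S.b i * (v 2 : ℕ)|
      ≤ |(S.b 2 : ℝ) * (v i : ℕ)| + |(S.b i : ℝ) * (v 2 : ℕ)| := abs_sub _ _
    _ ≤ S.H * L + S.H * L := by
        rw [abs_mul, abs_mul, Nat.abs_cast, Nat.abs_cast]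
        gcongr
        · exact hb 2
        · exact Nat.lt_succ_iff.1 (v i).2
        · exact hb i
        · exact Nat.lt_succ_iff.1 (v 2).2
    _ = _ := by ring

lemma abs_weight_le (hL : 1 ≤ L) {M : ℕ} {m : ℕ × ℕ} (hm : m.1 + m.2 ≤ M)
    (v : Fin 3 → Fin (L + 1)) : |(S.weight m v : ℝ)| ≤ (2 * L * S.H) ^ M := by
  have h1 : (1 : ℝ) ≤ 2 * L * S.H := by
    have a1 : (1 : ℝ) ≤ L := by exact_mod_cast hL
    have a2 : (1 : ℝ) ≤ S.H := by exact_mod_cast S.one_le_H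
    nlinarith
  simp only [weight]
  push_cast
  rw [abs_mul, abs_pow, abs_pow]
  calc _ ≤ (2 * L * S.H : ℝ) ^ m.1 * (2 * L * S.H : ℝ) ^ m.2 := by
        gcongr <;> exact S.abs_coef_le v _
    _ = (2 * L * S.H : ℝ) ^ (m.1 + m.2) := (pow_add _ _ _).symm
    _ ≤ _ := pow_le_pow_right₀ h1 hm

lemma norm_mono_le (k : ι) (v : Fin 3 → Fin (L + 1)) :
    ‖S.σ k (S.mono v)‖ ≤ Real.exp (3 * L * S.h) := by
  simp only [mono, map_prod, map_mul, map_pow, norm_prod, norm_mul, norm_pow]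
  calc _ ≤ ∏ _i : Fin 3, Real.exp (L * S.h) := by
        refine prod_le_prod (fun _ _ => by positivity) fun i _ => ?_
        have hv := Nat.lt_succ_iff.1 (v i).2
        calc _ ≤ Real.exp S.h ^ (v i : ℕ) * Real.exp S.h ^ (L - (v i : ℕ)) := by
              gcongr
              · exact S.norm_N k i
              · exact S.norm_D k i
          _ = _ := by rw [← pow_add, Nat.add_sub_cancel' hv, ← Real.exp_nat_mul]
    _ = _ := by rw [prod_const, ← Real.exp_nat_mul]; congr 1; simp; ring

/-- The common denominator of the algebraic values at the distinguished place. -/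
def den (L : ℕ) : ℂ := ∏ i, S.σ S.k₀ (S.D i) ^ L

lemma den_ne : S.den L ≠ 0 := prod_ne_zero_iff.2 fun i _ => pow_ne_zero _ (S.D_ne i)

lemma norm_den_le : ‖S.den L‖ ≤ Real.exp (3 * L * S.h) := by
  simp only [den, norm_prod, norm_pow]
  calc _ ≤ ∏ _i : Fin 3, Real.exp (L * S.h) := by
        refine prod_le_prod (fun _ _ => by positivity) fun i _ => ?_
        rw [Real.exp_nat_mul]
        gcongr
        exact S.norm_D _ i
    _ = _ := by rw [prod_const, ← Real.exp_nat_mul]; congr 1; simp; ring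

lemma map_mono (v : Fin 3 → Fin (L + 1)) :
    S.σ S.k₀ (S.mono v) = S.den L * Complex.exp (S.expo v) := by
  simp only [mono, den, expo, map_prod, map_mul, map_pow, S.N_eq]
  push_cast
  rw [Complex.exp_sum, ← prod_mul_distrib]
  refine prod_congr rfl fun i _ => ?_
  have hv := Nat.lt_succ_iff.1 (v i).2
  rw [Complex.exp_nat_mul, mul_pow, mul_assoc, ← pow_add, Nat.add_sub_cancel' hv]
  ring

lemma map_algVal (p : (Fin 3 → Fin (L + 1)) → ℤ) (m : ℕ × ℕ) (x : ℕ) :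
    S.σ S.k₀ (S.algVal p m x) = S.den L ^ x *
      ∑ v, ((p v * S.weight m v : ℤ) : ℂ) * Complex.exp (S.expo v * x) := by
  simp only [algVal, map_sum, map_mul, map_pow, map_intCast, S.map_mono, mul_sum]
  refine sum_congr rfl fun v _ => ?_
  rw [mul_pow, ← Complex.exp_nat_mul, mul_comm (x : ℂ)]
  ring

lemma iteratedDeriv_aux (p : (Fin 3 → Fin (L + 1)) → ℤ) (m : ℕ × ℕ) (k : ℕ) :
    iteratedDeriv k (S.aux p m) = fun z =>
      ∑ v, ((p v * S.weight m v : ℤ) : ℂ) * ((S.freq v : ℂ) ^ k * Complex.exp (S.freq v * z)) := by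
  induction k with
  | zero => funext z; simp [aux]
  | succ k ih =>
    rw [iteratedDeriv_succ, ih]
    funext z
    refine HasDerivAt.deriv ?_
    refine HasDerivAt.fun_sum fun v _ => ?_
    have h1 : HasDerivAt (fun z : ℂ => (S.freq v : ℂ) * z) (S.freq v) z := by
      simpa using (hasDerivAt_id z).const_mul (S.freq v : ℂ)
    have h2 := ((h1.cexp).const_mul ((S.freq v : ℂ) ^ k)).const_mul
      (((p v * S.weight m v : ℤ) : ℂ))
    refine h2.congr_deriv ?_
    rw [pow_succ]
    ring

lemma norm_iteratedDeriv_aux_le (p : (Fin 3 → Fin (L + 1)) → ℤ) (m : ℕ × ℕ) (k : ℕ) (z : ℂ)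
    {ε : ℝ} (hε : ∀ m' : ℕ × ℕ, m'.1 + m'.2 = m.1 + m.2 + k → ‖S.aux p m' z‖ ≤ ε) :
    ‖iteratedDeriv k (S.aux p m) z‖ ≤ (2 * S.h) ^ k * ε := by
  have hε0 : 0 ≤ ε := (norm_nonneg _).trans (hε (m.1 + k, m.2) (by simp; ring))
  set κ₀ : ℝ := S.l 0 / S.b 2
  set κ₁ : ℝ := S.l 1 / S.b 2
  have hκ : ∀ i, |S.l i / S.b 2| ≤ S.h := fun i => by
    rw [abs_div]
    exact (div_le_self (abs_nonneg _) S.one_le_abs_b).trans (S.abs_l i)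
  have key : iteratedDeriv k (S.aux p m) z = ∑ s ∈ range (k + 1),
      (κ₀ : ℂ) ^ s * (κ₁ : ℂ) ^ (k - s) * (k.choose s : ℂ) *
        S.aux p (m.1 + s, m.2 + (k - s)) z := by
    rw [iteratedDeriv_aux]
    simp only [aux, mul_sum]
    rw [sum_comm]
    refine sum_congr rfl fun v _ => ?_
    have : (S.freq v : ℂ) ^ k = ∑ s ∈ range (k + 1), ((S.coef v 0 : ℂ) * κ₀) ^ s *
        ((S.coef v 1 : ℂ) * κ₁) ^ (k - s) * (k.choose s : ℂ) := by
      rw [← add_pow]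
      congr 1
      simp only [freq, κ₀, κ₁]
      push_cast
      ring
    rw [this, sum_mul, mul_sum]
    refine sum_congr rfl fun s _ => ?_
    simp only [weight]
    push_cast
    rw [mul_pow, mul_pow, pow_add, pow_add]
    ring
  rw [key]
  calc _ ≤ ∑ s ∈ range (k + 1), S.h ^ s * S.h ^ (k - s) * (k.choose s : ℝ) * ε := by
        refine (norm_sum_le _ _).trans (sum_le_sum fun s hs => ?_)
        have hs' : s ≤ k := Nat.lt_succ_iff.1 (mem_range.1 hs)
        simp only [norm_mul, norm_pow, Complex.norm_real, Complex.norm_natCast, Real.norm_eq_abs]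
        have hh := S.h_nonneg
        gcongr
        · exact hκ 0
        · exact hκ 1
        · exact hε _ (by simp only; omega)
    _ = _ := by rw [← sum_mul, ← add_pow, two_mul]

end LogFormData

namespace LogFormData

variable {R ι : Type} [CommRing R] [Fintype ι] (S : LogFormData R ι) {L : ℕ}

lemma sum_coeff_le (hL : 1 ≤ L) {p : (Fin 3 → Fin (L + 1)) → ℤ} {P X : ℝ} {M : ℕ}
    (hp : ∀ v, |(p v : ℝ)| ≤ P) (hX : ((L : ℝ) + 1) ^ 3 * P * (2 * L * S.H) ^ M ≤ X)
    {m : ℕ × ℕ} (hm : m.1 + m.2 ≤ M) {F : (Fin 3 → Fin (L + 1)) → ℂ} {C : ℝ}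
    (hF : ∀ v, ‖F v‖ ≤ C) :
    ‖∑ v, ((p v * S.weight m v : ℤ) : ℂ) * F v‖ ≤ X * C := by
  have hP : 0 ≤ P := (abs_nonneg _).trans (hp 0)
  have hC : 0 ≤ C := (norm_nonneg _).trans (hF 0)
  calc _ ≤ ∑ _v : Fin 3 → Fin (L + 1), P * (2 * L * S.H) ^ M * C := by
        refine (norm_sum_le _ _).trans (sum_le_sum fun v _ => ?_)
        rw [norm_mul, Complex.norm_intCast]
        push_cast
        rw [abs_mul]
        gcongr
        · exact hp v
        · exact S.abs_weight_le hL hm v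
        · exact hF v
    _ = ((L : ℝ) + 1) ^ 3 * P * (2 * L * S.H) ^ M * C := by
        simp only [sum_const, card_univ, Fintype.card_fun, Fintype.card_fin, nsmul_eq_mul]
        push_cast
        ring
    _ ≤ X * C := by gcongr

lemma norm_algVal_le (hL : 1 ≤ L) {p : (Fin 3 → Fin (L + 1)) → ℤ} {P X : ℝ} {M : ℕ}
    (hp : ∀ v, |(p v : ℝ)| ≤ P) (hX : ((L : ℝ) + 1) ^ 3 * P * (2 * L * S.H) ^ M ≤ X)
    {m : ℕ × ℕ} (hm : m.1 + m.2 ≤ M) (k : ι) (x : ℕ) :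
    ‖S.σ k (S.algVal p m x)‖ ≤ X * Real.exp (3 * L * S.h * x) := by
  have h1 : S.σ k (S.algVal p m x)
      = ∑ v, ((p v * S.weight m v : ℤ) : ℂ) * S.σ k (S.mono v) ^ x := by
    simp only [algVal, map_sum, map_mul, map_pow, map_intCast]
  rw [h1]
  refine S.sum_coeff_le hL hp hX hm fun v => ?_
  rw [norm_pow, mul_comm (3 * L * S.h), Real.exp_nat_mul]
  gcongr
  exact S.norm_mono_le k v

lemma norm_aux_le (hL : 1 ≤ L) {p : (Fin 3 → Fin (L + 1)) → ℤ} {P X : ℝ} {M : ℕ}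
    (hp : ∀ v, |(p v : ℝ)| ≤ P) (hX : ((L : ℝ) + 1) ^ 3 * P * (2 * L * S.H) ^ M ≤ X)
    {m : ℕ × ℕ} (hm : m.1 + m.2 ≤ M) (hform : L * |S.form| ≤ 1) (z : ℂ) {ρ : ℝ} (hz : ‖z‖ ≤ ρ) :
    ‖S.aux p m z‖ ≤ X * Real.exp (4 * L * S.h * ρ) := by
  refine S.sum_coeff_le hL hp hX hm fun v => ?_
  refine (Complex.norm_exp_le_exp_norm _).trans (Real.exp_le_exp.2 ?_)
  rw [norm_mul, Complex.norm_real, Real.norm_eq_abs]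
  have h1 := S.abs_freq_sub_expo_le v
  have h2 := S.abs_expo_le v
  have h3 : |S.freq v| ≤ |S.freq v - S.expo v| + |S.expo v| := by
    have := abs_add_le (S.freq v - S.expo v) (S.expo v)
    simpa using this
  have h4 : (1 : ℝ) ≤ L * S.h := by
    have a1 : (1 : ℝ) ≤ L := by exact_mod_cast hL
    nlinarith [S.one_le_h]
  have h5 : |S.freq v| ≤ 4 * L * S.h := by nlinarith
  exact mul_le_mul h5 hz (norm_nonneg _) (by nlinarith)

lemma norm_sum_sub_aux_le (hL : 1 ≤ L) {p : (Fin 3 → Fin (L + 1)) → ℤ} {P X : ℝ} {M : ℕ}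
    (hp : ∀ v, |(p v : ℝ)| ≤ P) (hX : ((L : ℝ) + 1) ^ 3 * P * (2 * L * S.H) ^ M ≤ X)
    {m : ℕ × ℕ} (hm : m.1 + m.2 ≤ M) {W : ℝ} (hform : L * |S.form| * W ≤ 1) {x : ℕ}
    (hx : (x : ℝ) ≤ W) :
    ‖∑ v, ((p v * S.weight m v : ℤ) : ℂ) * Complex.exp (S.expo v * x) - S.aux p m x‖
      ≤ X * (Real.exp (3 * L * S.h * W) * (2 * (L * |S.form| * W))) := by
  have hW : 0 ≤ W := (Nat.cast_nonneg x).trans hx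
  rw [aux, ← sum_sub_distrib]
  simp only [← mul_sub]
  refine S.sum_coeff_le hL hp hX hm fun v => ?_
  have e1 : Complex.exp (S.expo v * x) - Complex.exp (S.freq v * x)
      = ((Real.exp (S.expo v * x) * (-(Real.exp ((S.freq v - S.expo v) * x) - 1)) : ℝ) : ℂ) := by
    push_cast
    rw [neg_sub, mul_sub, mul_one, ← Complex.exp_add]
    congr 2
    ring
  rw [e1, Complex.norm_real, Real.norm_eq_abs, abs_mul, Real.abs_exp, abs_neg]
  have h1 : |(S.freq v - S.expo v) * x| ≤ L * |S.form| * W := by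
    rw [abs_mul, Nat.abs_cast]
    exact mul_le_mul (S.abs_freq_sub_expo_le v) hx (Nat.cast_nonneg _) (by positivity)
  refine mul_le_mul (Real.exp_le_exp.2 ?_) ?_ (abs_nonneg _) (Real.exp_pos _).le
  · calc S.expo v * x ≤ |S.expo v| * x := by gcongr; exact le_abs_self _
      _ ≤ 3 * L * S.h * W := mul_le_mul (S.abs_expo_le v) hx (Nat.cast_nonneg _)
          (by have := S.h_nonneg; positivity)
  · exact (Real.abs_exp_sub_one_le (h1.trans hform)).trans (by linarith)

/-- If the image at the distinguished place is tiny then the element vanishes. -/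
lemma eq_zero_of_small {x : R} {Y : ℝ} (hY : 1 ≤ Y) (hx : ∀ k, ‖S.σ k x‖ ≤ Y)
    (hsmall : ‖S.σ S.k₀ x‖ * Y ^ Fintype.card ι < 1) : x = 0 := by
  classical
  by_contra hne
  have h1 := S.liouville x hne
  rw [← mul_prod_erase univ _ (mem_univ S.k₀)] at h1
  have h2 : ∏ k ∈ univ.erase S.k₀, ‖S.σ k x‖ ≤ Y ^ Fintype.card ι := by
    calc _ ≤ ∏ _k ∈ univ.erase S.k₀, Y :=
          prod_le_prod (fun _ _ => norm_nonneg _) fun k _ => hx k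
      _ = Y ^ (univ.erase S.k₀).card := by simp
      _ ≤ _ := pow_le_pow_right₀ hY (by
          rw [← card_univ]; exact card_le_card (erase_subset _ _))
  have h3 := mul_le_mul_of_nonneg_left h2 (norm_nonneg (S.σ S.k₀ x))
  linarith

/-- The extrapolation step. -/
lemma extrapolate (hL : 1 ≤ L) {p : (Fin 3 → Fin (L + 1)) → ℤ} {P X : ℝ} {M : ℕ}
    (hp : ∀ v, |(p v : ℝ)| ≤ P) (hX1 : 1 ≤ X)
    (hX : ((L : ℝ) + 1) ^ 3 * P * (2 * L * S.H) ^ M ≤ X) {μ s M' : ℕ} (hμ : 0 < μ) (hs : 0 < s)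
    (hM : M' + μ ≤ M) {W : ℝ} (hsW : (s : ℝ) ≤ W) (hform : L * |S.form| * W ≤ 1)
    (hsmall : (6 * ((2 * S.h) ^ μ * (X * (Real.exp (3 * L * S.h * W) *
          (2 * (L * |S.form| * W))))) * (28 * W) ^ (μ * s)
        + X * Real.exp (4 * L * S.h * (7 * W)) / 3 ^ (μ * s)
        + X * (Real.exp (3 * L * S.h * W) * (2 * (L * |S.form| * W))))
        * Real.exp (3 * L * S.h * W) * (X * Real.exp (3 * L * S.h * W)) ^ Fintype.card ι < 1)
    (hzero : ∀ m : ℕ × ℕ, m.1 + m.2 < M' + μ → ∀ x < s, S.algVal p m x = 0) :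
    ∀ m : ℕ × ℕ, m.1 + m.2 < M' → ∀ x : ℕ, (x : ℝ) ≤ W → S.algVal p m x = 0 := by
  intro m hm x hx
  have hW1 : 1 ≤ W := le_trans (by exact_mod_cast hs) hsW
  set δ : ℝ := X * (Real.exp (3 * L * S.h * W) * (2 * (L * |S.form| * W))) with hδ
  have hh0 := S.h_nonneg
  have hh1 := S.one_le_h
  have hδ0 : 0 ≤ δ := by positivity
  have hform1 : L * |S.form| ≤ 1 := le_trans (le_mul_of_one_le_right (by positivity) hW1) hform
  have hauxzero : ∀ m' : ℕ × ℕ, m'.1 + m'.2 < M' + μ → ∀ y < s, ‖S.aux p m' y‖ ≤ δ := by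
    intro m' hm' y hy
    have hyW : (y : ℝ) ≤ W := le_trans (by exact_mod_cast hy.le) hsW
    have h1 := S.norm_sum_sub_aux_le hL hp hX (m := m') (by omega) hform hyW
    have h2 := S.map_algVal p m' y
    rw [hzero m' hm' y hy, map_zero] at h2
    have h3 := (mul_eq_zero.1 h2.symm).resolve_left (pow_ne_zero _ S.den_ne)
    rwa [h3, zero_sub, norm_neg] at h1
  have hderiv : ∀ y < s, ∀ k < μ, ‖iteratedDeriv k (S.aux p m) (y : ℂ)‖ ≤ (2 * S.h) ^ μ * δ := by
    intro y hy k hk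
    refine (S.norm_iteratedDeriv_aux_le p m k y
      (fun m' hm' => hauxzero m' (by omega) y hy)).trans ?_
    gcongr
    · linarith
  have hdiff : Differentiable ℂ (S.aux p m) := by
    unfold aux; fun_prop
  have hbound := norm_le_of_small_derivatives hdiff hμ hs hsW hderiv
    (fun z hz => S.norm_aux_le hL hp hX (m := m) (by omega) hform1 z hz)
    (z := (x : ℂ)) (by rwa [Complex.norm_natCast])
  have happrox := S.norm_sum_sub_aux_le hL hp hX (m := m) (by omega) hform hx
  have hY : (1 : ℝ) ≤ X * Real.exp (3 * L * S.h * W) := by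
    have : 1 ≤ Real.exp (3 * L * S.h * W) := Real.one_le_exp (by positivity)
    nlinarith
  refine S.eq_zero_of_small hY (fun k => ?_) (lt_of_le_of_lt ?_ hsmall)
  · refine (S.norm_algVal_le hL hp hX (m := m) (by omega) k x).trans ?_
    gcongr
  · gcongr
    rw [S.map_algVal, norm_mul, mul_comm]
    have hden : ‖S.den L ^ x‖ ≤ Real.exp (3 * L * S.h * W) := by
      rw [norm_pow]
      calc _ ≤ Real.exp (3 * L * S.h) ^ x := by gcongr; exact S.norm_den_le
        _ = Real.exp (3 * L * S.h * x) := by rw [← Real.exp_nat_mul, mul_comm]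
        _ ≤ _ := by gcongr
    have hsum : ‖∑ v, ((p v * S.weight m v : ℤ) : ℂ) * Complex.exp (S.expo v * x)‖
        ≤ ‖S.aux p m x‖ + δ := by
      have := norm_add_le (∑ v, ((p v * S.weight m v : ℤ) : ℂ) * Complex.exp (S.expo v * x)
        - S.aux p m x) (S.aux p m x)
      rw [sub_add_cancel] at this
      linarith
    gcongr
    exact hsum.trans (by linarith)

/-- The initial auxiliary function. -/
lemma exists_initial (hL : 1 ≤ L) {M s : ℕ}
    (hcard : 4 * Fintype.card ι * M ^ 2 * s < (L + 1) ^ 3) {P : ℕ} (hP1 : 1 ≤ P)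
    (hP : 4 * ((L : ℝ) + 1) ^ 3 * ((2 * L * S.H) ^ (2 * M) * Real.exp (3 * L * S.h * s)) ≤ P) :
    ∃ p : (Fin 3 → Fin (L + 1)) → ℤ, p ≠ 0 ∧ (∀ v, |p v| ≤ P) ∧
      ∀ m : ℕ × ℕ, m.1 + m.2 < M → ∀ x < s, S.algVal p m x = 0 := by
  let a : (Fin M × Fin M × Fin s × ι × Bool) → (Fin 3 → Fin (L + 1)) → ℝ := fun e v =>
    let w : ℂ := (S.weight (e.1, e.2.1) v : ℂ) * S.σ e.2.2.2.1 (S.mono v) ^ (e.2.2.1 : ℕ)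
    if e.2.2.2.2 then w.re else w.im
  have ha : ∀ e v, |a e v| ≤ (2 * L * S.H) ^ (2 * M) * Real.exp (3 * L * S.h * s) := by
    intro e v
    have hw : ‖(S.weight (e.1, e.2.1) v : ℂ) * S.σ e.2.2.2.1 (S.mono v) ^ (e.2.2.1 : ℕ)‖
        ≤ (2 * L * S.H) ^ (2 * M) * Real.exp (3 * L * S.h * s) := by
      rw [norm_mul, Complex.norm_intCast, norm_pow]
      gcongr
      · exact S.abs_weight_le hL (by have := e.1.2; have := e.2.1.2; simp only; omega) v
      · calc _ ≤ Real.exp (3 * L * S.h) ^ (e.2.2.1 : ℕ) := by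
              gcongr; exact S.norm_mono_le _ v
          _ ≤ Real.exp (3 * L * S.h) ^ s :=
              pow_le_pow_right₀ (Real.one_le_exp (by have := S.h_nonneg; positivity))
                e.2.2.1.2.le
          _ = _ := by rw [← Real.exp_nat_mul, mul_comm]
    simp only [a]
    split_ifs
    · exact (Complex.abs_re_le_norm _).trans hw
    · exact (Complex.abs_im_le_norm _).trans hw
  obtain ⟨p, hp0, hpP, hpa⟩ := exists_int_vector_small_forms a ha (by
      simp only [Fintype.card_prod, Fintype.card_fin, Fintype.card_bool, Fintype.card_fun]
      calc _ = 4 * Fintype.card ι * M ^ 2 * s := by ring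
        _ < _ := hcard) hP1 (by
      simpa only [Fintype.card_fun, Fintype.card_fin, Nat.cast_pow, Nat.cast_add, Nat.cast_one]
        using hP)
  refine ⟨p, hp0, hpP, fun m hm x hx => ?_⟩
  by_contra hne
  have h1 := S.liouville _ hne
  have h2 : ∏ k, ‖S.σ k (S.algVal p m x)‖ < 1 := by
    have hlt : ∀ k, ‖S.σ k (S.algVal p m x)‖ < 1 := by
      intro k
      have hm1 : m.1 < M := by omega
      have hm2 : m.2 < M := by omega
      have hE : S.σ k (S.algVal p m x) = ∑ v, ((p v : ℝ) : ℂ) *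
          ((S.weight m v : ℂ) * S.σ k (S.mono v) ^ x) := by
        simp only [algVal, map_sum, map_mul, map_pow, map_intCast]
        refine sum_congr rfl fun v _ => ?_
        push_cast; ring
      have hre := hpa (⟨m.1, hm1⟩, ⟨m.2, hm2⟩, ⟨x, hx⟩, k, true)
      have him := hpa (⟨m.1, hm1⟩, ⟨m.2, hm2⟩, ⟨x, hx⟩, k, false)
      have hre' : |(S.σ k (S.algVal p m x)).re| < 1 / 2 := by
        rw [hE, Complex.re_sum]
        simpa only [a, Complex.re_ofReal_mul, mul_comm, if_true] using hre
      have him' : |(S.σ k (S.algVal p m x)).im| < 1 / 2 := by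
        rw [hE, Complex.im_sum]
        simpa only [a, Complex.im_ofReal_mul, mul_comm, if_false, Bool.false_eq_true] using him
      exact (Complex.norm_le_abs_re_add_abs_im _).trans_lt (by linarith)
    calc _ < ∏ _k : ι, (1 : ℝ) := by
          have : Nonempty ι := ⟨S.k₀⟩
          refine prod_lt_prod_of_nonempty (fun k _ => norm_pos_iff.2 fun h0 => ?_)
            (fun k _ => hlt k) univ_nonempty
          rw [prod_eq_zero (mem_univ k) (by rw [h0, norm_zero])] at h1
          linarith
      _ = 1 := by simp
  linarith

/-- Vanishing at enough integers forces two exponents to coincide. -/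
lemma exists_expo_eq {p : (Fin 3 → Fin (L + 1)) → ℤ} (hp : p ≠ 0)
    (hzero : ∀ x < (L + 1) ^ 3, S.algVal p (0, 0) x = 0) :
    ∃ v v' : Fin 3 → Fin (L + 1), v ≠ v' ∧ S.expo v = S.expo v' := by
  by_contra! hcon
  apply hp
  have hinj : Function.Injective fun v : Fin 3 → Fin (L + 1) => Complex.exp (S.expo v) := by
    intro v v' hvv
    by_contra hne
    refine hcon v v' hne ?_
    simp only [← Complex.ofReal_exp] at hvv
    exact Real.exp_injective (by exact_mod_cast hvv)
  let e := Fintype.equivFin (Fin 3 → Fin (L + 1))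
  have hc : Fintype.card (Fin 3 → Fin (L + 1)) = (L + 1) ^ 3 := by simp
  have hvan := Matrix.eq_zero_of_forall_pow_sum_mul_pow_eq_zero
    (f := fun j => Complex.exp (S.expo (e.symm j))) (v := fun j => (p (e.symm j) : ℂ))
    (hinj.comp e.symm.injective) (fun i => by
      have h1 := S.map_algVal p (0, 0) i
      rw [hzero i (hc ▸ i.2), map_zero] at h1
      have h2 := (mul_eq_zero.1 h1.symm).resolve_left (pow_ne_zero _ S.den_ne)
      rw [← h2, ← e.symm.sum_comp]
      refine sum_congr rfl fun j _ => ?_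
      simp only [weight, pow_zero, mul_one]
      rw [← Complex.exp_nat_mul, mul_comm ((i : ℕ) : ℂ)])
  funext v
  have := congrFun hvan (e v)
  simpa using this

end LogFormData

lemma log_size_budget {d J G μ s t : ℝ} (hd : 0 ≤ d) (hJ : 0 ≤ J) (hG : 0 ≤ G) (ht : 0 ≤ t)
    (hs0 : 0 ≤ s) (hμ1 : 1 ≤ μ) (hμ : 8 * (3 * d + 31) * t ≤ μ)
    (hs : 11 * (d + 1) * (J + 1) * G + 6 ≤ s) :
    (d + 1) * (4 * ((J + 1) * μ) * G + 3 * t * s) + 2 ≤ μ * s / 2 := by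
  have e0 : (d + 1) * (3 * t) ≤ μ / 8 := by
    have : 0 ≤ d * t := mul_nonneg hd ht
    linarith
  have e1 : (d + 1) * (3 * t) * s ≤ μ / 8 * s := mul_le_mul_of_nonneg_right e0 hs0
  have e3 : (11 * (d + 1) * (J + 1) * G + 6) * μ ≤ s * μ :=
    mul_le_mul_of_nonneg_right hs (by linarith)
  have e4 : 0 ≤ (d + 1) * (J + 1) * G * μ := by positivity
  linarith

namespace LogFormData

variable {R ι : Type} [CommRing R] [Fintype ι] (S : LogFormData R ι)

set_option maxHeartbeats 1000000 in
/-- A linear form in three logarithms which is too small forces a multiplicative relation with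
small exponents. -/
theorem exists_relation_of_form_small {L μ J s : ℕ} {G : ℝ} (hL : 1 ≤ L) (hG1 : 1 ≤ G)
    (hG : 2 * L * S.H ≤ Real.exp G)
    (hμ : 8 * (3 * Fintype.card ι + 31) * (L * S.h) ≤ μ)
    (hs : 11 * (Fintype.card ι + 1) * (J + 1) * G + 6 ≤ s)
    (hcard : 4 * Fintype.card ι * ((J + 1) * μ) ^ 2 * s < (L + 1) ^ 3)
    (hB : (L + 1) ^ 3 ≤ 4 ^ J * s)
    (hform : 40 * (L * |S.form| * (4 ^ J * s : ℕ)) *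
      Real.exp (μ * (4 ^ J * s : ℕ) * (Real.log (56 * S.h * (4 ^ J * s : ℕ)) + 1)) ≤ 1) :
    ∃ k : Fin 3 → ℤ, k ≠ 0 ∧ (∀ i, |k i| ≤ L) ∧ ∑ i, (k i : ℝ) * S.l i = 0 := by
  set d := Fintype.card ι with hd
  set B : ℕ := 4 ^ J * s with hBdef
  set M := (J + 1) * μ with hMdef
  have hh1 := S.one_le_h
  have hh0 := S.h_nonneg
  have hL1 : (1 : ℝ) ≤ L := by exact_mod_cast hL
  have hLh : 1 ≤ L * S.h := one_le_mul_of_one_le_of_one_le hL1 hh1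
  have hμ1 : (248 : ℝ) ≤ μ := by
    have : (0 : ℝ) ≤ d := Nat.cast_nonneg _
    linarith [mul_nonneg (show 0 ≤ 8 * (3 * (d : ℝ) + 31) by positivity) (sub_nonneg.2 hLh)]
  have hμpos : 0 < μ := by
    have : (0 : ℝ) < μ := by linarith
    exact_mod_cast this
  have hMμ : (μ : ℝ) ≤ M := by
    have : μ ≤ M := Nat.le_mul_of_pos_left μ (Nat.succ_pos J)
    exact_mod_cast this
  have hspos : 0 < s := by
    have h1 : (0 : ℝ) ≤ 11 * (d + 1) * (J + 1) * G := by positivity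
    have : (0 : ℝ) < s := by linarith
    exact_mod_cast this
  have hs0 : (0 : ℝ) < s := by exact_mod_cast hspos
  set P : ℕ := ⌈4 * ((L : ℝ) + 1) ^ 3 * ((2 * L * S.H) ^ (2 * M) *
    Real.exp (3 * L * S.h * s))⌉₊ with hP
  set ξ : ℝ := 4 * M * G + 3 * L * S.h * s with hξ
  have hH1 : (1 : ℝ) ≤ S.H := by exact_mod_cast S.one_le_H
  have h2L : (2 * L : ℝ) ≤ Real.exp G := (le_mul_of_one_le_right (by positivity) hH1).trans hG
  have hX : ((L : ℝ) + 1) ^ 3 * P * (2 * L * S.H) ^ M ≤ Real.exp ξ := by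
    have hone : (1 : ℝ) ≤ 4 * ((L : ℝ) + 1) ^ 3 * ((2 * L * S.H) ^ (2 * M) *
        Real.exp (3 * L * S.h * s)) := by
      have e1 : (1 : ℝ) ≤ ((L : ℝ) + 1) ^ 3 := one_le_pow₀ (by linarith)
      have e2 : (1 : ℝ) ≤ (2 * L * S.H) ^ (2 * M) := one_le_pow₀ 
        (one_le_mul_of_one_le_of_one_le (by linarith) hH1)
      have e3 : (1 : ℝ) ≤ Real.exp (3 * L * S.h * s) := Real.one_le_exp (by positivity)
      have e4 := one_le_mul_of_one_le_of_one_le e2 e3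
      linarith [one_le_mul_of_one_le_of_one_le e1 e4]
    have hPle : (P : ℝ) ≤ 8 * ((L : ℝ) + 1) ^ 3 * ((2 * L * S.H) ^ (2 * M) *
        Real.exp (3 * L * S.h * s)) := by
      have := (Nat.ceil_lt_add_one (zero_le_one.trans hone)).le
      rw [hP]
      linarith
    have hexp8 : (8 : ℝ) ≤ Real.exp (3 * G) := by
      have e1 : (2 : ℝ) ≤ Real.exp G := by linarith
      calc (8 : ℝ) = 2 ^ 3 := by norm_num
        _ ≤ Real.exp G ^ 3 := by gcongr
        _ = _ := by rw [← Real.exp_nat_mul]; norm_num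
    have hL6 : ((L : ℝ) + 1) ^ 6 ≤ Real.exp (6 * G) := by
      calc ((L : ℝ) + 1) ^ 6 ≤ Real.exp G ^ 6 := by gcongr; linarith
        _ = _ := by rw [← Real.exp_nat_mul]; norm_num
    have hLH : (2 * L * S.H : ℝ) ^ (3 * M) ≤ Real.exp (3 * M * G) := by
      calc (2 * L * S.H : ℝ) ^ (3 * M) ≤ Real.exp G ^ (3 * M) := by gcongr
        _ = _ := by rw [← Real.exp_nat_mul]; push_cast; ring_nf
    calc ((L : ℝ) + 1) ^ 3 * P * (2 * L * S.H) ^ M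
        ≤ ((L : ℝ) + 1) ^ 3 * (8 * ((L : ℝ) + 1) ^ 3 * ((2 * L * S.H) ^ (2 * M) *
            Real.exp (3 * L * S.h * s))) * (2 * L * S.H) ^ M := by gcongr
      _ = 8 * ((L : ℝ) + 1) ^ 6 * (2 * L * S.H) ^ (3 * M) * Real.exp (3 * L * S.h * s) := by
          ring
      _ ≤ Real.exp (3 * G) * Real.exp (6 * G) * Real.exp (3 * M * G) *
            Real.exp (3 * L * S.h * s) := by gcongr
      _ = Real.exp (3 * G + 6 * G + 3 * M * G + 3 * L * S.h * s) := by
          rw [← Real.exp_add, ← Real.exp_add, ← Real.exp_add]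
      _ ≤ _ := by
          rw [hξ, Real.exp_le_exp]
          linarith [mul_le_mul_of_nonneg_right (show (9 : ℝ) ≤ M by linarith) (zero_le_one.trans hG1)]
  have hP1 : 1 ≤ P := Nat.one_le_iff_ne_zero.2 (Nat.ceil_pos.2 (by positivity)).ne'
  obtain ⟨p, hp0, hpP, hpz⟩ := S.exists_initial hL (M := M) (s := s) hcard hP1 (Nat.le_ceil _)
  have hpP' : ∀ v, |(p v : ℝ)| ≤ (P : ℝ) := fun v => by exact_mod_cast hpP v
  have hξμ : (d + 1) * ξ + 2 ≤ μ * s / 2 := by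
    have hM' : (M : ℝ) = (J + 1) * μ := by rw [hMdef]; push_cast; ring
    rw [hξ, hM']
    have := log_size_budget (d := d) (J := J) (Nat.cast_nonneg _) (Nat.cast_nonneg _)
      (zero_le_one.trans hG1) (zero_le_one.trans hLh) hs0.le (by linarith) hμ hs
    convert this using 3
    ring
  have claim : ∀ j ≤ J, ∀ m : ℕ × ℕ, m.1 + m.2 < (J - j + 1) * μ → ∀ x < 4 ^ j * s,
      S.algVal p m x = 0 := by
    intro j
    induction j with
    | zero =>
      intro _ m hm x hx
      exact hpz m (by simpa [hMdef] using hm) x (by simpa using hx)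
    | succ j ih =>
      intro hj m hm x hx
      have ihj := ih (by omega)
      set sj : ℕ := 4 ^ j * s with hsj
      have hsjpos : 0 < sj := by positivity
      have hssj : (s : ℝ) ≤ sj := by
        have : s ≤ sj := Nat.le_mul_of_pos_left _ (by positivity)
        exact_mod_cast this
      have hWB : (4 * sj : ℝ) ≤ B := by
        have : 4 * sj ≤ B := by
          rw [hsj, hBdef, ← mul_assoc, ← pow_succ']
          exact Nat.mul_le_mul_right _ (Nat.pow_le_pow_right (by norm_num) hj)
        exact_mod_cast this
      have hsj1 : (1 : ℝ) ≤ sj := by exact_mod_cast hsjpos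
      set W : ℝ := 4 * sj with hW
      have hB1 : (1 : ℝ) ≤ B := by linarith
      have hexp1 : 1 ≤ Real.exp (μ * (B : ℕ) * (Real.log (56 * S.h * (B : ℕ)) + 1)) := by
        refine Real.one_le_exp ?_
        have : 0 ≤ Real.log (56 * S.h * B) := Real.log_nonneg 
          (one_le_mul_of_one_le_of_one_le (by linarith) hB1)
        positivity
      have hfB : L * |S.form| * B ≤ 1 := by
        have : 0 ≤ L * |S.form| * B := by positivity
        linarith [le_mul_of_one_le_right (show 0 ≤ 40 * (L * |S.form| * B) by positivity) hexp1]
      have hfW : L * |S.form| * W ≤ 1 := le_trans (by gcongr) hfB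
      refine S.extrapolate hL hpP' (Real.one_le_exp (by rw [hξ]; positivity)) hX hμpos hsjpos
        (M' := (J - (j + 1) + 1) * μ) ?_ (W := W) (by rw [hW]; linarith) hfW ?_ ?_ m hm x ?_
      · rw [hMdef, ← Nat.succ_mul]
        exact Nat.mul_le_mul_right _ (by omega)
      · clear_value ξ
        set T := μ * sj with hT
        have hTr : (T : ℝ) = μ * sj := by rw [hT]; push_cast; ring
        have hμT : (μ : ℝ) ≤ T := by rw [hTr]; exact le_mul_of_one_le_right (Nat.cast_nonneg _) hsj1
        have hTB : (T : ℝ) ≤ μ * B := by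
          rw [hTr]; exact mul_le_mul_of_nonneg_left (by linarith) (Nat.cast_nonneg _)
        set w : ℝ := 3 * L * S.h * W with hw
        have hexps : (3 * d + 31) * (L * S.h * W) ≤ T / 2 := by
          rw [hTr, hW]
          linarith [mul_le_mul_of_nonneg_right hμ (zero_le_one.trans hsj1)]
        have hξT : (d + 1) * ξ + 2 ≤ T / 2 := by
          refine hξμ.trans ?_
          rw [hTr]; gcongr
        have hd0 : (0 : ℝ) ≤ d := Nat.cast_nonneg _
        have hYd : (Real.exp ξ * Real.exp w) ^ d = Real.exp (d * (ξ + w)) := by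
          rw [← Real.exp_add, ← Real.exp_nat_mul]
        have t2 : Real.exp ξ * Real.exp (4 * L * S.h * (7 * W)) / 3 ^ T * Real.exp w *
            (Real.exp ξ * Real.exp w) ^ d ≤ 1 / 4 := by
          have h3 : Real.exp (T : ℝ) ≤ 3 ^ T := by
            have := Real.exp_one_lt_d9
            calc Real.exp (T : ℝ) = Real.exp 1 ^ T := by rw [← Real.exp_nat_mul, mul_one]
              _ ≤ _ := by gcongr; linarith
          rw [hYd]
          calc _ ≤ Real.exp ξ * Real.exp (4 * L * S.h * (7 * W)) / Real.exp T * Real.exp w *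
                Real.exp (d * (ξ + w)) := by gcongr
            _ = Real.exp (ξ + 4 * L * S.h * (7 * W) - T + w + d * (ξ + w)) := by
                simp only [Real.exp_add, Real.exp_sub]
            _ ≤ Real.exp (-2) := by
                rw [Real.exp_le_exp, hw]
                linarith
            _ ≤ 1 / 4 := by
                rw [Real.exp_neg, inv_le_comm₀ (Real.exp_pos _) (by norm_num)]
                have := Real.add_one_le_exp (1 : ℝ)
                have e2 : Real.exp 2 = Real.exp 1 * Real.exp 1 := by
                  rw [← Real.exp_add]; norm_num
                rw [e2]; norm_num at this ⊢; linarith [mul_self_le_mul_self two_pos.le this]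
        set D : ℝ := 2 * (L * |S.form| * W) with hD
        have hD0 : 0 ≤ D := by positivity
        have hDle : 20 * D * Real.exp (μ * B * (Real.log (56 * S.h * B) + 1)) ≤ 1 := by
          refine le_trans ?_ hform
          rw [hD]
          have : L * |S.form| * W ≤ L * |S.form| * B := by gcongr
          have e0 := (Real.exp_pos (μ * B * (Real.log (56 * S.h * B) + 1))).le
          have := mul_le_mul_of_nonneg_right this e0
          linarith
        have hpow : (2 * S.h) ^ μ * (28 * W) ^ T ≤ Real.exp (μ * B * Real.log (56 * S.h * B)) := by
          have hW1 : 1 ≤ W := by linarith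
          calc (2 * S.h) ^ μ * (28 * W) ^ T
              = Real.exp (μ * Real.log (2 * S.h) + T * Real.log (28 * W)) := by
                rw [Real.exp_add, Real.exp_nat_mul, Real.exp_nat_mul,
                  Real.exp_log (by linarith), Real.exp_log (by linarith)]
            _ ≤ _ := by
                rw [Real.exp_le_exp, show 56 * S.h * B = (2 * S.h) * (28 * B) by ring,
                  Real.log_mul (x := 2 * S.h) (y := 28 * B) (by positivity) (by positivity),
                  mul_add (μ * B : ℝ)]
                have l1 : 0 ≤ Real.log (2 * S.h) := Real.log_nonneg (by linarith)
                have l2 : Real.log (28 * W) ≤ Real.log (28 * B) :=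
                  Real.log_le_log (by positivity) (by linarith)
                have l3 : 0 ≤ Real.log (28 * W) := Real.log_nonneg (by linarith)
                have l4 : (μ : ℝ) ≤ μ * B := le_mul_of_one_le_right (Nat.cast_nonneg _) hB1
                exact add_le_add (mul_le_mul_of_nonneg_right l4 l1)
                  (mul_le_mul hTB l2 l3 (by positivity))
        have hpow1 : (1 : ℝ) ≤ (2 * S.h) ^ μ * (28 * W) ^ T := by
          have hW1 : 1 ≤ W := by linarith
          exact one_le_mul_of_one_le_of_one_le (one_le_pow₀ (by linarith))
            (one_le_pow₀ (by linarith))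
        have t13 : (6 * ((2 * S.h) ^ μ * (Real.exp ξ * (Real.exp w * D))) * (28 * W) ^ T
            + Real.exp ξ * (Real.exp w * D)) * Real.exp w * (Real.exp ξ * Real.exp w) ^ d
            ≤ 7 / 20 := by
          rw [hYd]
          calc _ = (6 * ((2 * S.h) ^ μ * (28 * W) ^ T) + 1) * D *
                Real.exp (ξ + w + w + d * (ξ + w)) := by
                simp only [Real.exp_add]; ring
            _ ≤ (7 * ((2 * S.h) ^ μ * (28 * W) ^ T)) * D * Real.exp T := by
                gcongr
                · linarith
                · rw [hw]; linarith [show 0 ≤ L * S.h * W by positivity]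
            _ ≤ (7 * Real.exp (μ * B * Real.log (56 * S.h * B))) * D * Real.exp (μ * B) := by
                gcongr
            _ = 7 / 20 * (20 * D * Real.exp (μ * B * (Real.log (56 * S.h * B) + 1))) := by
                rw [mul_add, Real.exp_add, mul_one]; ring
            _ ≤ _ := by linarith
        calc _ = (6 * ((2 * S.h) ^ μ * (Real.exp ξ * (Real.exp w * D))) * (28 * W) ^ T
            + Real.exp ξ * (Real.exp w * D)) * Real.exp w * (Real.exp ξ * Real.exp w) ^ d
            + Real.exp ξ * Real.exp (4 * L * S.h * (7 * W)) / 3 ^ T * Real.exp w *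
            (Real.exp ξ * Real.exp w) ^ d := by ring
          _ < 1 := by linarith
      · intro m' hm' y hy
        refine ihj m' ?_ y hy
        have : J - j + 1 = J - (j + 1) + 1 + 1 := by omega
        rw [this, Nat.succ_mul]
        exact hm'
      · have : x < 4 * sj := by rw [hsj, ← mul_assoc, ← pow_succ']; exact hx
        rw [hW]
        exact_mod_cast this.le
  obtain ⟨v, v', hne, heq⟩ := S.exists_expo_eq hp0 fun x hx =>
    claim J le_rfl (0, 0) (by simpa using hμpos) x (hx.trans_le hB)
  refine ⟨fun i => (v i : ℤ) - (v' i : ℤ), fun h0 => hne ?_, fun i => ?_, ?_⟩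
  · funext i
    have := congrFun h0 i
    simp only [Pi.zero_apply, sub_eq_zero] at this
    exact Fin.ext (by exact_mod_cast this)
  · have h1 := (v i).2
    have h2 := (v' i).2
    simp only [abs_le]; constructor <;> omega
  · simp only [expo] at heq
    push_cast
    simp only [sub_mul, sum_sub_distrib]
    exact sub_eq_zero.2 heq

end LogFormData

end

/-- The three real roots of `X (X - A) (X - B) - 1`, in increasing order. -/
structure ThueRoots (A B : ℤ) where
  two_le : 2 ≤ A
  four_mul_le : 4 * A ≤ B
  α : Fin 3 → ℝ
  root : ∀ i, α i * (α i - A) * (α i - B) = 1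
  pos : 0 < α 0
  lt_half : α 0 < 1 / 2
  lt_one : A - 1 < α 1
  one_lt : α 1 < A
  lt_two : (B : ℝ) < α 2
  two_lt : α 2 < B + 1

namespace ThueRoots

theorem nonempty {A B : ℤ} (hA : 2 ≤ A) (hB : 4 * A ≤ B) : Nonempty (ThueRoots A B) := by
  have hA' : (2 : ℝ) ≤ A := by exact_mod_cast hA
  have hB' : 4 * (A : ℝ) ≤ B := by exact_mod_cast hB
  set f : ℝ → ℝ := fun x => x * (x - A) * (x - B) with hf
  have hc : Continuous f := by fun_prop
  obtain ⟨r, hr, hr1⟩ := intermediate_value_Ioo (a := 0) (b := 1 / 2) (by norm_num)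
    hc.continuousOn (show (1 : ℝ) ∈ _ by constructor <;> simp only [hf] <;> nlinarith)
  obtain ⟨s, hs, hs1⟩ := intermediate_value_Ioo' (a := (A : ℝ) - 1) (b := A) (by linarith)
    hc.continuousOn (show (1 : ℝ) ∈ _ by constructor <;> simp only [hf] <;> nlinarith)
  obtain ⟨t, ht, ht1⟩ := intermediate_value_Ioo (a := (B : ℝ)) (b := B + 1) (by linarith)
    hc.continuousOn (show (1 : ℝ) ∈ _ by constructor <;> simp only [hf] <;> nlinarith)
  exact ⟨⟨hA, hB, ![r, s, t], by intro i; fin_cases i <;> assumption,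
    hr.1, hr.2, hs.1, hs.2, ht.1, ht.2⟩⟩

variable {A B : ℤ}

theorem two_le' (S : ThueRoots A B) : (2 : ℝ) ≤ A := by exact_mod_cast S.two_le

theorem four_mul_le' (S : ThueRoots A B) : 4 * (A : ℝ) ≤ B := by exact_mod_cast S.four_mul_le

variable (S : ThueRoots A B)

theorem vieta : S.α 0 + S.α 1 + S.α 2 = A + B ∧
    S.α 0 * S.α 1 + S.α 0 * S.α 2 + S.α 1 * S.α 2 = A * B ∧
    S.α 0 * S.α 1 * S.α 2 = 1 := by
  have h0 := S.root 0
  have h1 := S.root 1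
  have h2 := S.root 2
  have hA := S.two_le'
  have hB := S.four_mul_le'
  have n01 : S.α 0 - S.α 1 ≠ 0 := by linarith [S.lt_half, S.lt_one]
  have n02 : S.α 0 - S.α 2 ≠ 0 := by linarith [S.lt_half, S.lt_two]
  have n12 : S.α 1 - S.α 2 ≠ 0 := by linarith [S.one_lt, S.lt_two]
  generalize S.α 0 = x at *
  generalize S.α 1 = y at *
  generalize S.α 2 = z at *
  have e01 : x ^ 2 + x * y + y ^ 2 - (A + B) * (x + y) + A * B = 0 :=
    mul_left_cancel₀ n01 (by linear_combination h0 - h1)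
  have e02 : x ^ 2 + x * z + z ^ 2 - (A + B) * (x + z) + A * B = 0 :=
    mul_left_cancel₀ n02 (by linear_combination h0 - h2)
  have e : x + y + z = A + B :=
    sub_eq_zero.1 (mul_left_cancel₀ n12 (by linear_combination e01 - e02))
  have e2 : x * y + x * z + y * z = A * B := by
    linear_combination -e01 + (x + y) * e
  refine ⟨e, e2, ?_⟩
  linear_combination h0 - x ^ 2 * e + x * e2

theorem prod_sub_mul (x y : ℝ) :
    (x - S.α 0 * y) * (x - S.α 1 * y) * (x - S.α 2 * y) =
      x * (x - A * y) * (x - B * y) - y ^ 3 := by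
  obtain ⟨h1, h2, h3⟩ := S.vieta
  linear_combination -x ^ 2 * y * h1 + x * y ^ 2 * h2 - y ^ 3 * h3

theorem α_pos (i : Fin 3) : 0 < S.α i := by
  have hA := S.two_le'
  have hB := S.four_mul_le'
  fin_cases i
  · exact S.pos
  · exact lt_trans (by linarith) S.lt_one
  · exact lt_trans (by linarith) S.lt_two

theorem sub_ne (i : Fin 3) : S.α i - A ≠ 0 := by
  intro h; have := S.root i; rw [h] at this; simp at this

/-- A root is not rational. -/
theorem intCast_mul_ne (i : Fin 3) {c d : ℤ} (hd : d ≠ 0) : (d : ℝ) * S.α i ≠ c := by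
  intro h
  have hr := S.root i
  have hq : (c : ℝ) * (c - A * d) * (c - B * d) = d ^ 3 := by
    rw [← h]; linear_combination (d : ℝ) ^ 3 * hr
  have hz : c * (c - A * d) * (c - B * d) = d ^ 3 := by exact_mod_cast hq
  have hdvd : d ∣ c := by
    have hIntegral : IsIntegral ℤ ((c : ℚ) / d) := by
      refine ⟨Polynomial.X ^ 3 + (- Polynomial.C (A + B) * Polynomial.X ^ 2
        + Polynomial.C (A * B) * Polynomial.X - 1), ?_, ?_⟩
      · refine Polynomial.monic_X_pow_add ?_
        compute_degree!
      · have hd' : (d : ℚ) ≠ 0 := by exact_mod_cast hd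
        have hz' : (c : ℚ) * (c - A * d) * (c - B * d) = d ^ 3 := by exact_mod_cast hz
        simp only [Polynomial.eval₂_add, Polynomial.eval₂_sub, Polynomial.eval₂_mul,
          Polynomial.eval₂_pow, Polynomial.eval₂_neg, Polynomial.eval₂_C, Polynomial.eval₂_X,
          Polynomial.eval₂_one,
          algebraMap_int_eq, Int.coe_castRingHom]
        push_cast
        field_simp
        linear_combination hz'
    obtain ⟨k, hk⟩ := IsIntegrallyClosed.isIntegral_iff.1 hIntegral
    refine ⟨k, ?_⟩
    have hd' : (d : ℚ) ≠ 0 := by exact_mod_cast hd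
    have : (k : ℚ) = c / d := by simpa using hk
    field_simp at this
    exact_mod_cast (by linear_combination -this : (c : ℚ) = d * k)
  obtain ⟨k, rfl⟩ := hdvd
  have hk : k * ((k - A) * (k - B)) = 1 :=
    mul_left_cancel₀ (pow_ne_zero 3 hd) (by linear_combination hz)
  have hA := S.two_le
  have hB := S.four_mul_le
  rcases Int.eq_one_or_neg_one_of_mul_eq_one hk with rfl | rfl <;> nlinarith

/-- Membership of a triple of reals in the order generated by the root. -/
def InOrder (w : Fin 3 → ℝ) : Prop :=
  ∃ c₀ c₁ c₂ : ℤ, ∀ i, w i = c₀ + c₁ * S.α i + c₂ * S.α i ^ 2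

variable {S}

theorem InOrder.mul {v w : Fin 3 → ℝ} (hv : S.InOrder v) (hw : S.InOrder w) :
    S.InOrder (v * w) := by
  obtain ⟨a, b, c, h⟩ := hv
  obtain ⟨d, e, f, k⟩ := hw
  refine ⟨a * d + (b * f + c * e) + (A + B) * (c * f),
    a * e + b * d - A * B * (b * f + c * e) + (1 - (A + B) * (A * B)) * (c * f),
    a * f + b * e + c * d + (A + B) * (b * f + c * e) + ((A + B) ^ 2 - A * B) * (c * f),
    fun i => ?_⟩
  have hr := S.root i
  rw [Pi.mul_apply, h, k]
  push_cast
  linear_combination ((b : ℝ) * f + c * e + c * f * (S.α i + A + B)) * hr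

theorem InOrder.pow {v : Fin 3 → ℝ} (hv : S.InOrder v) (k : ℕ) :
    S.InOrder (v ^ k) := by
  induction k with
  | zero => exact ⟨1, 0, 0, by simp⟩
  | succ k ih => rw [pow_succ]; exact ih.mul hv

theorem InOrder.zpow {v : Fin 3 → ℝ} (hv : S.InOrder v)
    (hv' : S.InOrder v⁻¹) (k : ℤ) : S.InOrder (v ^ k) := by
  obtain ⟨k, rfl | rfl⟩ := k.eq_nat_or_neg
  · simpa using hv.pow k
  · simpa using hv'.pow k

variable (S)

/-- The unit `α ^ u * (α - A) ^ v`, as a triple of conjugates. -/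
noncomputable def unit (u v : ℤ) : Fin 3 → ℝ := fun i => S.α i ^ u * (S.α i - A) ^ v

theorem inOrder_unit (u v : ℤ) : S.InOrder (S.unit u v) := by
  have h1 : S.InOrder S.α := ⟨0, 1, 0, by simp⟩
  have h2 : S.InOrder S.α⁻¹ := by
    refine ⟨A * B, -(A + B), 1, fun i => ?_⟩
    rw [Pi.inv_apply]
    refine inv_eq_of_mul_eq_one_right ?_
    push_cast
    linear_combination S.root i
  have h3 : S.InOrder (fun i => S.α i - A) := ⟨-A, 1, 0, fun i => by push_cast; ring⟩
  have h4 : S.InOrder (fun i => S.α i - A)⁻¹ := by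
    refine ⟨0, -B, 1, fun i => ?_⟩
    rw [Pi.inv_apply]
    refine inv_eq_of_mul_eq_one_right ?_
    push_cast
    linear_combination S.root i
  exact (h1.zpow h2 u).mul (h3.zpow h4 v)

/-- The index form: a nonconstant element of the order has at least the discriminant of the
root. -/
theorem one_le_index {c₁ c₂ : ℤ} (h : ¬ (c₁ = 0 ∧ c₂ = 0)) :
    1 ≤ |(c₁ + c₂ * (S.α 0 + S.α 1)) * (c₁ + c₂ * (S.α 0 + S.α 2)) *
      (c₁ + c₂ * (S.α 1 + S.α 2))| := by
  obtain ⟨v1, v2, v3⟩ := S.vieta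
  have hne : ∀ i, (c₁ + c₂ * (A + B - S.α i) : ℝ) ≠ 0 := by
    intro i hi
    by_cases h2 : c₂ = 0
    · subst h2
      simp at hi
      exact h ⟨hi, rfl⟩
    · exact S.intCast_mul_ne i h2 (c := c₁ + c₂ * (A + B)) (by push_cast; linarith)
  have e2 : S.α 0 + S.α 1 = A + B - S.α 2 := by linarith
  have e1 : S.α 0 + S.α 2 = A + B - S.α 1 := by linarith
  have e0 : S.α 1 + S.α 2 = A + B - S.α 0 := by linarith
  rw [e0, e1, e2]
  set z : ℤ := (c₁ + c₂ * (A + B)) ^ 3 - (c₁ + c₂ * (A + B)) ^ 2 * c₂ * (A + B)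
    + (c₁ + c₂ * (A + B)) * c₂ ^ 2 * (A * B) - c₂ ^ 3 with hz
  have hzz : (c₁ + c₂ * (A + B - S.α 2)) * (c₁ + c₂ * (A + B - S.α 1)) *
      (c₁ + c₂ * (A + B - S.α 0)) = (z : ℝ) := by
    rw [hz]
    push_cast
    linear_combination (-(c₁ + c₂ * (A + B) : ℝ) ^ 2 * c₂) * v1
      + ((c₁ + c₂ * (A + B) : ℝ) * c₂ ^ 2) * v2 - (c₂ : ℝ) ^ 3 * v3
  have hz0 : z ≠ 0 := by
    intro h0
    rw [h0] at hzz
    simp only [Int.cast_zero, mul_eq_zero] at hzz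
    rcases hzz with (h | h) | h
    exacts [hne _ h, hne _ h, hne _ h]
  rw [hzz]
  exact_mod_cast Int.one_le_abs hz0

end ThueRoots

theorem abs_disc_le_of_abs_le_abs {a b c : ℝ} (hab : |a| ≤ |b|) (hbc : |b| ≤ |c|) :
    |(a - b) * (b - c) * (c - a)| ≤ 2 * |b| * |c| ^ 2 := by
  wlog hc : 0 ≤ c generalizing a b c
  · have := this (a := -a) (b := -b) (c := -c) (by simpa using hab) (by simpa using hbc)
      (by linarith)
    rw [abs_neg, abs_neg] at this
    refine le_trans (le_of_eq ?_) this
    rw [← abs_neg]; congr 1; ring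
  rw [abs_of_nonneg hc] at *
  rcases le_total 0 b with hb | hb
  · rw [abs_of_nonneg hb] at *
    obtain ⟨h1, h2⟩ := abs_le.1 hab
    rw [show (a - b) * (b - c) * (c - a) = (b - a) * (c - b) * (c - a) by ring,
      abs_of_nonneg (mul_nonneg (mul_nonneg (by linarith) (by linarith)) (by linarith))]
    have h3 : (b - a) * (c - a) ≤ (2 * b) * (c + b) := by
      apply mul_le_mul <;> linarith
    nlinarith [mul_le_mul_of_nonneg_right h3 (by linarith : 0 ≤ c - b), pow_nonneg hb 3]
  · rw [abs_of_nonpos hb] at *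
    obtain ⟨p, rfl⟩ : ∃ p, b = -p := ⟨-b, by ring⟩
    rw [neg_neg] at *
    obtain ⟨h1, h2⟩ := abs_le.1 hab
    have hp : 0 ≤ p := by linarith
    rw [show (a - -p) * (-p - c) * (c - a) = -((a + p) * (c - a) * (c + p)) by ring, abs_neg,
      abs_of_nonneg (mul_nonneg (mul_nonneg (by linarith) (by linarith)) (by linarith))]
    rcases le_total (c ^ 2 - p ^ 2 - 4 * p * c) 0 with h | h
    · rcases hc.eq_or_lt with rfl | hc
      · obtain rfl : p = 0 := by linarith
        simp
      refine le_of_mul_le_mul_left ?_ (by linarith : 0 < 4 * (c + p))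
      have h4 := mul_nonneg (mul_nonneg (by linarith : 0 ≤ c + p) (by linarith : 0 ≤ c - p))
        (neg_nonneg.2 h)
      nlinarith [sq_nonneg ((c + p) * (2 * a - (c - p)))]
    · have hcp : 3 * p ≤ c := by nlinarith
      have : (a + p) * (c - a) ≤ (2 * p) * (c - p) := by nlinarith
      nlinarith [mul_le_mul_of_nonneg_right this (by linarith : 0 ≤ c + p), pow_nonneg hp 3]

theorem abs_disc_lt {a b c D : ℝ} (ha : a ≠ 0) (hb : b ≠ 0) (hc : c ≠ 0)
    (h1 : 2 * |a| < D * |b|) (h2 : 2 * |b| < D * |a|) (h3 : 2 * |a| < D * |c|)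
    (h4 : 2 * |c| < D * |a|) (h5 : 2 * |b| < D * |c|) (h6 : 2 * |c| < D * |b|) :
    |(a - b) * (b - c) * (c - a)| < D * (|a| * |b| * |c|) := by
  have key : ∀ {x y z : ℝ}, 0 < |y| → 0 < |z| → |x| ≤ |y| → |y| ≤ |z| → 2 * |z| < D * |x| →
      |(x - y) * (y - z) * (z - x)| < D * (|x| * |y| * |z|) := by
    intro x y z hy hz hxy hyz h
    refine (abs_disc_le_of_abs_le_abs hxy hyz).trans_lt ?_
    have := mul_lt_mul_of_pos_right h (mul_pos hy hz)
    nlinarith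
  have swap : ∀ {x y : ℝ}, x = -y → |x| = |y| := by rintro x y rfl; rw [abs_neg]
  have ha := abs_pos.2 ha
  have hb := abs_pos.2 hb
  have hc := abs_pos.2 hc
  have e1 : |(a - b) * (b - c) * (c - a)| = |(a - c) * (c - b) * (b - a)| :=
    swap (by ring)
  have e2 : |(a - b) * (b - c) * (c - a)| = |(b - a) * (a - c) * (c - b)| := swap (by ring)
  have e3 : |(a - b) * (b - c) * (c - a)| = |(c - b) * (b - a) * (a - c)| := swap (by ring)
  have e4 : (a - b) * (b - c) * (c - a) = (b - c) * (c - a) * (a - b) := by ring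
  have e5 : (a - b) * (b - c) * (c - a) = (c - a) * (a - b) * (b - c) := by ring
  rcases le_total |a| |b| with hab | hab
  · rcases le_total |b| |c| with hbc | hbc
    · exact key hb hc hab hbc h4
    · rcases le_total |a| |c| with hac | hac
      · rw [e1]; linarith [key hc hb hac hbc h2]
      · rw [e5]; linarith [key ha hb hac hab h5]
  · rcases le_total |b| |c| with hbc | hbc
    · rcases le_total |a| |c| with hac | hac
      · rw [e2]; linarith [key ha hc hab hac h6]
      · rw [e4]; linarith [key hc ha hbc hac h1]
    · rw [e3]; linarith [key hb ha hbc hab h3]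

namespace ThueRoots

variable {A B : ℤ} (S : ThueRoots A B)

theorem α_zero_le : S.α 0 ≤ 1 / 10 := by
  have hA := S.two_le'
  have hB := S.four_mul_le'
  have h := S.root 0
  have h0 := S.pos
  have h1 := S.lt_half
  by_contra! hc
  have : (3 / 2 : ℝ) * (15 / 2) ≤ (A - S.α 0) * (B - S.α 0) := by
    apply mul_le_mul <;> linarith
  nlinarith [mul_le_mul_of_nonneg_left this h0.le]

theorem α_one_ge : A - 1 / 6 ≤ S.α 1 := by
  have hA := S.two_le'
  have hB := S.four_mul_le'
  have h := S.root 1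
  have h0 := S.lt_one
  have h1 := S.one_lt
  by_contra! hc
  have : (1 : ℝ) * 6 ≤ S.α 1 * (B - S.α 1) := by
    apply mul_le_mul <;> linarith
  nlinarith [mul_le_mul_of_nonneg_left this (by linarith : 0 ≤ A - S.α 1)]

theorem α_two_le : S.α 2 ≤ B + 1 / 48 := by
  have hA := S.two_le'
  have hB := S.four_mul_le'
  have h := S.root 2
  have h0 := S.lt_two
  by_contra! hc
  have : (8 : ℝ) * 6 ≤ S.α 2 * (S.α 2 - A) := by
    apply mul_le_mul <;> linarith
  nlinarith [mul_le_mul_of_nonneg_left this (by linarith : 0 ≤ S.α 2 - B)]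

/-- Logarithms of the two fundamental units. -/
noncomputable def ℓ (i : Fin 3) : ℝ := Real.log |S.α i|

/-- Logarithms of the two fundamental units. -/
noncomputable def m (i : Fin 3) : ℝ := Real.log |S.α i - A|

theorem sum_ℓ : S.ℓ 0 + S.ℓ 1 + S.ℓ 2 = 0 := by
  have h := S.vieta.2.2
  rw [ℓ, ℓ, ℓ, ← Real.log_mul, ← Real.log_mul, ← abs_mul, ← abs_mul, h]
  · simp
  all_goals simp [(S.α_pos _).ne']

theorem prod_sub : (S.α 0 - A) * (S.α 1 - A) * (S.α 2 - A) = 1 := by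
  have := S.prod_sub_mul A 1
  simp at this
  linear_combination -this

theorem sum_m : S.m 0 + S.m 1 + S.m 2 = 0 := by
  have h := S.prod_sub
  rw [m, m, m, ← Real.log_mul, ← Real.log_mul, ← abs_mul, ← abs_mul, h]
  · simp
  all_goals simp only [ne_eq, mul_eq_zero, abs_eq_zero, S.sub_ne]
  all_goals simp

theorem ℓ_one_pos : 0 < S.ℓ 1 := by
  have hA := S.two_le'
  have := S.α_one_ge
  rw [ℓ, abs_of_pos (S.α_pos _)]
  exact Real.log_pos (by linarith)

theorem ℓ_one_lt_two : S.ℓ 1 < S.ℓ 2 := by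
  have hA := S.two_le'
  have hB := S.four_mul_le'
  rw [ℓ, ℓ, abs_of_pos (S.α_pos _), abs_of_pos (S.α_pos _)]
  exact Real.log_lt_log (S.α_pos _) (by linarith [S.one_lt, S.lt_two])

theorem m_zero_pos : 0 < S.m 0 := by
  have hA := S.two_le'
  have := S.α_zero_le
  rw [m, abs_sub_comm, abs_of_pos (by linarith)]
  exact Real.log_pos (by linarith)

theorem m_zero_lt_two : S.m 0 < S.m 2 := by
  have hA := S.two_le'
  have hB := S.four_mul_le'
  have := S.α_zero_le
  have := S.lt_two
  have := S.pos
  rw [m, m, abs_sub_comm, abs_of_pos (by linarith), abs_of_pos (by linarith)]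
  exact Real.log_lt_log (by linarith) (by linarith)

theorem det_pos : 0 < S.ℓ 2 * S.m 0 - S.ℓ 0 * S.m 2 := by
  have h1 := S.ℓ_one_pos
  have h2 := S.ℓ_one_lt_two
  have h3 := S.m_zero_pos
  have h4 := S.m_zero_lt_two
  have h5 := S.sum_ℓ
  have : 0 < S.ℓ 2 * S.m 0 := mul_pos (by linarith) h3
  have : 0 < -S.ℓ 0 * S.m 2 := mul_pos (by linarith) (by linarith)
  linarith

theorem log_abs_unit (u v : ℤ) (i : Fin 3) :
    Real.log |S.unit u v i| = u * S.ℓ i + v * S.m i := by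
  rw [unit, abs_mul, Real.log_mul (abs_ne_zero.2 (zpow_ne_zero _ (S.α_pos i).ne'))
    (abs_ne_zero.2 (zpow_ne_zero _ (S.sub_ne i))), abs_zpow, abs_zpow, Real.log_zpow,
    Real.log_zpow, ℓ, m]

theorem unit_ne (u v : ℤ) (i : Fin 3) : S.unit u v i ≠ 0 :=
  mul_ne_zero (zpow_ne_zero _ (S.α_pos i).ne') (zpow_ne_zero _ (S.sub_ne i))

/-- The product of the differences of the roots. -/
noncomputable def disc : ℝ := (S.α 1 - S.α 0) * (S.α 2 - S.α 0) * (S.α 2 - S.α 1)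

theorem disc_ge : 85 / 100 * (A * B * (B - A)) ≤ S.disc := by
  have hA := S.two_le'
  have hB := S.four_mul_le'
  have h0 := S.α_zero_le
  have h1 := S.α_one_ge
  have h2 := S.lt_two
  have h3 := S.one_lt
  have e1 : 866 / 1000 * A ≤ S.α 1 - S.α 0 := by linarith
  have e2 : 9875 / 10000 * B ≤ S.α 2 - S.α 0 := by linarith
  have e3 : B - A ≤ S.α 2 - S.α 1 := by linarith
  have e4 := mul_le_mul e1 e2 (by linarith) (by linarith)
  have e5 := mul_le_mul e4 e3 (by linarith) (by nlinarith)
  rw [disc]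
  refine le_trans ?_ e5
  have : (0:ℝ) ≤ A * B * (B - A) := by
    refine mul_nonneg (mul_nonneg ?_ ?_) ?_ <;> linarith
  nlinarith

/-- A difference of logarithms of conjugates, for the half-integral corner units. -/
noncomputable def spread (i j : Fin 3) : ℝ := |S.ℓ i - S.ℓ j| + |S.m i - S.m j|

theorem spread_comm (i j : Fin 3) : S.spread i j = S.spread j i := by
  rw [spread, spread, abs_sub_comm, abs_sub_comm (S.m i)]

theorem spread_lt_of_lt (i j : Fin 3) {q : ℝ} (hq : 0 < q) (h : S.spread i j ≤ Real.log q)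
    (hlt : 4 * q < S.disc ^ 2) :
    2 * Real.log 2 + S.spread i j < 2 * Real.log S.disc := by
  have h1 : Real.log (4 * q) < Real.log (S.disc ^ 2) := Real.log_lt_log (by linarith) hlt
  rw [Real.log_mul (by norm_num) hq.ne', Real.log_pow,
    show (4 : ℝ) = 2 ^ 2 by norm_num, Real.log_pow] at h1
  push_cast at h1
  linarith

theorem disc_pos : 0 < S.disc := by
  have hA := S.two_le'
  have hB := S.four_mul_le'
  refine lt_of_lt_of_le ?_ S.disc_ge
  refine mul_pos (by norm_num) (mul_pos (mul_pos ?_ ?_) ?_) <;> linarith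

theorem neg_m_one : -S.m 1 = S.ℓ 1 + Real.log (B - S.α 1) := by
  have hB := S.four_mul_le'
  have hA := S.two_le'
  have h1 := S.one_lt
  have p1 := S.α_pos 1
  rw [ℓ, m, abs_of_pos p1, ← Real.log_inv, ← Real.log_mul p1.ne' (by linarith), abs_sub_comm,
    abs_of_pos (by linarith)]
  congr 1
  refine inv_eq_of_mul_eq_one_right ?_
  linear_combination S.root 1

theorem m_one_neg : S.m 1 < 0 := by linarith [S.m_zero_pos, S.m_zero_lt_two, S.sum_m]

theorem ℓ_zero_neg : S.ℓ 0 < 0 := by linarith [S.ℓ_one_pos, S.ℓ_one_lt_two, S.sum_ℓ]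

theorem spread_zero_one : 2 * Real.log 2 + S.spread 0 1 < 2 * Real.log S.disc := by
  have hA := S.two_le'
  have hB := S.four_mul_le'
  have h0 := S.α_zero_le
  have h0' := S.pos
  have h1 := S.α_one_ge
  have h1' := S.one_lt
  have h2 := S.lt_two
  have h2' := S.α_two_le
  have p1 := S.α_pos 1
  have p2 := S.α_pos 2
  have hD := S.disc_ge
  have pA : (0 : ℝ) < A := by linarith
  have pB : (0 : ℝ) < B := by linarith
  have pBA : (0 : ℝ) < B - A := by linarith
  have k1 : 0 < A - S.α 0 := by linarith
  have k2 : 0 < B - S.α 1 := by linarith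
  refine S.spread_lt_of_lt 0 1
    (q := S.α 1 ^ 3 * S.α 2 * ((A - S.α 0) * (B - S.α 1))) (by positivity) ?_ ?_
  · rw [Real.log_mul (by positivity) (by positivity), Real.log_mul (by positivity) (by positivity),
      Real.log_mul k1.ne' k2.ne', Real.log_pow, spread, abs_sub_comm, abs_of_pos
      (by linarith [S.ℓ_zero_neg, S.ℓ_one_pos]),
      abs_of_pos (by linarith [S.m_zero_pos, S.m_one_neg])]
    have e1 : S.m 0 = Real.log (A - S.α 0) := by rw [m, abs_sub_comm, abs_of_pos k1]
    have e2 : S.ℓ 1 = Real.log (S.α 1) := by rw [ℓ, abs_of_pos p1]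
    have e3 : S.ℓ 2 = Real.log (S.α 2) := by rw [ℓ, abs_of_pos p2]
    rw [← e1, ← e2, ← e3]
    push_cast
    linarith [S.neg_m_one, S.sum_ℓ]
  · have a1 : S.α 1 ^ 3 ≤ (A : ℝ) ^ 3 := by gcongr
    have a2 : S.α 2 ≤ 1003 / 1000 * (B : ℝ) := by linarith
    have a3 : (A - S.α 0) * (B - S.α 1) ≤ A * (103 / 100 * (B - A)) := by
      apply mul_le_mul <;> linarith
    have a4 := mul_le_mul a1 a2 p2.le (by positivity)
    have a5 := mul_le_mul a4 a3 (by positivity) (by positivity)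
    have a6 := pow_le_pow_left₀ (by positivity) hD 2
    have a7 : 12 * (A : ℝ) ^ 2 ≤ B * (B - A) := by nlinarith
    have a8 : (0 : ℝ) < A ^ 2 * (B * (B - A)) := by
      positivity
    have a9 := mul_le_mul_of_nonneg_left a7 a8.le
    nlinarith

theorem spread_zero_two : 2 * Real.log 2 + S.spread 0 2 < 2 * Real.log S.disc := by
  have hA := S.two_le'
  have hB := S.four_mul_le'
  have h0 := S.α_zero_le
  have h0' := S.pos
  have h1 := S.α_one_ge
  have h1' := S.one_lt
  have h2 := S.lt_two
  have h2' := S.α_two_le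
  have p1 := S.α_pos 1
  have p2 := S.α_pos 2
  have hD := S.disc_ge
  have pA : (0 : ℝ) < A := by linarith
  have pB : (0 : ℝ) < B := by linarith
  have pBA : (0 : ℝ) < B - A := by linarith
  have k1 : 0 < A - S.α 0 := by linarith
  have k2 : 0 < S.α 2 - A := by linarith
  refine S.spread_lt_of_lt 0 2
    (q := S.α 1 * S.α 2 ^ 2 * (S.α 2 - A) / (A - S.α 0)) (by positivity) ?_ ?_
  · rw [Real.log_div (by positivity) (by positivity), Real.log_mul (by positivity) (by positivity),
      Real.log_mul (by positivity) (by positivity), Real.log_pow, spread, abs_sub_comm, abs_of_pos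
      (by linarith [S.ℓ_zero_neg, S.ℓ_one_pos, S.ℓ_one_lt_two]), abs_sub_comm,
      abs_of_pos (by linarith [S.m_zero_lt_two])]
    have e1 : S.m 0 = Real.log (A - S.α 0) := by rw [m, abs_sub_comm, abs_of_pos k1]
    have e2 : S.ℓ 1 = Real.log (S.α 1) := by rw [ℓ, abs_of_pos p1]
    have e3 : S.ℓ 2 = Real.log (S.α 2) := by rw [ℓ, abs_of_pos p2]
    have e4 : S.m 2 = Real.log (S.α 2 - A) := by rw [m, abs_of_pos k2]
    rw [← e1, ← e2, ← e3, ← e4]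
    push_cast
    linarith [S.sum_ℓ]
  · have a1 : S.α 1 ≤ 106 / 100 * (A - S.α 0) := by linarith
    have a2 : S.α 2 ^ 2 ≤ (1003 / 1000 * (B : ℝ)) ^ 2 := by gcongr; linarith
    have a3 : S.α 2 - A ≤ 1004 / 1000 * (B - A) := by linarith
    have a4 := mul_le_mul (mul_le_mul a1 a2 (by positivity) (by positivity)) a3 k2.le
      (by positivity)
    have a6 := pow_le_pow_left₀ (by positivity) hD 2
    have a7 : 24 ≤ (A : ℝ) ^ 2 * (B - A) := by nlinarith
    have a8 : (0 : ℝ) < B ^ 2 * (B - A) := by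
      positivity
    have a9 := mul_le_mul_of_nonneg_left a7 a8.le
    have a10 : S.α 1 * S.α 2 ^ 2 * (S.α 2 - A) / (A - S.α 0) ≤
        106 / 100 * (1003 / 1000 * B) ^ 2 * (1004 / 1000 * (B - A)) := by
      rw [div_le_iff₀ k1]; linarith
    nlinarith

theorem spread_one_two : 2 * Real.log 2 + S.spread 1 2 < 2 * Real.log S.disc := by
  have hA := S.two_le'
  have hB := S.four_mul_le'
  have h1 := S.α_one_ge
  have h1' := S.one_lt
  have h2 := S.lt_two
  have h2' := S.α_two_le
  have p1 := S.α_pos 1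
  have p2 := S.α_pos 2
  have hD := S.disc_ge
  have pA : (0 : ℝ) < A := by linarith
  have pB : (0 : ℝ) < B := by linarith
  have pBA : (0 : ℝ) < B - A := by linarith
  have k1 : 0 < B - S.α 1 := by linarith
  have k2 : 0 < S.α 2 - A := by linarith
  refine S.spread_lt_of_lt 1 2
    (q := S.α 2 * (S.α 2 - A) * (B - S.α 1)) (by positivity) ?_ ?_
  · rw [Real.log_mul (by positivity) (by positivity),
      Real.log_mul (by positivity) (by positivity), spread, abs_sub_comm, abs_of_pos
      (by linarith [S.ℓ_one_lt_two]), abs_sub_comm,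
      abs_of_pos (by linarith [S.m_zero_lt_two, S.m_one_neg, S.m_zero_pos])]
    have e3 : S.ℓ 2 = Real.log (S.α 2) := by rw [ℓ, abs_of_pos p2]
    have e4 : S.m 2 = Real.log (S.α 2 - A) := by rw [m, abs_of_pos k2]
    rw [← e3, ← e4]
    linarith [S.neg_m_one]
  · have a2 : S.α 2 ≤ 1003 / 1000 * (B : ℝ) := by linarith
    have a3 : S.α 2 - A ≤ 1004 / 1000 * (B - A) := by linarith
    have a1 : B - S.α 1 ≤ 103 / 100 * (B - A) := by linarith
    have a0 : (0 : ℝ) < B - A := by linarith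
    have a4 := mul_le_mul (mul_le_mul a2 a3 k2.le (by positivity)) a1 k1.le
      (by positivity)
    have a6 := pow_le_pow_left₀ (by positivity) hD 2
    have a7 : 24 ≤ (A : ℝ) ^ 2 * B := by nlinarith
    have a8 : (0 : ℝ) < B * (B - A) ^ 2 := by positivity
    have a9 := mul_le_mul_of_nonneg_left a7 a8.le
    nlinarith

theorem exists_unit_of_abs_prod_eq_one {x y : ℤ}
    (h : |((x * (x - A * y) * (x - B * y) - y ^ 3 : ℤ) : ℝ)| = 1) :
    ∃ u v : ℤ, ∀ i, |(x - S.α i * y : ℝ)| = |S.unit u v i| := by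
  have hspread : ∀ i j, i ≠ j → 2 * Real.log 2 + S.spread i j < 2 * Real.log S.disc := by
    intro i j hij
    fin_cases i <;> fin_cases j <;> first
      | exact absurd rfl hij
      | exact S.spread_zero_one
      | exact S.spread_zero_two
      | exact S.spread_one_two
      | (rw [spread_comm]; exact S.spread_zero_one)
      | (rw [spread_comm]; exact S.spread_zero_two)
      | (rw [spread_comm]; exact S.spread_one_two)
  have hprod : |(x - S.α 0 * y : ℝ)| * |(x - S.α 1 * y : ℝ)| * |(x - S.α 2 * y : ℝ)| = 1 := by
    rw [← abs_mul, ← abs_mul, S.prod_sub_mul, ← h]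
    push_cast; rfl
  have hne : ∀ i, (x - S.α i * y : ℝ) ≠ 0 := by
    intro i hi
    have : ∀ i : Fin 3, i = 0 ∨ i = 1 ∨ i = 2 := by decide
    rcases this i with rfl | rfl | rfl <;> simp [hi] at hprod
  set e : Fin 3 → ℝ := fun i => Real.log |(x - S.α i * y : ℝ)| with he
  have hesum : e 0 + e 1 + e 2 = 0 := by
    simp only [he]
    rw [← Real.log_mul (abs_ne_zero.2 (hne 0)) (abs_ne_zero.2 (hne 1)),
      ← Real.log_mul (mul_ne_zero (abs_ne_zero.2 (hne 0)) (abs_ne_zero.2 (hne 1)))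
        (abs_ne_zero.2 (hne 2)), hprod, Real.log_one]
  have hdet := S.det_pos
  set d := S.ℓ 2 * S.m 0 - S.ℓ 0 * S.m 2 with hd
  obtain ⟨s, hs⟩ : ∃ s, s * d = e 2 * S.m 0 - e 0 * S.m 2 := ⟨_, div_mul_cancel₀ _ hdet.ne'⟩
  obtain ⟨t, ht⟩ : ∃ t, t * d = S.ℓ 2 * e 0 - S.ℓ 0 * e 2 := ⟨_, div_mul_cancel₀ _ hdet.ne'⟩
  have hst : ∀ i, e i = s * S.ℓ i + t * S.m i := by
    have h0 : e 0 = s * S.ℓ 0 + t * S.m 0 :=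
      mul_left_cancel₀ hdet.ne' (by rw [hd] at *; linear_combination -S.ℓ 0 * hs - S.m 0 * ht)
    have h2 : e 2 = s * S.ℓ 2 + t * S.m 2 :=
      mul_left_cancel₀ hdet.ne' (by rw [hd] at *; linear_combination -S.ℓ 2 * hs - S.m 2 * ht)
    intro i
    fin_cases i
    · exact h0
    · have := S.sum_ℓ
      have := S.sum_m
      show e 1 = s * S.ℓ 1 + t * S.m 1
      linear_combination hesum - h0 - h2 - s * S.sum_ℓ - t * S.sum_m
    · exact h2
  refine ⟨round s, round t, ?_⟩
  have hs' := abs_sub_round s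
  have ht' := abs_sub_round t
  set u := round s
  set v := round t
  set η : Fin 3 → ℝ := (fun i => (x - S.α i * y : ℝ)) * S.unit (-u) (-v) with hη
  have hηne : ∀ i, η i ≠ 0 := fun i => mul_ne_zero (hne i) (S.unit_ne _ _ i)
  have hlog : ∀ i, Real.log |η i| = (s - u) * S.ℓ i + (t - v) * S.m i := by
    intro i
    have : Real.log |η i| = e i + Real.log |S.unit (-u) (-v) i| := by
      rw [hη, Pi.mul_apply, abs_mul,
        Real.log_mul (abs_ne_zero.2 (hne i)) (abs_ne_zero.2 (S.unit_ne _ _ i))]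
    rw [this, hst, S.log_abs_unit]
    push_cast; ring
  have hratio : ∀ i j, i ≠ j → 2 * |η i| < S.disc * |η j| := by
    intro i j hij
    have hi := abs_pos.2 (hηne i)
    have hj := abs_pos.2 (hηne j)
    rw [← Real.log_lt_log_iff (by positivity) (mul_pos S.disc_pos hj),
      Real.log_mul (by norm_num) hi.ne', Real.log_mul S.disc_pos.ne' hj.ne', hlog, hlog]
    have h1 := hspread i j hij
    rw [spread] at h1
    have k1 : (s - u) * (S.ℓ i - S.ℓ j) ≤ 1 / 2 * |S.ℓ i - S.ℓ j| := by
      refine (le_abs_self _).trans ?_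
      rw [abs_mul]; gcongr
    have k2 : (t - v) * (S.m i - S.m j) ≤ 1 / 2 * |S.m i - S.m j| := by
      refine (le_abs_self _).trans ?_
      rw [abs_mul]; gcongr
    linarith
  have hηprod : |η 0| * |η 1| * |η 2| = 1 := by
    have : Real.log (|η 0| * |η 1| * |η 2|) = 0 := by
      rw [Real.log_mul (mul_ne_zero (abs_ne_zero.2 (hηne 0)) (abs_ne_zero.2 (hηne 1)))
        (abs_ne_zero.2 (hηne 2)), Real.log_mul (abs_ne_zero.2 (hηne 0)) (abs_ne_zero.2 (hηne 1)),
        hlog, hlog, hlog]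
      linear_combination (s - u) * S.sum_ℓ + (t - v) * S.sum_m
    have hp : 0 < |η 0| * |η 1| * |η 2| :=
      mul_pos (mul_pos (abs_pos.2 (hηne 0)) (abs_pos.2 (hηne 1))) (abs_pos.2 (hηne 2))
    exact Real.eq_one_of_pos_of_log_eq_zero hp this
  obtain ⟨c₀, c₁, c₂, hc⟩ : S.InOrder η :=
    InOrder.mul ⟨x, -y, 0, fun i => by push_cast; ring⟩ (S.inOrder_unit _ _)
  have hconst : c₁ = 0 ∧ c₂ = 0 := by
    by_contra hcon
    have h1 := S.one_le_index hcon
    have h2 := abs_disc_lt (hηne 0) (hηne 1) (hηne 2) (hratio 0 1 (by decide))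
      (hratio 1 0 (by decide)) (hratio 0 2 (by decide)) (hratio 2 0 (by decide))
      (hratio 1 2 (by decide)) (hratio 2 1 (by decide))
    rw [hηprod, mul_one, hc, hc, hc] at h2
    have h3 : (c₀ + c₁ * S.α 0 + c₂ * S.α 0 ^ 2 - (c₀ + c₁ * S.α 1 + c₂ * S.α 1 ^ 2)) *
        (c₀ + c₁ * S.α 1 + c₂ * S.α 1 ^ 2 - (c₀ + c₁ * S.α 2 + c₂ * S.α 2 ^ 2)) *
        (c₀ + c₁ * S.α 2 + c₂ * S.α 2 ^ 2 - (c₀ + c₁ * S.α 0 + c₂ * S.α 0 ^ 2)) =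
        S.disc * ((c₁ + c₂ * (S.α 0 + S.α 1)) * (c₁ + c₂ * (S.α 0 + S.α 2)) *
          (c₁ + c₂ * (S.α 1 + S.α 2))) := by rw [disc]; ring
    rw [h3, abs_mul, abs_of_pos S.disc_pos] at h2
    nlinarith [S.disc_pos]
  obtain ⟨rfl, rfl⟩ := hconst
  have hc' : ∀ i, η i = c₀ := fun i => by rw [hc]; simp
  have hone : |(c₀ : ℝ)| = 1 := by
    rw [hc', hc', hc'] at hηprod
    have : |(c₀ : ℝ)| ^ 3 = 1 := by rw [← hηprod]; ring
    exact (pow_eq_one_iff_of_nonneg (abs_nonneg _) (by norm_num)).1 this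
  intro i
  have h1 : |η i| = 1 := by rw [hc', hone]
  have h2 : Real.log |(x - S.α i * y : ℝ)| = Real.log |S.unit u v i| := by
    have h3 := hlog i
    rw [h1, Real.log_one] at h3
    rw [S.log_abs_unit]
    have := hst i
    simp only [he] at this
    linarith
  exact Real.log_injOn_pos (abs_pos.2 (hne i)) (abs_pos.2 (S.unit_ne _ _ i)) h2

end ThueRoots

namespace ThueRoots

variable {A B : ℤ} (S : ThueRoots A B)

/-- Logarithm of the distance between two roots. -/
noncomputable def gap (i j : Fin 3) : ℝ := Real.log |S.α i - S.α j|

/-- The linear form attached to a solution close to the root of index `j`. -/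
noncomputable def lam (j : Fin 3) (u v : ℤ) : ℝ :=
  u * (S.ℓ (j + 1) - S.ℓ (j + 2)) + v * (S.m (j + 1) - S.m (j + 2))
    - (S.gap j (j + 1) - S.gap j (j + 2))

theorem le_abs_sub {i j : Fin 3} (h : i ≠ j) : 8 / 5 ≤ |S.α i - S.α j| := by
  have hA := S.two_le'
  have hB := S.four_mul_le'
  have h0 := S.α_zero_le
  have h1 := S.α_one_ge
  have h2 := S.lt_two
  have h3 := S.one_lt
  have a : 8 / 5 ≤ |S.α 0 - S.α 1| := le_abs.2 (Or.inr (by linarith))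
  have b : 8 / 5 ≤ |S.α 0 - S.α 2| := le_abs.2 (Or.inr (by linarith))
  have c : 8 / 5 ≤ |S.α 1 - S.α 2| := le_abs.2 (Or.inr (by linarith))
  fin_cases i <;> fin_cases j <;> first
    | exact absurd rfl h
    | assumption
    | (rw [abs_sub_comm]; assumption)

theorem α_le (i : Fin 3) : S.α i ≤ B + 1 := by
  have hA := S.two_le'
  have hB := S.four_mul_le'
  have h1 := S.one_lt
  have h2 := S.two_lt
  have h0 := S.lt_half
  fin_cases i
  · show S.α 0 ≤ _; linarith
  · show S.α 1 ≤ _; linarith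
  · show S.α 2 ≤ _; linarith

theorem abs_sub_le (i j : Fin 3) : |S.α i - S.α j| ≤ B + 1 := by
  have := S.α_pos i
  have := S.α_pos j
  have := S.α_le i
  have := S.α_le j
  rw [abs_sub_le_iff]; constructor <;> linarith

theorem le_abs_sub_mul (j : Fin 3) :
    10 ≤ |S.α j - S.α (j + 1)| * |S.α j - S.α (j + 2)| := by
  have hA := S.two_le'
  have hB := S.four_mul_le'
  have h0 := S.α_zero_le
  have h1 := S.α_one_ge
  have h2 := S.lt_two
  have h3 := S.one_lt
  have a : 17 / 10 ≤ |S.α 0 - S.α 1| := le_abs.2 (Or.inr (by linarith))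
  have b : 6 ≤ |S.α 0 - S.α 2| := le_abs.2 (Or.inr (by linarith))
  have c : 6 ≤ |S.α 1 - S.α 2| := le_abs.2 (Or.inr (by linarith))
  fin_cases j
  · show _ ≤ |S.α 0 - S.α 1| * |S.α 0 - S.α 2|
    nlinarith
  · show _ ≤ |S.α 1 - S.α 2| * |S.α 1 - S.α 0|
    rw [abs_sub_comm _ (S.α 0)]; nlinarith
  · show _ ≤ |S.α 2 - S.α 0| * |S.α 2 - S.α 1|
    rw [abs_sub_comm _ (S.α 0), abs_sub_comm _ (S.α 1)]; nlinarith

/-- Recovering exponents from logarithms. -/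
theorem abs_exponents_le {u v : ℤ} {E : ℝ} (h0 : |u * S.ℓ 0 + v * S.m 0| ≤ E)
    (h2 : |u * S.ℓ 2 + v * S.m 2| ≤ E) : |(u : ℝ)| * S.ℓ 2 ≤ E ∧ |(v : ℝ)| * S.m 2 ≤ 2 * E := by
  have k1 := S.ℓ_one_pos
  have k2 := S.ℓ_one_lt_two
  have k3 := S.m_zero_pos
  have k4 := S.m_zero_lt_two
  have k5 := S.sum_ℓ
  have hd := S.det_pos
  have hE : 0 ≤ E := (abs_nonneg _).trans h0
  set e0 := u * S.ℓ 0 + v * S.m 0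
  set e2 := u * S.ℓ 2 + v * S.m 2
  set d := S.ℓ 2 * S.m 0 - S.ℓ 0 * S.m 2 with hdd
  have hu : |(u : ℝ)| * d ≤ E * (S.m 0 + S.m 2) := by
    rw [show |(u : ℝ)| * d = |(u : ℝ) * d| by rw [abs_mul, abs_of_pos hd],
      show (u : ℝ) * d = e2 * S.m 0 - e0 * S.m 2 by ring]
    refine (abs_sub _ _).trans ?_
    rw [abs_mul, abs_mul, abs_of_pos k3, abs_of_pos (k3.trans k4)]
    nlinarith
  have hv : |(v : ℝ)| * d ≤ E * (S.ℓ 2 - S.ℓ 0) := by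
    rw [show |(v : ℝ)| * d = |(v : ℝ) * d| by rw [abs_mul, abs_of_pos hd],
      show (v : ℝ) * d = e0 * S.ℓ 2 - e2 * S.ℓ 0 by ring]
    refine (abs_sub _ _).trans ?_
    rw [abs_mul, abs_mul, abs_of_pos (k1.trans k2), abs_of_neg S.ℓ_zero_neg]
    nlinarith [S.ℓ_zero_neg]
  have hp : 0 < S.ℓ 2 := k1.trans k2
  constructor
  · have : S.ℓ 2 * (S.m 0 + S.m 2) ≤ d := by rw [hdd]; nlinarith
    refine le_of_mul_le_mul_right ?_ (show 0 < S.m 0 + S.m 2 by linarith)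
    calc |(u : ℝ)| * S.ℓ 2 * (S.m 0 + S.m 2) = |(u : ℝ)| * (S.ℓ 2 * (S.m 0 + S.m 2)) := by ring
      _ ≤ |(u : ℝ)| * d := by gcongr
      _ ≤ _ := hu
  · have : S.m 2 * (S.ℓ 2 - S.ℓ 0) ≤ 2 * d := by rw [hdd]; nlinarith
    refine le_of_mul_le_mul_right ?_ (show 0 < S.ℓ 2 - S.ℓ 0 by linarith)
    calc |(v : ℝ)| * S.m 2 * (S.ℓ 2 - S.ℓ 0) = |(v : ℝ)| * (S.m 2 * (S.ℓ 2 - S.ℓ 0)) := by ring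
      _ ≤ |(v : ℝ)| * (2 * d) := by gcongr
      _ ≤ _ := by linarith

theorem abs_log_one_add_le {t : ℝ} (ht : |t| ≤ 1 / 2) : |Real.log (|1 + t|)| ≤ 2 * |t| := by
  obtain ⟨h1, h2⟩ := abs_le.1 ht
  have hp : 0 < 1 + t := by linarith
  rw [abs_of_pos hp, abs_le]
  have hu := Real.log_le_sub_one_of_pos hp
  have hl := Real.one_sub_inv_le_log_of_pos hp
  constructor
  · refine le_trans ?_ hl
    rw [le_sub_iff_add_le, ← le_sub_iff_add_le', inv_le_comm₀ hp (by linarith [abs_nonneg t])]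
    rw [inv_le_comm₀ (by linarith [abs_nonneg t]) hp]
    rw [inv_le_iff_one_le_mul₀ hp]
    rcases abs_cases t with ⟨h, h'⟩ | ⟨h, h'⟩ <;> rw [h] <;> nlinarith
  · linarith [le_abs_self t, abs_nonneg t]

set_option maxHeartbeats 1000000 in
theorem exists_lam_small {x y : ℤ}
    (h : |((x * (x - A * y) * (x - B * y) - y ^ 3 : ℤ) : ℝ)| = 1) (hy : 2 ≤ |y|) :
    ∃ (j : Fin 3) (u v : ℤ), |S.lam j u v| ≤ 1 / |(y : ℝ)| ^ 3 ∧ A * B / 2 ≤ |(y : ℝ)| ∧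
      |(u : ℝ)| ≤ 7 * Real.log |(y : ℝ)| ∧ |(v : ℝ)| ≤ 7 * Real.log |(y : ℝ)| ∧
      |x - S.α j * y| ≤ 1 / (2 * |(y : ℝ)| ^ 2) ∧ |x - S.α j * y| = |S.unit u v j| := by
  obtain ⟨u, v, huv⟩ := S.exists_unit_of_abs_prod_eq_one h
  set η : Fin 3 → ℝ := fun i => x - S.α i * y with hη
  have hprod : |η 0| * |η 1| * |η 2| = 1 := by
    rw [← abs_mul, ← abs_mul, hη, S.prod_sub_mul, ← h]
    push_cast; rfl
  have hne : ∀ i, 0 < |η i| := by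
    intro i
    rw [show |η i| = _ from huv i]
    exact abs_pos.2 (S.unit_ne _ _ i)
  obtain ⟨j, hj⟩ := Finite.exists_min fun i => |η i|
  set Y : ℝ := |(y : ℝ)| with hY
  have hY2 : 2 ≤ Y := by rw [hY]; exact_mod_cast hy
  have hbig : ∀ i, i ≠ j → Y * |S.α j - S.α i| ≤ 2 * |η i| := by
    intro i hi
    have : (y : ℝ) * (S.α j - S.α i) = η i - η j := by simp only [hη]; ring
    rw [hY, ← abs_mul, this]
    linarith [abs_sub (η i) (η j), hj i]
  have hprodj : |η j| * (|η (j + 1)| * |η (j + 2)|) = 1 := by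
    rw [← hprod]
    have : ∀ j : Fin 3, j = 0 ∨ j = 1 ∨ j = 2 := by decide
    rcases this j with rfl | rfl | rfl
    · show |η 0| * (|η 1| * |η 2|) = _; ring
    · show |η 1| * (|η 2| * |η 0|) = _; ring
    · show |η 2| * (|η 0| * |η 1|) = _; ring
  have n1 : j + 1 ≠ j := by clear * -; revert j; decide
  have n2 : j + 2 ≠ j := by clear * -; revert j; decide
  have hsmall' : |η j| ≤ 2 / (5 * Y ^ 2) := by
    rw [le_div_iff₀ (by positivity)]
    have h1 := hbig _ n1
    have h2 := hbig _ n2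
    have h3 := mul_le_mul h1 h2 (by positivity) (by positivity)
    have h4 := S.le_abs_sub_mul j
    have h5 : 10 * Y ^ 2 ≤ 4 * (|η (j + 1)| * |η (j + 2)|) := by nlinarith [sq_nonneg Y]
    nlinarith [mul_le_mul_of_nonneg_left h5 (hne j).le]
  have hsmall : |η j| ≤ 1 / (2 * Y ^ 2) := by
    refine hsmall'.trans ?_
    rw [div_le_div_iff₀ (by positivity) (by positivity)]; nlinarith [sq_nonneg Y]
  have hY3 : 1 / (2 * Y ^ 2) ≤ 1 / 8 := by
    rw [div_le_div_iff₀ (by positivity) (by norm_num)]; nlinarith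
  have hlog : ∀ i, i ≠ j → |Real.log |η i| - Real.log Y - S.gap j i| ≤ 1 / (2 * Y ^ 3) ∧
      0 ≤ Real.log |η i| := by
    intro i hi
    have hd := S.le_abs_sub hi.symm
    have hd0 : S.α j - S.α i ≠ 0 := by
      intro h0
      rw [h0] at hd
      norm_num at hd
    have hy0 : (y : ℝ) ≠ 0 := by
      intro h0
      rw [hY, h0] at hY2
      norm_num at hY2
    constructor
    · set t := η j / (y * (S.α j - S.α i)) with ht
      have hηi : η i = y * (S.α j - S.α i) * (1 + t) := by
        rw [ht]; field_simp; simp only [hη]; ring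
      have ht' : |t| ≤ 1 / (4 * Y ^ 3) := by
        rw [ht, abs_div, abs_mul, ← hY, div_le_iff₀ (by positivity)]
        refine hsmall'.trans ?_
        calc 2 / (5 * Y ^ 2) = 1 / (4 * Y ^ 3) * (Y * (8 / 5)) := by field_simp; norm_num
          _ ≤ _ := by gcongr
      have hq : 1 / (4 * Y ^ 3) ≤ 1 / 2 := by
        rw [div_le_div_iff₀ (by positivity) (by norm_num)]
        nlinarith [pow_le_pow_left₀ (by norm_num) hY2 3]
      have hl := abs_log_one_add_le (ht'.trans hq)
      have h1t : |1 + t| ≠ 0 := by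
        intro h0
        rw [abs_eq_zero] at h0
        rw [h0, mul_zero] at hηi
        have := hne i
        rw [hηi, abs_zero] at this
        exact lt_irrefl _ this
      rw [hηi, abs_mul, abs_mul, ← hY, Real.log_mul (by positivity) h1t,
        Real.log_mul (by positivity) (abs_ne_zero.2 hd0), gap]
      rw [show Real.log Y + Real.log |S.α j - S.α i| + Real.log (|1 + t|) - Real.log Y -
        Real.log |S.α j - S.α i| = Real.log (|1 + t|) by ring]
      refine hl.trans ?_
      calc 2 * |t| ≤ 2 * (1 / (4 * Y ^ 3)) := by gcongr
        _ = _ := by field_simp; norm_num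
    · refine Real.log_nonneg ?_
      nlinarith [hbig i hi]
  have hYlog : 0.69 < Real.log Y := by
    have := Real.log_two_gt_d9
    have := Real.log_le_log (by norm_num) hY2
    norm_num at *; linarith
  have hlow : A * B / 2 ≤ Y := by
    have hA := S.two_le'
    have hB := S.four_mul_le'
    have h0 := S.α_zero_le
    have h0' := S.pos
    have h1 := S.α_one_ge
    have h1' := S.one_lt
    have h2 := S.lt_two
    have key : ∀ c : ℤ, c * (c - A) * (c - B) = 0 → 7 / 8 ≤ |S.α j - c| * Y := by
      intro c hc
      have hxc : x - c * y ≠ 0 := by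
        intro h0
        obtain rfl : x = c * y := by linarith
        have : c * y * (c * y - A * y) * (c * y - B * y) - y ^ 3 = -y ^ 3 := by
          linear_combination y ^ 3 * hc
        rw [this] at h
        push_cast at h
        rw [abs_neg, abs_pow, ← hY] at h
        nlinarith [pow_le_pow_left₀ (by norm_num) hY2 3]
      have h1 : (1 : ℝ) ≤ |(x - c * y : ℝ)| := by exact_mod_cast Int.one_le_abs hxc
      have h2 : (x - c * y : ℝ) = η j + (S.α j - c) * y := by simp only [hη]; ring
      rw [h2] at h1
      have := abs_add_le (η j) ((S.α j - c) * y)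
      rw [abs_mul, ← hY] at this
      linarith
    have : ∀ j : Fin 3, j = 0 ∨ j = 1 ∨ j = 2 := by decide
    have hr := S.root j
    rcases this j with rfl | rfl | rfl
    · have k := key 0 (by ring)
      rw [Int.cast_zero, sub_zero, abs_of_pos h0'] at k
      have k2 : (A : ℝ) * B * (4 / 7) ≤ (A - S.α 0) * (B - S.α 0) := by nlinarith
      have k3 := mul_le_mul_of_nonneg_left k (by nlinarith : 0 ≤ (A - S.α 0) * (B - S.α 0))
      have k4 : (A - S.α 0) * (B - S.α 0) * (S.α 0 * Y) = Y := by linear_combination Y * hr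
      linarith
    · have k := key A (by ring)
      rw [abs_sub_comm, abs_of_pos (by linarith)] at k
      have k2 : (A : ℝ) * B * (4 / 7) ≤ S.α 1 * (B - S.α 1) := by nlinarith
      have k3 := mul_le_mul_of_nonneg_left k (by nlinarith : 0 ≤ S.α 1 * (B - S.α 1))
      have k4 : S.α 1 * (B - S.α 1) * ((A - S.α 1) * Y) = Y := by linear_combination Y * hr
      linarith
    · have k := key B (by ring)
      rw [abs_of_pos (by linarith)] at k
      have k2 : (A : ℝ) * B * (4 / 7) ≤ S.α 2 * (S.α 2 - A) := by nlinarith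
      have k3 := mul_le_mul_of_nonneg_left k (by nlinarith : 0 ≤ S.α 2 * (S.α 2 - A))
      have k4 : S.α 2 * (S.α 2 - A) * ((S.α 2 - B) * Y) = Y := by linear_combination Y * hr
      linarith
  have hlogu : ∀ i, Real.log |η i| = u * S.ℓ i + v * S.m i := by
    intro i
    rw [← S.log_abs_unit, ← huv i]
  have hE : |(u : ℝ)| ≤ 7 * Real.log Y ∧ |(v : ℝ)| ≤ 7 * Real.log Y := by
    have hA := S.two_le'
    have hB := S.four_mul_le'
    have hYB : B ≤ Y := by nlinarith
    have hlog4 : Real.log 4 = 2 * Real.log 2 := by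
      rw [show (4 : ℝ) = 2 ^ 2 by norm_num, Real.log_pow]; norm_num
    have hlog8 : Real.log 8 = 3 * Real.log 2 := by
      rw [show (8 : ℝ) = 2 ^ 3 by norm_num, Real.log_pow]; norm_num
    have l2 := Real.log_two_gt_d9
    have hY8 : 2 ≤ Real.log Y := by
      have := Real.log_le_log (by norm_num) (show (8 : ℝ) ≤ Y by linarith)
      norm_num at l2; linarith
    have hB1 : Real.log (B + 1) ≤ Real.log Y + 1 / 8 := by
      have e1 : (B : ℝ) + 1 ≤ Y * (1 + 1 / 8) := by linarith
      have e2 := Real.log_le_log (by linarith) e1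
      rw [Real.log_mul (by linarith) (by norm_num)] at e2
      linarith [Real.log_le_sub_one_of_pos (show (0 : ℝ) < 1 + 1 / 8 by norm_num)]
    have hq : 1 / (2 * Y ^ 3) ≤ 1 / 8 := by
      rw [div_le_div_iff₀ (by positivity) (by norm_num)]
      nlinarith [pow_le_pow_left₀ (by norm_num) hY2 3]
    have hup : ∀ i, i ≠ j → Real.log |η i| ≤ 2 * Real.log Y + 1 / 4 := by
      intro i hi
      have e1 := (abs_le.1 (hlog i hi).1).2
      have e2 : S.gap j i ≤ Real.log (B + 1) :=
        Real.log_le_log (lt_of_lt_of_le (by norm_num) (S.le_abs_sub hi.symm)) (S.abs_sub_le _ _)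
      linarith
    have hall : ∀ i, |Real.log (|η i|)| ≤ 4 * Real.log Y + 1 / 2 := by
      intro i
      by_cases hi : i = j
      · subst hi
        have hs : Real.log |η i| + (Real.log |η (i + 1)| + Real.log |η (i + 2)|) = 0 := by
          rw [← Real.log_mul (hne _).ne' (hne _).ne', ← Real.log_mul (hne _).ne'
            (mul_ne_zero (hne _).ne' (hne _).ne'), hprodj, Real.log_one]
        have := hup _ n1
        have := hup _ n2
        have := (hlog _ n1).2
        have := (hlog _ n2).2
        rw [abs_le]; constructor <;> linarith
      · rw [abs_of_nonneg (hlog i hi).2]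
        linarith [hup i hi]
    obtain ⟨r1, r2⟩ := S.abs_exponents_le (E := 4 * Real.log Y + 1 / 2) (u := u) (v := v)
      (by rw [← hlogu]; exact hall 0)
      (by rw [← hlogu]; exact hall 2)
    have q1 : 4 / 3 ≤ S.ℓ 2 := by
      have := S.lt_two
      rw [ℓ, abs_of_pos (S.α_pos _)]
      have := Real.log_le_log (by norm_num) (show (8 : ℝ) ≤ S.α 2 by linarith)
      norm_num at l2; linarith
    have q2 : 4 / 3 ≤ S.m 2 := by
      have := S.lt_two
      rw [m, abs_of_pos (by linarith)]
      have := Real.log_le_log (by norm_num) (show (4 : ℝ) ≤ S.α 2 - A by linarith)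
      norm_num at l2; linarith
    constructor
    · nlinarith [mul_le_mul_of_nonneg_left q1 (abs_nonneg (u : ℝ))]
    · nlinarith [mul_le_mul_of_nonneg_left q2 (abs_nonneg (v : ℝ))]
  refine ⟨j, u, v, ?_, hlow, hE.1, hE.2, hsmall, huv j⟩
  have h1 := (hlog _ n1).1
  have h2 := (hlog _ n2).1
  rw [hlogu] at h1 h2
  rw [abs_le] at h1 h2 ⊢
  have : 1 / Y ^ 3 = 2 * (1 / (2 * Y ^ 3)) := by field_simp
  rw [lam, this]
  constructor <;> linarith [h1.1, h1.2, h2.1, h2.2]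

end ThueRoots

open NumberField in
theorem NumberField.one_le_prod_norm_embeddings {K : Type} [Field K] [NumberField K] {x : 𝓞 K}
    (hx : x ≠ 0) : 1 ≤ ∏ σ : K →ₐ[ℚ] ℂ, ‖σ x‖ := by
  rw [← norm_prod, ← Algebra.norm_eq_prod_embeddings]
  have h : Algebra.norm ℤ x ≠ 0 := Algebra.norm_ne_zero_iff.2 hx
  have h2 : (Algebra.norm ℚ (x : K)) = ((Algebra.norm ℤ x : ℤ) : ℚ) := by
    exact (Algebra.coe_norm_int x).symm
  rw [h2]
  simp only [map_intCast, Complex.norm_intCast]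
  exact_mod_cast Int.one_le_abs h

namespace ThueRoots

variable {A B : ℤ} (S : ThueRoots A B)

theorem isIntegral_α (i : Fin 3) : IsIntegral ℤ (S.α i) := by
  have hm : (Polynomial.X ^ 3 + ((Polynomial.C (-(A + B)) : Polynomial ℤ) * Polynomial.X ^ 2 +
      Polynomial.C (A * B) * Polynomial.X + Polynomial.C (-1)) : Polynomial ℤ).Monic := by
    monicity!
  refine ⟨_, hm, ?_⟩
  have := S.root i
  simp only [Polynomial.eval₂_add, Polynomial.eval₂_mul, Polynomial.eval₂_pow,
    Polynomial.eval₂_X, Polynomial.eval₂_C, algebraMap_int_eq]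
  simp only [eq_intCast, Int.cast_neg, Int.cast_add, Int.cast_mul, Int.cast_one]
  linear_combination this

/-- The field generated by the roots. -/
noncomputable abbrev field : IntermediateField ℚ ℝ :=
  IntermediateField.adjoin ℚ (Set.range S.α)

instance : NumberField S.field where
  to_finiteDimensional := by
    have : Finite (Set.range S.α) := Set.finite_range _
    refine IntermediateField.finiteDimensional_adjoin fun x hx => ?_
    obtain ⟨i, rfl⟩ := hx
    exact (S.isIntegral_α i).tower_top

/-- The roots as elements of the field they generate. -/
noncomputable def gen (i : Fin 3) : S.field :=
  ⟨S.α i, IntermediateField.subset_adjoin _ _ ⟨i, rfl⟩⟩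

theorem α_injective : Function.Injective S.α := by
  intro i j h
  by_contra hij
  have := S.le_abs_sub hij
  rw [h] at this
  norm_num at this

theorem exists_map_gen_eq (σ : S.field →ₐ[ℚ] ℂ) (i : Fin 3) :
    ∃ k, σ (S.gen i) = S.α k := by
  have h : S.gen i * (S.gen i - (A : S.field)) * (S.gen i - (B : S.field)) = 1 := by
    apply Subtype.ext
    simpa [gen] using S.root i
  have h' : (σ (S.gen i) - S.α 0) * (σ (S.gen i) - S.α 1) * (σ (S.gen i) - S.α 2) = 0 := by
    have h1 := congrArg σ h
    simp only [map_mul, map_sub, map_intCast, map_one] at h1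
    obtain ⟨v1, v2, v3⟩ := S.vieta
    have v1' : (S.α 0 : ℂ) + S.α 1 + S.α 2 = A + B := by exact_mod_cast congrArg Complex.ofReal v1
    have v2' : (S.α 0 : ℂ) * S.α 1 + S.α 0 * S.α 2 + S.α 1 * S.α 2 = A * B := by
      exact_mod_cast congrArg Complex.ofReal v2
    have v3' : (S.α 0 : ℂ) * S.α 1 * S.α 2 = 1 := by exact_mod_cast congrArg Complex.ofReal v3
    linear_combination h1 - (σ (S.gen i)) ^ 2 * v1' + σ (S.gen i) * v2' - v3'
  rcases mul_eq_zero.1 h' with h' | h'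
  · rcases mul_eq_zero.1 h' with h' | h'
    · exact ⟨0, sub_eq_zero.1 h'⟩
    · exact ⟨1, sub_eq_zero.1 h'⟩
  · exact ⟨2, sub_eq_zero.1 h'⟩

theorem card_embeddings_le : Fintype.card (S.field →ₐ[ℚ] ℂ) ≤ 6 := by
  choose f hf using S.exists_map_gen_eq
  have hinj : ∀ σ, Function.Injective (f σ) := by
    intro σ i j h
    have h1 : σ (S.gen i) = σ (S.gen j) := by rw [hf, hf, h]
    have h2 := σ.injective h1
    exact S.α_injective (congrArg Subtype.val h2)
  have := Fintype.card_le_of_injective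
    (fun σ => (⟨f σ, hinj σ⟩ : Fin 3 ↪ Fin 3)) (by
      intro σ τ h
      have h' : f σ = f τ := congrArg Function.Embedding.toFun h
      refine IntermediateField.algHom_ext_of_eq_adjoin ℚ rfl fun x hx => ?_
      obtain ⟨i, rfl⟩ := hx
      exact (hf σ i).trans ((by rw [h'] : (S.α (f σ i) : ℂ) = S.α (f τ i)).trans (hf τ i).symm))
  refine this.trans ?_
  rw [Fintype.card_embedding_eq]
  decide

/-- `t` is an algebraic integer of the field, all of whose conjugates are at most `exp h`. -/
def HouseLE (h t : ℝ) : Prop :=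
  ∃ x : NumberField.RingOfIntegers S.field, ((x : S.field) : ℝ) = t ∧
    ∀ σ : S.field →ₐ[ℚ] ℂ, ‖σ x‖ ≤ Real.exp h

variable {S}

theorem HouseLE.neg {h t : ℝ} (ht : S.HouseLE h t) : S.HouseLE h (-t) := by
  obtain ⟨x, hx, hx'⟩ := ht
  exact ⟨-x, by simp [hx], fun σ => by simpa using hx' σ⟩

theorem HouseLE.abs {h t : ℝ} (ht : S.HouseLE h t) : S.HouseLE h |t| := by
  rcases abs_choice t with h | h <;> rw [h]
  · exact ht
  · exact ht.neg

variable (S)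

theorem houseLE_intCast {h : ℝ} (k : ℤ) (hk : |(k : ℝ)| ≤ Real.exp h) : S.HouseLE h k :=
  ⟨k, by simp, fun σ => by simpa using hk⟩

theorem isIntegral_gen (i : Fin 3) : IsIntegral ℤ (S.gen i) :=
  (isIntegral_algebraMap_iff (algebraMap S.field ℝ).injective).1 (S.isIntegral_α i)

theorem houseLE_α {h : ℝ} (hB : (B : ℝ) + 1 ≤ Real.exp h) (i : Fin 3) : S.HouseLE h (S.α i) := by
  refine ⟨⟨S.gen i, S.isIntegral_gen i⟩, rfl, fun σ => ?_⟩
  obtain ⟨k, hk⟩ := S.exists_map_gen_eq σ i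
  change ‖σ (S.gen i)‖ ≤ _
  rw [hk, Complex.norm_real, Real.norm_eq_abs, abs_of_pos (S.α_pos k)]
  exact (S.α_le k).trans hB

theorem houseLE_α_sub {h : ℝ} (hB : (B : ℝ) + 1 ≤ Real.exp h) (i : Fin 3) :
    S.HouseLE h (S.α i - A) := by
  refine ⟨⟨S.gen i - (A : S.field), (S.isIntegral_gen i).sub (isIntegral_algebraMap (x := A))⟩, by simp [gen], fun σ => ?_⟩
  obtain ⟨k, hk⟩ := S.exists_map_gen_eq σ i
  change ‖σ (S.gen i - (A : S.field))‖ ≤ _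
  rw [map_sub, hk, map_intCast, ← Complex.ofReal_intCast, ← Complex.ofReal_sub,
    Complex.norm_real, Real.norm_eq_abs]
  refine le_trans ?_ hB
  have := S.α_le k
  have := S.α_pos k
  have := S.two_le'
  have := S.four_mul_le'
  rw [abs_le]; constructor <;> linarith

theorem houseLE_sub {h : ℝ} (hB : (B : ℝ) + 1 ≤ Real.exp h) (i j : Fin 3) :
    S.HouseLE h (S.α i - S.α j) := by
  refine ⟨⟨S.gen i - S.gen j, (S.isIntegral_gen i).sub (S.isIntegral_gen j)⟩, by simp [gen],
    fun σ => ?_⟩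
  obtain ⟨k, hk⟩ := S.exists_map_gen_eq σ i
  obtain ⟨l, hl⟩ := S.exists_map_gen_eq σ j
  change ‖σ (S.gen i - S.gen j)‖ ≤ _
  rw [map_sub, hk, hl, ← Complex.ofReal_sub, Complex.norm_real, Real.norm_eq_abs]
  exact (S.abs_sub_le _ _).trans hB

/-- Baker's theorem for quotients of algebraic integers of the field of roots. -/
theorem exists_relation_of_form_small {h : ℝ} (hh : 1 ≤ h) {t t' : Fin 3 → ℝ}
    (ht : ∀ i, S.HouseLE h (t i)) (ht' : ∀ i, S.HouseLE h (t' i)) (t_ne : ∀ i, t i ≠ 0)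
    (t'_ne : ∀ i, t' i ≠ 0) {l : Fin 3 → ℝ} (hl : ∀ i, l i = Real.log |t i| - Real.log |t' i|)
    (hlh : ∀ i, |l i| ≤ h) {b : Fin 3 → ℤ} (hb : b 2 ≠ 0) {H : ℕ} (hH : 1 ≤ H)
    (hbH : ∀ i, |b i| ≤ H)
    {L μ J s : ℕ} {G : ℝ} (hL : 1 ≤ L) (hG1 : 1 ≤ G) (hG : 2 * L * H ≤ Real.exp G)
    (hμ : 392 * (L * h) ≤ μ) (hs : 77 * (J + 1) * G + 6 ≤ s)
    (hcard : 24 * ((J + 1) * μ) ^ 2 * s < (L + 1) ^ 3) (hB : (L + 1) ^ 3 ≤ 4 ^ J * s)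
    (hform : 40 * (L * |b 0 * l 0 + b 1 * l 1 + b 2 * l 2| * (4 ^ J * s : ℕ)) *
      Real.exp (μ * (4 ^ J * s : ℕ) * (Real.log (56 * h * (4 ^ J * s : ℕ)) + 1)) ≤ 1) :
    ∃ k : Fin 3 → ℤ, k ≠ 0 ∧ (∀ i, |k i| ≤ L) ∧ ∑ i, (k i : ℝ) * l i = 0 := by
  choose N hN hN' using fun i => (ht i).abs
  choose D hD hD' using fun i => (ht' i).abs
  let T : LogFormData (NumberField.RingOfIntegers S.field) (S.field →ₐ[ℚ] ℂ) :=
    { σ := fun σ => (σ : S.field →+* ℂ).comp (algebraMap _ S.field)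
      k₀ := (Complex.ofRealAm.restrictScalars ℚ).comp S.field.val
      liouville := fun x hx => NumberField.one_le_prod_norm_embeddings hx
      N := N
      D := D
      h := h
      one_le_h := hh
      norm_N := fun k i => hN' _ _
      norm_D := fun k i => hD' _ _
      D_ne := fun i => by
        change ((((D i : S.field) : ℝ)) : ℂ) ≠ 0
        rw [hD]
        exact_mod_cast abs_ne_zero.2 (t'_ne i)
      l := l
      abs_l := hlh
      N_eq := fun i => by
        change ((((N i : S.field) : ℝ)) : ℂ) = _ * ((((D i : S.field) : ℝ)) : ℂ)
        rw [hD, hN, hl, Real.exp_sub, Real.exp_log (abs_pos.2 (t_ne i)),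
          Real.exp_log (abs_pos.2 (t'_ne i)), ← Complex.ofReal_mul,
          div_mul_cancel₀ _ (abs_ne_zero.2 (t'_ne i))]
      b := b
      b_ne := hb
      H := H
      one_le_H := hH
      abs_b := hbH }
  have hc := S.card_embeddings_le
  have hc' : (Fintype.card (S.field →ₐ[ℚ] ℂ) : ℝ) ≤ 6 := by exact_mod_cast hc
  refine T.exists_relation_of_form_small (L := L) (μ := μ) (J := J) (s := s) (G := G) hL hG1 hG
    ?_ ?_ ?_ hB hform
  · refine le_trans ?_ hμ
    have : 0 ≤ L * h := by positivity
    change 8 * (3 * (Fintype.card (S.field →ₐ[ℚ] ℂ) : ℝ) + 31) * (L * h) ≤ _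
    nlinarith
  · refine le_trans ?_ hs
    have : 0 ≤ (J + 1) * G := by positivity
    nlinarith
  · refine lt_of_le_of_lt ?_ hcard
    gcongr
    omega

end ThueRoots

namespace ThueRoots

variable {A B : ℤ} (S : ThueRoots A B)

theorem unit_two_mul_pos (p q : ℤ) (i : Fin 3) : 0 < S.unit (2 * p) (2 * q) i := by
  have h := S.unit_ne p q i
  have : S.unit (2 * p) (2 * q) i = S.unit p q i ^ 2 := by
    rw [unit, unit, mul_pow, ← zpow_natCast, ← zpow_natCast, ← zpow_mul, ← zpow_mul]
    simp [mul_comm]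
  rw [this]
  positivity

theorem log_unit_two_mul (p q : ℤ) (i : Fin 3) :
    Real.log (S.unit (2 * p) (2 * q) i) = 2 * (p * S.ℓ i + q * S.m i) := by
  have := S.log_abs_unit (2 * p) (2 * q) i
  rw [abs_of_pos (S.unit_two_mul_pos p q i)] at this
  rw [this]; push_cast; ring

/-- The two fundamental units are independent even after dividing by a conjugate. -/
theorem eq_zero_of_sub_eq_zero {p q : ℤ} {i k : Fin 3} (hik : i ≠ k)
    (h : p * (S.ℓ i - S.ℓ k) + q * (S.m i - S.m k) = 0) : p = 0 ∧ q = 0 := by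
  have hw : S.unit (2 * p) (2 * q) i = S.unit (2 * p) (2 * q) k := by
    refine Real.log_injOn_pos (S.unit_two_mul_pos p q i) (S.unit_two_mul_pos p q k) ?_
    rw [log_unit_two_mul, log_unit_two_mul]; linarith
  obtain ⟨c₀, c₁, c₂, hc⟩ := S.inOrder_unit (2 * p) (2 * q)
  have hz : (c₁ + c₂ * (S.α i + S.α k) : ℝ) = 0 := by
    rw [hc, hc] at hw
    have hne : S.α i - S.α k ≠ 0 := sub_ne_zero.2 (S.α_injective.ne hik)
    refine (mul_eq_zero.1 (?_ : (S.α i - S.α k) * (c₁ + c₂ * (S.α i + S.α k) : ℝ) = 0)).resolve_left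
      hne
    linear_combination hw
  have h0 : c₁ = 0 ∧ c₂ = 0 := by
    by_contra hcon
    have h1 := S.one_le_index hcon
    have : (c₁ + c₂ * (S.α 0 + S.α 1)) * (c₁ + c₂ * (S.α 0 + S.α 2)) *
      (c₁ + c₂ * (S.α 1 + S.α 2)) = 0 := by
      fin_cases i <;> fin_cases k <;> first
        | exact absurd rfl hik
        | (simp only [Fin.zero_eta, Fin.mk_one, Fin.reduceFinMk] at hz
           first
             | rw [hz]; ring
             | (rw [add_comm (S.α _)] at hz; rw [hz]; ring))
    rw [this] at h1
    norm_num at h1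
  have hconst : ∀ i, p * S.ℓ i + q * S.m i = Real.log c₀ / 2 := by
    intro i
    have := S.log_unit_two_mul p q i
    rw [hc, h0.1, h0.2] at this
    simp at this
    linarith
  have hsum : Real.log c₀ / 2 = 0 := by
    have h1 := hconst 0
    have h2 := hconst 1
    have h3 := hconst 2
    have h4 := S.sum_ℓ
    have h5 := S.sum_m
    have : 3 * (Real.log c₀ / 2) = p * (S.ℓ 0 + S.ℓ 1 + S.ℓ 2) + q * (S.m 0 + S.m 1 + S.m 2) := by
      linarith
    rw [h4, h5] at this
    linarith
  have h1 := hconst 0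
  have h2 := hconst 2
  rw [hsum] at h1 h2
  have hd := S.det_pos
  constructor
  · have : (p : ℝ) * (S.ℓ 2 * S.m 0 - S.ℓ 0 * S.m 2) = 0 := by
      linear_combination S.m 0 * h2 - S.m 2 * h1
    exact_mod_cast (mul_eq_zero.1 this).resolve_right hd.ne'
  · have : (q : ℝ) * (S.ℓ 2 * S.m 0 - S.ℓ 0 * S.m 2) = 0 := by
      linear_combination S.ℓ 2 * h1 - S.ℓ 0 * h2
    exact_mod_cast (mul_eq_zero.1 this).resolve_right hd.ne'

theorem isIntegral_unit (p q : ℤ) (i : Fin 3) : IsIntegral ℤ (S.unit p q i) := by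
  obtain ⟨c₀, c₁, c₂, hc⟩ := S.inOrder_unit p q
  rw [hc]
  have h := S.isIntegral_α i
  have hi : ∀ c : ℤ, IsIntegral ℤ (c : ℝ) := fun c => isIntegral_algebraMap (x := c)
  exact ((hi _).add ((hi _).mul h)).add ((hi _).mul (h.pow 2))

/-- The number `2` is multiplicatively independent of the units. -/
theorem eq_zero_of_log_two_add {r p q : ℤ} {i k : Fin 3}
    (h : r * Real.log 2 + p * (S.ℓ i - S.ℓ k) + q * (S.m i - S.m k) = 0) : r = 0 := by
  wlog hr : 0 ≤ r generalizing r p q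
  · have := this (r := -r) (p := -p) (q := -q) (by push_cast; linarith) (by omega)
    omega
  obtain ⟨r, rfl⟩ := Int.eq_ofNat_of_zero_le hr
  by_contra hr0
  have hr1 : r ≠ 0 := by rintro rfl; simp at hr0
  have hIntegral := (S.isIntegral_unit (2 * p) (2 * q) i).mul
    (S.isIntegral_unit (2 * (-p)) (2 * (-q)) k)
  have hval : S.unit (2 * p) (2 * q) i * S.unit (2 * (-p)) (2 * (-q)) k = (1 / 4) ^ r := by
    refine Real.log_injOn_pos (mul_pos (S.unit_two_mul_pos _ _ _) (S.unit_two_mul_pos _ _ _))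
      (show (0 : ℝ) < (1 / 4) ^ r by positivity) ?_
    rw [Real.log_mul (S.unit_ne _ _ _) (S.unit_ne _ _ _), log_unit_two_mul, log_unit_two_mul,
      Real.log_pow, Real.log_div (by norm_num) (by norm_num), Real.log_one,
      show (4 : ℝ) = 2 ^ 2 by norm_num, Real.log_pow]
    push_cast at h ⊢
    linarith
  rw [hval] at hIntegral
  have hq : IsIntegral ℤ ((1 / 4 : ℚ) ^ r) := by
    refine (isIntegral_algebraMap_iff (algebraMap ℚ ℝ).injective).1 ?_
    simpa using hIntegral
  obtain ⟨z, hz⟩ := IsIntegrallyClosed.isIntegral_iff.1 hq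
  have h1 : (0 : ℚ) < (1 / 4 : ℚ) ^ r := by positivity
  have h2 : (1 / 4 : ℚ) ^ r < 1 := pow_lt_one₀ (by norm_num) (by norm_num) hr1
  rw [← hz] at h1 h2
  simp at h1 h2
  have : z < 1 := by exact_mod_cast h2
  omega

theorem two_le_log (S : ThueRoots A B) : 2 ≤ Real.log B := by
  have := S.two_le'
  have := S.four_mul_le'
  have h1 := Real.log_le_log (by norm_num) (show (8 : ℝ) ≤ B by linarith)
  have l2 := Real.log_two_gt_d9
  rw [show (8 : ℝ) = 2 ^ 3 by norm_num, Real.log_pow] at h1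
  norm_num at h1 l2; linarith

theorem ℓ_two_le : S.ℓ 2 ≤ Real.log B + 1 / 8 := by
  have := S.two_le'
  have := S.four_mul_le'
  have h0 : (0 : ℝ) < B := by linarith
  have := S.α_two_le
  have e2 := Real.log_le_log (S.α_pos 2) (show S.α 2 ≤ B * (1 + 1 / 8) by linarith)
  rw [Real.log_mul (by linarith) (by norm_num)] at e2
  rw [ℓ, abs_of_pos (S.α_pos _)]
  linarith [Real.log_le_sub_one_of_pos (show (0 : ℝ) < 1 + 1 / 8 by norm_num)]

theorem log_le_log_sub_one (S : ThueRoots A B) : Real.log A ≤ Real.log B - 1 := by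
  have := S.two_le'
  have := S.four_mul_le'
  have h1 := Real.log_le_log (show (0 : ℝ) < A * 4 by linarith) (show (A : ℝ) * 4 ≤ B by linarith)
  rw [Real.log_mul (by linarith) (by norm_num), show (4 : ℝ) = 2 ^ 2 by norm_num,
    Real.log_pow] at h1
  have l2 := Real.log_two_gt_d9
  norm_num at h1 l2; linarith

theorem ℓ_one_le : S.ℓ 1 ≤ Real.log A := by
  rw [ℓ, abs_of_pos (S.α_pos _)]
  exact Real.log_le_log (S.α_pos _) S.one_lt.le

theorem m_zero_le : S.m 0 ≤ Real.log A := by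
  have := S.two_le'
  have := S.lt_half
  have := S.pos
  rw [m, abs_sub_comm, abs_of_pos (by linarith)]
  exact Real.log_le_log (by linarith) (by linarith)

theorem m_two_le : S.m 2 ≤ Real.log B := by
  have := S.two_le'
  have := S.four_mul_le'
  have := S.lt_two
  have := S.two_lt
  rw [m, abs_of_pos (by linarith)]
  exact Real.log_le_log (by linarith) (by linarith)

theorem abs_ℓ_sub_le (i k : Fin 3) : |S.ℓ i - S.ℓ k| ≤ 3 * Real.log B := by
  have h1 := S.sum_ℓ
  have h2 := S.ℓ_one_pos
  have h3 := S.ℓ_one_lt_two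
  have h4 := S.ℓ_one_le
  have h5 := S.ℓ_two_le
  have h6 := S.log_le_log_sub_one
  have h7 := S.two_le_log
  rw [abs_le]
  fin_cases i <;> fin_cases k <;>
    simp only [Fin.zero_eta, Fin.mk_one, Fin.reduceFinMk] <;> constructor <;> linarith

theorem abs_m_sub_le (i k : Fin 3) : |S.m i - S.m k| ≤ 3 * Real.log B := by
  have h1 := S.sum_m
  have h2 := S.m_zero_pos
  have h3 := S.m_zero_lt_two
  have h4 := S.m_zero_le
  have h5 := S.m_two_le
  have h6 := S.log_le_log_sub_one
  have h7 := S.two_le_log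
  rw [abs_le]
  fin_cases i <;> fin_cases k <;>
    simp only [Fin.zero_eta, Fin.mk_one, Fin.reduceFinMk] <;> constructor <;> linarith

theorem gap_mem {i k : Fin 3} (h : i ≠ k) : 0 ≤ S.gap i k ∧ S.gap i k ≤ 3 * Real.log B := by
  have h1 := S.le_abs_sub h
  have h2 := S.abs_sub_le i k
  have := S.two_le'
  have := S.four_mul_le'
  have h7 := S.two_le_log
  refine ⟨Real.log_nonneg (by linarith), ?_⟩
  have h3 := Real.log_le_log (by linarith) (h2.trans (show (B : ℝ) + 1 ≤ B ^ 2 by nlinarith))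
  rw [Real.log_pow] at h3
  rw [gap]
  push_cast at h3
  linarith

theorem abs_gap_sub_le {j i k : Fin 3} (hi : j ≠ i) (hk : j ≠ k) :
    |S.gap j i - S.gap j k| ≤ 3 * Real.log B := by
  have h1 := S.gap_mem hi
  have h2 := S.gap_mem hk
  rw [abs_le]; constructor <;> linarith [h1.1, h1.2, h2.1, h2.2]

end ThueRoots

/-- Admissible parameters for Baker's method in a field of degree at most six. -/
structure SexticParams (h : ℝ) (H L μ J s : ℕ) (G : ℝ) : Prop where
  one_le_L : 1 ≤ L
  one_le_G : 1 ≤ G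
  le_exp_G : 2 * L * H ≤ Real.exp G
  le_μ : 392 * (L * h) ≤ μ
  le_s : 77 * (J + 1) * G + 6 ≤ s
  card_lt : 24 * ((J + 1) * μ) ^ 2 * s < (L + 1) ^ 3
  le_pow : (L + 1) ^ 3 ≤ 4 ^ J * s

namespace ThueRoots

variable {A B : ℤ} (S : ThueRoots A B) {h G : ℝ} {H L μ J s : ℕ}

theorem add_one_le_exp (S : ThueRoots A B) (hh : 3 * Real.log B ≤ h) :
    (B : ℝ) + 1 ≤ Real.exp h := by
  have hA := S.two_le'
  have hB := S.four_mul_le'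
  have hB8 : (8 : ℝ) ≤ B := by linarith
  have h0 : (0 : ℝ) < B := by linarith
  refine le_trans (show (B : ℝ) + 1 ≤ B ^ 3 by nlinarith [mul_le_mul hB8 hB8 (by norm_num) h0.le]) ?_
  rw [← Real.log_le_iff_le_exp (by positivity), Real.log_pow]
  exact_mod_cast hh

theorem eq_zero_of_small (P : SexticParams h H L μ J s G) (hh : 3 * Real.log B ≤ h)
    {i k : Fin 3} (hik : i ≠ k) {p q : ℤ} (hp : |p| ≤ H) (hq : |q| ≤ H) (hH : 1 ≤ H)
    (hform : 40 * (L * |p * (S.ℓ i - S.ℓ k) + q * (S.m i - S.m k)| * (4 ^ J * s : ℕ)) *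
      Real.exp (μ * (4 ^ J * s : ℕ) * (Real.log (56 * h * (4 ^ J * s : ℕ)) + 1)) ≤ 1) :
    p = 0 ∧ q = 0 := by
  have hA := S.two_le'
  have hB' := S.four_mul_le'
  have hB := S.two_le_log
  have hh1 : 1 ≤ h := by linarith
  have hBh := S.add_one_le_exp hh
  have h2 : (2 : ℝ) ≤ Real.exp h := by linarith
  have hlog2 : |Real.log 2| ≤ h := by
    rw [abs_of_pos (Real.log_pos (by norm_num))]
    linarith [Real.log_two_lt_d9]
  by_contra hne
  rw [not_and_or] at hne
  by_cases hq0 : q = 0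
  · have hp0 : p ≠ 0 := by tauto
    obtain ⟨c, hc, -, hrel⟩ := S.exists_relation_of_form_small hh1
      (t := ![2, S.α i - A, S.α i]) (t' := ![1, S.α k - A, S.α k])
      (l := ![Real.log 2, S.m i - S.m k, S.ℓ i - S.ℓ k]) (b := ![0, q, p]) (H := H)
      (by
        intro r; fin_cases r
        · simpa using S.houseLE_intCast 2 (by simpa using h2)
        · exact S.houseLE_α_sub hBh i
        · exact S.houseLE_α hBh i)
      (by
        intro r; fin_cases r
        · simpa using S.houseLE_intCast 1 (by simpa using hh1.trans' zero_le_one)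
        · exact S.houseLE_α_sub hBh k
        · exact S.houseLE_α hBh k)
      (by
        intro r; fin_cases r
        · simp
        · exact S.sub_ne i
        · exact (S.α_pos i).ne')
      (by
        intro r; fin_cases r
        · simp
        · exact S.sub_ne k
        · exact (S.α_pos k).ne')
      (by
        intro r; fin_cases r
        · simp
        · rfl
        · rfl)
      (by
        intro r; fin_cases r
        · exact hlog2
        · exact (S.abs_m_sub_le i k).trans hh
        · exact (S.abs_ℓ_sub_le i k).trans hh)
      hp0 hH
      (by
        intro r; fin_cases r
        · simp
        · exact hq
        · exact hp)
      P.one_le_L P.one_le_G P.le_exp_G P.le_μ P.le_s P.card_lt P.le_pow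
      (by
        refine le_of_eq_of_le ?_ hform
        congr 5
        simp
        ring)
    rw [Fin.sum_univ_three] at hrel
    simp only [Matrix.cons_val_zero, Matrix.cons_val_one, Matrix.cons_val] at hrel
    have r0 := S.eq_zero_of_log_two_add (r := c 0) (p := c 2) (q := c 1) (i := i) (k := k)
      (by linarith)
    rw [r0] at hrel
    obtain ⟨r1, r2⟩ := S.eq_zero_of_sub_eq_zero (p := c 2) (q := c 1) hik
      (by push_cast at hrel; linarith)
    apply hc
    funext r; fin_cases r <;> assumption
  · obtain ⟨c, hc, -, hrel⟩ := S.exists_relation_of_form_small hh1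
      (t := ![2, S.α i, S.α i - A]) (t' := ![1, S.α k, S.α k - A])
      (l := ![Real.log 2, S.ℓ i - S.ℓ k, S.m i - S.m k]) (b := ![0, p, q]) (H := H)
      (by
        intro r; fin_cases r
        · simpa using S.houseLE_intCast 2 (by simpa using h2)
        · exact S.houseLE_α hBh i
        · exact S.houseLE_α_sub hBh i)
      (by
        intro r; fin_cases r
        · simpa using S.houseLE_intCast 1 (by simpa using hh1.trans' zero_le_one)
        · exact S.houseLE_α hBh k
        · exact S.houseLE_α_sub hBh k)
      (by
        intro r; fin_cases r
        · simp
        · exact (S.α_pos i).ne'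
        · exact S.sub_ne i)
      (by
        intro r; fin_cases r
        · simp
        · exact (S.α_pos k).ne'
        · exact S.sub_ne k)
      (by
        intro r; fin_cases r
        · simp
        · rfl
        · rfl)
      (by
        intro r; fin_cases r
        · exact hlog2
        · exact (S.abs_ℓ_sub_le i k).trans hh
        · exact (S.abs_m_sub_le i k).trans hh)
      hq0 hH
      (by
        intro r; fin_cases r
        · simp
        · exact hp
        · exact hq)
      P.one_le_L P.one_le_G P.le_exp_G P.le_μ P.le_s P.card_lt P.le_pow
      (by
        refine le_of_eq_of_le ?_ hform
        congr 5
        simp)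
    rw [Fin.sum_univ_three] at hrel
    simp only [Matrix.cons_val_zero, Matrix.cons_val_one, Matrix.cons_val] at hrel
    have r0 := S.eq_zero_of_log_two_add (r := c 0) (p := c 1) (q := c 2) (i := i) (k := k)
      (by linarith)
    rw [r0] at hrel
    obtain ⟨r1, r2⟩ := S.eq_zero_of_sub_eq_zero (p := c 1) (q := c 2) hik
      (by push_cast at hrel; linarith)
    apply hc
    funext r; fin_cases r <;> assumption

/-- A lower bound for the linear form attached to a solution. -/
theorem abs_exponent_le_of_lam_small {V : ℕ} (P : SexticParams h (2 * L * V) L μ J s G)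
    (hh : 3 * Real.log B ≤ h) {j : Fin 3} {u v : ℤ} (hu : |u| ≤ V) (hv : |v| ≤ V) (hV : 1 ≤ V)
    (hform : 40 * (L * (L * |S.lam j u v|) * (4 ^ J * s : ℕ)) *
      Real.exp (μ * (4 ^ J * s : ℕ) * (Real.log (56 * h * (4 ^ J * s : ℕ)) + 1)) ≤ 1) :
    |u| ≤ L ∧ |v| ≤ L := by
  have hA := S.two_le'
  have hB' := S.four_mul_le'
  have hB := S.two_le_log
  have hh1 : 1 ≤ h := by linarith
  have hBh := S.add_one_le_exp hh
  have hik : j + 1 ≠ j + 2 := by clear * -; revert j; decide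
  have hji : j ≠ j + 1 := by clear * -; revert j; decide
  have hjk : j ≠ j + 2 := by clear * -; revert j; decide
  have hL := P.one_le_L
  have hL' : (1 : ℝ) ≤ L := by exact_mod_cast hL
  have hVH : (V : ℤ) ≤ (2 * L * V : ℕ) := by push_cast; nlinarith
  have h1H : 1 ≤ 2 * L * V := by nlinarith
  have hmono : 40 * (L * |S.lam j u v| * (4 ^ J * s : ℕ)) *
      Real.exp (μ * (4 ^ J * s : ℕ) * (Real.log (56 * h * (4 ^ J * s : ℕ)) + 1)) ≤ 1 := by
    refine le_trans ?_ hform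
    gcongr
    exact le_mul_of_one_le_left (abs_nonneg _) hL'
  obtain ⟨c, hc, hcL, hrel⟩ := S.exists_relation_of_form_small hh1
    (t := ![S.α (j + 1), S.α (j + 1) - A, S.α j - S.α (j + 1)])
    (t' := ![S.α (j + 2), S.α (j + 2) - A, S.α j - S.α (j + 2)])
    (l := ![S.ℓ (j + 1) - S.ℓ (j + 2), S.m (j + 1) - S.m (j + 2),
      S.gap j (j + 1) - S.gap j (j + 2)]) (b := ![u, v, -1]) (H := 2 * L * V)
    (by
      intro r; fin_cases r
      · exact S.houseLE_α hBh _
      · exact S.houseLE_α_sub hBh _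
      · exact S.houseLE_sub hBh _ _)
    (by
      intro r; fin_cases r
      · exact S.houseLE_α hBh _
      · exact S.houseLE_α_sub hBh _
      · exact S.houseLE_sub hBh _ _)
    (by
      intro r; fin_cases r
      · exact (S.α_pos _).ne'
      · exact S.sub_ne _
      · exact sub_ne_zero.2 (S.α_injective.ne hji))
    (by
      intro r; fin_cases r
      · exact (S.α_pos _).ne'
      · exact S.sub_ne _
      · exact sub_ne_zero.2 (S.α_injective.ne hjk))
    (by intro r; fin_cases r <;> rfl)
    (by
      intro r; fin_cases r
      · exact (S.abs_ℓ_sub_le _ _).trans hh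
      · exact (S.abs_m_sub_le _ _).trans hh
      · exact (S.abs_gap_sub_le hji hjk).trans hh)
    (by simp) h1H
    (by
      intro r; fin_cases r
      · exact hu.trans hVH
      · exact hv.trans hVH
      · simpa using (by exact_mod_cast h1H : (1 : ℤ) ≤ (2 * L * V : ℕ)))
    P.one_le_L P.one_le_G P.le_exp_G P.le_μ P.le_s P.card_lt P.le_pow
    (by
      refine le_of_eq_of_le ?_ hmono
      congr 5
      simp [lam]
      ring)
  rw [Fin.sum_univ_three] at hrel
  simp only [Matrix.cons_val_zero, Matrix.cons_val_one, Matrix.cons_val] at hrel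
  have hc0 := hcL 0
  have hc1 := hcL 1
  have hc2 := hcL 2
  by_cases h2 : c 2 = 0
  · exfalso
    rw [h2] at hrel
    obtain ⟨r1, r2⟩ := S.eq_zero_of_sub_eq_zero (p := c 0) (q := c 1) hik
      (by push_cast at hrel; linarith)
    apply hc
    funext r; fin_cases r <;> assumption
  have hmul : ((u * c 2 + c 0 : ℤ) : ℝ) * (S.ℓ (j + 1) - S.ℓ (j + 2)) +
      ((v * c 2 + c 1 : ℤ) : ℝ) * (S.m (j + 1) - S.m (j + 2)) = c 2 * S.lam j u v := by
    rw [lam]; push_cast; linear_combination hrel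
  have hbound : ∀ w c' : ℤ, |w| ≤ V → |c'| ≤ L → |w * c 2 + c'| ≤ (2 * L * V : ℕ) := by
    intro w c' hw hc'
    refine (abs_add_le _ _).trans ?_
    rw [abs_mul]
    have : |w| * |c 2| ≤ V * L := mul_le_mul hw hc2 (abs_nonneg _) (by positivity)
    have : (L : ℤ) ≤ L * V := by exact_mod_cast Nat.le_mul_of_pos_right L hV
    push_cast
    nlinarith
  have hz := S.eq_zero_of_small P hh hik (hbound u _ hu hc0) (hbound v _ hv hc1) h1H (by
    rw [hmul, abs_mul]
    refine le_trans ?_ hform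
    gcongr
    exact_mod_cast hc2)
  have h2' : 1 ≤ |c 2| := Int.one_le_abs h2
  constructor
  · have : u * c 2 = -c 0 := by linarith [hz.1]
    have : |u| * |c 2| = |c 0| := by rw [← abs_mul, this, abs_neg]
    nlinarith [abs_nonneg u]
  · have : v * c 2 = -c 1 := by linarith [hz.2]
    have : |v| * |c 2| = |c 1| := by rw [← abs_mul, this, abs_neg]
    nlinarith [abs_nonneg v]

end ThueRoots

namespace ExpBound

/-- The number of points in the parameter choice. -/
def s (k : ℕ) : ℕ := 77 * (4 * k + 69) * (12 * k + 240) + 6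

/-- The subexponential factor of the degree in the parameter choice. -/
def M (k : ℕ) : ℕ := 15980544 * (4 * k + 69) ^ 2 * s k

theorem s_succ_le (t : ℕ) : 4 * s (12 + t + 1) ≤ 5 * s (12 + t) := by
  simp only [s]; ring_nf; nlinarith

theorem s_mono (k : ℕ) : s k ≤ s (k + 1) := by
  simp only [s]; gcongr <;> omega

theorem M_succ_le (t : ℕ) : 8 * M (12 + t + 1) ≤ 11 * M (12 + t) := by
  have h1 := s_succ_le t
  have h2 : 10 * (4 * (12 + t + 1) + 69) ^ 2 ≤ 11 * (4 * (12 + t) + 69) ^ 2 := by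
    ring_nf; nlinarith
  have h3 := Nat.mul_le_mul h1 h2
  simp only [M]
  generalize s (12 + t + 1) = a at *
  generalize s (12 + t) = b at *
  generalize (4 * (12 + t + 1) + 69) ^ 2 = c at *
  generalize (4 * (12 + t) + 69) ^ 2 = d at *
  nlinarith

theorem s_le (t : ℕ) : s (12 + t) ≤ 2 ^ (12 + t + 10) := by
  induction t with
  | zero => decide
  | succ t ih =>
    have := s_succ_le t
    rw [← add_assoc, show 12 + t + 1 + 10 = 12 + t + 10 + 1 by ring, pow_succ]
    omega

theorem M_cube_le (t : ℕ) : (M (12 + t) + 1) ^ 3 ≤ 4 ^ (12 + t + 68) * s (12 + t) := by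
  induction t with
  | zero => decide
  | succ t ih =>
    have h1 := M_succ_le t
    have h2 := s_mono (12 + t)
    rw [← add_assoc]
    have h3 : 8 * (M (12 + t + 1) + 1) ≤ 11 * (M (12 + t) + 1) := by omega
    have h4 := Nat.pow_le_pow_left h3 3
    rw [mul_pow, mul_pow] at h4
    have h5 : 4 ^ (12 + t + 1 + 68) * s (12 + t + 1) ≥ 4 * (4 ^ (12 + t + 68) * s (12 + t)) := by
      rw [show 12 + t + 1 + 68 = 12 + t + 68 + 1 by ring, pow_succ]
      nlinarith [Nat.mul_le_mul_left (4 ^ (12 + t + 68)) h2]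
    omega

theorem M_sq_le (t : ℕ) : M (12 + t) ^ 2 ≤ 2 ^ (12 + t + 108) := by
  induction t with
  | zero => decide
  | succ t ih =>
    have h := Nat.pow_le_pow_left (M_succ_le t) 2
    rw [mul_pow, mul_pow] at h
    rw [← add_assoc, show 12 + t + 1 + 108 = 12 + t + 108 + 1 by ring, pow_succ 2]
    omega

theorem exponent_le (t : ℕ) : 7 * (816 * M (12 + t) * s (12 + t) * (7 * (12 + t) + 110)) ≤
    3 * 2 ^ (12 + t + 88) := by
  induction t with
  | zero => decide
  | succ t ih =>
    have h1 := M_succ_le t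
    have h2 := s_succ_le t
    have h3 : 17 * (7 * (12 + (t + 1)) + 110) ≤ 18 * (7 * (12 + t) + 110) := by omega
    have h4 := Nat.mul_le_mul (Nat.mul_le_mul h1 h2) h3
    rw [← add_assoc] at *
    rw [show 12 + t + 1 + 88 = 12 + t + 88 + 1 by ring, pow_succ]
    generalize M (12 + t + 1) = a at *
    generalize s (12 + t + 1) = a' at *
    generalize M (12 + t) = b at *
    generalize s (12 + t) = b' at *
    generalize (7 * (12 + t + 1) + 110) = c at *
    generalize (7 * (12 + t) + 110) = c' at *
    have e1 : 8 * a * (4 * a') * (17 * c) = 544 * (a * a' * c) := by ring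
    have e2 : 11 * b * (5 * b') * (18 * c') = 990 * (b * b' * c') := by ring
    have e3 : 7 * (816 * a * a' * c) = 5712 * (a * a' * c) := by ring
    have e4 : 7 * (816 * b * b' * c') = 5712 * (b * b' * c') := by ring
    omega

theorem params {k J e s M V : ℕ} (hk : 12 ≤ k) (hV : V < 2 ^ e) (he : e ≤ 12 * k + 236)
    (hJ : J = 4 * k + 68) (hs : s = 77 * (J + 1) * (12 * k + 240) + 6)
    (hM : M = 15980544 * (J + 1) ^ 2 * s) {f g : ℕ} (hML : M ^ 2 ≤ 2 ^ f) (hf : f = k + 108)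
    (hMc : (M + 1) ^ 3 ≤ 4 ^ g * s) (hg : g = k + 68) :
    SexticParams (52 / 25 * 2 ^ k) (2 * (M * 4 ^ k) * V) (M * 4 ^ k)
      (816 * 2 ^ k * (M * 4 ^ k)) J s (12 * k + 240) := by
  have hs0 : 0 < s := by omega
  have hM0 : 0 < M := by rw [hM]; positivity
  have h24 : (2 ^ k) ^ 2 = 4 ^ k := by rw [← pow_mul, mul_comm, pow_mul]; norm_num
  have hk' : (12 : ℝ) ≤ k := by exact_mod_cast hk
  refine ⟨Nat.mul_pos hM0 (by positivity), ?_, ?_, ?_, ?_, ?_, ?_⟩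
  · linarith
  · have h1 : 2 * (M * 4 ^ k) * (2 * (M * 4 ^ k) * V) ≤ 2 ^ (2 + f + 4 * k + e) := by
      calc _ = 4 * M ^ 2 * (4 ^ k) ^ 2 * V := by ring
        _ ≤ 4 * 2 ^ f * (4 ^ k) ^ 2 * 2 ^ e := by gcongr
        _ = _ := by
          rw [pow_add, pow_add, pow_add, ← h24, ← pow_mul, ← pow_mul, mul_comm 4 k]
          norm_num
    have h2 : (2 : ℝ) ^ (2 + f + 4 * k + e) ≤ Real.exp (12 * k + 240) := by
      rw [← Real.log_le_iff_le_exp (by positivity), Real.log_pow]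
      have h3 : ((2 + f + 4 * k + e : ℕ) : ℝ) ≤ 17 * k + 346 := by
        exact_mod_cast (by omega : 2 + f + 4 * k + e ≤ 17 * k + 346)
      have := Real.log_two_lt_d9
      have h4 := Real.log_pos (show (1 : ℝ) < 2 by norm_num)
      nlinarith
    refine le_trans ?_ h2
    exact_mod_cast h1
  · push_cast
    have : (0 : ℝ) ≤ 2 ^ k * (M * 4 ^ k) := by positivity
    nlinarith
  · rw [hs]; push_cast; rfl
  · have e : 24 * ((J + 1) * (816 * 2 ^ k * (M * 4 ^ k))) ^ 2 * s = (M * 4 ^ k) ^ 3 := by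
      rw [← h24]
      generalize 2 ^ k = y at *
      calc _ = (15980544 * (J + 1) ^ 2 * s) * y ^ 2 * (M * y ^ 2) ^ 2 := by ring
        _ = _ := by rw [← hM]; ring
    rw [e]
    exact Nat.pow_lt_pow_left (Nat.lt_succ_self _) (by norm_num)
  · calc (M * 4 ^ k + 1) ^ 3 ≤ ((M + 1) * 4 ^ k) ^ 3 := by
          gcongr
          have : 1 ≤ 4 ^ k := Nat.one_le_pow _ _ (by norm_num)
          nlinarith
      _ = (M + 1) ^ 3 * (4 ^ k) ^ 3 := by rw [mul_pow]
      _ ≤ 4 ^ g * s * (4 ^ k) ^ 3 := by gcongr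
      _ = 4 ^ (g + k * 3) * s := by rw [pow_add, pow_mul, mul_right_comm]
      _ = _ := by congr 2; omega

theorem exp_bound {k J e s M L μ N d g : ℕ} (hk : 12 ≤ k) {x V : ℝ} (hV : 2 ^ e ≤ V)
    (hx : |x| ≤ Real.exp (-(3 / 7 * V))) (hs0 : 0 < s)
    (hsle : s ≤ 2 ^ d) (hd : d = k + 10) (hex : 7 * (816 * M * s * (7 * k + 110)) ≤ 3 * 2 ^ g)
    (hJ : J = 4 * k + 68) (hg : g = k + 88) (he : e = 12 * k + 224) (hN : N = 4 ^ J * s)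
    (hL : L = M * 4 ^ k) (hμ : μ = 816 * 2 ^ k * L) :
    40 * (L * (L * |x|) * N) *
      Real.exp (μ * N * (Real.log (56 * (52 / 25 * 2 ^ k) * N) + 1)) ≤ 1 := by
  have hk' : (12 : ℝ) ≤ k := by exact_mod_cast hk
  have hN1 : 1 ≤ N := by rw [hN]; exact Nat.mul_pos (by positivity) hs0
  have h4J : (4 : ℕ) ^ J = 2 ^ (2 * J) := by rw [pow_mul]; norm_num
  have h4k : (4 : ℕ) ^ k = 2 ^ (2 * k) := by rw [pow_mul]; norm_num
  have hlog : Real.log (56 * (52 / 25 * 2 ^ k) * N) ≤ 7 * k + 108 := by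
    have h1 : 56 * (52 / 25 * 2 ^ k) * (N : ℝ) ≤ 2 ^ (7 + k + (2 * J + d)) := by
      have h0 : (N : ℝ) ≤ 2 ^ (2 * J + d) := by
        have : N ≤ 2 ^ (2 * J + d) := by
          rw [hN, h4J, pow_add]; gcongr
        exact_mod_cast this
      calc 56 * (52 / 25 * 2 ^ k) * (N : ℝ) = 56 * (52 / 25) * 2 ^ k * N := by ring
        _ ≤ 2 ^ 7 * 2 ^ k * 2 ^ (2 * J + d) := by gcongr; norm_num
        _ = _ := by rw [← pow_add, ← pow_add]
    have hpos : (0 : ℝ) < 56 * (52 / 25 * 2 ^ k) * N := by positivity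
    refine (Real.log_le_log hpos h1).trans ?_
    rw [Real.log_pow]
    have h3 : ((7 + k + (2 * J + d) : ℕ) : ℝ) ≤ 10 * k + 153 := by
      exact_mod_cast (by omega : 7 + k + (2 * J + d) ≤ 10 * k + 153)
    have := Real.log_two_lt_d9
    have h4 := Real.log_pos (show (1 : ℝ) < 2 by norm_num)
    nlinarith
  have hμL : 816 * (L : ℝ) ≤ μ := by
    have : 816 * L ≤ μ := by
      rw [hμ]; nlinarith [Nat.one_le_pow k 2 (by norm_num), Nat.zero_le L]
    exact_mod_cast this
  have hpoly : 40 * ((L : ℝ) * L * N) ≤ Real.exp (μ * N) := by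
    have h1 := Real.add_one_le_exp ((μ : ℝ) * N / 2)
    have h0 : (0 : ℝ) ≤ μ * N / 2 := by positivity
    have h2 : Real.exp (μ * N) = Real.exp (μ * N / 2) ^ 2 := by
      rw [← Real.exp_nat_mul]; congr 1; push_cast; ring
    rw [h2]
    refine le_trans ?_ (pow_le_pow_left₀ h0 (by linarith) 2)
    have h3 : (1 : ℝ) ≤ N := by exact_mod_cast hN1
    have h4 : (816 * (L : ℝ) * N / 2) ^ 2 ≤ (μ * N / 2) ^ 2 := by gcongr
    refine le_trans ?_ h4
    have h5 : (L : ℝ) * L * N ≤ L * L * N * N := le_mul_of_one_le_right (by positivity) h3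
    have h6 : (0 : ℝ) ≤ L * L * N * N := by positivity
    have h7 : (816 * (L : ℝ) * N / 2) ^ 2 = 166464 * (L * L * N * N) := by ring
    linarith
  have htot : (μ : ℝ) * N * (7 * k + 110) ≤ 3 / 7 * V := by
    have h1 : 7 * (μ * N * (7 * k + 110)) ≤ 3 * 2 ^ e := by
      calc 7 * (μ * N * (7 * k + 110)) =
            7 * (816 * M * s * (7 * k + 110)) * (2 ^ k * 4 ^ k * 4 ^ J) := by
            rw [hμ, hL, hN]; ring
        _ ≤ 3 * 2 ^ g * (2 ^ k * 4 ^ k * 4 ^ J) := by gcongr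
        _ = 3 * 2 ^ (g + (k + 2 * k + 2 * J)) := by
          rw [h4J, h4k, pow_add 2 g, pow_add, pow_add, mul_assoc]
        _ = _ := by congr 2; omega
    have h2 : 7 * ((μ : ℝ) * N * (7 * k + 110)) ≤ 3 * 2 ^ e := by exact_mod_cast h1
    linarith
  calc _ = 40 * ((L : ℝ) * L * N) * |x| * Real.exp (μ * N *
        (Real.log (56 * (52 / 25 * 2 ^ k) * N) + 1)) := by ring
    _ ≤ Real.exp (μ * N) * Real.exp (-(3 / 7 * V)) * Real.exp (μ * N * (7 * k + 108 + 1)) := by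
        gcongr
    _ = Real.exp (μ * N + -(3 / 7 * V) + μ * N * (7 * k + 108 + 1)) := by
        rw [Real.exp_add, Real.exp_add]
    _ ≤ 1 := Real.exp_le_one_iff.2 (by linarith)

end ExpBound

namespace ThueRoots

open ExpBound

/-- An upper bound for the exponents of the unit attached to a solution. -/
theorem exponent_lt {A B : ℤ} (S : ThueRoots A B) {k : ℕ} (hk : 12 ≤ k)
    (hB : 3 * Real.log B ≤ 52 / 25 * 2 ^ k) {j : Fin 3} {u v : ℤ} {V : ℕ} (hu : |u| ≤ V)
    (hv : |v| ≤ V) (hV : (V : ℤ) ≤ |u| ∨ (V : ℤ) ≤ |v|)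
    (hlam : |S.lam j u v| ≤ Real.exp (-(3 / 7 * V))) : V < 2 ^ (12 * k + 224) := by
  by_contra! hlarge
  obtain ⟨k', hk', h1, h2⟩ : ∃ k', k ≤ k' ∧ 2 ^ (12 * k' + 224) ≤ V ∧ V < 2 ^ (12 * k' + 236) := by
    have hV0 : V ≠ 0 := by rintro rfl; simp at hlarge
    have hl : 12 * k + 224 ≤ Nat.log 2 V := (Nat.le_log_iff_pow_le (by norm_num) hV0).2 hlarge
    refine ⟨(Nat.log 2 V - 224) / 12, by omega, ?_, ?_⟩
    · exact (Nat.le_log_iff_pow_le (by norm_num) hV0).1 (by omega)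
    · exact Nat.lt_pow_of_log_lt (by norm_num) (by omega)
  have h12 : 12 ≤ k' := hk.trans hk'
  have hh : 3 * Real.log B ≤ 52 / 25 * 2 ^ k' :=
    hB.trans (by gcongr; norm_num)
  obtain ⟨hMs, hMc, hsd, hex⟩ : M k' ^ 2 ≤ 2 ^ (k' + 108) ∧
      (M k' + 1) ^ 3 ≤ 4 ^ (k' + 68) * s k' ∧ s k' ≤ 2 ^ (k' + 10) ∧
      7 * (816 * M k' * s k' * (7 * k' + 110)) ≤ 3 * 2 ^ (k' + 88) := by
    obtain ⟨t, rfl⟩ := Nat.exists_eq_add_of_le h12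
    exact ⟨M_sq_le t, M_cube_le t, s_le t, exponent_le t⟩
  obtain ⟨s, hs⟩ : ∃ s', s' = s k' := ⟨_, rfl⟩
  obtain ⟨M, hM⟩ : ∃ M', M' = M k' := ⟨_, rfl⟩
  rw [← hM] at hMs hMc hex
  rw [← hs] at hMc hsd hex
  rw [ExpBound.M, ← hs] at hM
  rw [ExpBound.s] at hs
  obtain ⟨e, he⟩ : ∃ e, e = 12 * k' + 224 := ⟨_, rfl⟩
  obtain ⟨e', he'⟩ : ∃ e, e = 12 * k' + 236 := ⟨_, rfl⟩
  obtain ⟨f, hf⟩ : ∃ e, e = k' + 108 := ⟨_, rfl⟩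
  obtain ⟨g, hg⟩ : ∃ e, e = k' + 68 := ⟨_, rfl⟩
  obtain ⟨d, hd⟩ : ∃ e, e = k' + 10 := ⟨_, rfl⟩
  obtain ⟨i, hi⟩ : ∃ e, e = k' + 88 := ⟨_, rfl⟩
  obtain ⟨J, hJ⟩ : ∃ e, e = 4 * k' + 68 := ⟨_, rfl⟩
  rw [← he] at h1
  rw [← he'] at h2
  rw [← hf] at hMs
  rw [← hg] at hMc
  rw [← hd] at hsd
  rw [← hi] at hex
  have hs0 : 0 < s := by omega
  have hres := S.abs_exponent_le_of_lam_small
    (params h12 h2 he'.le hJ (by rw [hs, hJ]) (by rw [hM, hJ]) hMs hf hMc hg) hh hu hv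
    (le_trans Nat.one_le_two_pow h1)
    (exp_bound h12 (by exact_mod_cast h1) hlam hs0 hsd hd hex hJ hi he rfl rfl rfl)
  have hL : M * 4 ^ k' < 2 ^ e := by
    have hML : M ≤ 2 ^ f := le_trans (Nat.le_self_pow (by norm_num) _) hMs
    calc M * 4 ^ k' ≤ 2 ^ f * 4 ^ k' := by gcongr
      _ = 2 ^ f * 2 ^ (2 * k') := by rw [pow_mul 2 2]; norm_num
      _ = 2 ^ (f + 2 * k') := (pow_add _ _ _).symm
      _ < _ := Nat.pow_lt_pow_right (by norm_num) (by omega)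
  have hL' : ((M * 4 ^ k' : ℕ) : ℤ) < V := by exact_mod_cast lt_of_lt_of_le hL h1
  rcases hV with hV | hV
  · linarith [hres.1]
  · linarith [hres.2]

end ThueRoots

theorem Real.abs_log_sub_log_le {x y e : ℝ} (hy : 0 < y) (h : |x - y| ≤ e * y)
    (he : e ≤ 1 / 2) : |Real.log x - Real.log y| ≤ 2 * e := by
  set t := (x - y) / y with ht
  have ht' : |t| ≤ e := by rwa [ht, abs_div, abs_of_pos hy, div_le_iff₀ hy]
  have h1 : x = y * (1 + t) := by rw [ht]; field_simp; ring
  have h2 : 0 < 1 + t := by nlinarith [(abs_le.1 ht').1]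
  have h3 := ThueRoots.abs_log_one_add_le (ht'.trans he)
  rw [abs_of_pos h2] at h3
  rw [h1, Real.log_mul hy.ne' h2.ne', add_sub_cancel_left]
  linarith

namespace ThueRoots

variable {A B : ℤ} (S : ThueRoots A B)

theorem α_zero_mul_le : S.α 0 * (A * B) ≤ 11 / 10 := by
  have hA := S.two_le'
  have hB := S.four_mul_le'
  have h0 := S.α_zero_le
  have h0' := S.pos
  have hr := S.root 0
  have k : 10 / 11 * ((A : ℝ) * B) ≤ (A - S.α 0) * (B - S.α 0) := by nlinarith
  nlinarith [mul_le_mul_of_nonneg_left k h0'.le]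

theorem sub_α_one_mul_le : (A - S.α 1) * (A * B) ≤ 3 / 2 := by
  have hA := S.two_le'
  have hB := S.four_mul_le'
  have h1 := S.α_one_ge
  have h1' := S.one_lt
  have hr := S.root 1
  have k : 2 / 3 * ((A : ℝ) * B) ≤ S.α 1 * (B - S.α 1) := by nlinarith
  nlinarith [mul_le_mul_of_nonneg_left k (by linarith : 0 ≤ A - S.α 1)]

theorem α_two_sub_mul_le : (S.α 2 - B) * (A * B) ≤ 1 / 3 := by
  have hA := S.two_le'
  have hB := S.four_mul_le'
  have h2 := S.lt_two
  have hr := S.root 2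
  have k : 3 * ((A : ℝ) * B) ≤ S.α 2 * (S.α 2 - A) := by nlinarith
  nlinarith [mul_le_mul_of_nonneg_left k (by linarith : 0 ≤ S.α 2 - B)]

theorem abs_sub_log_le :
    |S.ℓ 1 - Real.log A| ≤ 6 / (A ^ 2 * B) ∧ |S.ℓ 2 - Real.log B| ≤ 6 / (A ^ 2 * B) ∧
    |S.m 0 - Real.log A| ≤ 6 / (A ^ 2 * B) ∧ |S.m 2 - Real.log (B - A)| ≤ 6 / (A ^ 2 * B) ∧
    |S.gap 0 1 - Real.log A| ≤ 6 / (A ^ 2 * B) ∧ |S.gap 0 2 - Real.log B| ≤ 6 / (A ^ 2 * B) ∧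
    |S.gap 1 2 - Real.log (B - A)| ≤ 6 / (A ^ 2 * B) := by
  have hA := S.two_le'
  have hB := S.four_mul_le'
  have h0 := S.α_zero_le
  have h0' := S.pos
  have h1 := S.α_one_ge
  have h1' := S.one_lt
  have h2 := S.lt_two
  have A0 : (0 : ℝ) < A := by linarith
  have B0 : (0 : ℝ) < B := by linarith
  have AB : (0 : ℝ) < A * B := by positivity
  have e : (3 : ℝ) / (A ^ 2 * B) ≤ 1 / 2 := by
    rw [div_le_div_iff₀ (by positivity) (by norm_num)]
    nlinarith [mul_le_mul hA hA (by norm_num) A0.le]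
  have k0 : S.α 0 ≤ 11 / 10 / (A * B) := (le_div_iff₀ AB).2 S.α_zero_mul_le
  have k1 : A - S.α 1 ≤ 3 / 2 / (A * B) := (le_div_iff₀ AB).2 S.sub_α_one_mul_le
  have k2 : S.α 2 - B ≤ 1 / 3 / (A * B) := (le_div_iff₀ AB).2 S.α_two_sub_mul_le
  have key : ∀ {x y : ℝ}, 0 < x → A ≤ y → |x - y| ≤ 3 / (A * B) →
      |Real.log |x| - Real.log y| ≤ 6 / (A ^ 2 * B) := by
    intro x y hx hy hxy
    have h := Real.abs_log_sub_log_le (e := 3 / (A ^ 2 * B)) (A0.trans_le hy)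
      (hxy.trans ?_) e
    · rw [abs_of_pos hx]
      exact h.trans_eq (by ring)
    · calc (3 : ℝ) / (A * B) = 3 / (A ^ 2 * B) * A := by field_simp
        _ ≤ _ := by gcongr
  have e3 : (3 : ℝ) / (A * B) = 3 * (1 / (A * B)) := by ring
  have e11 : (11 : ℝ) / 10 / (A * B) = 11 / 10 * (1 / (A * B)) := by ring
  have e32 : (3 : ℝ) / 2 / (A * B) = 3 / 2 * (1 / (A * B)) := by ring
  have e13 : (1 : ℝ) / 3 / (A * B) = 1 / 3 * (1 / (A * B)) := by ring
  have q0 : (0 : ℝ) < 1 / (A * B) := by positivity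
  rw [e11] at k0
  rw [e32] at k1
  rw [e13] at k2
  rw [e3] at key
  generalize (1 : ℝ) / (A * B) = q at *
  refine ⟨?_, ?_, ?_, ?_, ?_, ?_, ?_⟩
  · exact key (by linarith) le_rfl (by rw [abs_le]; constructor <;> linarith)
  · exact key (by linarith) (by linarith) (by rw [abs_le]; constructor <;> linarith)
  · rw [m, abs_sub_comm (S.α 0)]
    exact key (by linarith) le_rfl (by rw [abs_le]; constructor <;> linarith)
  · exact key (by linarith) (by linarith) (by rw [abs_le]; constructor <;> linarith)
  · rw [gap, abs_sub_comm (S.α 0)]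
    exact key (by linarith) le_rfl (by rw [abs_le]; constructor <;> linarith)
  · rw [gap, abs_sub_comm (S.α 0)]
    exact key (by linarith) (by linarith) (by rw [abs_le]; constructor <;> linarith)
  · rw [gap, abs_sub_comm (S.α 1)]
    exact key (by linarith) (by linarith) (by rw [abs_le]; constructor <;> linarith)

end ThueRoots

theorem abs_mul_sub_le {u x y V E : ℝ} (hu : |u| ≤ V) (h : |x - y| ≤ E) :
    |u * x - u * y| ≤ V * E := by
  rw [← mul_sub, abs_mul]
  exact mul_le_mul hu h (abs_nonneg _) ((abs_nonneg _).trans hu)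

namespace ThueRoots

variable {A B : ℤ} (S : ThueRoots A B)

theorem abs_form_le {u v : ℤ} {V : ℝ} (hu : |(u : ℝ)| ≤ V) (hv : |(v : ℝ)| ≤ V) :
    |((u - 1 : ℤ) : ℝ) * (Real.log B - Real.log A)
        - ((-v : ℤ) : ℝ) * (Real.log A + 2 * Real.log (B - A))| ≤
      |S.lam 0 u v| + (6 * V + 2) * (6 / (A ^ 2 * B)) ∧
    |((v - 1 : ℤ) : ℝ) * (Real.log (B - A) - Real.log A)
        - ((-u : ℤ) : ℝ) * (Real.log A + 2 * Real.log B)| ≤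
      |S.lam 1 u v| + (6 * V + 2) * (6 / (A ^ 2 * B)) ∧
    |((u + 1 : ℤ) : ℝ) * (2 * Real.log A + Real.log B)
        - ((v + 1 : ℤ) : ℝ) * (2 * Real.log A + Real.log (B - A))| ≤
      |S.lam 2 u v| + (6 * V + 2) * (6 / (A ^ 2 * B)) := by
  obtain ⟨h1, h2, h3, h4, h5, h6, h7⟩ := S.abs_sub_log_le
  have sℓ := S.sum_ℓ
  have sm := S.sum_m
  have hV : 0 ≤ V := (abs_nonneg _).trans hu
  have g10 : S.gap 1 0 = S.gap 0 1 := by simp only [gap, abs_sub_comm]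
  have g20 : S.gap 2 0 = S.gap 0 2 := by simp only [gap, abs_sub_comm]
  have g21 : S.gap 2 1 = S.gap 1 2 := by simp only [gap, abs_sub_comm]
  have l0 : S.lam 0 u v = u * (S.ℓ 1 - S.ℓ 2) + v * (S.m 1 - S.m 2) - (S.gap 0 1 - S.gap 0 2) := rfl
  have l1 : S.lam 1 u v = u * (S.ℓ 2 - S.ℓ 0) + v * (S.m 2 - S.m 0) - (S.gap 1 2 - S.gap 1 0) := rfl
  have l2 : S.lam 2 u v = u * (S.ℓ 0 - S.ℓ 1) + v * (S.m 0 - S.m 1) - (S.gap 2 0 - S.gap 2 1) := rfl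
  rw [g10] at l1
  rw [g20, g21] at l2
  rw [show S.m 1 = -S.m 0 - S.m 2 by linarith] at l0 l2
  rw [show S.ℓ 0 = -S.ℓ 1 - S.ℓ 2 by linarith] at l1 l2
  have u1 := abs_mul_sub_le hu h1
  have u2 := abs_mul_sub_le hu h2
  have v3 := abs_mul_sub_le hv h3
  have v4 := abs_mul_sub_le hv h4
  generalize (6 : ℝ) / (A ^ 2 * B) = E at *
  have hE : 0 ≤ E := (abs_nonneg _).trans h1
  have hVE : 0 ≤ V * E := mul_nonneg hV hE
  rw [abs_le] at h5 h6 h7 u1 u2 v3 v4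
  have a0 := le_abs_self (S.lam 0 u v)
  have a0' := neg_abs_le (S.lam 0 u v)
  have a1 := le_abs_self (S.lam 1 u v)
  have a1' := neg_abs_le (S.lam 1 u v)
  have a2 := le_abs_self (S.lam 2 u v)
  have a2' := neg_abs_le (S.lam 2 u v)
  generalize |S.lam 0 u v| = L0 at *
  generalize |S.lam 1 u v| = L1 at *
  generalize |S.lam 2 u v| = L2 at *
  rw [l0] at a0 a0'
  rw [l1] at a1 a1'
  rw [l2] at a2 a2'
  push_cast
  refine ⟨?_, ?_, ?_⟩ <;> rw [abs_le] <;> constructor <;> linarith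

theorem lt_abs_unit (j : Fin 3) : 1 / (2 * ((A : ℝ) * B / 2) ^ 2) <
    |S.unit (![1, 0, -1] j) (![0, 1, -1] j) j| := by
  have hA := S.two_le'
  have hB := S.four_mul_le'
  have h0 := S.α_zero_le
  have h0' := S.pos
  have h1 := S.α_one_ge
  have h1' := S.one_lt
  have h2 := S.lt_two
  have h2' := S.α_two_le
  have AB : (0 : ℝ) < A * B := by nlinarith
  have AB16 : (16 : ℝ) ≤ A * B := by nlinarith
  rw [div_lt_iff₀ (by positivity)]
  have : ∀ j : Fin 3, j = 0 ∨ j = 1 ∨ j = 2 := by decide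
  have hr := S.root j
  rcases this j with rfl | rfl | rfl
  · simp only [unit, Matrix.cons_val_zero, zpow_one, zpow_zero, mul_one, abs_of_pos h0']
    have k : (A - S.α 0) * (B - S.α 0) ≤ A * B := by nlinarith
    have k2 : 1 ≤ S.α 0 * (A * B) := by nlinarith [mul_le_mul_of_nonneg_left k h0'.le]
    nlinarith
  · simp only [unit, Matrix.cons_val_one, Matrix.cons_val_zero, zpow_one, zpow_zero, one_mul]
    rw [abs_sub_comm, abs_of_pos (by linarith)]
    have k : S.α 1 * (B - S.α 1) ≤ A * B := by nlinarith
    have k2 : 1 ≤ (A - S.α 1) * (A * B) := by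
      nlinarith [mul_le_mul_of_nonneg_left k (by linarith : 0 ≤ A - S.α 1)]
    nlinarith
  · have e : S.unit (![1, 0, -1] 2) (![0, 1, -1] 2) 2 = S.α 2 - B := by
      simp only [unit, Matrix.cons_val, zpow_neg, zpow_one]
      have := S.sub_ne 2
      have := (S.α_pos 2).ne'
      field_simp
      linear_combination -hr
    rw [e, abs_of_pos (by linarith)]
    have k : S.α 2 * (S.α 2 - A) ≤ B ^ 2 := by nlinarith
    have k2 : 1 ≤ (S.α 2 - B) * B ^ 2 := by
      nlinarith [mul_le_mul_of_nonneg_left k (by linarith : 0 ≤ S.α 2 - B)]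
    have k3 : 2 * ((A : ℝ) * B / 2) ^ 2 = A ^ 2 / 2 * B ^ 2 := by ring
    have k4 : 2 ≤ (A : ℝ) ^ 2 / 2 := by nlinarith
    rw [k3]
    nlinarith

/-- The smallness of one of the three linear forms in `log A`, `log B` and `log (B - A)`. -/
def SmallForm (A B : ℤ) (V : ℕ) (δ : ℝ) : Prop :=
  ∃ U W : ℤ, ¬ (U = 0 ∧ W = 0) ∧ |U| ≤ V ∧ |W| ≤ V ∧
    (|U * (Real.log B - Real.log A) - W * (Real.log A + 2 * Real.log (B - A))| ≤ δ ∨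
      |U * (Real.log (B - A) - Real.log A) - W * (Real.log A + 2 * Real.log B)| ≤ δ ∨
      |U * (2 * Real.log A + Real.log B) - W * (2 * Real.log A + Real.log (B - A))| ≤ δ)

theorem exponents_lt {y u v : ℤ} {j : Fin 3}
    (hu : |(u : ℝ)| ≤ 7 * Real.log |(y : ℝ)|) (hv : |(v : ℝ)| ≤ 7 * Real.log |(y : ℝ)|)
    (hy : 2 ≤ |y|) (hlam : |S.lam j u v| ≤ 1 / |(y : ℝ)| ^ 3) {k : ℕ} (hk : 12 ≤ k)
    (hB : 3 * Real.log B ≤ 52 / 25 * 2 ^ k) :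
    |u| < 2 ^ (12 * k + 224) ∧ |v| < 2 ^ (12 * k + 224) := by
  have hY : (2 : ℝ) ≤ |(y : ℝ)| := by exact_mod_cast hy
  have hV : ((max u.natAbs v.natAbs : ℕ) : ℝ) ≤ 7 * Real.log |(y : ℝ)| := by
    rw [Nat.cast_max, Nat.cast_natAbs, Nat.cast_natAbs]
    push_cast
    exact max_le hu hv
  have h := S.exponent_lt hk hB (j := j) (u := u) (v := v) (V := max u.natAbs v.natAbs)
    (by rw [Int.abs_eq_natAbs]; exact_mod_cast le_max_left _ _)
    (by rw [Int.abs_eq_natAbs]; exact_mod_cast le_max_right _ _)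
    (by
      rw [Int.abs_eq_natAbs, Int.abs_eq_natAbs]
      rcases max_choice u.natAbs v.natAbs with h | h <;> rw [h]
      · exact Or.inl le_rfl
      · exact Or.inr le_rfl)
    (hlam.trans (by
      have e : 1 / |(y : ℝ)| ^ 3 = Real.exp (-(3 * Real.log |(y : ℝ)|)) := by
        rw [Real.exp_neg, one_div]
        congr 1
        rw [← Real.log_rpow (by linarith), Real.exp_log (by positivity)]
        norm_num
      rw [e, Real.exp_le_exp]
      linarith))
  generalize 12 * k + 224 = e at *
  have h1 := (le_max_left _ _).trans_lt h
  have h2 := (le_max_right _ _).trans_lt h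
  rw [Int.abs_eq_natAbs, Int.abs_eq_natAbs]
  exact ⟨by exact_mod_cast h1, by exact_mod_cast h2⟩

theorem smallForm (S : ThueRoots A B) {x y : ℤ} (h : |((x * (x - A * y) * (x - B * y) - y ^ 3 : ℤ) : ℝ)| = 1)
    (hy : 2 ≤ |y|) {k e : ℕ} (hk : 12 ≤ k) (hB : 3 * Real.log B ≤ 52 / 25 * 2 ^ k)
    (he : e = 12 * k + 224) : SmallForm A B (2 ^ e) (40 * 2 ^ e / (A ^ 2 * B)) := by
  obtain ⟨j, u, v, hlam, hY, hu, hv, hs, hunit⟩ := S.exists_lam_small h hy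
  obtain ⟨hu', hv'⟩ := S.exponents_lt hu hv hy hlam hk hB
  rw [← he] at hu' hv'
  have he1 : 13 < (2 : ℝ) ^ e := by
    have : 2 ^ 4 ≤ 2 ^ e := Nat.pow_le_pow_right (by norm_num) (by omega)
    have : ((2 ^ 4 : ℕ) : ℝ) ≤ (2 ^ e : ℕ) := by exact_mod_cast this
    push_cast at this
    linarith
  have hu2 : |(u : ℝ)| ≤ 2 ^ e - 1 := by
    have : |u| ≤ 2 ^ e - 1 := by linarith
    exact_mod_cast this
  have hv2 : |(v : ℝ)| ≤ 2 ^ e - 1 := by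
    have : |v| ≤ 2 ^ e - 1 := by linarith
    exact_mod_cast this
  obtain ⟨f0, f1, f2⟩ := S.abs_form_le hu2 hv2
  have hA := S.two_le'
  have hB4 := S.four_mul_le'
  have hA0 : (0 : ℝ) < A := by linarith
  have hB0 : (0 : ℝ) < B := by linarith
  have hη : |S.lam j u v| + (6 * (2 ^ e - 1) + 2) * (6 / ((A : ℝ) ^ 2 * B)) ≤
      40 * 2 ^ e / (A ^ 2 * B) := by
    have l1 : 1 / |(y : ℝ)| ^ 3 ≤ 1 / (A ^ 2 * B) := by
      apply one_div_le_one_div_of_le (by positivity)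
      calc ((A : ℝ) ^ 2 * B) ≤ (A * B / 2) ^ 3 := by
            have : 8 ≤ (A : ℝ) * B ^ 2 := by nlinarith
            have : (A : ℝ) ^ 2 * B * 8 ≤ A ^ 2 * B * (A * B ^ 2) := by gcongr
            nlinarith
        _ ≤ _ := by gcongr
    have e1 : (6 * (2 ^ e - 1) + 2) * (6 / ((A : ℝ) ^ 2 * B)) =
      (36 * 2 ^ e - 24) * (1 / (A ^ 2 * B)) := by ring
    have e2 : 40 * 2 ^ e / ((A : ℝ) ^ 2 * B) = 40 * 2 ^ e * (1 / (A ^ 2 * B)) := by ring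
    have q : 0 < 1 / ((A : ℝ) ^ 2 * B) := by positivity
    rw [e1, e2]
    nlinarith
  have habs1 : ∀ {z : ℤ}, |z| < 2 ^ e → |z + 1| ≤ ((2 ^ e : ℕ) : ℤ) ∧ |z - 1| ≤ ((2 ^ e : ℕ) : ℤ) ∧
      |-z| ≤ ((2 ^ e : ℕ) : ℤ) := by
    intro z hz
    rw [abs_lt] at hz
    push_cast
    refine ⟨?_, ?_, ?_⟩ <;> rw [abs_le] <;> constructor <;> linarith
  have hnt : ¬ (u = ![1, 0, -1] j ∧ v = ![0, 1, -1] j) := by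
    rintro ⟨hu0, hv0⟩
    have := S.lt_abs_unit j
    rw [← hu0, ← hv0, ← hunit] at this
    have h2 : 1 / (2 * |(y : ℝ)| ^ 2) ≤ 1 / (2 * ((A : ℝ) * B / 2) ^ 2) := by gcongr
    linarith
  have : ∀ j : Fin 3, j = 0 ∨ j = 1 ∨ j = 2 := by decide
  rcases this j with rfl | rfl | rfl
  · refine ⟨u - 1, -v, fun h => hnt ⟨?_, ?_⟩, (habs1 hu').2.1, (habs1 hv').2.2,
      Or.inl (f0.trans hη)⟩
    · show u = 1; omega
    · show v = 0; omega
  · refine ⟨v - 1, -u, fun h => hnt ⟨?_, ?_⟩, (habs1 hv').2.1, (habs1 hu').2.2,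
      Or.inr (Or.inl (f1.trans hη))⟩
    · show u = 0; omega
    · show v = 1; omega
  · refine ⟨u + 1, v + 1, fun h => hnt ⟨?_, ?_⟩, (habs1 hu').1, (habs1 hv').1,
      Or.inr (Or.inr (f2.trans hη))⟩
    · show u = -1; omega
    · show v = -1; omega

end ThueRoots

theorem Nat.fib_mul_eight_pow_le (n : ℕ) (hn : 3 ≤ n) : Nat.fib n * 8 ^ (n / 10) ≤ 2 ^ n := by
  induction n using Nat.strong_induction_on with
  | _ n ih =>
    by_cases h : n < 13
    · interval_cases n <;> decide
    · obtain ⟨m, rfl⟩ : ∃ m, n = m + 1 + 10 := ⟨n - 11, by omega⟩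
      have h1 := ih (m + 1) (by omega) (by omega)
      have h2 : (m + 1 + 10) / 10 = (m + 1) / 10 + 1 := by omega
      have h3 : 3 * Nat.fib (m + 1 + 1) ≤ 5 * Nat.fib (m + 1) := by
        obtain ⟨i, rfl⟩ : ∃ i, m = i + 2 := ⟨m - 2, by omega⟩
        have a1 := Nat.fib_add_two (n := i)
        have a2 := Nat.fib_add_two (n := i + 1)
        have a3 := Nat.fib_add_two (n := i + 2)
        have a4 : Nat.fib i ≤ Nat.fib (i + 1) := Nat.fib_le_fib_succ
        simp only [add_assoc, Nat.reduceAdd] at *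
        omega
      have h4 : Nat.fib (m + 1 + 10) = 55 * Nat.fib (m + 1 + 1) + 34 * Nat.fib (m + 1) := by
        have := Nat.fib_add (m + 1) 9
        rw [show m + 1 + 9 + 1 = m + 1 + 10 by ring] at this
        rw [this, show Nat.fib 9 = 34 by decide, show Nat.fib (9 + 1) = 55 by decide]
        ring
      rw [h2, pow_succ, pow_add 2 (m + 1) 10]
      have h5 : Nat.fib (m + 1 + 10) ≤ 128 * Nat.fib (m + 1) := by omega
      calc _ ≤ 128 * Nat.fib (m + 1) * (8 ^ ((m + 1) / 10) * 8) := by gcongr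
        _ = 1024 * (Nat.fib (m + 1) * 8 ^ ((m + 1) / 10)) := by ring
        _ ≤ 1024 * 2 ^ (m + 1) := by gcongr
        _ = _ := by norm_num; ring

theorem Nat.four_pow_le_fib_pow (n : ℕ) (hn : 1 ≤ n) : 4 ^ n ≤ 16 * Nat.fib n ^ 3 := by
  induction n using Nat.strong_induction_on with
  | _ n ih =>
    by_cases h : n < 5
    · interval_cases n <;> decide
    · obtain ⟨m, rfl⟩ : ∃ m, n = m + 2 + 3 := ⟨n - 5, by omega⟩
      have h1 := ih (m + 2) (by omega) (by omega)
      have h3 : 4 * Nat.fib (m + 2) ≤ Nat.fib (m + 2 + 3) := by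
        have a1 := Nat.fib_add_two (n := m)
        have a2 := Nat.fib_add_two (n := m + 1)
        have a3 := Nat.fib_add_two (n := m + 2)
        have a4 := Nat.fib_add_two (n := m + 3)
        have a5 : Nat.fib m ≤ Nat.fib (m + 1) := Nat.fib_le_fib_succ
        simp only [add_assoc, Nat.reduceAdd] at *
        omega
      have h4 := Nat.pow_le_pow_left h3 3
      rw [mul_pow] at h4
      rw [pow_add 4]
      omega

theorem Nat.four_mul_fib_le (n : ℕ) (hn : 3 ≤ n) : 4 * Nat.fib n ≤ 2 ^ n := by
  induction n, hn using Nat.le_induction with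
  | base => decide
  | succ n hn ih =>
    have : Nat.fib (n + 1) ≤ 2 * Nat.fib n := by
      obtain ⟨i, rfl⟩ : ∃ i, n = i + 1 := ⟨n - 1, by omega⟩
      have := Nat.fib_add_two (n := i)
      have := Nat.fib_le_fib_succ (n := i)
      simp only [add_assoc, Nat.reduceAdd] at *
      omega
    rw [pow_succ]; omega

/-- The size of the error in Binet's formula, on the logarithmic scale. -/
theorem abs_log_fib_sub_le (n : ℕ) (hn : 3 ≤ n) :
    |Real.log (Nat.fib n) - (n * Real.log Real.goldenRatio - Real.log (√5))| ≤ 2 / 2 ^ n := by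
  have h5 : (0 : ℝ) < √5 := by positivity
  have hφ := Real.goldenRatio_pos
  have hF : (0 : ℝ) < Nat.fib n := by exact_mod_cast Nat.fib_pos.2 (by omega)
  have hφ2 : (2 : ℝ) ≤ Real.goldenRatio ^ 2 := by
    rw [Real.goldenRatio_sq]; linarith [Real.one_lt_goldenRatio]
  have hψφ : |Real.goldenConj| = Real.goldenRatio⁻¹ := by
    rw [abs_of_neg Real.goldenConj_neg, Real.inv_goldenRatio]
  have hp : (0 : ℝ) < Real.goldenRatio ^ n := by positivity
  have key : |√5 * Nat.fib n - Real.goldenRatio ^ n| ≤ 1 / 2 ^ n * Real.goldenRatio ^ n := by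
    rw [Real.coe_fib_eq]
    have : √5 * ((Real.goldenRatio ^ n - Real.goldenConj ^ n) / √5) - Real.goldenRatio ^ n =
      -Real.goldenConj ^ n := by field_simp; ring
    rw [this, abs_neg, abs_pow, hψφ, inv_pow, inv_eq_one_div, div_le_iff₀ hp]
    have : (2 : ℝ) ^ n ≤ Real.goldenRatio ^ n * Real.goldenRatio ^ n := by
      rw [← mul_pow, ← sq]; exact pow_le_pow_left₀ (by norm_num) hφ2 n
    rw [mul_assoc, one_div, inv_mul_eq_div, le_div_iff₀ (by positivity)]
    linarith
  have h2 : (1 : ℝ) / 2 ^ n ≤ 1 / 2 := by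
    apply one_div_le_one_div_of_le (by norm_num)
    calc (2 : ℝ) = 2 ^ 1 := by norm_num
      _ ≤ _ := pow_le_pow_right₀ (by norm_num) (by omega)
  have := Real.abs_log_sub_log_le hp key h2
  rw [Real.log_mul h5.ne' hF.ne', Real.log_pow] at this
  calc _ = |Real.log (√5) + Real.log (Nat.fib n) - n * Real.log Real.goldenRatio| := by
        congr 1; ring
    _ ≤ _ := this
    _ = _ := by ring

theorem ThueRoots.SmallForm.exists_two_logs {A B : ℤ} {V : ℕ} (hA : 2 ≤ A)
    (hB : 4 * A ≤ B) (hVA : 40 * V < A ^ 3) (hVB : 5 * V * A < B)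
    (h : SmallForm A B V (40 * V / (A ^ 2 * B))) :
    ∃ w t : ℤ, w ≠ 0 ∧ |w| ≤ 2 * V ∧ |t| ≤ 3 * V ∧
      |w * Real.log A - t * Real.log B| ≤ 5 * (V * (A / B)) := by
  obtain ⟨U, W, hne, hU, hW, hform⟩ := h
  have hA' : (2 : ℝ) ≤ A := by exact_mod_cast hA
  have hB' : 4 * (A : ℝ) ≤ B := by exact_mod_cast hB
  have hVA' : 40 * (V : ℝ) < A ^ 3 := by exact_mod_cast hVA
  have hVB' : 5 * (V : ℝ) * A < B := by exact_mod_cast hVB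
  have hU' : |(U : ℝ)| ≤ V := by exact_mod_cast hU
  have hW' : |(W : ℝ)| ≤ V := by exact_mod_cast hW
  have A0 : (0 : ℝ) < A := by linarith
  have B0 : (0 : ℝ) < B := by linarith
  have hV1 : (1 : ℝ) ≤ V := by
    have : 1 ≤ V := by
      by_contra! h0
      obtain rfl : V = 0 := by omega
      simp only [Nat.cast_zero, abs_nonpos_iff] at hU hW
      exact hne ⟨hU, hW⟩
    exact_mod_cast this
  have hδ : 40 * V / ((A : ℝ) ^ 2 * B) < A / B := by
    rw [div_lt_div_iff₀ (by positivity) B0]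
    nlinarith [mul_lt_mul_of_pos_right hVA' B0]
  have hq : 5 * (V * ((A : ℝ) / B)) < 1 := by
    rw [← mul_div_assoc, ← mul_div_assoc, div_lt_one B0]; linarith
  have hAB : (A : ℝ) / B ≤ V * ((A : ℝ) / B) := le_mul_of_one_le_left (by positivity) hV1
  have hc : |Real.log (B - A) - Real.log B| ≤ 2 * (A / B) := by
    refine Real.abs_log_sub_log_le B0 ?_ ?_
    · rw [sub_sub_cancel_left, abs_neg, abs_of_pos A0]; field_simp; rfl
    · rw [div_le_div_iff₀ B0 (by norm_num)]; linarith
  have hc' : A / B ≤ Real.log B - Real.log (B - A) := by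
    rw [← Real.log_div B0.ne' (by linarith)]
    have := Real.one_sub_inv_le_log_of_pos (show (0 : ℝ) < B / (B - A) from
      div_pos B0 (by linarith))
    refine le_trans (le_of_eq ?_) this
    rw [inv_div]; field_simp; ring
  have hlA : 0 < Real.log A := Real.log_pos (by linarith)
  have hlB : 2 ≤ Real.log B := by
    have := Real.log_le_log (by norm_num) (show (8 : ℝ) ≤ B by linarith)
    rw [show (8 : ℝ) = 2 ^ 3 by norm_num, Real.log_pow] at this
    have l2 := Real.log_two_gt_d9
    norm_num at this l2; linarith
  have hUc := abs_mul_sub_le hU' hc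
  have hWc := abs_mul_sub_le hW' hc
  rw [show (V : ℝ) * (2 * (A / B)) = 2 * (V * (A / B)) by ring] at hUc hWc
  have hq0 : 0 ≤ (V : ℝ) * ((A : ℝ) / B) := by positivity
  generalize (A : ℝ) / B = q at *
  generalize 40 * V / ((A : ℝ) ^ 2 * B) = δ at *
  have hred : |((U + W : ℤ) : ℝ) * Real.log A - ((U - 2 * W : ℤ) : ℝ) * Real.log B| ≤ 5 * (V * q) →
      ∃ w t : ℤ, w ≠ 0 ∧ |w| ≤ 2 * V ∧ |t| ≤ 3 * V ∧
        |w * Real.log A - t * Real.log B| ≤ 5 * (V * q) := by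
    intro h
    refine ⟨U + W, U - 2 * W, fun h0 => hne ?_, ?_, ?_, h⟩
    · rw [h0, Int.cast_zero, zero_mul, zero_sub, abs_neg, abs_mul] at h
      have : U - 2 * W = 0 := by
        by_contra h1
        have h2 : (1 : ℝ) ≤ |((U - 2 * W : ℤ) : ℝ)| := by exact_mod_cast Int.one_le_abs h1
        rw [abs_of_pos (by linarith : 0 < Real.log B)] at h
        nlinarith
      omega
    · rw [abs_le] at hU hW ⊢; constructor <;> linarith
    · rw [abs_le] at hU hW ⊢; constructor <;> linarith
  rw [abs_le] at hUc hWc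
  rcases hform with h | h | h
  · refine hred ?_
    rw [abs_le] at h ⊢
    push_cast
    constructor <;> linarith
  · refine hred ?_
    rw [abs_le] at h ⊢
    push_cast
    constructor <;> linarith
  · exfalso
    by_cases hUW : U = W
    · subst hUW
      rw [show (U : ℝ) * (2 * Real.log A + Real.log B) - U * (2 * Real.log A + Real.log (B - A)) =
        U * (Real.log B - Real.log (B - A)) by ring, abs_mul] at h
      have h2 : (1 : ℝ) ≤ |(U : ℝ)| := by
        exact_mod_cast Int.one_le_abs (fun h0 => hne ⟨h0, h0⟩)
      have h3 := le_abs_self (Real.log B - Real.log (B - A))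
      nlinarith [abs_nonneg (Real.log B - Real.log (B - A))]
    · have h2 : (1 : ℝ) ≤ |((U - W : ℤ) : ℝ)| := by
        exact_mod_cast Int.one_le_abs (sub_ne_zero.2 hUW)
      have h3 : |((U - W : ℤ) : ℝ) * (2 * Real.log A + Real.log B)| ≤ 3 * (V * q) := by
        rw [abs_le] at h ⊢
        push_cast
        constructor <;> linarith
      rw [abs_mul, abs_of_pos (by linarith : 0 < 2 * Real.log A + Real.log B)] at h3
      nlinarith

theorem mul_add_lt_two_pow {k : ℕ} (hk : 12 ≤ k) : 40 * k + 1200 < 2 ^ (k - 1) := by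
  induction k, hk using Nat.le_induction with
  | base => decide
  | succ k hk ih =>
    obtain ⟨m, rfl⟩ : ∃ m, k = m + 1 := ⟨k - 1, by omega⟩
    simp only [Nat.add_sub_cancel] at *
    rw [pow_succ]; omega

/-- For large indices, a nontrivial solution yields a small form in the logarithms of `2`, of
the golden ratio and of `√5`. -/
theorem exists_fib_form_small {n k e : ℕ} (hk : 12 ≤ k) (hnk : 2 ^ (k - 1) < n) (hnk' : n ≤ 2 ^ k)
    (he : e = 12 * k + 224) {x y : ℤ} (hy : 2 ≤ |y|)
    (h : |((x * (x - (Nat.fib n : ℤ) * y) * (x - (2 : ℤ) ^ n * y) - y ^ 3 : ℤ) : ℝ)| = 1) :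
    ∃ w t : ℤ, w ≠ 0 ∧ |w| ≤ 2 * 2 ^ e ∧ |t| ≤ 3 * 2 ^ e ∧
      |w * (n * Real.log Real.goldenRatio - Real.log (√5)) - t * (n * Real.log 2)| ≤
        7 * (2 ^ e / 8 ^ (n / 10)) := by
  have hk2 := mul_add_lt_two_pow hk
  have hn : 3 ≤ n := by omega
  have hA : (2 : ℤ) ≤ Nat.fib n := by
    have : Nat.fib 3 ≤ Nat.fib n := Nat.fib_mono hn
    exact_mod_cast this
  have hB : 4 * (Nat.fib n : ℤ) ≤ 2 ^ n := by exact_mod_cast Nat.four_mul_fib_le n hn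
  obtain ⟨S⟩ := ThueRoots.nonempty hA hB
  have hlog : 3 * Real.log ((2 ^ n : ℤ) : ℝ) ≤ 52 / 25 * 2 ^ k := by
    push_cast
    rw [Real.log_pow]
    have h1 : (n : ℝ) ≤ 2 ^ k := by exact_mod_cast hnk'
    have h2 := Real.log_two_lt_d9
    have h3 : (0 : ℝ) ≤ n := by positivity
    norm_num at h2
    nlinarith
  have hsf := S.smallForm h hy hk hlog he
  have h8 := Nat.fib_mul_eight_pow_le n hn
  have h4 := Nat.four_pow_le_fib_pow n (by omega)
  have hF0 : 0 < Nat.fib n := Nat.fib_pos.2 (by omega)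
  have p1 : 40 * 2 ^ e < Nat.fib n ^ 3 := by
    have : 16 * (40 * 2 ^ e) < 4 ^ n := by
      calc 16 * (40 * 2 ^ e) < 2 ^ 10 * 2 ^ e := by
            have : 0 < 2 ^ e := by positivity
            omega
        _ = 2 ^ (10 + e) := (pow_add _ _ _).symm
        _ ≤ 2 ^ (2 * n) := Nat.pow_le_pow_right (by norm_num) (by omega)
        _ = 4 ^ n := by rw [pow_mul]; norm_num
    omega
  have p2 : 5 * 2 ^ e * Nat.fib n < 2 ^ n := by
    refine lt_of_lt_of_le ?_ h8
    rw [mul_comm]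
    refine Nat.mul_lt_mul_of_pos_left ?_ hF0
    calc 5 * 2 ^ e < 2 ^ 3 * 2 ^ e := by
          have : 0 < 2 ^ e := by positivity
          omega
      _ = 2 ^ (3 + e) := (pow_add _ _ _).symm
      _ ≤ 2 ^ (3 * (n / 10)) := Nat.pow_le_pow_right (by norm_num) (by omega)
      _ = 8 ^ (n / 10) := by rw [pow_mul]; norm_num
  obtain ⟨w, t, hw, hwV, htV, hf⟩ := ThueRoots.SmallForm.exists_two_logs (V := 2 ^ e) hA hB
    (by exact_mod_cast p1) (by exact_mod_cast p2) (by simpa using hsf)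
  refine ⟨w, t, hw, by exact_mod_cast hwV, by exact_mod_cast htV, ?_⟩
  have hbin := abs_log_fib_sub_le n hn
  have hw' : |(w : ℝ)| ≤ 2 * 2 ^ e := by exact_mod_cast hwV
  have hb := abs_mul_sub_le hw' hbin
  push_cast at hf
  rw [Real.log_pow] at hf
  have h8' : (Nat.fib n : ℝ) * 8 ^ (n / 10) ≤ 2 ^ n := by exact_mod_cast h8
  have hA' : (2 : ℝ) ≤ Nat.fib n := by exact_mod_cast hA
  have r1 : (Nat.fib n : ℝ) / 2 ^ n ≤ 1 / 8 ^ (n / 10) := by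
    rw [div_le_div_iff₀ (by positivity) (by positivity)]; linarith
  have r2 : (2 : ℝ) / 2 ^ n ≤ Nat.fib n / 2 ^ n := by gcongr
  have r3 : (2 : ℝ) ^ e / 8 ^ (n / 10) = 2 ^ e * (1 / 8 ^ (n / 10)) := by ring
  rw [r3]
  have e0 : (0 : ℝ) < 2 ^ e := by positivity
  have s1 := mul_le_mul_of_nonneg_left r1 e0.le
  have s2 := mul_le_mul_of_nonneg_left (r2.trans r1) e0.le
  rw [abs_le] at hf hb ⊢
  constructor <;> linarith

namespace GoldenForm

/-- The number of points in the parameter choice. -/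
def s (m : ℕ) : ℕ := 33 * (3 * m + 1) * (140 * m + 360) + 6

/-- The degree in the parameter choice. -/
def L (m : ℕ) : ℕ := 2803712 * (3 * m + 1) ^ 2 * s m

theorem s_succ_le (t : ℕ) : 10 * s (26 + t + 1) ≤ 11 * s (26 + t) := by
  simp only [s]; ring_nf; nlinarith

theorem s_mono (m : ℕ) : s m ≤ s (m + 1) := by
  simp only [s]; gcongr <;> omega

theorem L_succ_le (t : ℕ) : 4 * L (26 + t + 1) ≤ 5 * L (26 + t) := by
  have h1 := s_succ_le t
  have h2 : 12 * (3 * (26 + t + 1) + 1) ^ 2 ≤ 13 * (3 * (26 + t) + 1) ^ 2 := by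
    ring_nf; nlinarith
  have h3 := Nat.mul_le_mul h1 h2
  simp only [L]
  generalize s (26 + t + 1) = a at *
  generalize s (26 + t) = b at *
  generalize (3 * (26 + t + 1) + 1) ^ 2 = c at *
  generalize (3 * (26 + t) + 1) ^ 2 = d at *
  nlinarith

theorem s_le (t : ℕ) : s (26 + t) ≤ 2 ^ (26 + t) := by
  induction t with
  | zero => decide
  | succ t ih =>
    have := s_succ_le t
    rw [← add_assoc, pow_succ]
    omega

theorem L_le (t : ℕ) : L (26 + t) ≤ 2 ^ (33 + (26 + t)) := by
  induction t with
  | zero => decide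
  | succ t ih =>
    have := L_succ_le t
    rw [← add_assoc, ← add_assoc, ← add_assoc, pow_succ]
    rw [← add_assoc] at ih
    omega

theorem L_cube_le (t : ℕ) : (L (26 + t) + 1) ^ 3 ≤ 4 ^ (3 * (26 + t)) * s (26 + t) := by
  induction t with
  | zero => decide
  | succ t ih =>
    have h1 := L_succ_le t
    have h2 := s_mono (26 + t)
    rw [← add_assoc]
    have h3 : 4 * (L (26 + t + 1) + 1) ≤ 5 * (L (26 + t) + 1) := by omega
    have h4 := Nat.pow_le_pow_left h3 3
    rw [mul_pow, mul_pow] at h4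
    have h5 : 4 ^ (3 * (26 + t + 1)) * s (26 + t + 1) ≥ 4 * (4 ^ (3 * (26 + t)) * s (26 + t)) := by
      rw [show 3 * (26 + t + 1) = 3 * (26 + t) + 3 by ring, pow_add]
      have h6 := Nat.mul_le_mul_left (4 ^ (3 * (26 + t))) h2
      rw [mul_right_comm]
      generalize 4 ^ (3 * (26 + t)) * s (26 + t + 1) = a at *
      generalize 4 ^ (3 * (26 + t)) * s (26 + t) = b at *
      omega
    omega

theorem exponent_le (t : ℕ) : 16 * (1184 * L (26 + t) * s (26 + t) * (5 * (26 + t) + 8)) ≤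
    2 ^ (4 * (26 + t)) := by
  induction t with
  | zero => decide
  | succ t ih =>
    have h1 := L_succ_le t
    have h2 := s_succ_le t
    have h3 : 20 * (5 * (26 + (t + 1)) + 8) ≤ 21 * (5 * (26 + t) + 8) := by omega
    have h4 := Nat.mul_le_mul (Nat.mul_le_mul h1 h2) h3
    rw [← add_assoc] at *
    rw [show 4 * (26 + t + 1) = 4 * (26 + t) + 4 by ring, pow_add]
    generalize L (26 + t + 1) = a at *
    generalize s (26 + t + 1) = a' at *
    generalize L (26 + t) = b at *
    generalize s (26 + t) = b' at *
    generalize (5 * (26 + t + 1) + 8) = c at *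
    generalize (5 * (26 + t) + 8) = c' at *
    have e1 : 4 * a * (10 * a') * (20 * c) = 800 * (a * a' * c) := by ring
    have e2 : 5 * b * (11 * b') * (21 * c') = 1155 * (b * b' * c') := by ring
    have e3 : 16 * (1184 * a * a' * c) = 18944 * (a * a' * c) := by ring
    have e4 : 16 * (1184 * b * b' * c') = 18944 * (b * b' * c') := by ring
    omega

/-- The two embeddings of `ℤ[√5]` in `ℂ`. -/
noncomputable def emb (i : Bool) : ℤ√5 →+* ℂ :=
  Zsqrtd.lift ⟨((cond i (√5) (-√5) : ℝ) : ℂ), by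
    rw [← Complex.ofReal_mul]
    cases i <;> simp⟩

theorem emb_apply (i : Bool) (x : ℤ√5) :
    emb i x = ((x.re + x.im * cond i (√5) (-√5) : ℝ) : ℂ) := by
  simp [emb, Zsqrtd.lift_apply_apply]

theorem prod_norm_emb (x : ℤ√5) : ∏ i, ‖emb i x‖ = |(x.norm : ℝ)| := by
  rw [Fintype.prod_bool, emb_apply, emb_apply, Complex.norm_real, Complex.norm_real,
    Real.norm_eq_abs, Real.norm_eq_abs, ← abs_mul]
  congr 1
  have h5 : √5 * √5 = (5 : ℝ) := Real.mul_self_sqrt (by norm_num)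
  simp only [Zsqrtd.norm, cond_true, cond_false]
  push_cast
  linear_combination -(x.im : ℝ) ^ 2 * h5

theorem norm_ne_zero {x : ℤ√5} (hx : x ≠ 0) : x.norm ≠ 0 := by
  intro h
  refine hx ((Zsqrtd.norm_eq_zero ?_ x).1 h)
  rintro m hm
  have h1 : m.natAbs * m.natAbs = 5 := by
    have := congrArg Int.natAbs hm
    rw [Int.natAbs_mul] at this; simpa using this.symm
  have h2 : m.natAbs ≤ 2 := by nlinarith
  interval_cases m.natAbs <;> omega

/-- The elements `2`, `1 + √5` and `√5` of `ℤ[√5]`. -/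
def gen : Fin 3 → ℤ√5 := ![⟨2, 0⟩, ⟨1, 1⟩, ⟨0, 1⟩]

/-- The logarithms of the three elements `2`, `1 + √5` and `√5`. -/
noncomputable def l : Fin 3 → ℝ := ![Real.log 2, Real.log (1 + √5), Real.log (√5)]

theorem sqrt_five_bounds : 2 < √5 ∧ √5 < 5 / 2 :=
  ⟨by rw [Real.lt_sqrt (by norm_num)]; norm_num,
    by rw [Real.sqrt_lt' (by norm_num)]; norm_num⟩

theorem four_le_exp_two : 4 ≤ Real.exp 2 := by
  have h := Real.add_one_le_exp (1 : ℝ)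
  rw [show (2 : ℝ) = 1 + 1 by norm_num, Real.exp_add]
  nlinarith

theorem norm_emb_gen_le (i : Bool) (j : Fin 3) : ‖emb i (gen j)‖ ≤ Real.exp 2 := by
  refine le_trans ?_ four_le_exp_two
  obtain ⟨h1, h2⟩ := sqrt_five_bounds
  rw [emb_apply, Complex.norm_real, Real.norm_eq_abs]
  cases i <;> fin_cases j <;> simp [gen, abs_le] <;> (try constructor) <;> linarith

theorem emb_gen (j : Fin 3) : emb true (gen j) = Real.exp (l j) := by
  obtain ⟨h1, h2⟩ := sqrt_five_bounds
  rw [emb_apply]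
  congr 1
  fin_cases j
  · simp [gen, l, Real.exp_log]
  · simp only [gen, l]
    simp [Real.exp_log (show (0 : ℝ) < 1 + √5 by linarith)]
  · simp only [gen, l]
    simp [Real.exp_log (show (0 : ℝ) < √5 by linarith)]

theorem abs_l_le (j : Fin 3) : |l j| ≤ 2 := by
  obtain ⟨h1, h2⟩ := sqrt_five_bounds
  have key : ∀ x : ℝ, 1 ≤ x → x ≤ 4 → |Real.log x| ≤ 2 := by
    intro x h1 h2
    rw [abs_of_nonneg (Real.log_nonneg h1), Real.log_le_iff_le_exp (by linarith)]
    exact h2.trans four_le_exp_two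
  fin_cases j
  · exact key 2 (by norm_num) (by norm_num)
  · exact key _ (by linarith) (by linarith)
  · exact key _ (by linarith) (by linarith)

theorem emb_injective (i : Bool) : Function.Injective (emb i) := by
  rw [injective_iff_map_eq_zero]
  intro x hx
  by_contra h0
  have h1 := prod_norm_emb x
  have h2 : ∏ i, ‖emb i x‖ = 0 := Finset.prod_eq_zero (Finset.mem_univ i) (by simp [hx])
  rw [h2] at h1
  exact norm_ne_zero h0 (by exact_mod_cast abs_eq_zero.1 h1.symm)

/-- The numbers `2`, `1 + √5` and `√5` are multiplicatively independent. -/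
theorem eq_zero_of_sum_eq_zero {k : Fin 3 → ℤ} (h : ∑ i, (k i : ℝ) * l i = 0) : k = 0 := by
  have hprod : ∏ i, gen i ^ (k i).toNat = ∏ i, gen i ^ (-k i).toNat := by
    apply emb_injective true
    simp only [map_prod, map_pow, emb_gen, ← Complex.ofReal_pow, ← Complex.ofReal_prod]
    congr 1
    simp only [← Real.exp_nat_mul, ← Real.exp_sum]
    congr 1
    rw [← sub_eq_zero, ← Finset.sum_sub_distrib, ← h]
    refine Finset.sum_congr rfl fun i _ => ?_
    rw [← sub_mul]
    congr 1
    have : ((k i).toNat : ℤ) - (-k i).toNat = k i := by omega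
    exact_mod_cast congrArg (Int.cast : ℤ → ℝ) this
  have hnorm := congrArg (fun x => (Zsqrtd.normMonoidHom x).natAbs) hprod
  simp only [map_mul, map_pow, Fin.prod_univ_three, Int.natAbs_mul, Int.natAbs_pow] at hnorm
  have g0 : (Zsqrtd.normMonoidHom (gen 0)).natAbs = 4 := by decide
  have g1 : (Zsqrtd.normMonoidHom (gen 1)).natAbs = 4 := by decide
  have g2 : (Zsqrtd.normMonoidHom (gen 2)).natAbs = 5 := by decide
  rw [g0, g1, g2, ← pow_add, ← pow_add] at hnorm
  have hf := congrArg (fun x => x.factorization 5) hnorm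
  have hf' := congrArg (fun x => x.factorization 2) hnorm
  have h54 : Nat.factorization 4 5 = 0 := Nat.factorization_eq_zero_of_not_dvd (by norm_num)
  have h25 : Nat.factorization 5 2 = 0 := Nat.factorization_eq_zero_of_not_dvd (by norm_num)
  have h24 : Nat.factorization 4 2 = 2 := by
    rw [show 4 = 2 ^ 2 by norm_num, Nat.Prime.factorization_pow Nat.prime_two]; simp
  have h55 : Nat.factorization 5 5 = 1 := Nat.Prime.factorization_self (by norm_num)
  simp only [Nat.factorization_mul (pow_ne_zero _ (by norm_num : (4 : ℕ) ≠ 0))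
    (pow_ne_zero _ (by norm_num : (5 : ℕ) ≠ 0)), Nat.factorization_pow, Finsupp.add_apply,
    Finsupp.smul_apply, smul_eq_mul, h54, h25, h24, h55] at hf hf'
  have k2 : k 2 = 0 := by omega
  have k01 : k 0 = - k 1 := by omega
  rw [Fin.sum_univ_three, k2, k01] at h
  have hlog : l 0 < l 1 := by
    obtain ⟨h1, h2⟩ := sqrt_five_bounds
    exact Real.log_lt_log (by norm_num) (by linarith)
  have k1 : (k 1 : ℝ) = 0 := by
    push_cast at h
    have : (k 1 : ℝ) * (l 1 - l 0) = 0 := by linarith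
    exact (mul_eq_zero.1 this).resolve_right (by linarith)
  have k1' : k 1 = 0 := by exact_mod_cast k1
  funext i
  fin_cases i
  · change k 0 = 0; omega
  · exact k1'
  · exact k2

/-- Baker's lower bound for forms in the logarithms of `2`, `1 + √5` and `√5`. -/
theorem one_lt_of_form {b : Fin 3 → ℤ} (hb : b 2 ≠ 0) {H : ℕ} (hbH : ∀ i, |b i| ≤ H)
    {L μ J s : ℕ} {G : ℝ} (hL : 1 ≤ L) (hG1 : 1 ≤ G) (hG : 2 * L * H ≤ Real.exp G)
    (hμ : 592 * L ≤ μ) (hs : 33 * (J + 1) * G + 6 ≤ s)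
    (hcard : 8 * ((J + 1) * μ) ^ 2 * s < (L + 1) ^ 3) (hB : (L + 1) ^ 3 ≤ 4 ^ J * s) :
    1 < 40 * (L * |b 0 * l 0 + b 1 * l 1 + b 2 * l 2| * (4 ^ J * s : ℕ)) *
      Real.exp (μ * (4 ^ J * s : ℕ) * (Real.log (112 * (4 ^ J * s : ℕ)) + 1)) := by
  by_contra! hform
  have hH : 1 ≤ H := by
    have := (Int.one_le_abs hb).trans (hbH 2)
    exact_mod_cast this
  let T : LogFormData (ℤ√5) Bool :=
    { σ := emb
      k₀ := true
      liouville := fun x hx => by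
        rw [prod_norm_emb]
        exact_mod_cast Int.one_le_abs (norm_ne_zero hx)
      N := gen
      D := fun _ => 1
      h := 2
      one_le_h := by norm_num
      norm_N := norm_emb_gen_le
      norm_D := fun k i => by
        simp
      D_ne := fun i => by simp
      l := l
      abs_l := abs_l_le
      N_eq := fun i => by rw [map_one, mul_one, emb_gen]
      b := b
      b_ne := hb
      H := H
      one_le_H := hH
      abs_b := hbH }
  obtain ⟨k, hk, -, hk'⟩ := T.exists_relation_of_form_small (L := L) (μ := μ) (J := J) (s := s)
    (G := G) hL hG1 hG
    (by
      have : (592 * L : ℝ) ≤ μ := by exact_mod_cast hμ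
      change 8 * (3 * ((Fintype.card Bool : ℕ) : ℝ) + 31) * (L * 2) ≤ _
      rw [Fintype.card_bool]; push_cast; linarith)
    (by
      rw [Fintype.card_bool]; push_cast; linarith)
    (by rw [Fintype.card_bool]; exact hcard) hB
    (by
      change 40 * (L * |b 0 * l 0 + b 1 * l 1 + b 2 * l 2| * (4 ^ J * s : ℕ)) *
        Real.exp (μ * (4 ^ J * s : ℕ) * (Real.log (56 * 2 * (4 ^ J * s : ℕ)) + 1)) ≤ 1
      rw [show (56 * 2 : ℝ) = 112 by norm_num]
      exact hform)
  exact hk (eq_zero_of_sum_eq_zero hk')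

theorem l_one : l 1 = Real.log 2 + Real.log Real.goldenRatio := by
  have h5 := sqrt_five_bounds.1
  rw [← Real.log_mul (by norm_num) Real.goldenRatio_ne_zero]
  change Real.log (1 + √5) = Real.log (2 * ((1 + √5) / 2))
  congr 1; ring

/-- The size of the auxiliary quantities in the final contradiction. -/
theorem exp_bound {n m e J s L μ N f g : ℕ} (hm : 26 ≤ m) (hn : 2 ^ g < n) (hg : g = 10 * m - 1)
    (he : e ≤ 120 * m + 332) (hJ : J = 3 * m) (hs : s ≤ 2 ^ m) (hs0 : 0 < s) (hL : L ≤ 2 ^ f)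
    (hf : f = 33 + m) (hμ : μ = 592 * L) (hN : N = 4 ^ J * s)
    (hex : 16 * (1184 * L * s * (5 * m + 8)) ≤ 2 ^ (4 * m)) {x : ℝ} (hx : 0 ≤ x)
    (hx' : x ≤ 7 * (2 ^ e / 8 ^ (n / 10))) :
    40 * (L * x * N) * Real.exp (μ * N * (Real.log (112 * N) + 1)) ≤ 1 := by
  have hN1 : 1 ≤ N := by rw [hN]; exact Nat.mul_pos (by positivity) hs0
  have h4J : (4 : ℕ) ^ J = 2 ^ (6 * m) := by
    rw [hJ, show 6 * m = 2 * (3 * m) by ring, pow_mul 2 2]; norm_num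
  have hN2 : N ≤ 2 ^ (7 * m) := by
    rw [hN, h4J, show 7 * m = 6 * m + m by ring, pow_add]; gcongr
  have hlog : Real.log (112 * N) ≤ 5 * m + 7 := by
    have h1 : 112 * (N : ℝ) ≤ 2 ^ (7 + 7 * m) := by
      have h0 : (N : ℝ) ≤ 2 ^ (7 * m) := by exact_mod_cast hN2
      rw [pow_add]; gcongr; norm_num
    have hpos : (0 : ℝ) < 112 * N := by positivity
    refine (Real.log_le_log hpos h1).trans ?_
    rw [Real.log_pow]
    have h3 := Real.log_two_lt_d9
    have h4 := Real.log_pos (show (1 : ℝ) < 2 by norm_num)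
    have h5 : (0 : ℝ) ≤ m := by positivity
    push_cast
    norm_num at h3
    nlinarith
  have hexp : Real.exp (μ * N * (Real.log (112 * N) + 1)) ≤ 2 ^ (2 * (μ * N * (5 * m + 8))) := by
    rw [pow_mul]
    have h1 : Real.exp 1 ≤ 2 ^ 2 := by
      have := Real.exp_one_lt_d9
      norm_num at this ⊢; linarith
    refine le_trans ?_ (pow_le_pow_left₀ (Real.exp_pos 1).le h1 _)
    rw [← Real.exp_nat_mul]
    refine Real.exp_le_exp.2 ?_
    push_cast
    rw [mul_one]
    exact mul_le_mul_of_nonneg_left (by linarith) (by positivity)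
  have htot : 9 + f + 7 * m + e + 2 * (μ * N * (5 * m + 8)) ≤ 3 * (n / 10) := by
    have h1 : 16 * (2 * (μ * N * (5 * m + 8))) ≤ 2 ^ (10 * m) := by
      calc 16 * (2 * (μ * N * (5 * m + 8))) =
            2 ^ (6 * m) * (16 * (1184 * L * s * (5 * m + 8))) := by rw [hμ, hN, h4J]; ring
        _ ≤ 2 ^ (6 * m) * 2 ^ (4 * m) := by gcongr
        _ = 2 ^ (10 * m) := by rw [← pow_add]; congr 1; ring
    have h2 : 2 ^ (10 * m) = 2 * 2 ^ g := by
      rw [← pow_succ', show g + 1 = 10 * m by omega]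
    have h3 : 100 * (200 * m) ≤ 2 ^ g := by
      rw [hg]
      clear * - hm
      induction m, hm using Nat.le_induction with
      | base => decide
      | succ m hm ih =>
        rw [show 10 * (m + 1) - 1 = 10 * m - 1 + 10 by omega, pow_add]
        omega
    generalize 2 * (μ * N * (5 * m + 8)) = z at *
    generalize 2 ^ (10 * m) = z' at *
    generalize 2 ^ g = z'' at *
    omega
  have hL' : (L : ℝ) ≤ 2 ^ f := by exact_mod_cast hL
  have hN' : (N : ℝ) ≤ 2 ^ (7 * m) := by exact_mod_cast hN2
  have h8 : (8 : ℝ) ^ (n / 10) = 2 ^ (3 * (n / 10)) := by rw [pow_mul]; norm_num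
  calc _ ≤ (40 : ℝ) * (2 ^ f * (7 * (2 ^ e / 8 ^ (n / 10))) * 2 ^ (7 * m)) *
        2 ^ (2 * (μ * N * (5 * m + 8))) := by gcongr
    _ = 280 * 2 ^ f * 2 ^ (7 * m) * 2 ^ e * 2 ^ (2 * (μ * N * (5 * m + 8))) /
        2 ^ (3 * (n / 10)) := by rw [h8]; ring
    _ ≤ 2 ^ 9 * 2 ^ f * 2 ^ (7 * m) * 2 ^ e * 2 ^ (2 * (μ * N * (5 * m + 8))) /
        2 ^ (3 * (n / 10)) := by gcongr; norm_num
    _ ≤ 1 := by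
      rw [div_le_one (by positivity), ← pow_add, ← pow_add, ← pow_add, ← pow_add]
      exact pow_le_pow_right₀ (by norm_num) htot

end GoldenForm

open GoldenForm in
/-- An upper bound for the index, provided that there is a nontrivial solution. -/
theorem index_le_of_solution {n : ℕ} {x y : ℤ} (hy : 2 ≤ |y|)
    (h : |((x * (x - (Nat.fib n : ℤ) * y) * (x - (2 : ℤ) ^ n * y) - y ^ 3 : ℤ) : ℝ)| = 1) :
    n ≤ 2 ^ 259 := by
  by_contra! hn
  obtain ⟨k, hk⟩ : ∃ k, k = Nat.clog 2 n := ⟨_, rfl⟩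
  have hk1 : 260 ≤ k := by
    rw [hk, Nat.succ_le_iff, Nat.lt_clog_iff_pow_lt (by norm_num)]; exact hn
  have hk2 : n ≤ 2 ^ k := by rw [hk]; exact Nat.le_pow_clog (by norm_num) n
  have hk3 : 2 ^ (k - 1) < n := by
    rw [hk]
    exact Nat.pow_pred_clog_lt_self (by norm_num)
      (lt_of_le_of_lt Nat.one_le_two_pow hn)
  obtain ⟨e, he⟩ : ∃ e, e = 12 * k + 224 := ⟨_, rfl⟩
  obtain ⟨w, t, hw, hwV, htV, hf⟩ := exists_fib_form_small (by omega) hk3 hk2 he hy h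
  obtain ⟨m, hm⟩ : ∃ m, m = k / 10 := ⟨_, rfl⟩
  have hm1 : 26 ≤ m := by omega
  obtain ⟨hss, hLL, hLc, hex⟩ : s m ≤ 2 ^ m ∧ L m ≤ 2 ^ (33 + m) ∧
      (L m + 1) ^ 3 ≤ 4 ^ (3 * m) * s m ∧
      16 * (1184 * L m * s m * (5 * m + 8)) ≤ 2 ^ (4 * m) := by
    obtain ⟨t, rfl⟩ := Nat.exists_eq_add_of_le hm1
    exact ⟨s_le t, L_le t, L_cube_le t, exponent_le t⟩
  obtain ⟨J, hJ⟩ : ∃ J, J = 3 * m := ⟨_, rfl⟩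
  obtain ⟨s', hs'⟩ : ∃ s', s' = s m := ⟨_, rfl⟩
  obtain ⟨L', hL'⟩ : ∃ L', L' = L m := ⟨_, rfl⟩
  obtain ⟨f, hf'⟩ : ∃ f, f = 33 + m := ⟨_, rfl⟩
  obtain ⟨g, hg⟩ : ∃ g, g = 10 * m - 1 := ⟨_, rfl⟩
  obtain ⟨i, hi⟩ : ∃ i, i = 3 + e + k := ⟨_, rfl⟩
  rw [← hL'] at hLL hLc hex
  rw [← hs'] at hss hLc hex
  rw [← hf'] at hLL
  rw [← hJ] at hLc
  rw [GoldenForm.L, ← hs', ← hJ] at hL'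
  rw [GoldenForm.s, ← hJ] at hs'
  have hs0 : 0 < s' := by omega
  have hL0 : 0 < L' := by rw [hL']; positivity
  have hng : 2 ^ g < n := lt_of_le_of_lt (Nat.pow_le_pow_right (by norm_num) (by omega)) hk3
  have hform : ((-(t + w) * n : ℤ) : ℝ) * l 0 + ((w * n : ℤ) : ℝ) * l 1 + ((-w : ℤ) : ℝ) * l 2 =
      w * (n * Real.log Real.goldenRatio - Real.log (√5)) - t * (n * Real.log 2) := by
    rw [l_one]
    simp only [l, Matrix.cons_val_zero, Matrix.cons_val]
    push_cast
    ring
  have hnk : (n : ℤ) ≤ 2 ^ k := by exact_mod_cast hk2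
  have e0 : (0 : ℤ) < 2 ^ e := by positivity
  have k0 : (1 : ℤ) ≤ 2 ^ k := one_le_pow₀ (by norm_num)
  have hH : ((2 ^ i : ℕ) : ℤ) = 8 * 2 ^ e * 2 ^ k := by
    push_cast
    rw [hi, pow_add, pow_add]; norm_num
  have hlt := one_lt_of_form (b := ![-(t + w) * n, w * n, -w]) (H := 2 ^ i) (L := L')
    (μ := 592 * L') (J := J) (s := s') (G := 140 * m + 360) (by simpa using hw)
    (by
      rw [hH]
      have key : ∀ a c : ℤ, |a| ≤ 8 * 2 ^ e → |c| ≤ 2 ^ k → |a * c| ≤ 8 * 2 ^ e * 2 ^ k := by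
        intro a c h1 h2
        rw [abs_mul]; gcongr
      have n0 : |(n : ℤ)| ≤ 2 ^ k := by rwa [Nat.abs_cast]
      intro j
      fin_cases j
      · refine key _ _ ?_ n0
        rw [abs_neg]
        have := abs_add_le t w
        linarith
      · exact key _ _ (by linarith) n0
      · change |-w| ≤ _
        have := key (-w) 1 (by rw [abs_neg]; linarith) (by simpa using k0)
        rwa [mul_one] at this)
    hL0 (by linarith [(Nat.cast_nonneg m : (0 : ℝ) ≤ m)])
    (by
      have h1 : 2 * (L' : ℝ) * (2 ^ i : ℕ) ≤ 2 ^ (140 * m + 360) := by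
        have : 2 * L' * 2 ^ i ≤ 2 ^ (140 * m + 360) := by
          calc 2 * L' * 2 ^ i ≤ 2 ^ 1 * 2 ^ f * 2 ^ i := by gcongr; norm_num
            _ = 2 ^ (1 + f + i) := by rw [pow_add, pow_add]
            _ ≤ _ := Nat.pow_le_pow_right (by norm_num) (by omega)
        exact_mod_cast this
      refine h1.trans ?_
      have h2 : (2 : ℝ) ≤ Real.exp 1 := by linarith [Real.add_one_le_exp (1 : ℝ)]
      refine (pow_le_pow_left₀ (by norm_num) h2 _).trans (le_of_eq ?_)
      rw [← Real.exp_nat_mul]; push_cast; rw [mul_one])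
    le_rfl
    (by
      rw [hs', hJ]; push_cast; linarith)
    (by
      calc 8 * ((J + 1) * (592 * L')) ^ 2 * s' = L' ^ 2 * (2803712 * (J + 1) ^ 2 * s') := by ring
        _ = L' ^ 3 := by rw [← hL']; ring
        _ < _ := Nat.pow_lt_pow_left (Nat.lt_succ_self _) (by norm_num))
    hLc
  refine absurd hlt (not_lt.2 ?_)
  refine exp_bound hm1 hng hg (by omega : e ≤ _) hJ hss hs0 hLL hf' rfl rfl hex (abs_nonneg _) ?_
  simp only [Matrix.cons_val_zero, Matrix.cons_val_one, Matrix.cons_val]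
  rw [hform]
  exact hf

/-- Summation of `f` over `a, …, a + 2 ^ L - 1` by bisection. -/
def binSum (f : ℕ → ℕ) (L : ℕ) : ℕ → ℕ :=
  Nat.rec (motive := fun _ => ℕ → ℕ) (fun a => f a)
    (fun L ih a => Nat.add (ih a) (ih (Nat.add a (Nat.pow 2 L)))) L

theorem binSum_eq (f : ℕ → ℕ) (L a : ℕ) :
    binSum f L a = ∑ i ∈ Finset.range (2 ^ L), f (a + i) := by
  induction L generalizing a with
  | zero => simp [binSum]
  | succ L ih =>
    have : binSum f (L + 1) a = binSum f L a + binSum f L (a + 2 ^ L) := rfl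
    rw [this, ih, ih, pow_succ, mul_two, Finset.sum_range_add]
    simp only [add_assoc]

/-- The partial sums of the series `∑ 2 / ((2 * k + 1) * c ^ k)` in fixed-point arithmetic. -/
def atanhSum (c P L : ℕ) : ℕ :=
  binSum (fun k => Nat.div (Nat.pow 2 (Nat.succ P))
    (Nat.mul (Nat.succ (Nat.mul 2 k)) (Nat.pow c k))) L 0

theorem atanhSum_bounds {c P L : ℕ} (hc : 2 ≤ c) (hP : 2 ^ (P + 2) ≤ c ^ 2 ^ L) {T : ℝ}
    (hT : HasSum (fun k : ℕ => 2 / ((2 * k + 1) * (c : ℝ) ^ k)) T) :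
    (atanhSum c P L : ℝ) ≤ 2 ^ P * T ∧ 2 ^ P * T ≤ atanhSum c P L + (2 ^ L + 1) := by
  have hS : atanhSum c P L =
      ∑ k ∈ Finset.range (2 ^ L), 2 ^ (P + 1) / ((2 * k + 1) * c ^ k) := by
    rw [atanhSum, binSum_eq]
    refine Finset.sum_congr rfl fun k _ => ?_
    rw [zero_add]; rfl
  have hc0 : (0 : ℝ) < c := by positivity
  have hc2 : (2 : ℝ) ≤ c := by exact_mod_cast hc
  obtain ⟨N, hN⟩ : ∃ N, N = 2 ^ L := ⟨_, rfl⟩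
  rw [← hN] at hS hP
  have hterm : ∀ k : ℕ, (2 : ℝ) ^ P * (2 / ((2 * k + 1) * (c : ℝ) ^ k)) =
      ((2 ^ (P + 1) : ℕ) : ℝ) / (((2 * k + 1) * c ^ k : ℕ) : ℝ) := by
    intro k; push_cast; rw [pow_succ]; ring
  have hlow : ∀ k : ℕ, ((2 ^ (P + 1) / ((2 * k + 1) * c ^ k) : ℕ) : ℝ) ≤
      2 ^ P * (2 / ((2 * k + 1) * (c : ℝ) ^ k)) := by
    intro k; rw [hterm]; exact Nat.cast_div_le
  have hup : ∀ k : ℕ, 2 ^ P * (2 / ((2 * k + 1) * (c : ℝ) ^ k)) ≤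
      ((2 ^ (P + 1) / ((2 * k + 1) * c ^ k) : ℕ) : ℝ) + 1 := by
    intro k; rw [hterm]
    have hpos : 0 < (2 * k + 1) * c ^ k := by positivity
    rw [div_le_iff₀ (by exact_mod_cast hpos)]
    have := Nat.lt_div_mul_add hpos (a := 2 ^ (P + 1))
    have h2 : 2 ^ (P + 1) ≤ (2 ^ (P + 1) / ((2 * k + 1) * c ^ k) + 1) * ((2 * k + 1) * c ^ k) := by
      rw [add_mul, one_mul]; exact this.le
    exact_mod_cast h2
  have hsplit := hT.summable.sum_add_tsum_nat_add N
  rw [hT.tsum_eq] at hsplit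
  have htail0 : 0 ≤ ∑' k : ℕ, 2 / ((2 * ((k + N : ℕ) : ℝ) + 1) * (c : ℝ) ^ (k + N)) :=
    tsum_nonneg fun k => by positivity
  have hgeo := (hasSum_geometric_of_lt_one (show (0 : ℝ) ≤ 1 / 2 by norm_num)
    (by norm_num)).mul_left (2 / (c : ℝ) ^ N)
  have htail : ∑' k : ℕ, 2 / ((2 * ((k + N : ℕ) : ℝ) + 1) * (c : ℝ) ^ (k + N)) ≤
      4 / (c : ℝ) ^ N := by
    have hs' : Summable fun k : ℕ => 2 / ((2 * ((k + N : ℕ) : ℝ) + 1) * (c : ℝ) ^ (k + N)) :=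
      (summable_nat_add_iff (f := fun k : ℕ => 2 / ((2 * (k : ℝ) + 1) * (c : ℝ) ^ k)) N).2
        hT.summable
    refine (hs'.tsum_le_tsum (fun k => ?_) hgeo.summable).trans (le_of_eq ?_)
    · rw [one_div, inv_pow, ← div_eq_mul_inv, div_div]
      refine div_le_div_of_nonneg_left (by norm_num) (by positivity) ?_
      rw [pow_add, mul_comm ((c : ℝ) ^ N)]
      have h1 : (2 : ℝ) ^ k ≤ (c : ℝ) ^ k := pow_le_pow_left₀ (by norm_num) hc2 k
      have h2 : (2 : ℝ) ^ k * c ^ N ≤ c ^ k * c ^ N := by gcongr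
      refine h2.trans (le_mul_of_one_le_left (by positivity) ?_)
      have : (0 : ℝ) ≤ ((k + N : ℕ) : ℝ) := by positivity
      linarith
    · rw [hgeo.tsum_eq]; ring
  have hcN : (2 : ℝ) ^ P * (4 / (c : ℝ) ^ N) ≤ 1 := by
    rw [← mul_div_assoc, div_le_one (by positivity)]
    have : (2 : ℝ) ^ (P + 2) ≤ c ^ N := by exact_mod_cast hP
    rw [pow_add] at this; linarith
  have h2P : (0 : ℝ) < 2 ^ P := by positivity
  rw [← hsplit, mul_add, Finset.mul_sum, hS]
  have hN' : ((2 : ℝ) ^ L) = N := by rw [hN]; push_cast; rfl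
  rw [hN']
  push_cast
  constructor
  · refine le_trans (Finset.sum_le_sum fun k _ => ?_) (le_add_of_nonneg_right (by positivity))
    exact_mod_cast hlow k
  · have h3 : ∑ k ∈ Finset.range N, 2 ^ P * (2 / ((2 * k + 1) * (c : ℝ) ^ k)) ≤
        ∑ k ∈ Finset.range N, (((2 ^ (P + 1) / ((2 * k + 1) * c ^ k) : ℕ) : ℝ) + 1) :=
      Finset.sum_le_sum fun k _ => hup k
    rw [Finset.sum_add_distrib, Finset.sum_const, Finset.card_range, nsmul_eq_mul, mul_one] at h3
    have h4 := mul_le_mul_of_nonneg_left htail h2P.le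
    push_cast at h3 h4 ⊢
    linarith

theorem hasSum_atanh {c : ℕ} {x : ℝ} (hx : 0 < x) (hx1 : x < 1) (hxc : x ^ 2 * c = 1) :
    HasSum (fun k : ℕ => 2 / ((2 * k + 1) * (c : ℝ) ^ k))
      ((Real.log (1 + x) - Real.log (1 - x)) / x) := by
  have h := (Real.hasSum_log_sub_log_of_abs_lt_one (x := x) (by rwa [abs_of_pos hx])).div_const x
  refine (congrArg (HasSum · _) (funext fun k => ?_)).mpr h
  have h1 : (c : ℝ) ^ k * x ^ (2 * k) = 1 := by
    rw [pow_mul, ← mul_pow, mul_comm, hxc, one_pow]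
  have h2 : (c : ℝ) ^ k ≠ 0 := by
    intro h0; rw [h0, zero_mul] at h1; exact zero_ne_one h1
  have h3 : (2 * (k : ℝ) + 1) ≠ 0 := by positivity
  rw [pow_succ, div_eq_div_iff (by positivity) hx.ne']
  field_simp
  linear_combination -h1

/-- `a` is an approximation to `t` in fixed-point arithmetic with `P` bits, up to `E` units. -/
def IsApprox (P E a : ℕ) (t : ℝ) : Prop := |(a : ℝ) - 2 ^ P * t| ≤ E

/-- Newton's iteration for the square root of `N`. -/
def newtonSqrt (N k x : ℕ) : ℕ :=
  Nat.rec (motive := fun _ => ℕ → ℕ) (fun x => x)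
    (fun _ ih x => ih (Nat.div (Nat.add x (Nat.div N x)) 2)) k x

/-- Fixed-point approximation of `log 2`. -/
def logTwoApprox (P L : ℕ) : ℕ := Nat.div (atanhSum 9 P L) 3

/-- Fixed-point approximation of `log √5`. -/
def logSqrtFiveApprox (P L : ℕ) : ℕ :=
  Nat.div (Nat.add (atanhSum 81 P L) (Nat.mul 6 (atanhSum 9 P L))) 18

/-- Fixed-point approximation of the logarithm of the golden ratio, where `r` is a fixed-point
approximation of `√5`. -/
def logGoldenApprox (P L r : ℕ) : ℕ :=
  Nat.div (Nat.mul (atanhSum 5 P (Nat.succ L)) r) (Nat.mul 10 (Nat.pow 2 P))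

theorem Nat.div_cast_bounds (a : ℕ) {b : ℕ} (hb : 0 < b) :
    ((a / b : ℕ) : ℝ) ≤ a / b ∧ (a : ℝ) / b ≤ (a / b : ℕ) + 1 := by
  refine ⟨Nat.cast_div_le, ?_⟩
  rw [div_le_iff₀ (by exact_mod_cast hb)]
  have := (Nat.lt_div_mul_add hb (a := a)).le
  rw [← Nat.succ_mul] at this
  exact_mod_cast this

theorem hasSum_log_two : HasSum (fun k : ℕ => 2 / ((2 * k + 1) * ((9 : ℕ) : ℝ) ^ k))
    (3 * Real.log 2) := by
  have h := hasSum_atanh (c := 9) (x := 1 / 3) (by norm_num) (by norm_num) (by norm_num)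
  convert h using 1
  rw [← Real.log_div (by norm_num) (by norm_num)]
  norm_num
  ring

theorem hasSum_log_five : HasSum (fun k : ℕ => 2 / ((2 * k + 1) * ((81 : ℕ) : ℝ) ^ k))
    (18 * (Real.log (√5) - Real.log 2)) := by
  have h := hasSum_atanh (c := 81) (x := 1 / 9) (by norm_num) (by norm_num) (by norm_num)
  convert h using 1
  rw [Real.log_sqrt (by norm_num), ← Real.log_div (by norm_num) (by norm_num)]
  norm_num
  rw [Real.log_div (by norm_num) (by norm_num), show (4 : ℝ) = 2 ^ 2 by norm_num, Real.log_pow]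
  push_cast
  ring

theorem hasSum_log_golden : HasSum (fun k : ℕ => 2 / ((2 * k + 1) * ((5 : ℕ) : ℝ) ^ k))
    (2 * √5 * Real.log Real.goldenRatio) := by
  have h5 : √5 ^ 2 = (5 : ℝ) := Real.sq_sqrt (by norm_num)
  obtain ⟨h2, -⟩ := GoldenForm.sqrt_five_bounds
  have h0 : (0 : ℝ) < √5 := by linarith
  have h := hasSum_atanh (c := 5) (x := 1 / √5) (by positivity)
    (by rw [div_lt_one h0]; linarith) (by rw [div_pow, h5]; norm_num)
  convert h using 1
  have h1 : (0 : ℝ) < 1 - 1 / √5 := by rw [sub_pos, div_lt_one h0]; linarith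
  rw [← Real.log_div (by positivity) h1.ne', div_div_eq_mul_div, div_one,
    show (1 + 1 / √5) / (1 - 1 / √5) = Real.goldenRatio ^ 2 from ?_, Real.log_pow]
  · push_cast; ring
  · rw [Real.goldenRatio, div_eq_iff h1.ne']
    field_simp
    linear_combination (-(1 : ℝ)) * (√5 + 1) * h5

theorem isApprox_logTwo {P L : ℕ} (hP : 2 ^ (P + 2) ≤ 9 ^ 2 ^ L) :
    IsApprox P (2 ^ (L + 1) + 2) (logTwoApprox P L) (Real.log 2) := by
  obtain ⟨h1, h2⟩ := atanhSum_bounds (by norm_num) hP hasSum_log_two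
  obtain ⟨h3, h4⟩ := Nat.div_cast_bounds (atanhSum 9 P L) (b := 3) (by norm_num)
  change |((atanhSum 9 P L / 3 : ℕ) : ℝ) - _| ≤ _
  have hL : (0 : ℝ) < 2 ^ L := by positivity
  push_cast at *
  rw [pow_succ, abs_le]
  constructor <;> linarith

theorem isApprox_logSqrtFive {P L : ℕ} (hP : 2 ^ (P + 2) ≤ 9 ^ 2 ^ L) :
    IsApprox P (2 ^ (L + 1) + 2) (logSqrtFiveApprox P L) (Real.log (√5)) := by
  obtain ⟨h1, h2⟩ := atanhSum_bounds (by norm_num) hP hasSum_log_two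
  obtain ⟨h5, h6⟩ := atanhSum_bounds (by norm_num)
    (hP.trans (Nat.pow_le_pow_left (by norm_num) _)) hasSum_log_five
  obtain ⟨h3, h4⟩ := Nat.div_cast_bounds (atanhSum 81 P L + 6 * atanhSum 9 P L) (b := 18)
    (by norm_num)
  change |(((atanhSum 81 P L + 6 * atanhSum 9 P L) / 18 : ℕ) : ℝ) - _| ≤ _
  have hL : (0 : ℝ) < 2 ^ L := by positivity
  push_cast at *
  rw [pow_succ, abs_le]
  constructor <;> linarith

theorem isApprox_logGolden {P L r : ℕ} (hP : 2 ^ (P + 2) ≤ 9 ^ 2 ^ L)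
    (hr : r ^ 2 ≤ 5 * 4 ^ P) (hr' : 5 * 4 ^ P ≤ (r + 1) ^ 2) :
    IsApprox P (2 ^ (L + 1) + 2) (logGoldenApprox P L r) (Real.log Real.goldenRatio) := by
  have h9 : 9 ^ 2 ^ L ≤ 5 ^ 2 ^ (L + 1) := by
    rw [pow_succ 2, mul_comm, pow_mul]; exact Nat.pow_le_pow_left (by norm_num) _
  obtain ⟨h1, h2⟩ := atanhSum_bounds (by norm_num) (hP.trans h9) hasSum_log_golden
  obtain ⟨h3, h4⟩ := Nat.div_cast_bounds (atanhSum 5 P (L + 1) * r) (b := 10 * 2 ^ P)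
    (by positivity)
  change |((atanhSum 5 P (L + 1) * r / (10 * 2 ^ P) : ℕ) : ℝ) - _| ≤ _
  generalize atanhSum 5 P (L + 1) = S at *
  have h5 : √5 ^ 2 = (5 : ℝ) := Real.sq_sqrt (by norm_num)
  obtain ⟨b1, b2⟩ := GoldenForm.sqrt_five_bounds
  have h2P : (0 : ℝ) < 2 ^ P := by positivity
  have h4P : (4 : ℝ) ^ P = (2 ^ P) ^ 2 := by rw [← pow_mul, mul_comm, pow_mul]; norm_num
  have hρ : (2 ^ P * √5) ^ 2 = 5 * 4 ^ P := by rw [mul_pow, h5, h4P, mul_comm]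
  have hρ0 : 0 < 2 ^ P * √5 := by positivity
  have r1 : (r : ℝ) ≤ 2 ^ P * √5 := by
    refine (pow_le_pow_iff_left₀ (by positivity) hρ0.le two_ne_zero).1 ?_
    rw [hρ]; exact_mod_cast hr
  have r2 : 2 ^ P * √5 ≤ (r : ℝ) + 1 := by
    refine (pow_le_pow_iff_left₀ hρ0.le (by positivity) two_ne_zero).1 ?_
    rw [hρ]; exact_mod_cast hr'
  have hl1 : Real.log Real.goldenRatio ≤ 3 / 4 := by
    have := Real.log_le_sub_one_of_pos Real.goldenRatio_pos
    rw [Real.goldenRatio] at this ⊢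
    linarith
  have hl0 : 0 < Real.log Real.goldenRatio := Real.log_pos Real.one_lt_goldenRatio
  have ht : 2 ^ P * Real.log Real.goldenRatio =
      2 ^ P * (2 * √5 * Real.log Real.goldenRatio) * (2 ^ P * √5) / (10 * 2 ^ P) := by
    rw [eq_div_iff (by positivity)]
    linear_combination (-2 * 2 ^ P * 2 ^ P * Real.log Real.goldenRatio) * h5
  have hT4 : 2 ^ P * (2 * √5 * Real.log Real.goldenRatio) ≤ 2 ^ P * 4 := by
    gcongr
    nlinarith
  have hlow : (S : ℝ) * r / (10 * 2 ^ P) ≤ 2 ^ P * Real.log Real.goldenRatio := by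
    rw [ht]; gcongr
  have hup : 2 ^ P * Real.log Real.goldenRatio ≤ (S : ℝ) * r / (10 * 2 ^ P) +
      (2 ^ (L + 1) + 1) / 4 + 1 / 2 := by
    rw [ht, div_add' _ _ _ (by positivity), div_add' _ _ _ (by positivity)]
    refine div_le_div_of_nonneg_right ?_ (by positivity)
    have e1 := mul_le_mul_of_nonneg_right h2 hρ0.le
    have e2 : (S : ℝ) * (2 ^ P * √5) ≤ S * (r + 1) := by gcongr
    have e3 : (2 ^ (L + 1) + 1) * (2 ^ P * √5) ≤ (2 ^ (L + 1) + 1) * (2 ^ P * (5 / 2) : ℝ) := by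
      gcongr
    linarith
  have hN : (0 : ℝ) < 2 ^ (L + 1) := by positivity
  push_cast at *
  rw [abs_le]
  constructor <;> linarith

/-- `f n`, with `n` evaluated before it is substituted. -/
def withValue {β : Type} (n : ℕ) (f : ℕ → β) : β :=
  Nat.rec (motive := fun _ => β) (f 0) (fun p _ => f (Nat.succ p)) n

theorem withValue_eq {β : Type} (n : ℕ) (f : ℕ → β) : withValue n f = f n := by
  cases n <;> rfl

/-- The distance of two natural numbers. -/
def natDist (a b : ℕ) : ℕ := Nat.add (Nat.sub a b) (Nat.sub b a)

theorem natDist_cast (a b : ℕ) : (natDist a b : ℝ) = |(a : ℝ) - b| := by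
  change (((a - b) + (b - a) : ℕ) : ℝ) = _
  rcases le_total a b with h | h
  · rw [Nat.sub_eq_zero_of_le h, zero_add, Nat.cast_sub h, abs_sub_comm, abs_of_nonneg]
    rw [sub_nonneg]; exact_mod_cast h
  · rw [Nat.sub_eq_zero_of_le h, add_zero, Nat.cast_sub h, abs_of_nonneg]
    rw [sub_nonneg]; exact_mod_cast h

/-- The integer nearest to `a / b`. -/
def nearestDiv (a b : ℕ) : ℕ := Nat.div (Nat.add (Nat.mul 2 a) b) (Nat.mul 2 b)

namespace FormReduction

/-- The size condition making `(d, D₂, D₃)` orthogonal to every small integer vector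
at which a linear form with approximate coefficients `a₁, a₂, a₃` is small. -/
def rowOk (a₁ a₂ a₃ E X δ d D₂ D₃ : ℕ) : Bool :=
  Nat.ble (Nat.succ (X * (natDist (D₂ * a₁) (d * a₂) + (D₂ + d) * E +
    (natDist (D₃ * a₁) (d * a₃) + (D₃ + d) * E)) + d * δ + E)) a₁

theorem sum_eq_zero_of_rowOk {P a₁ a₂ a₃ E X δ d D₂ D₃ : ℕ} {l₁ l₂ l₃ : ℝ}
    (h : rowOk a₁ a₂ a₃ E X δ d D₂ D₃ = true)
    (h₁ : IsApprox P E a₁ l₁) (h₂ : IsApprox P E a₂ l₂) (h₃ : IsApprox P E a₃ l₃)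
    {x₁ x₂ x₃ : ℤ} (b₂ : |(x₂ : ℝ)| ≤ X) (b₃ : |(x₃ : ℝ)| ≤ X)
    (hδ : 2 ^ P * |x₁ * l₁ + x₂ * l₂ + x₃ * l₃| ≤ δ) : d * x₁ + D₂ * x₂ + D₃ * x₃ = 0 := by
  have h := Nat.le_of_ble_eq_true h
  have hR : (X : ℝ) * (|(D₂ : ℝ) * a₁ - d * a₂| + (D₂ + d) * E +
      (|(D₃ : ℝ) * a₁ - d * a₃| + (D₃ + d) * E)) + d * δ + E + 1 ≤ a₁ := by
    have := (Nat.cast_le (α := ℝ)).2 h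
    push_cast [natDist_cast] at this
    exact this
  unfold IsApprox at h₁ h₂ h₃
  rw [← abs_of_pos (show (0 : ℝ) < 2 ^ P by positivity), ← abs_mul] at hδ
  generalize hp : (2 : ℝ) ^ P = p at *
  have key : ∀ (D : ℕ) (a : ℕ) (l : ℝ), |(a : ℝ) - p * l| ≤ E →
      |(D : ℝ) * (p * l₁) - d * (p * l)| ≤ |(D : ℝ) * a₁ - d * a| + (D + d) * E := by
    intro D a l hl
    have e1 := abs_mul (D : ℝ) (a₁ - p * l₁)
    have e2 := abs_mul (d : ℝ) (a - p * l)
    rw [Nat.abs_cast] at e1 e2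
    have e3 : |(D : ℝ) * (a₁ - p * l₁)| ≤ D * E := by rw [e1]; gcongr
    have e4 : |(d : ℝ) * (a - p * l)| ≤ d * E := by rw [e2]; gcongr
    rw [show (D : ℝ) * (p * l₁) - d * (p * l) = (D * a₁ - d * a) - D * (a₁ - p * l₁) +
      d * (a - p * l) by ring]
    refine (abs_add_le _ _).trans ?_
    have := abs_sub (D * a₁ - d * a : ℝ) (D * (a₁ - p * l₁))
    linarith
  have k₂ := key D₂ a₂ l₂ h₂
  have k₃ := key D₃ a₃ l₃ h₃
  by_contra hne
  have h1 : (1 : ℝ) ≤ |((d * x₁ + D₂ * x₂ + D₃ * x₃ : ℤ) : ℝ)| := by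
    exact_mod_cast Int.one_le_abs hne
  have hl₁ : (a₁ : ℝ) - E ≤ p * l₁ := by have := (abs_le.1 h₁).2; linarith
  have hpos : 0 < p * l₁ := by
    have : (0 : ℝ) ≤ (X : ℝ) * (|(D₂ : ℝ) * a₁ - d * a₂| + (D₂ + d) * E +
      (|(D₃ : ℝ) * a₁ - d * a₃| + (D₃ + d) * E)) + d * δ := by positivity
    linarith
  have h2 : p * l₁ ≤ |((d * x₁ + D₂ * x₂ + D₃ * x₃ : ℤ) : ℝ)| * (p * l₁) :=
    le_mul_of_one_le_left hpos.le h1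
  rw [← abs_of_pos hpos, ← abs_mul, abs_of_pos hpos] at h2
  have h3 : ((d * x₁ + D₂ * x₂ + D₃ * x₃ : ℤ) : ℝ) * (p * l₁) =
      d * (p * (x₁ * l₁ + x₂ * l₂ + x₃ * l₃)) + x₂ * (D₂ * (p * l₁) - d * (p * l₂)) +
        x₃ * (D₃ * (p * l₁) - d * (p * l₃)) := by
    push_cast; ring
  rw [h3] at h2
  have t := abs_add_three (d * (p * (x₁ * l₁ + x₂ * l₂ + x₃ * l₃)))
    (x₂ * (D₂ * (p * l₁) - d * (p * l₂))) (x₃ * (D₃ * (p * l₁) - d * (p * l₃)))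
  rw [abs_mul, abs_mul (x₂ : ℝ), abs_mul (x₃ : ℝ), Nat.abs_cast] at t
  have t1 := mul_le_mul_of_nonneg_left hδ (Nat.cast_nonneg (α := ℝ) d)
  have t2 := mul_le_mul b₂ k₂ (abs_nonneg _) (Nat.cast_nonneg _)
  have t3 := mul_le_mul b₃ k₃ (abs_nonneg _) (Nat.cast_nonneg _)
  linarith

/-- Positivity of a `3 × 3` determinant up to sign, in natural number arithmetic. -/
def detNeZero (d D E d' D' E' d'' D'' E'' : ℕ) : Bool :=
  Bool.not (Nat.beq (d * D' * E'' + D * E' * d'' + E * d' * D'')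
    (d * E' * D'' + D * d' * E'' + E * D' * d''))

theorem eq_zero_of_detNeZero {d D E d' D' E' d'' D'' E'' : ℕ}
    (h : detNeZero d D E d' D' E' d'' D'' E'' = true) {x y z : ℤ}
    (h₁ : d * x + D * y + E * z = 0) (h₂ : d' * x + D' * y + E' * z = 0)
    (h₃ : d'' * x + D'' * y + E'' * z = 0) : z = 0 := by
  have h0 : (d * D' * E'' + D * E' * d'' + E * d' * D'' -
      (d * E' * D'' + D * d' * E'' + E * D' * d'') : ℤ) ≠ 0 := by
    rw [sub_ne_zero]
    intro h'
    have h'' : d * D' * E'' + D * E' * d'' + E * d' * D'' =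
      d * E' * D'' + D * d' * E'' + E * D' * d'' := by exact_mod_cast h'
    rw [detNeZero, h''] at h
    simp at h
  refine (mul_eq_zero.1 ?_).resolve_left h0
  linear_combination (d' * D'' - D' * d'' : ℤ) * h₁ + (D * d'' - d * D'' : ℤ) * h₂ +
    (d * D' - D * d' : ℤ) * h₃

/-- The three size conditions and the determinant condition for the vectors with first
coordinates `d, d', d''`. -/
def rowsOk (a₁ a₂ a₃ E X δ d d' d'' : ℕ) : Bool :=
  withValue (nearestDiv (d * a₂) a₁) fun D₂ => withValue (nearestDiv (d * a₃) a₁) fun D₃ =>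
  withValue (nearestDiv (d' * a₂) a₁) fun D₂' => withValue (nearestDiv (d' * a₃) a₁) fun D₃' =>
  withValue (nearestDiv (d'' * a₂) a₁) fun D₂'' => withValue (nearestDiv (d'' * a₃) a₁) fun D₃'' =>
    rowOk a₁ a₂ a₃ E X δ d D₂ D₃ && rowOk a₁ a₂ a₃ E X δ d' D₂' D₃' &&
    rowOk a₁ a₂ a₃ E X δ d'' D₂'' D₃'' && detNeZero d D₂ D₃ d' D₂' D₃' d'' D₂'' D₃''

/-- The certificate that `|x₁ log 2 + x₂ log φ + x₃ log √5| > δ / 2 ^ P` for all integers with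
`x₃ ≠ 0` and `|xᵢ| ≤ X`. -/
def certificate (P L X δ d d' d'' : ℕ) : Bool :=
  Nat.ble (2 ^ (P + 2)) (9 ^ 2 ^ L) &&
  withValue (newtonSqrt (5 * 4 ^ P) 20 (2 ^ (P + 2))) fun r =>
    Nat.ble (r ^ 2) (5 * 4 ^ P) && Nat.ble (5 * 4 ^ P) ((r + 1) ^ 2) &&
    withValue (logTwoApprox P L) fun a₁ => withValue (logGoldenApprox P L r) fun a₂ =>
    withValue (logSqrtFiveApprox P L) fun a₃ => rowsOk a₁ a₂ a₃ (2 ^ (L + 1) + 2) X δ d d' d''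

theorem lt_of_certificate {P L X δ d d' d'' : ℕ} (h : certificate P L X δ d d' d'' = true)
    {x₁ x₂ x₃ : ℤ} (b₂ : |(x₂ : ℝ)| ≤ X) (b₃ : |(x₃ : ℝ)| ≤ X) (hx : x₃ ≠ 0) :
    δ < 2 ^ P * |x₁ * Real.log 2 + x₂ * Real.log Real.goldenRatio + x₃ * Real.log (√5)| := by
  simp only [certificate, rowsOk, withValue_eq, Bool.and_eq_true] at h
  obtain ⟨hP, ⟨hr, hr'⟩, ⟨⟨r₁, r₂⟩, r₃⟩, hdet⟩ := h
  by_contra! hδ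
  have hP := Nat.le_of_ble_eq_true hP
  have i₁ := isApprox_logTwo hP
  have i₂ := isApprox_logGolden hP (Nat.le_of_ble_eq_true hr) (Nat.le_of_ble_eq_true hr')
  have i₃ := isApprox_logSqrtFive hP
  exact hx (eq_zero_of_detNeZero hdet (sum_eq_zero_of_rowOk r₁ i₁ i₂ i₃ b₂ b₃ hδ)
    (sum_eq_zero_of_rowOk r₂ i₁ i₂ i₃ b₂ b₃ hδ) (sum_eq_zero_of_rowOk r₃ i₁ i₂ i₃ b₂ b₃ hδ))

theorem index_lt {P L K f m d d' d'' : ℕ}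
    (hc : certificate P L (2 ^ (13 * K + 226)) (2 ^ f) d d' d'' = true)
    (hf : P + 12 * K + 227 ≤ f + 3 * m) (hm : 2 ^ 11 < 10 * m) {n : ℕ} (hn : n ≤ 2 ^ K)
    {x y : ℤ} (hy : 2 ≤ |y|)
    (h : |((x * (x - (Nat.fib n : ℤ) * y) * (x - (2 : ℤ) ^ n * y) - y ^ 3 : ℤ) : ℝ)| = 1) :
    n < 10 * m := by
  by_contra! hmn
  obtain ⟨k, hk⟩ : ∃ k, k = Nat.clog 2 n := ⟨_, rfl⟩
  have hn1 : 1 < n := by omega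
  have hkK : k ≤ K := hk ▸ Nat.clog_le_of_le_pow hn
  have hk2 : n ≤ 2 ^ k := hk ▸ Nat.le_pow_clog (by norm_num) n
  have hk1 : 2 ^ (k - 1) < n := hk ▸ Nat.pow_pred_clog_lt_self (by norm_num) hn1
  have hk12 : 12 ≤ k := by
    by_contra! hlt
    have : 2 ^ k ≤ 2 ^ 11 := Nat.pow_le_pow_right (by norm_num) (by omega)
    omega
  obtain ⟨e, he⟩ : ∃ e, e = 12 * k + 224 := ⟨_, rfl⟩
  obtain ⟨w, t, hw0, hw, ht, hwt⟩ := exists_fib_form_small hk12 hk1 hk2 he hy h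
  have hwR : |(w : ℝ)| ≤ 2 * 2 ^ e := by exact_mod_cast hw
  have hX : (2 : ℝ) * 2 ^ e * 2 ^ k ≤ ((2 ^ (13 * K + 226) : ℕ) : ℝ) := by
    push_cast
    rw [mul_assoc, ← pow_add, ← pow_succ']
    exact pow_le_pow_right₀ (by norm_num) (by omega)
  have hnk : (n : ℝ) ≤ 2 ^ k := by exact_mod_cast hk2
  have hw2 : |((w * n : ℤ) : ℝ)| ≤ ((2 ^ (13 * K + 226) : ℕ) : ℝ) := by
    refine le_trans ?_ hX
    push_cast
    rw [abs_mul, Nat.abs_cast]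
    gcongr
  have hw3 : |((-w : ℤ) : ℝ)| ≤ ((2 ^ (13 * K + 226) : ℕ) : ℝ) := by
    refine le_trans ?_ hX
    push_cast
    rw [abs_neg]
    refine hwR.trans (le_mul_of_one_le_right (by positivity) (one_le_pow₀ (by norm_num) (n := k)))
  have hlow := lt_of_certificate hc (x₁ := -(t * n)) hw2 hw3 (neg_ne_zero.2 hw0)
  rw [show ((-(t * n) : ℤ) : ℝ) * Real.log 2 + ((w * n : ℤ) : ℝ) * Real.log Real.goldenRatio +
    ((-w : ℤ) : ℝ) * Real.log (√5) = w * (n * Real.log Real.goldenRatio - Real.log √5) -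
      t * (n * Real.log 2) by push_cast; ring] at hlow
  refine hlow.not_ge ((mul_le_mul_of_nonneg_left hwt (by positivity)).trans ?_)
  have h8 : (8 : ℝ) ^ m ≤ 8 ^ (n / 10) := pow_le_pow_right₀ (by norm_num) (by omega)
  rw [← mul_div_assoc, ← mul_div_assoc, div_le_iff₀ (by positivity)]
  push_cast
  refine le_trans ?_ (mul_le_mul_of_nonneg_left h8 (by positivity))
  rw [show (8 : ℝ) = 2 ^ 3 by norm_num, ← pow_mul, ← pow_add]
  have h7 : (7 : ℝ) * 2 ^ e ≤ 2 ^ (e + 3) := by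
    rw [pow_add]; nlinarith [show (0 : ℝ) < 2 ^ e by positivity]
  refine (mul_le_mul_of_nonneg_left h7 (by positivity)).trans ?_
  rw [← pow_add]
  exact pow_le_pow_right₀ (by norm_num) (by omega)

end FormReduction

set_option maxRecDepth 100000 in
set_option exponentiation.threshold 100000 in
/-- A solution with `2 ≤ |y|` has `n < 3960`. -/
theorem index_lt_of_solution {n : ℕ} {x y : ℤ} (hy : 2 ≤ |y|)
    (h : |((x * (x - (Nat.fib n : ℤ) * y) * (x - (2 : ℤ) ^ n * y) - y ^ 3 : ℤ) : ℝ)| = 1) :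
    n < 3960 := by
  have h1 : n < 10 * 3512 := FormReduction.index_lt (P := 10860) (L := 12) (K := 259) (f := 3659)
    (d := 1437331772453278121553165576780964311261717744567765046022461734449703506927553278933711059969977238086500995785519788032109349773544213182788350683020971551135053652096847360396061315911581342242513306411458010861538003803685210743438736743480034799797448849901095691596696074462328528388596683148367324892183923743487727858031249795076634240650004040740520640359469694048957225423412224062937749878682226948935942164953705966408954000536254628275801326690925018140669601447402570417595832932045255977398341013013178527491428695098641761783969782159698095850725370769991462655932777715205430357311787840438701021257847040557404252944801081967871817347083602221910401338282415761652918081906482363631833275572848243974540299859280022151799906348170526385753290135819387541105752380439336666312639576068987367615349161994590974319779402169303764822314384328612760546512416598041434306319747767714233306174322856705953697372812054753112065337988513050129504403680063237700732565821957932021549524706023529081653614247005305015840516173926150011718860662839888085012255005472656281960319571970833765827194208859838941419629462949433679938598372599144277878821625452692168122520649212169333803968433181005862048186251503113177888162949498031375815145097645192325339876903713878430545742080470280970911901661061624745308071969183769833431162951003232032483089030262694135416884783393430329365549438276811220307260312439970259180364972896136388338214870958429381022247566068905994876322156079556602947707100504912783249484469317428745859388765337154180373934882259620720726465187296392831237177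72333120422003370336951254369197962044285660331647241044761444327824709864986882090895972166401425279016374906614727074528665524982007693921075922002247740040391598365336915301273362984815746578207159468262888976461280161084821143981218769923718821392472722271844364626725662531318924542686748951970806404305425344199894220969737568456751972960291027058580783097517954296892128422644707882373055572981134789999588187609013812441127168671663549662598604432074744743560921837744980345600575569300561530017694716044494156647865943469266341330298997293813089428394504248379240556962)
    (d' := 2854277916264037492330808320847378328063538680341035350095777647326781810361529516712278647750473322828676337296683902303754379745353558568412072276720847725822402901659780543757078891510501748030409028902132925731314449631428372720840987162948435226539576193338343129641056898092090505540591164656546184424255965179881089438975211462734037163499436258416512166267257723520511411774175449262731510052848840623509210145156337679047474226184211898582381988140521025919619175979140670524363870484793179785918755455841343946637689535421135326504834396516392280719273930729677359621457966812128818482571351993140074266105312029962802279990734168091520887889283905816465377220217724434185738771078752824410969652160030834634457826213624992449124004879694266105560935088418775228787102446758892240637448575245410145699889607497344637884722577185629639920387845772878172972593258877986349829841244682800027333772233096405642414546093595789643137891018939055580018083844980110907423642220093016996277982753039131336323235045059078062275659514105838037006084947947860859543011000395717640031621322634609726193375476250308396879404560491969000529090373142125199210894799095322215580921349046466994681831342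84652488892531754157643757903580267607132216289711014791679287133981109321918993236012806767743097333116960914822160291180921950324474540448748056969764589901883867688882410596393579237969027073950184072498528370680050195045787525367626874145558858827741337460148720534572343529683257411697339223218182506631640243324525657619566313030928421399479020421938588717925957254420294947653755175015584733462286113025212660608695374853805306632237130425811738551705135708994864064029347159163253308195131792626378215182541821556343708524202673631789827590171330020927354966235226671082615144502293587031477691770292419269008396227558429564884993748029459193075522039561421871452946402039517460669704688766831077294060320960665011857978883346016889258081976379124347786444373532328164616154190565479319017694120252310051428292404744243776629146425376863487848917639625818793171192474565742318114230968099857336686336401799574981890577422912733905328741539301916744746979148016431)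
    (d'' := 1495772643479251375503145869440757197256490541649495891736617185747565503499234647417086077927086869580216269315697150702851388085726401801341361921920567280443737700663151620792566108766532629498382678065998388983157379108657450041149369467815373073193170020723568843103361898195484124802397784298466771025918387468565838351447649794793536775187830214022990591824749559553543712685587818983611339561498313242136069044676337024178674656325799442275719975834538542701557914402536562527486465545638237265453835945411921688496582548239967411609346729528251727454443809539578065292628250855225921971342695554001588565855234480965941854240251042894940958399263898739759077453948517462967454824423690019242265019780814243561279635198267996873201319926329434973170377767643872173903305563862850475910692740717169576599377245012199210221719299811835281395802182988163819290527873997171651860469244916231591128811399440941899358243035217497787450545034089224929255498821097070507354719525230124096897927479097701563090672252928827173132384691950191945212412927269156669875518829078993332548760275063842157323356506064504248272836061527480269564099075063070498142795966035952787118302630700015946578258290309227809019687679376710435121500641952088894089632194594575702634765266397546837904312661253838718910856476922953440758962579489895964635096984877824681202620943694744578709285350622232601825459564851329299485019662389089001447131092110770137959920540479524916709514030332878761051667548540344520277554552894561232509189847068247286309879754775180521548578991629483001407521984809988823399885512068952855176795334580203437149327184879043849047566704346717294875021956423432396201484270492655718613858012157150976670765116186412258069360550061884783843618247422051178899924689115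63880039937294131502654602872232786811996920153064811488454567410898503713326798669561760753814573773977082897237987718503167531108504958211882016369734445809203424921087755643371346815881684962142257855659158155702848913679272925245305829287561797574228262726500871891996712592772902094351780123399302101675292082726419718994916443570971813153926895469001582605522870459536537126132945837774)
    (by decide +kernel) (by norm_num) (by norm_num) (index_le_of_solution hy h) hy h
  have h2 : n < 10 * 434 := FormReduction.index_lt (P := 1350) (L := 9) (K := 16) (f := 467)
    (d := 171628023306690211270896382743161874893199572125119133069572051310676918985473756777361877452838320844254680168234954301362440990656653085918727996592333115841516615746510717713787468375121394410639482519614003173076389807597270438534967641749776211651518953459284)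
    (d' := 331392321503371209919531737202433813780710449699375975132180997065532550382185043913842945408248398267213743200863087627098675746725872124389033948052885507681200339396971122674542421842992519990516735213893645147010336648536658362064115416979569178608452986141366)
    (d'' := 256434732355050913003441185492043421580838202017880460517200649221652214113848626983144375245170962980422587086819245805836940160438323693910058191688698910493279476200154888326517840532557372585644881309111152369386272128070524942694421541405088465862452052477077)
    (by decide +kernel) (by norm_num) (by norm_num) ((by omega)) hy h
  have h3 : n < 10 * 396 := FormReduction.index_lt (P := 1240) (L := 9) (K := 13) (f := 435)
    (d := 1126489020050343642083309328982586733124284827083719541187387662393010609492428801003368795708673622336019567805845699779741944899207606384798404324331898168739045819295889520731531532223840563618417554499603193365291274993373794778425753887)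
    (d' := 1133280440530341239482595489931505022228896198618135852894612021504988661750190884872361044767633773854859785474572865194805889614666258726042222612956551658204535665314152894336466921775041202931917185761397989691423612040107904555605035684)
    (d'' := 884881803824492586009884053553178902137584138966061060088197972530395364965168449889691277150133380044719727117141493720034892193562529324325938185115347632059233902144830042931867605126680400296179700585242073144499667052351790499577482990)
    (by decide +kernel) (by norm_num) (by norm_num) ((by omega)) hy h
  exact h3

/-- The tails `∑ yⁱ / (2 (m + i) + 1)` of the series of the inverse hyperbolic tangent. -/
noncomputable def atanhTail (y : ℝ) (m : ℕ) : ℝ := ∑' i : ℕ, y ^ i / (2 * ((m + i : ℕ) : ℝ) + 1)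

section atanhTail

variable {y : ℝ}

theorem atanhTail_term_le (hy : 0 ≤ y) (m i : ℕ) :
    y ^ i / (2 * ((m + i : ℕ) : ℝ) + 1) ≤ y ^ i :=
  div_le_self (by positivity) (by
    have : (0 : ℝ) ≤ ((m + i : ℕ) : ℝ) := by positivity
    linarith)

theorem summable_atanhTail (hy : 0 ≤ y) (hy1 : y ≤ 1 / 9) (m : ℕ) :
    Summable fun i : ℕ => y ^ i / (2 * ((m + i : ℕ) : ℝ) + 1) :=
  Summable.of_nonneg_of_le (fun i => by positivity) (atanhTail_term_le hy m)
    (summable_geometric_of_lt_one hy (by linarith))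

theorem atanhTail_nonneg (hy : 0 ≤ y) (m : ℕ) : 0 ≤ atanhTail y m :=
  tsum_nonneg fun i => by positivity

theorem atanhTail_le (hy : 0 ≤ y) (hy1 : y ≤ 1 / 9) (m : ℕ) : atanhTail y m ≤ 9 / 8 := by
  have h := (summable_atanhTail hy hy1 m).tsum_le_tsum (atanhTail_term_le hy m)
    (summable_geometric_of_lt_one hy (by linarith))
  refine h.trans ?_
  rw [tsum_geometric_of_lt_one hy (by linarith), inv_le_comm₀ (by linarith) (by norm_num)]
  linarith

theorem atanhTail_eq (hy : 0 ≤ y) (hy1 : y ≤ 1 / 9) (m : ℕ) :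
    atanhTail y m = 1 / (2 * m + 1) + y * atanhTail y (m + 1) := by
  rw [atanhTail, (summable_atanhTail hy hy1 m).tsum_eq_zero_add, atanhTail, ← tsum_mul_left]
  refine congrArg₂ (· + ·) (by simp) ?_
  · refine tsum_congr fun i => ?_
    rw [pow_succ, show m + (i + 1) = m + 1 + i by ring]
    ring

theorem log_div_eq_atanhTail {x : ℝ} (hx : 0 ≤ x) (hx1 : x ≤ 1 / 3) :
    Real.log (1 + x) - Real.log (1 - x) = 2 * x * atanhTail (x ^ 2) 0 := by
  rw [← (Real.hasSum_log_sub_log_of_abs_lt_one (x := x) (by rw [abs_of_nonneg hx]; linarith)).tsum_eq,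
    atanhTail, ← tsum_mul_left]
  refine tsum_congr fun i => ?_
  rw [pow_succ, pow_mul, zero_add]
  ring

end atanhTail

/-- Horner's scheme for the first `N` terms of `atanhTail` in fixed-point arithmetic. -/
def hornerSum (P N z p : ℕ) : ℕ :=
  Nat.rec (motive := fun _ => ℕ) 0 (fun p ih =>
    Nat.add (Nat.div (Nat.pow 2 P) (Nat.sub (Nat.mul 2 N) (Nat.succ (Nat.mul 2 p))))
      (Nat.div (Nat.mul ih z) (Nat.pow 2 P))) p

theorem abs_hornerSum_sub_le {P N z : ℕ} {y : ℝ} (hy : 0 ≤ y) (hy1 : y ≤ 1 / 9)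
    (hz : (z : ℝ) ≤ 2 ^ P * y) (hz' : 2 ^ P * y ≤ z + 1) {p : ℕ} (hp : p ≤ N) :
    |(hornerSum P N z p : ℝ) - 2 ^ P * atanhTail y (N - p)| ≤ 4 + 2 * 2 ^ P * y ^ p := by
  have hP : (0 : ℝ) < 2 ^ P := by positivity
  induction p with
  | zero =>
    have h1 := atanhTail_le hy hy1 N
    have h2 := atanhTail_nonneg hy N
    have h3 := mul_le_mul_of_nonneg_left h1 hP.le
    rw [show hornerSum P N z 0 = 0 from rfl, Nat.cast_zero, zero_sub, abs_neg, Nat.sub_zero,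
      pow_zero, mul_one]
    rw [abs_of_nonneg (by positivity)]
    linarith
  | succ p ih =>
    have ih := ih (by omega)
    obtain ⟨m, hm⟩ : ∃ m, N = m + p + 1 := ⟨N - p - 1, by omega⟩
    have e1 : N - p = m + 1 := by omega
    have e2 : N - (p + 1) = m := by omega
    have hG : hornerSum P N z (p + 1) = 2 ^ P / (2 * m + 1) + hornerSum P N z p * z / 2 ^ P := by
      change 2 ^ P / (2 * N - (2 * p + 1)) + hornerSum P N z p * z / 2 ^ P = _
      rw [show 2 * N - (2 * p + 1) = 2 * m + 1 by omega]
    rw [e1] at ih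
    rw [e2, hG, atanhTail_eq hy hy1]
    generalize hornerSum P N z p = G at *
    have ht0 := atanhTail_nonneg hy (m + 1)
    have ht1 := atanhTail_le hy hy1 (m + 1)
    generalize atanhTail y (m + 1) = t at *
    obtain ⟨a1, a2⟩ := Nat.div_cast_bounds (2 ^ P) (b := 2 * m + 1) (by positivity)
    obtain ⟨b1, b2⟩ := Nat.div_cast_bounds (G * z) (b := 2 ^ P) (by positivity)
    push_cast at *
    have hzP : (z : ℝ) / 2 ^ P ≤ y := by rw [div_le_iff₀ hP]; linarith
    have hz0 : (0 : ℝ) ≤ z / 2 ^ P := by positivity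
    have k1 : |(G : ℝ) - 2 ^ P * t| * (z / 2 ^ P) ≤ (4 + 2 * 2 ^ P * y ^ p) * y := by gcongr
    have k2 : |(z - 2 ^ P * y) * t| ≤ 1 * (9 / 8) := by
      rw [abs_mul, abs_of_nonneg ht0]
      have : |(z : ℝ) - 2 ^ P * y| ≤ 1 := by rw [abs_le]; constructor <;> linarith
      gcongr
    have k3 : (G : ℝ) * z / 2 ^ P - 2 ^ P * (y * t) =
        (G - 2 ^ P * t) * (z / 2 ^ P) + (z - 2 ^ P * y) * t := by
      field_simp; ring
    have k4 : |(G : ℝ) * z / 2 ^ P - 2 ^ P * (y * t)| ≤ (4 + 2 * 2 ^ P * y ^ p) * y + 9 / 8 := by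
      rw [k3]
      refine (abs_add_le _ _).trans ?_
      rw [abs_mul _ ((z : ℝ) / 2 ^ P), abs_of_nonneg hz0]
      linarith
    rw [abs_le] at k4 ⊢
    rw [pow_succ, mul_add, mul_one_div]
    constructor <;> nlinarith

/-- Fixed-point approximation of `log ((q + p) / (q - p))`. -/
def logRatioApprox (P N p q : ℕ) : ℕ :=
  withValue (Nat.div (Nat.mul (Nat.mul p p) (Nat.pow 2 P)) (Nat.mul q q)) fun z =>
    Nat.div (Nat.mul (Nat.mul 2 p) (hornerSum P N z N)) q

theorem isApprox_logRatio {P N p q ρ : ℕ} (hρ : 3 ≤ ρ) (hq : 0 < q) (hpq : ρ * p ≤ q)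
    (hN : 2 ^ (P + 1) ≤ ρ ^ (2 * N)) :
    IsApprox P 5 (logRatioApprox P N p q) (Real.log (q + p) - Real.log (q - p)) := by
  have hq0 : (0 : ℝ) < q := by exact_mod_cast hq
  have hρ0 : (0 : ℝ) < ρ := by positivity
  have hx0 : (0 : ℝ) ≤ p / q := by positivity
  have hpq' : (ρ : ℝ) * p ≤ q := by exact_mod_cast hpq
  have hxρ : (p : ℝ) / q ≤ 1 / ρ := by
    rw [div_le_div_iff₀ hq0 hρ0]; linarith
  have hx3 : (p : ℝ) / q ≤ 1 / 3 := hxρ.trans (by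
    have : (3 : ℝ) ≤ ρ := by exact_mod_cast hρ
    gcongr)
  have hlog : Real.log (q + p) - Real.log (q - p) =
      2 * (p / q) * atanhTail ((p / q : ℝ) ^ 2) 0 := by
    rw [← log_div_eq_atanhTail hx0 hx3, show (q + p : ℝ) = q * (1 + p / q) by field_simp,
      show (q - p : ℝ) = q * (1 - p / q) by field_simp,
      Real.log_mul hq0.ne' (by positivity), Real.log_mul hq0.ne' (by linarith)]
    ring
  rw [IsApprox, hlog, logRatioApprox, withValue_eq]
  have hP : (0 : ℝ) < 2 ^ P := by positivity
  have hy1 : ((p / q : ℝ) ^ 2) ≤ 1 / 9 := by nlinarith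
  obtain ⟨z1, z2⟩ := Nat.div_cast_bounds (p * p * 2 ^ P) (b := q * q) (by positivity)
  have hzy : ((p * p * 2 ^ P : ℕ) : ℝ) / ((q * q : ℕ) : ℝ) = 2 ^ P * (p / q : ℝ) ^ 2 := by
    push_cast; field_simp
  rw [hzy] at z1 z2
  have hH := abs_hornerSum_sub_le (N := N) (sq_nonneg _) hy1 z1 z2 le_rfl
  rw [Nat.sub_self] at hH
  obtain ⟨d1, d2⟩ := Nat.div_cast_bounds (2 * p * hornerSum P N (p * p * 2 ^ P / (q * q)) N) hq
  change |((2 * p * hornerSum P N (p * p * 2 ^ P / (q * q)) N / q : ℕ) : ℝ) - _| ≤ _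
  generalize hornerSum P N (p * p * 2 ^ P / (q * q)) N = G at *
  have hsmall : 2 * 2 ^ P * ((p / q : ℝ) ^ 2) ^ N ≤ 1 := by
    have h1 : ((p / q : ℝ) ^ 2) ^ N ≤ (1 / ρ) ^ (2 * N) := by
      rw [← pow_mul]; exact pow_le_pow_left₀ hx0 hxρ _
    have h2 : (2 : ℝ) ^ (P + 1) ≤ ρ ^ (2 * N) := by exact_mod_cast hN
    rw [← pow_succ']
    refine (mul_le_mul_of_nonneg_left h1 (by positivity)).trans ?_
    rw [one_div_pow, mul_one_div, div_le_one (by positivity)]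
    exact h2
  have hH' : |(G : ℝ) - 2 ^ P * atanhTail ((p / q : ℝ) ^ 2) 0| ≤ 5 := by linarith
  generalize atanhTail ((p / q : ℝ) ^ 2) 0 = t at *
  have e1 : 2 * (p / q) * |(G : ℝ) - 2 ^ P * t| ≤ 2 * (1 / 3) * 5 := by gcongr
  have e2 : |(2 * p * G : ℝ) / q - 2 ^ P * (2 * (p / q) * t)| ≤ 10 / 3 := by
    rw [show (2 * p * G : ℝ) / q - 2 ^ P * (2 * (p / q) * t) =
      2 * (p / q) * ((G : ℝ) - 2 ^ P * t) by ring, abs_mul, abs_of_nonneg (by positivity)]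
    linarith
  push_cast at *
  rw [abs_le] at e2 ⊢
  constructor <;> linarith

/-- Binary search for the exponent of the largest power of two not exceeding `M`. -/
def fastLog2Search (M k : ℕ) : ℕ → ℕ :=
  Nat.rec (motive := fun _ => ℕ → ℕ) (fun s => s)
    (fun i ih s => withValue (Nat.add s (Nat.pow 2 i)) fun s' =>
      cond (Nat.ble (Nat.pow 2 s') M) (ih s') (ih s)) k

/-- The binary logarithm, in a form suitable for evaluation by the kernel. -/
def fastLog2 (M : ℕ) : ℕ :=
  withValue (fastLog2Search M 14 0) fun s =>
    cond (Nat.ble (Nat.pow 2 s) M && Nat.blt M (Nat.pow 2 (Nat.succ s))) s (Nat.log2 M)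

theorem fastLog2_eq (M : ℕ) : fastLog2 M = Nat.log2 M := by
  rw [fastLog2, withValue_eq]
  generalize fastLog2Search M 14 0 = s
  cases h : (Nat.ble (Nat.pow 2 s) M && Nat.blt M (Nat.pow 2 (Nat.succ s))) with
  | false => rfl
  | true =>
    rw [Bool.and_eq_true] at h
    have h1 : 2 ^ s ≤ M := Nat.le_of_ble_eq_true h.1
    have h2 : M < 2 ^ (s + 1) := Nat.le_of_ble_eq_true h.2
    have hM : M ≠ 0 := by have := Nat.two_pow_pos s; omega
    exact ((Nat.log2_eq_iff hM).2 ⟨h1, h2⟩).symm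

/-- Fixed-point approximation of `log (M / 2 ^ Q)`, where `a` approximates `log 2`. -/
def logNatApprox (P N a Q M : ℕ) : ℕ :=
  withValue (fastLog2 M) fun s => Nat.add (Nat.mul (Nat.sub s Q) a)
    (logRatioApprox P N (Nat.sub M (Nat.pow 2 s)) (Nat.add M (Nat.pow 2 s)))

theorem isApprox_logNat {P N a E Q w M : ℕ} (ha : IsApprox P E a (Real.log 2))
    (hN : 2 ^ (P + 1) ≤ 9 ^ N) (hM : 2 ^ Q ≤ M) (hw : M < 2 ^ (Q + w)) :
    IsApprox P (w * E + 5) (logNatApprox P N a Q M) (Real.log (M / 2 ^ Q)) := by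
  have hM0 : M ≠ 0 := by have := Nat.two_pow_pos Q; omega
  obtain ⟨s, hs⟩ : ∃ s, s = Nat.log2 M := ⟨_, rfl⟩
  have hs1 : 2 ^ s ≤ M := hs ▸ Nat.log2_self_le hM0
  have hs2 : M < 2 ^ (s + 1) := hs ▸ Nat.lt_log2_self
  have hQs : Q ≤ s := hs ▸ (Nat.le_log2 hM0).2 hM
  have hsw : s < Q + w := hs ▸ (Nat.log2_lt hM0).2 hw
  have hr := isApprox_logRatio (P := P) (N := N) (p := M - 2 ^ s) (q := M + 2 ^ s) le_rfl
    (by positivity) (by rw [pow_succ] at hs2; omega) (by rw [pow_mul]; exact hN)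
  have e1 : ((M + 2 ^ s : ℕ) : ℝ) + ((M - 2 ^ s : ℕ) : ℝ) = 2 * M := by
    rw [Nat.cast_sub hs1]; push_cast; ring
  have e2 : ((M + 2 ^ s : ℕ) : ℝ) - ((M - 2 ^ s : ℕ) : ℝ) = 2 * 2 ^ s := by
    rw [Nat.cast_sub hs1]; push_cast; ring
  have hMR : (M : ℝ) ≠ 0 := by exact_mod_cast hM0
  rw [e1, e2, ← Real.log_div (by positivity) (by positivity), mul_div_mul_left _ _ two_ne_zero] at hr
  have hlog : Real.log (M / 2 ^ Q) = (s - Q : ℕ) * Real.log 2 + Real.log (M / 2 ^ s) := by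
    rw [Real.log_div hMR (by positivity), Real.log_div hMR (by positivity), Real.log_pow,
      Real.log_pow, Nat.cast_sub hQs]
    ring
  rw [IsApprox, hlog, logNatApprox, withValue_eq, fastLog2_eq, ← hs]
  change |(((s - Q) * a + logRatioApprox P N (M - 2 ^ s) (M + 2 ^ s) : ℕ) : ℝ) - _| ≤ _
  have hsQ : s - Q ≤ w := by omega
  generalize s - Q = v at *
  unfold IsApprox at ha hr
  have h1 : |(v : ℝ) * (a - 2 ^ P * Real.log 2)| ≤ w * E := by
    rw [abs_mul, Nat.abs_cast]; gcongr
  push_cast at *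
  rw [show (v * a + logRatioApprox P N (M - 2 ^ s) (M + 2 ^ s) : ℝ) -
    2 ^ P * (v * Real.log 2 + Real.log (M / 2 ^ s)) = v * (a - 2 ^ P * Real.log 2) +
      (logRatioApprox P N (M - 2 ^ s) (M + 2 ^ s) - 2 ^ P * Real.log (M / 2 ^ s)) by ring]
  refine (abs_add_le _ _).trans ?_
  linarith

namespace IsApprox

variable {P E E' a b : ℕ} {s t : ℝ}

theorem mono (h : IsApprox P E a s) (hE : E ≤ E') : IsApprox P E' a s :=
  le_trans h (by exact_mod_cast hE)

theorem add (h : IsApprox P E a s) (h' : IsApprox P E' b t) :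
    IsApprox P (E + E') (a + b) (s + t) := by
  unfold IsApprox at *
  push_cast
  rw [show (a + b - 2 ^ P * (s + t) : ℝ) = (a - 2 ^ P * s) + (b - 2 ^ P * t) by ring]
  exact (abs_add_le _ _).trans (add_le_add h h')

theorem nat_mul (c : ℕ) (h : IsApprox P E a s) : IsApprox P (c * E) (c * a) (c * s) := by
  unfold IsApprox at *
  push_cast
  rw [show (c * a - 2 ^ P * (c * s) : ℝ) = c * (a - 2 ^ P * s) by ring, abs_mul, Nat.abs_cast]
  gcongr

theorem dist (h : IsApprox P E a s) (h' : IsApprox P E' b t) :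
    IsApprox P (E + E') (natDist a b) |s - t| := by
  unfold IsApprox at *
  rw [natDist_cast, ← abs_of_pos (show (0 : ℝ) < 2 ^ P by positivity), ← abs_mul]
  refine (abs_abs_sub_abs_le_abs_sub _ _).trans ?_
  rw [show (a - b - 2 ^ P * (s - t) : ℝ) = (a - 2 ^ P * s) - (b - 2 ^ P * t) by ring]
  push_cast
  exact (abs_sub _ _).trans (add_le_add h h')

/-- Transfer of an approximation to a nearby real number. -/
theorem of_log_near {x y : ℝ} {c : ℕ} (h : IsApprox P E a (Real.log x)) (hy : 1 ≤ x)
    (hxy : |y - x| ≤ c / 2 ^ P) (hc : 2 * c ≤ 2 ^ P) :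
    IsApprox P (E + 2 * c) a (Real.log y) := by
  have hP : (0 : ℝ) < 2 ^ P := by positivity
  have hc' : (2 * c : ℝ) ≤ 2 ^ P := by exact_mod_cast hc
  have h0 : (0 : ℝ) ≤ c / 2 ^ P := by positivity
  have h1 := Real.abs_log_sub_log_le (x := y) (y := x) (e := c / 2 ^ P) (by linarith)
    (hxy.trans (le_mul_of_one_le_right h0 hy)) (by rw [div_le_div_iff₀ hP two_pos]; linarith)
  unfold IsApprox at *
  rw [show (a - 2 ^ P * Real.log y : ℝ) = (a - 2 ^ P * Real.log x) -
    2 ^ P * (Real.log y - Real.log x) by ring]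
  refine (abs_sub _ _).trans ?_
  rw [abs_mul, abs_of_pos hP]
  have h2 := mul_le_mul_of_nonneg_left h1 hP.le
  rw [show (2 : ℝ) ^ P * (2 * (c / 2 ^ P)) = 2 * c by field_simp] at h2
  push_cast
  linarith

end IsApprox

namespace BakerDavenport

/-- The size condition under which `u N₁ + v N₂ - N₃` cannot be at most `D` in absolute value for
integers with `|u| ≤ X`. -/
def multiplierOk (N₁ N₂ N₃ X D q : ℕ) : Bool :=
  withValue (Nat.mod (Nat.mul q N₁) N₂) fun s => withValue (Nat.mod (Nat.mul q N₃) N₂) fun s' =>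
  withValue (Nat.add (Nat.mul X (cond (Nat.ble (Nat.mul 2 s) N₂) s (Nat.sub N₂ s)))
    (Nat.mul q D)) fun b => Nat.ble (Nat.succ b) s' && Nat.ble (Nat.succ (Nat.add b s')) N₂

theorem lt_abs_of_multiplierOk {N₁ N₂ N₃ X D q : ℕ} (h : multiplierOk N₁ N₂ N₃ X D q = true)
    {u v : ℤ} (hu : |u| ≤ X) : D < |u * N₁ + v * N₂ - N₃| := by
  simp only [multiplierOk, withValue_eq, Bool.and_eq_true] at h
  obtain ⟨h₁, h₂⟩ := h
  have h₁ : X * (cond (Nat.ble (2 * (q * N₁ % N₂)) N₂) (q * N₁ % N₂) (N₂ - q * N₁ % N₂)) + q * D <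
    q * N₃ % N₂ := Nat.le_of_ble_eq_true h₁
  have h₂ : X * (cond (Nat.ble (2 * (q * N₁ % N₂)) N₂) (q * N₁ % N₂) (N₂ - q * N₁ % N₂)) + q * D +
    q * N₃ % N₂ < N₂ := Nat.le_of_ble_eq_true h₂
  by_contra! hD
  have hN₂ : 0 < N₂ := by omega
  obtain ⟨c, r, hr, hcr⟩ : ∃ c r : ℤ, |r| = ((cond (Nat.ble (2 * (q * N₁ % N₂)) N₂) (q * N₁ % N₂)
      (N₂ - q * N₁ % N₂) : ℕ) : ℤ) ∧ (q : ℤ) * N₁ = N₂ * c + r := by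
    have e : (q : ℤ) * N₁ = N₂ * ((q * N₁ / N₂ : ℕ) : ℤ) + ((q * N₁ % N₂ : ℕ) : ℤ) := by
      exact_mod_cast (Nat.div_add_mod (q * N₁) N₂).symm
    have hlt := Nat.mod_lt (q * N₁) hN₂
    cases Nat.ble (2 * (q * N₁ % N₂)) N₂
    · refine ⟨(q * N₁ / N₂ : ℕ) + 1, ((q * N₁ % N₂ : ℕ) : ℤ) - N₂, ?_, by rw [e]; ring⟩
      rw [abs_of_neg (by omega), cond_false, Nat.cast_sub hlt.le]; ring
    · exact ⟨_, _, by rw [cond_true, Nat.abs_cast], e⟩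
  have e' : (q : ℤ) * N₃ = N₂ * ((q * N₃ / N₂ : ℕ) : ℤ) + ((q * N₃ % N₂ : ℕ) : ℤ) := by
    exact_mod_cast (Nat.div_add_mod (q * N₃) N₂).symm
  generalize cond (Nat.ble (2 * (q * N₁ % N₂)) N₂) (q * N₁ % N₂) (N₂ - q * N₁ % N₂) = R at *
  generalize q * N₃ % N₂ = s at *
  generalize ((q * N₃ / N₂ : ℕ) : ℤ) = c' at *
  obtain ⟨K, hK⟩ : ∃ K, K = u * c + q * v - c' := ⟨_, rfl⟩
  have hkey : (N₂ : ℤ) * K - s = q * (u * N₁ + v * N₂ - N₃) - u * r := by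
    rw [hK]; linear_combination e' - u * hcr
  have hb : |(N₂ : ℤ) * K - s| ≤ X * R + q * D := by
    rw [hkey]
    refine (abs_sub _ _).trans ?_
    rw [abs_mul, abs_mul, Nat.abs_cast, hr]
    have := mul_le_mul_of_nonneg_left hD (Int.natCast_nonneg q)
    have := mul_le_mul_of_nonneg_right hu (Int.natCast_nonneg R)
    linarith
  zify at h₁ h₂ hN₂
  rw [abs_le] at hb
  rcases le_or_gt K 0 with hK0 | hK0
  · nlinarith
  · nlinarith

/-- Search for a suitable multiplier among the denominators of the convergents of `N₁ / N₂`. -/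
def search (N₁ N₂ N₃ X D fuel : ℕ) : ℕ → ℕ → ℕ → ℕ → Bool :=
  Nat.rec (motive := fun _ => ℕ → ℕ → ℕ → ℕ → Bool) (fun _ _ _ _ => false)
    (fun _ ih a b q₀ q =>
      cond (Nat.ble X (Nat.mul 16 q) && multiplierOk N₁ N₂ N₃ X D q) true
        (ih b (Nat.mod a b) q (Nat.add q₀ (Nat.mul (Nat.div a b) q)))) fuel

theorem exists_of_search {N₁ N₂ N₃ X D fuel : ℕ} {a b q₀ q : ℕ}
    (h : search N₁ N₂ N₃ X D fuel a b q₀ q = true) :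
    ∃ q, multiplierOk N₁ N₂ N₃ X D q = true := by
  induction fuel generalizing a b q₀ q with
  | zero => exact absurd h (by simp [search])
  | succ k ih =>
    have h : cond (Nat.ble X (Nat.mul 16 q) && multiplierOk N₁ N₂ N₃ X D q) true
        (search N₁ N₂ N₃ X D k b (Nat.mod a b) q (Nat.add q₀ (Nat.mul (Nat.div a b) q))) = true := h
    cases hc : (Nat.ble X (Nat.mul 16 q) && multiplierOk N₁ N₂ N₃ X D q) with
    | true => exact ⟨q, (Bool.and_eq_true_iff.1 hc).2⟩
    | false =>
      rw [hc, cond_false] at h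
      exact ih h

theorem exists_sign (t : ℝ) : ∃ σ : ℤ, |σ| = 1 ∧ t = σ * |t| := by
  rcases le_total 0 t with h | h
  · exact ⟨1, by norm_num, by rw [abs_of_nonneg h]; norm_num⟩
  · exact ⟨-1, by norm_num, by rw [abs_of_nonpos h]; norm_num⟩

theorem lt_abs_of_approx {P E N₁ N₂ N₃ X D t q : ℕ} (h : multiplierOk N₁ N₂ N₃ X D q = true)
    {a₁ a₂ a₃ : ℝ} (h₁ : IsApprox P E N₁ a₁) (h₂ : IsApprox P E N₂ a₂) (h₃ : IsApprox P E N₃ a₃)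
    (ht : t ≤ P) (hD : 2 ^ (P - t) + (2 * X + 1) * E ≤ D) {u v : ℤ} (hu : |u| ≤ X) (hv : |v| ≤ X) :
    1 / 2 ^ t < |u * a₁ + v * a₂ - a₃| := by
  by_contra! hsmall
  have hu' : |(u : ℝ)| ≤ X := by exact_mod_cast hu
  have hv' : |(v : ℝ)| ≤ X := by exact_mod_cast hv
  have hlt : (D : ℝ) < |(u * N₁ + v * N₂ - N₃ : ℝ)| := by
    exact_mod_cast lt_abs_of_multiplierOk h (v := v) hu
  have hD' : (2 : ℝ) ^ (P - t) + (2 * X + 1) * E ≤ D := by exact_mod_cast hD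
  unfold IsApprox at h₁ h₂ h₃
  have k₁ := mul_le_mul hu' h₁ (abs_nonneg _) (Nat.cast_nonneg _)
  have k₂ := mul_le_mul hv' h₂ (abs_nonneg _) (Nat.cast_nonneg _)
  rw [← abs_mul] at k₁ k₂
  have hP : (0 : ℝ) < 2 ^ P := by positivity
  have k₃ := mul_le_mul_of_nonneg_left hsmall hP.le
  rw [mul_one_div, div_eq_mul_inv, ← pow_sub₀ _ two_ne_zero ht, ← abs_of_pos hP, ← abs_mul] at k₃
  rw [show (u * N₁ + v * N₂ - N₃ : ℝ) = 2 ^ P * (u * a₁ + v * a₂ - a₃) +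
    u * (N₁ - 2 ^ P * a₁) + v * (N₂ - 2 ^ P * a₂) - (N₃ - 2 ^ P * a₃) by ring] at hlt
  have k₄ := abs_sub (2 ^ P * (u * a₁ + v * a₂ - a₃) + u * (N₁ - 2 ^ P * a₁) +
    v * (N₂ - 2 ^ P * a₂)) (N₃ - 2 ^ P * a₃)
  have k₅ := abs_add_three (2 ^ P * (u * a₁ + v * a₂ - a₃)) (u * (N₁ - 2 ^ P * a₁))
    (v * (N₂ - 2 ^ P * a₂))
  linarith

theorem lt_abs_of_search {P E N₁ N₂ N₃ X D t fuel a b q₀ q : ℕ}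
    (h : search N₁ N₂ N₃ X D fuel a b q₀ q = true) {a₁ a₂ a₃ : ℝ}
    (h₁ : IsApprox P E N₁ |a₁|) (h₂ : IsApprox P E N₂ |a₂|) (h₃ : IsApprox P E N₃ |a₃|)
    (ht : t ≤ P) (hD : 2 ^ (P - t) + (2 * X + 1) * E ≤ D) {u v : ℤ} (hu : |u| ≤ X) (hv : |v| ≤ X) :
    1 / 2 ^ t < |u * a₁ + v * a₂ - a₃| := by
  obtain ⟨q, hq⟩ := exists_of_search h
  obtain ⟨σ₁, s₁, e₁⟩ := exists_sign a₁
  obtain ⟨σ₂, s₂, e₂⟩ := exists_sign a₂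
  obtain ⟨σ₃, s₃, e₃⟩ := exists_sign a₃
  have hu' : |σ₃ * σ₁ * u| ≤ X := by rw [abs_mul, abs_mul, s₁, s₃]; simpa using hu
  have hv' : |σ₃ * σ₂ * v| ≤ X := by rw [abs_mul, abs_mul, s₂, s₃]; simpa using hv
  have hlt := lt_abs_of_approx hq h₁ h₂ h₃ ht hD hu' hv'
  have h33 : (σ₃ : ℝ) * σ₃ = 1 := by
    have : σ₃ * σ₃ = 1 := by rw [← abs_mul_abs_self, s₃, one_mul]
    exact_mod_cast this
  have hs3 : |(σ₃ : ℝ)| = 1 := by exact_mod_cast s₃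
  have hform : ((σ₃ * σ₁ * u : ℤ) : ℝ) * |a₁| + ((σ₃ * σ₂ * v : ℤ) : ℝ) * |a₂| - |a₃| =
      σ₃ * (u * a₁ + v * a₂ - a₃) := by
    push_cast
    linear_combination (-(σ₃ : ℝ) * u) * e₁ - σ₃ * v * e₂ + σ₃ * e₃ + |a₃| * h33
  rwa [hform, abs_mul, hs3, one_mul] at hlt

end BakerDavenport

/-- `f` applied to a fixed-point approximation of `log (M / 2 ^ P)`, computed from an approximation
`a` of the logarithm of the nearby number `M₀ / 2 ^ P`; `false` if `M` is not in range. -/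
def withLogNear (P a M₀ M : ℕ) (f : ℕ → Bool) : Bool :=
  withValue (natDist M M₀) fun p => withValue (Nat.add M M₀) fun q =>
  withValue (fastLog2 (Nat.div q p)) fun s =>
  cond (Nat.ble 2 s && Nat.ble (Nat.pow 2 P) M)
    (withValue (logRatioApprox P (Nat.succ (Nat.div P (Nat.mul 2 s))) p q) fun r =>
      withValue (cond (Nat.ble M₀ M) (Nat.add a r) (Nat.sub a r)) f) false

theorem exists_of_withLogNear {P E a M₀ M : ℕ} {f : ℕ → Bool} (hM₀ : 0 < M₀)
    (ha : IsApprox P E a (Real.log (M₀ / 2 ^ P))) (h : withLogNear P a M₀ M f = true) :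
    2 ^ P ≤ M ∧ ∃ b, IsApprox P (E + 5) b (Real.log (M / 2 ^ P)) ∧ f b = true := by
  simp only [withLogNear, withValue_eq, fastLog2_eq] at h
  obtain ⟨s, hs⟩ : ∃ s, s = Nat.log2 (Nat.div (Nat.add M M₀) (natDist M M₀)) := ⟨_, rfl⟩
  rw [← hs] at h
  cases hc : (Nat.ble 2 s && Nat.ble (Nat.pow 2 P) M) with
  | false => rw [hc] at h; exact absurd h (by simp)
  | true =>
    rw [hc, cond_true] at h
    rw [Bool.and_eq_true] at hc
    have h2 : 2 ≤ s := Nat.le_of_ble_eq_true hc.1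
    have hPM : 2 ^ P ≤ M := Nat.le_of_ble_eq_true hc.2
    refine ⟨hPM, _, ?_, h⟩
    have hquot : (M + M₀) / natDist M M₀ ≠ 0 := by
      intro h0
      have : s = Nat.log2 ((M + M₀) / natDist M M₀) := hs
      rw [h0, Nat.log2_zero] at this
      omega
    have hspow : 2 ^ s * natDist M M₀ ≤ M + M₀ := by
      have h1 : 2 ^ s ≤ (M + M₀) / natDist M M₀ := hs ▸ Nat.log2_self_le hquot
      exact (Nat.mul_le_mul_right _ h1).trans (Nat.div_mul_le_self _ _)
    have hsN : P + 1 ≤ s * (2 * (P / (2 * s) + 1)) := by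
      have h1 := Nat.div_add_mod P (2 * s)
      have h3 := Nat.mod_lt P (show 0 < 2 * s by omega)
      have e : s * (2 * (P / (2 * s) + 1)) = 2 * s * (P / (2 * s)) + 2 * s := by ring
      omega
    have hr := isApprox_logRatio (P := P) (N := P / (2 * s) + 1) (ρ := 2 ^ s) (p := natDist M M₀)
      (q := M + M₀) ((show 3 ≤ 2 ^ 2 by norm_num).trans (Nat.pow_le_pow_right two_pos h2))
      (by omega) hspow (by rw [← pow_mul]; exact Nat.pow_le_pow_right two_pos hsN)
    change IsApprox P (E + 5) (cond (Nat.ble M₀ M)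
      (a + logRatioApprox P (P / (2 * s) + 1) (natDist M M₀) (M + M₀))
      (a - logRatioApprox P (P / (2 * s) + 1) (natDist M M₀) (M + M₀))) _
    generalize logRatioApprox P (P / (2 * s) + 1) (natDist M M₀) (M + M₀) = r at *
    have hU : (0 : ℝ) < 2 ^ P := by positivity
    have hM0R : (0 : ℝ) < M₀ := by exact_mod_cast hM₀
    have hMR : (2 : ℝ) ^ P ≤ M := by exact_mod_cast hPM
    have hM : (0 : ℝ) < M := hU.trans_le hMR
    rw [Real.log_div hM.ne' hU.ne']
    rw [Real.log_div hM0R.ne' hU.ne'] at ha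
    rw [natDist_cast] at hr
    have h0 : 0 ≤ Real.log M - Real.log (2 ^ P) := sub_nonneg.2 (Real.log_le_log hU hMR)
    unfold IsApprox at *
    push_cast at *
    cases hb : Nat.ble M₀ M with
    | true =>
      have hle : (M₀ : ℝ) ≤ M := by exact_mod_cast Nat.le_of_ble_eq_true hb
      rw [abs_of_nonneg (sub_nonneg.2 hle), show (M + M₀ + (M - M₀) : ℝ) = 2 * M by ring,
        show (M + M₀ - (M - M₀) : ℝ) = 2 * M₀ by ring, Real.log_mul two_ne_zero hM.ne',
        Real.log_mul two_ne_zero hM0R.ne'] at hr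
      rw [cond_true]
      push_cast
      rw [abs_le] at *
      constructor <;> linarith
    | false =>
      have hle : (M : ℝ) ≤ M₀ := by
        have : ¬ M₀ ≤ M := fun h => by rw [Nat.ble_eq_true_of_le h] at hb; cases hb
        exact_mod_cast (not_le.1 this).le
      rw [abs_of_nonpos (sub_nonpos.2 hle), show (M + M₀ + -(M - M₀) : ℝ) = 2 * M₀ by ring,
        show (M + M₀ - -(M - M₀) : ℝ) = 2 * M by ring, Real.log_mul two_ne_zero hM.ne',
        Real.log_mul two_ne_zero hM0R.ne'] at hr
      rw [cond_false]
      have h0' := mul_nonneg hU.le h0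
      rcases le_total r a with hra | hra
      · rw [Nat.cast_sub hra]
        rw [abs_le] at *
        constructor <;> linarith
      · have hra' : (a : ℝ) ≤ r := by exact_mod_cast hra
        rw [Nat.sub_eq_zero_of_le hra, Nat.cast_zero]
        rw [abs_le] at *
        constructor <;> linarith

namespace ThueRoots

variable {A B U r : ℕ} (S : ThueRoots (A : ℤ) (B : ℤ))

/-- Approximation of the middle root by a sign change. -/
theorem abs_α_one_mul_sub_le (hU : 0 < U) (hr : U ≤ r - 4)
    (h₁ : U ^ 3 < (r - 4) * (A * U - (r - 4)) * (B * U - (r - 4)))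
    (h₂ : (r + 4) * (A * U - (r + 4)) * (B * U - (r + 4)) < U ^ 3) :
    |S.α 1 * U - r| ≤ 4 := by
  obtain ⟨ρ, hρ⟩ : ∃ ρ, ρ = r - 4 := ⟨_, rfl⟩
  rw [← hρ] at hr h₁
  have hU' : (0 : ℝ) < U := by exact_mod_cast hU
  have hhalf := mul_lt_mul_of_pos_right S.lt_half hU'
  have hone := mul_lt_mul_of_pos_right S.one_lt hU'
  have htwo := mul_lt_mul_of_pos_right S.lt_two hU'
  have hAB : A ≤ B := by have := S.four_mul_le; have := S.two_le; omega
  have hABN : A * U ≤ B * U := Nat.mul_le_mul_right _ hAB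
  have hABU : (A : ℝ) * U ≤ B * U := by exact_mod_cast hABN
  have hr' : (U : ℝ) ≤ (ρ : ℝ) := by exact_mod_cast hr
  have h4 : (ρ : ℝ) = r - 4 := by rw [hρ, Nat.cast_sub (by omega)]; norm_num
  push_cast at hone htwo
  rw [abs_le]
  constructor
  · by_contra! hcon
    have k₁ : 0 < A * U - ρ := by
      rcases Nat.eq_zero_or_pos (A * U - ρ) with h0 | h0
      · rw [h0, mul_zero, zero_mul] at h₁; omega
      · exact h0
    have h₁' : (U : ℝ) ^ 3 < (r - 4) * (A * U - (r - 4)) * (B * U - (r - 4)) := by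
      rw [← h4]
      have : ((U ^ 3 : ℕ) : ℝ) < _ := Nat.cast_lt.2 h₁
      rw [Nat.cast_mul, Nat.cast_mul, Nat.cast_sub (by omega), Nat.cast_sub (by omega)] at this
      push_cast at this ⊢
      exact this
    have hρA : (ρ : ℝ) < A * U := by exact_mod_cast (by omega : ρ < A * U)
    have hprod := S.prod_sub_mul (r - 4) U
    push_cast at hprod
    have hneg : (r - 4 - S.α 0 * U) * (r - 4 - S.α 1 * U) * (r - 4 - S.α 2 * U) < 0 :=
      mul_neg_of_pos_of_neg (mul_pos (by linarith) (by linarith)) (by linarith)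
    rw [hprod] at hneg
    linarith
  · by_contra! hcon
    have hlt : r + 4 < A * U := by
      have : (r + 4 : ℝ) < A * U := by linarith
      exact_mod_cast this
    have h₂' : ((r : ℝ) + 4) * (A * U - (r + 4)) * (B * U - (r + 4)) < (U : ℝ) ^ 3 := by
      have : _ < ((U ^ 3 : ℕ) : ℝ) := Nat.cast_lt.2 h₂
      rw [Nat.cast_mul, Nat.cast_mul, Nat.cast_sub (by omega), Nat.cast_sub (by omega)] at this
      push_cast at this ⊢
      exact this
    have hprod := S.prod_sub_mul (r + 4) U
    push_cast at hprod
    have hpos : 0 < (r + 4 - S.α 0 * U) * (r + 4 - S.α 1 * U) * (r + 4 - S.α 2 * U) :=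
      mul_pos_of_neg_of_neg (mul_neg_of_pos_of_neg (by linarith) (by linarith)) (by linarith)
    rw [hprod] at hpos
    linarith

/-- Approximation of the largest root by a sign change. -/
theorem abs_α_two_mul_sub_le (hU : 0 < U) (hr : 4 ≤ r)
    (h₁ : (r - 4) * ((r - 4) - A * U) * ((r - 4) - B * U) < U ^ 3)
    (h₂ : U ^ 3 < (r + 4) * ((r + 4) - A * U) * ((r + 4) - B * U)) :
    |S.α 2 * U - r| ≤ 4 := by
  obtain ⟨ρ, hρ⟩ : ∃ ρ, ρ = r - 4 := ⟨_, rfl⟩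
  rw [← hρ] at h₁
  have hU' : (0 : ℝ) < U := by exact_mod_cast hU
  have hhalf := mul_lt_mul_of_pos_right S.lt_half hU'
  have hone := mul_lt_mul_of_pos_right S.one_lt hU'
  have htwo := mul_lt_mul_of_pos_right S.lt_two hU'
  have hA : 1 ≤ A := by have := S.two_le; omega
  have hAU : U ≤ A * U := Nat.le_mul_of_pos_left _ hA
  have hAU' : (U : ℝ) ≤ A * U := by exact_mod_cast hAU
  have hAB : A ≤ B := by have := S.four_mul_le; have := S.two_le; omega
  have hABN : A * U ≤ B * U := Nat.mul_le_mul_right _ hAB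
  have hABU : (A : ℝ) * U ≤ B * U := by exact_mod_cast hABN
  have h4 : (ρ : ℝ) = r - 4 := by rw [hρ, Nat.cast_sub (by omega)]; norm_num
  push_cast at hone htwo
  rw [abs_le]
  constructor
  · by_contra! hcon
    have hlt : B * U < ρ := by
      have : (B : ℝ) * U < (ρ : ℝ) := by rw [h4]; linarith
      exact_mod_cast this
    have h₁' : ((r : ℝ) - 4) * ((r - 4) - A * U) * ((r - 4) - B * U) < (U : ℝ) ^ 3 := by
      rw [← h4]
      have : _ < ((U ^ 3 : ℕ) : ℝ) := Nat.cast_lt.2 h₁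
      rw [Nat.cast_mul, Nat.cast_mul, Nat.cast_sub (by omega), Nat.cast_sub (by omega)] at this
      push_cast at this ⊢
      exact this
    have hprod := S.prod_sub_mul (r - 4) U
    push_cast at hprod
    have hpos : 0 < (r - 4 - S.α 0 * U) * (r - 4 - S.α 1 * U) * (r - 4 - S.α 2 * U) :=
      mul_pos (mul_pos (by linarith) (by linarith)) (by linarith)
    rw [hprod] at hpos
    linarith
  · by_contra! hcon
    have k₁ : 0 < r + 4 - B * U := by
      rcases Nat.eq_zero_or_pos (r + 4 - B * U) with h0 | h0
      · rw [h0, mul_zero] at h₂; omega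
      · exact h0
    have h₂' : (U : ℝ) ^ 3 < (r + 4) * ((r + 4) - A * U) * ((r + 4) - B * U) := by
      have : ((U ^ 3 : ℕ) : ℝ) < _ := Nat.cast_lt.2 h₂
      rw [Nat.cast_mul, Nat.cast_mul, Nat.cast_sub (by omega), Nat.cast_sub (by omega)] at this
      push_cast at this ⊢
      exact this
    have hlt : (B : ℝ) * U < r + 4 := by exact_mod_cast (by omega : B * U < r + 4)
    have hprod := S.prod_sub_mul (r + 4) U
    push_cast at hprod
    have hneg : (r + 4 - S.α 0 * U) * (r + 4 - S.α 1 * U) * (r + 4 - S.α 2 * U) < 0 :=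
      mul_neg_of_pos_of_neg (mul_pos (by linarith) (by linarith)) (by linarith)
    rw [hprod] at hneg
    linarith

end ThueRoots

namespace BakerDavenport

/-- Fixed-point iteration for the middle root, scaled by `U`, where `a = A U` and `b = B U`. -/
def rootOneIter (U a b k : ℕ) : ℕ :=
  Nat.rec (motive := fun _ => ℕ) a (fun _ x =>
    withValue x fun x => Nat.sub a (Nat.div (Nat.pow U 3) (Nat.mul x (Nat.sub b x)))) k

/-- Fixed-point iteration for the largest root, scaled by `U`, where `a = A U` and `b = B U`. -/
def rootTwoIter (U a b k : ℕ) : ℕ :=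
  Nat.rec (motive := fun _ => ℕ) b (fun _ x =>
    withValue x fun x => Nat.add b (Nat.div (Nat.pow U 3) (Nat.mul x (Nat.sub x a)))) k

/-- Sign changes certifying that `r₁`, `r₂` approximate the two larger roots. -/
def rootsOk (U a b r₁ r₂ : ℕ) : Bool :=
  Nat.ble U (r₁ - 4) &&
  Nat.blt (U ^ 3) ((r₁ - 4) * (a - (r₁ - 4)) * (b - (r₁ - 4))) &&
  Nat.blt ((r₁ + 4) * (a - (r₁ + 4)) * (b - (r₁ + 4))) (U ^ 3) &&
  Nat.ble 4 r₂ &&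
  Nat.blt ((r₂ - 4) * ((r₂ - 4) - a) * ((r₂ - 4) - b)) (U ^ 3) &&
  Nat.blt (U ^ 3) ((r₂ + 4) * ((r₂ + 4) - a) * ((r₂ + 4) - b))

/-- The reduction with exponents bounded by `X` for the form with coefficients close to
`N₁`, `N₂`, `N₃`, down to `|y| < 2 ^ t`. -/
def formOk (P E X t N₁ N₂ N₃ : ℕ) : Bool :=
  withValue (2 ^ (P - 3 * t) + (2 * X + 1) * E) fun D => search N₁ N₂ N₃ X D 900 N₂ N₁ 0 1

/-- The reduction for all three forms. -/
def roundOk (P E l₁ l₂ m₀ m₂ g g' g'' X t : ℕ) : Bool :=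
  withValue (natDist l₁ l₂) fun a => withValue (m₀ + 2 * m₂) fun b =>
  withValue (natDist g g') fun c => withValue (l₁ + 2 * l₂) fun a' =>
  withValue (natDist m₂ m₀) fun b' => withValue (natDist g'' g) fun c' =>
  withValue (2 * l₁ + l₂) fun a'' => withValue (2 * m₀ + m₂) fun b'' =>
  withValue (natDist g' g'') fun c'' =>
  formOk P E X t a b c && formOk P E X t a' b' c' && formOk P E X t a'' b'' c''

/-- Passes fixed-point approximations of the logarithms attached to the index `n`, with
`A = fib n`, to `f`; here `a` approximates `log 2`. -/
def withLogs (P N a n A : ℕ) (f : ℕ → ℕ → ℕ → ℕ → ℕ → ℕ → ℕ → Bool) : Bool :=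
  withValue (2 ^ P) fun U => withValue (A * U) fun AU => withValue (2 ^ n * U) fun BU =>
  withValue (P / n + 20) fun k =>
  withValue (rootOneIter U AU BU k) fun r₁ => withValue (rootTwoIter U AU BU k) fun r₂ =>
  rootsOk U AU BU r₁ r₂ &&
  withValue (logNatApprox P N a 0 A) fun la => withValue (n * a) fun lb =>
  withLogNear P la AU r₁ fun l₁ => withLogNear P lb BU r₂ fun l₂ =>
  withLogNear P la AU (r₁ + r₂ - BU) fun m₀ => withLogNear P lb BU (r₂ - AU) fun m₂ =>
  withLogNear P la AU (2 * r₁ + r₂ - (AU + BU)) fun g =>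
  withLogNear P lb BU (2 * r₂ + r₁ - (AU + BU)) fun g' =>
  withLogNear P m₂ (r₂ - AU) (r₂ - r₁) fun g'' => f l₁ l₂ m₀ m₂ g g' g''

/-- The complete reduction for the index `n`, with `A = fib n`. -/
def indexOk (P N a n A : ℕ) : Bool :=
  withValue (fastLog2 (A * 2 ^ n) - 1) fun T => withValue (3 * (n * (2 ^ 10 + 2) + 39)) fun E =>
  withLogs P N a n A fun l₁ l₂ m₀ m₂ g g' g'' =>
    cond (Nat.blt n 75)
      (roundOk P E l₁ l₂ m₀ m₂ g g' g'' (2 ^ 368) 130 &&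
        cond (Nat.blt T 16)
          (roundOk P E l₁ l₂ m₀ m₂ g g' g'' 631 16 &&
            roundOk P E l₁ l₂ m₀ m₂ g g' g'' 78 (cond (Nat.blt n 5) (T + 1) T))
          (roundOk P E l₁ l₂ m₀ m₂ g g' g'' 631 T))
      (roundOk P E l₁ l₂ m₀ m₂ g g' g'' (2 ^ 368) (min T (P / 3)))

/-- `p i (fib i)` for `k` consecutive indices starting with `n`, where `A = fib n` and
`A' = fib (n + 1)`. -/
def forallFib (p : ℕ → ℕ → Bool) (k : ℕ) : ℕ → ℕ → ℕ → Bool :=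
  Nat.rec (motive := fun _ => ℕ → ℕ → ℕ → Bool) (fun _ _ _ => true)
    (fun _ ih n A A' => p n A && withValue (Nat.succ n) fun n => withValue (Nat.add A A') fun A'' =>
      ih n A' A'') k

end BakerDavenport

theorem IsApprox.of_log_div_near {P E b M : ℕ} {y : ℝ}
    (h : IsApprox P E b (Real.log (M / 2 ^ P))) (hM : 2 ^ P ≤ M) (hy : |y * 2 ^ P - M| ≤ 12)
    (hP : 5 ≤ P) : IsApprox P (E + 24) b (Real.log y) := by
  have hU : (0 : ℝ) < 2 ^ P := by positivity
  refine h.of_log_near (c := 12) ?_ ?_ ?_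
  · rw [le_div_iff₀ hU, one_mul]; exact_mod_cast hM
  · rw [le_div_iff₀ hU, ← abs_of_pos hU, ← abs_mul, abs_of_pos hU, sub_mul,
      div_mul_cancel₀ _ hU.ne']
    exact_mod_cast hy
  · exact (by norm_num : 2 * 12 ≤ 2 ^ 5).trans (Nat.pow_le_pow_right two_pos hP)

namespace BakerDavenport

variable {P N a n A E : ℕ}

theorem exists_of_withLogs {f : ℕ → ℕ → ℕ → ℕ → ℕ → ℕ → ℕ → Bool}
    (S : ThueRoots (A : ℤ) ((2 ^ n : ℕ) : ℤ)) (ha : IsApprox P E a (Real.log 2))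
    (hN : 2 ^ (P + 1) ≤ 9 ^ N) (hP : 5 ≤ P) (h : withLogs P N a n A f = true) :
    ∃ l₁ l₂ m₀ m₂ g g' g'', IsApprox P (n * E + 39) l₁ (S.ℓ 1) ∧
      IsApprox P (n * E + 39) l₂ (S.ℓ 2) ∧ IsApprox P (n * E + 39) m₀ (S.m 0) ∧
      IsApprox P (n * E + 39) m₂ (S.m 2) ∧ IsApprox P (n * E + 39) g (S.gap 0 1) ∧
      IsApprox P (n * E + 39) g' (S.gap 0 2) ∧ IsApprox P (n * E + 39) g'' (S.gap 1 2) ∧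
      f l₁ l₂ m₀ m₂ g g' g'' = true := by
  simp only [withLogs, withValue_eq, Bool.and_eq_true] at h
  obtain ⟨hroots, h⟩ := h
  generalize rootOneIter (2 ^ P) (A * 2 ^ P) (2 ^ n * 2 ^ P) (P / n + 20) = r₁ at *
  generalize rootTwoIter (2 ^ P) (A * 2 ^ P) (2 ^ n * 2 ^ P) (P / n + 20) = r₂ at *
  have hUN : 0 < 2 ^ P := Nat.two_pow_pos P
  have hU : (0 : ℝ) < 2 ^ P := by positivity
  have hA2 : 2 ≤ A := by have := S.two_le; omega
  have hAB : A < 2 ^ n := by have := S.four_mul_le; omega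
  obtain ⟨d₁, d₂⟩ : |S.α 1 * 2 ^ P - r₁| ≤ 4 ∧ |S.α 2 * 2 ^ P - r₂| ≤ 4 := by
    simp only [rootsOk, Nat.blt, Bool.and_eq_true, Nat.ble_eq, Nat.succ_le_iff] at hroots
    obtain ⟨⟨⟨⟨⟨c₁, c₂⟩, c₃⟩, c₄⟩, c₅⟩, c₆⟩ := hroots
    have e₁ := S.abs_α_one_mul_sub_le hUN c₁ c₂ c₃
    have e₂ := S.abs_α_two_mul_sub_le hUN c₄ c₅ c₆
    push_cast at e₁ e₂
    exact ⟨e₁, e₂⟩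
  have hla : IsApprox P (n * E + 5) (logNatApprox P N a 0 A)
      (Real.log ((A * 2 ^ P : ℕ) / 2 ^ P)) := by
    have h0 := isApprox_logNat (Q := 0) (w := n) (M := A) ha hN (by rw [pow_zero]; omega)
      (by rw [zero_add]; exact hAB)
    rw [pow_zero, div_one] at h0
    push_cast
    rwa [mul_div_cancel_right₀ _ hU.ne']
  have hlb : IsApprox P (n * E + 5) (n * a) (Real.log ((2 ^ n * 2 ^ P : ℕ) / 2 ^ P)) := by
    have h0 := (ha.nat_mul n).mono (Nat.le_add_right _ 5)
    push_cast
    rwa [mul_div_cancel_right₀ _ hU.ne', Real.log_pow]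
  have hAU : 0 < A * 2 ^ P := by positivity
  have hBU : 0 < 2 ^ n * 2 ^ P := by positivity
  obtain ⟨p₁, l₁, hl₁, h⟩ := exists_of_withLogNear hAU hla h
  obtain ⟨p₂, l₂, hl₂, h⟩ := exists_of_withLogNear hBU hlb h
  obtain ⟨p₃, m₀, hm₀, h⟩ := exists_of_withLogNear hAU hla h
  obtain ⟨p₄, m₂, hm₂, h⟩ := exists_of_withLogNear hBU hlb h
  obtain ⟨p₅, g, hg, h⟩ := exists_of_withLogNear hAU hla h
  obtain ⟨p₆, g', hg', h⟩ := exists_of_withLogNear hBU hlb h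
  obtain ⟨p₇, g'', hg'', h⟩ := exists_of_withLogNear (hUN.trans_le p₄) hm₂ h
  have hv := S.vieta.1
  have hvU : S.α 0 * 2 ^ P + S.α 1 * 2 ^ P + S.α 2 * 2 ^ P = A * 2 ^ P + 2 ^ n * 2 ^ P := by
    push_cast at hv; rw [← add_mul, ← add_mul, hv, add_mul]
  rw [abs_le] at d₁ d₂
  refine ⟨l₁, l₂, m₀, m₂, g, g', g'', ?_, ?_, ?_, ?_, ?_, ?_, ?_, h⟩
  · rw [ThueRoots.ℓ, Real.log_abs]
    refine (hl₁.of_log_div_near p₁ ?_ hP).mono (by omega)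
    rw [abs_le]; constructor <;> linarith
  · rw [ThueRoots.ℓ, Real.log_abs]
    refine (hl₂.of_log_div_near p₂ ?_ hP).mono (by omega)
    rw [abs_le]; constructor <;> linarith
  · rw [ThueRoots.m, abs_sub_comm, Real.log_abs]
    refine (hm₀.of_log_div_near p₃ ?_ hP).mono (by omega)
    rw [Nat.cast_sub (by omega), abs_le]; push_cast; constructor <;> linarith
  · rw [ThueRoots.m, Real.log_abs]
    refine (hm₂.of_log_div_near p₄ ?_ hP).mono (by omega)
    rw [Nat.cast_sub (by omega), abs_le]; push_cast; constructor <;> linarith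
  · rw [ThueRoots.gap, abs_sub_comm, Real.log_abs]
    refine (hg.of_log_div_near p₅ ?_ hP).mono (by omega)
    rw [Nat.cast_sub (by omega), abs_le]; push_cast; constructor <;> linarith
  · rw [ThueRoots.gap, abs_sub_comm, Real.log_abs]
    refine (hg'.of_log_div_near p₆ ?_ hP).mono (by omega)
    rw [Nat.cast_sub (by omega), abs_le]; push_cast; constructor <;> linarith
  · rw [ThueRoots.gap, abs_sub_comm, Real.log_abs]
    refine (hg''.of_log_div_near p₇ ?_ hP).mono (by omega)
    rw [Nat.cast_sub (by omega), abs_le]; push_cast; constructor <;> linarith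

theorem lt_abs_of_formOk {X t N₁ N₂ N₃ : ℕ} (h : formOk P E X t N₁ N₂ N₃ = true) {a₁ a₂ a₃ : ℝ}
    (h₁ : IsApprox P E N₁ |a₁|) (h₂ : IsApprox P E N₂ |a₂|) (h₃ : IsApprox P E N₃ |a₃|)
    (ht : 3 * t ≤ P) {u v : ℤ} (hu : |u| ≤ X) (hv : |v| ≤ X) :
    1 / 2 ^ (3 * t) < |u * a₁ + v * a₂ - a₃| := by
  rw [formOk, withValue_eq] at h
  exact lt_abs_of_search h h₁ h₂ h₃ ht le_rfl hu hv

theorem lt_abs_lam_of_roundOk {A B : ℤ} (S : ThueRoots A B) {l₁ l₂ m₀ m₂ g g' g'' X t : ℕ}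
    (h : roundOk P (3 * E) l₁ l₂ m₀ m₂ g g' g'' X t = true)
    (hl₁ : IsApprox P E l₁ (S.ℓ 1)) (hl₂ : IsApprox P E l₂ (S.ℓ 2)) (hm₀ : IsApprox P E m₀ (S.m 0))
    (hm₂ : IsApprox P E m₂ (S.m 2)) (hg : IsApprox P E g (S.gap 0 1))
    (hg' : IsApprox P E g' (S.gap 0 2)) (hg'' : IsApprox P E g'' (S.gap 1 2))
    (ht : 3 * t ≤ P) (j : Fin 3) {u v : ℤ} (hu : |u| ≤ X) (hv : |v| ≤ X) :
    1 / 2 ^ (3 * t) < |S.lam j u v| := by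
  simp only [roundOk, withValue_eq, Bool.and_eq_true] at h
  obtain ⟨⟨h₀, h₁⟩, h₂⟩ := h
  have sℓ := S.sum_ℓ
  have sm := S.sum_m
  have p₁ := S.ℓ_one_pos
  have p₂ := S.ℓ_one_lt_two
  have p₃ := S.m_zero_pos
  have p₄ := S.m_zero_lt_two
  have gap_comm : ∀ i j, S.gap i j = S.gap j i := fun i j => by
    rw [ThueRoots.gap, ThueRoots.gap, abs_sub_comm]
  have hE : E + E ≤ 3 * E := by omega
  unfold ThueRoots.lam
  fin_cases j
  · refine lt_abs_of_formOk h₀ ((hl₁.dist hl₂).mono hE) ?_ ((hg.dist hg').mono hE) ht hu hv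
    have e : |S.m 1 - S.m 2| = S.m 0 + (2 : ℕ) * S.m 2 := by
      rw [abs_of_neg (by linarith)]; push_cast; linarith
    exact (e ▸ hm₀.add (hm₂.nat_mul 2)).mono (by omega)
  · refine lt_abs_of_formOk h₁ ?_ ((hm₂.dist hm₀).mono hE) ?_ ht hu hv
    · have e : |S.ℓ 2 - S.ℓ 0| = S.ℓ 1 + (2 : ℕ) * S.ℓ 2 := by
        rw [abs_of_pos (by linarith)]; push_cast; linarith
      exact (e ▸ hl₁.add (hl₂.nat_mul 2)).mono (by omega)
    · change IsApprox P _ _ |S.gap 1 2 - S.gap 1 0|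
      rw [gap_comm 1 0]
      exact (hg''.dist hg).mono hE
  · refine lt_abs_of_formOk h₂ ?_ ?_ ?_ ht hu hv
    · have e : |S.ℓ 0 - S.ℓ 1| = (2 : ℕ) * S.ℓ 1 + S.ℓ 2 := by
        rw [abs_of_neg (by linarith)]; push_cast; linarith
      exact (e ▸ (hl₁.nat_mul 2).add hl₂).mono (by omega)
    · have e : |S.m 0 - S.m 1| = (2 : ℕ) * S.m 0 + S.m 2 := by
        rw [abs_of_pos (by linarith)]; push_cast; linarith
      exact (e ▸ (hm₀.nat_mul 2).add hm₂).mono (by omega)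
    · change IsApprox P _ _ |S.gap 2 0 - S.gap 2 1|
      rw [gap_comm 2 0, gap_comm 2 1]
      exact (hg'.dist hg'').mono hE

end BakerDavenport

namespace BakerDavenport

theorem abs_lt_two_pow_of_lt {l : ℝ} {y : ℤ} {t : ℕ} (h : 1 / 2 ^ (3 * t) < l)
    (h' : l ≤ 1 / |(y : ℝ)| ^ 3) : |y| < 2 ^ t := by
  by_contra! hy
  have hy' : (2 : ℝ) ^ t ≤ |(y : ℝ)| := by exact_mod_cast hy
  have h3 : ((2 : ℝ) ^ t) ^ 3 ≤ |(y : ℝ)| ^ 3 := pow_le_pow_left₀ (by positivity) hy' 3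
  rw [← pow_mul, mul_comm] at h3
  have := one_div_le_one_div_of_le (by positivity) h3
  linarith

theorem abs_exponent_le {u y : ℤ} {t X : ℕ} (hu : |(u : ℝ)| ≤ 7 * Real.log |(y : ℝ)|)
    (hy : 2 ≤ |y|) (ht : |y| < 2 ^ t) (hX : 7 * t * 6931472 ≤ X * 10000000) : |u| ≤ X := by
  have hy2 : (2 : ℝ) ≤ |(y : ℝ)| := by exact_mod_cast hy
  have hyt : |(y : ℝ)| ≤ 2 ^ t := by exact_mod_cast ht.le
  have hlog : Real.log |(y : ℝ)| ≤ t * Real.log 2 := by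
    rw [← Real.log_pow]; exact Real.log_le_log (by linarith) hyt
  have hX' : (7 * t * 6931472 : ℝ) ≤ X * 10000000 := by exact_mod_cast hX
  have h2 := mul_le_mul_of_nonneg_left Real.log_two_lt_d9.le (Nat.cast_nonneg (α := ℝ) t)
  have : |(u : ℝ)| ≤ X := by
    have h0 : (0 : ℝ) ≤ t := Nat.cast_nonneg t
    norm_num at h2
    linarith
  exact_mod_cast this

theorem lt_of_indexOk {P N a n A : ℕ} (S : ThueRoots (A : ℤ) ((2 ^ n : ℕ) : ℤ))
    (ha : IsApprox P (2 ^ 10 + 2) a (Real.log 2)) (hN : 2 ^ (P + 1) ≤ 9 ^ N) (hP : 450 ≤ P)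
    (hn : n ≤ 4096) (h : indexOk P N a n A = true) {x y : ℤ} (hy : 2 ≤ |y|)
    (hxy : |((x * (x - (A : ℤ) * y) * (x - ((2 ^ n : ℕ) : ℤ) * y) - y ^ 3 : ℤ) : ℝ)| = 1) :
    n < 5 ∧ |y| < 2 ^ Nat.log2 (A * 2 ^ n) := by
  simp only [indexOk, withValue_eq, fastLog2_eq] at h
  obtain ⟨j, u, v, hlam, hY, hu, hv, -, -⟩ := S.exists_lam_small hxy hy
  have hlog2 : (0 : ℝ) < Real.log 2 := Real.log_pos one_lt_two
  obtain ⟨hu', hv'⟩ := S.exponents_lt hu hv hy hlam (k := 12) le_rfl (by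
    have hn' : (n : ℝ) ≤ 4096 := by exact_mod_cast hn
    push_cast
    rw [Real.log_pow]
    have := Real.log_two_lt_d9
    norm_num at this ⊢
    nlinarith)
  obtain ⟨l₁, l₂, m₀, m₂, g, g', g'', hl₁, hl₂, hm₀, hm₂, hg, hg', hg'', h⟩ :=
    exists_of_withLogs S ha hN (by omega) h
  have hround : ∀ {X t : ℕ}, roundOk P (3 * (n * (2 ^ 10 + 2) + 39)) l₁ l₂ m₀ m₂ g g' g'' X t = true →
      3 * t ≤ P → |u| ≤ X → |v| ≤ X → |y| < 2 ^ t := fun {X t} hr ht hu hv =>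
    abs_lt_two_pow_of_lt (lt_abs_lam_of_roundOk S hr hl₁ hl₂ hm₀ hm₂ hg hg' hg'' ht j hu hv) hlam
  have hA2 : 2 ≤ A := by have := S.two_le; omega
  have hAB0 : A * 2 ^ n ≠ 0 := by positivity
  have hA4 : 2 ^ 1 ≤ A * 2 ^ n := by have := Nat.two_pow_pos n; nlinarith
  have hlog1 : 1 ≤ Nat.log2 (A * 2 ^ n) := (Nat.le_log2 hAB0).2 hA4
  obtain ⟨T, hT⟩ : ∃ T, Nat.log2 (A * 2 ^ n) = T + 1 := ⟨_, (Nat.sub_add_cancel hlog1).symm⟩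
  have hT2 : 2 ^ (T + 1) ≤ A * 2 ^ n := hT ▸ Nat.log2_self_le hAB0
  have hTy : (2 : ℤ) ^ T ≤ |y| := by
    have h1 : ((2 ^ (T + 1) : ℕ) : ℝ) ≤ ((A * 2 ^ n : ℕ) : ℝ) := by exact_mod_cast hT2
    push_cast at h1 hY
    rw [pow_succ] at h1
    have : (2 : ℝ) ^ T ≤ |(y : ℝ)| := by linarith
    exact_mod_cast this
  rw [hT, Nat.add_sub_cancel] at h
  rw [hT]
  have hbig : |u| ≤ (2 ^ 368 : ℕ) ∧ |v| ≤ (2 ^ 368 : ℕ) := by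
    push_cast; exact ⟨hu'.le, hv'.le⟩
  cases hc : Nat.blt n 75 with
  | false =>
    rw [hc, cond_false] at h
    have := hround h (by have := Nat.div_mul_le_self P 3; omega) hbig.1 hbig.2
    have h2 : (2 : ℤ) ^ min T (P / 3) ≤ 2 ^ T := pow_le_pow_right₀ (by norm_num) (min_le_left _ _)
    omega
  | true =>
    have hn75 : n < 75 := by simpa [Nat.blt] using hc
    rw [hc, cond_true, Bool.and_eq_true] at h
    have hTle : T + 1 < 151 := by
      rw [← hT, Nat.log2_lt hAB0]
      have hA : A ≤ 2 ^ n := by have := S.four_mul_le; omega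
      have h1 : 2 ^ n ≤ 2 ^ 75 := Nat.pow_le_pow_right two_pos hn75.le
      calc A * 2 ^ n ≤ 2 ^ 75 * 2 ^ 75 := Nat.mul_le_mul (hA.trans h1) h1
        _ < 2 ^ 151 := by norm_num
    have hy130 := hround h.1 (by omega) hbig.1 hbig.2
    have hu130 := abs_exponent_le (X := 631) hu hy hy130 (by norm_num)
    have hv130 := abs_exponent_le (X := 631) hv hy hy130 (by norm_num)
    have h2 := h.2
    cases hd : Nat.blt T 16 with
    | false =>
      rw [hd, cond_false] at h2
      have := hround h2 (by omega) hu130 hv130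
      omega
    | true =>
      rw [hd, cond_true, Bool.and_eq_true] at h2
      have hT16 : T < 16 := by simpa [Nat.blt] using hd
      have hy16 := hround h2.1 (by omega) hu130 hv130
      have hu16 := abs_exponent_le (X := 78) hu hy hy16 (by norm_num)
      have hv16 := abs_exponent_le (X := 78) hv hy hy16 (by norm_num)
      have h3 := h2.2
      cases he : Nat.blt n 5 with
      | false =>
        rw [he, cond_false] at h3
        have := hround h3 (by omega) hu16 hv16
        omega
      | true =>
        rw [he, cond_true] at h3
        exact ⟨by simpa [Nat.blt] using he, hround h3 (by omega) hu16 hv16⟩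

theorem of_forallFib {p : ℕ → ℕ → Bool} {k n : ℕ}
    (h : forallFib p k n (Nat.fib n) (Nat.fib (n + 1)) = true) {i : ℕ} (hi : n ≤ i)
    (hik : i < n + k) : p i (Nat.fib i) = true := by
  induction k generalizing n with
  | zero => omega
  | succ k ih =>
    have h : (p n (Nat.fib n) && withValue (Nat.succ n) fun n' =>
      withValue (Nat.add (Nat.fib n) (Nat.fib (n + 1))) fun A'' =>
        forallFib p k n' (Nat.fib (n + 1)) A'') = true := h
    rw [withValue_eq, withValue_eq, Bool.and_eq_true] at h
    rcases hi.eq_or_lt with rfl | hlt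
    · exact h.1
    · refine ih (n := n + 1) ?_ hlt (by omega)
      rw [Nat.fib_add_two]
      exact h.2

end BakerDavenport

namespace BakerDavenport

theorem lt_of_forallFib {P N k m A A' : ℕ}
    (h : (withValue (logTwoApprox P 9) fun a => forallFib (indexOk P N a) k m A A') = true)
    (hA : A = Nat.fib m) (hA' : A' = Nat.fib (m + 1)) (hP : 2 ^ (P + 2) ≤ 9 ^ 2 ^ 9)
    (hN : 2 ^ (P + 1) ≤ 9 ^ N) (hP' : 450 ≤ P) (hmk : m + k ≤ 4096) {n : ℕ} (hn : 3 ≤ n)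
    (hmn : m ≤ n) (hnk : n < m + k) {x y : ℤ} (hy : 2 ≤ |y|)
    (hxy : |((x * (x - (Nat.fib n : ℤ) * y) * (x - (2 : ℤ) ^ n * y) - y ^ 3 : ℤ) : ℝ)| = 1) :
    n < 5 ∧ |y| < 2 ^ Nat.log2 (Nat.fib n * 2 ^ n) := by
  subst hA hA'
  rw [withValue_eq] at h
  have hA : (2 : ℤ) ≤ (Nat.fib n : ℤ) := by exact_mod_cast Nat.fib_mono hn
  have hB : 4 * (Nat.fib n : ℤ) ≤ ((2 ^ n : ℕ) : ℤ) := by exact_mod_cast Nat.four_mul_fib_le n hn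
  obtain ⟨S⟩ := ThueRoots.nonempty hA hB
  refine lt_of_indexOk S (isApprox_logTwo hP) hN hP' (by omega) (of_forallFib h hmn hnk) hy
    (x := x) ?_
  rw [← hxy]
  push_cast
  rfl

end BakerDavenport


theorem ThueRoots.abs_ne_one_of_forall {A B l m : ℤ} (S : ThueRoots A B) (hl : 2 * l ≤ A * B)
    (h : ∀ y ∈ Finset.Ico l m, ∀ x ∈ Finset.Icc (-1) ((B + 1) * m),
      (x * (x - A * y) * (x - B * y) - y ^ 3).natAbs ≠ 1) {x y : ℤ} (hy : 2 ≤ |y|) (hm : |y| < m) :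
    |((x * (x - A * y) * (x - B * y) - y ^ 3 : ℤ) : ℝ)| ≠ 1 := by
  wlog hy0 : 0 < y generalizing x y
  · rw [← abs_neg, ← Int.cast_neg, show -(x * (x - A * y) * (x - B * y) - y ^ 3) =
      -x * (-x - A * -y) * (-x - B * -y) - (-y) ^ 3 by ring]
    have hne : y ≠ 0 := by rintro rfl; simp at hy
    exact this (by rwa [abs_neg]) (by rwa [abs_neg]) (by omega)
  intro hxy
  obtain ⟨j, u, v, -, hY, -, -, hx, -⟩ := S.exists_lam_small hxy hy
  rw [abs_of_pos hy0] at hy hm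
  have hy2 : (2 : ℝ) ≤ y := by exact_mod_cast hy
  have hm' : (y : ℝ) + 1 ≤ m := by exact_mod_cast hm
  rw [abs_of_pos (show (0 : ℝ) < y by linarith)] at hY hx
  have hl' : (2 * l : ℝ) ≤ A * B := by exact_mod_cast hl
  have hly : (l : ℝ) ≤ y := by linarith
  have h1 : 1 / (2 * (y : ℝ) ^ 2) ≤ 1 := by
    rw [div_le_one (by positivity)]; nlinarith
  have hα := S.α_pos j
  have hα' := S.α_le j
  obtain ⟨hx1, hx2⟩ := abs_le.1 (hx.trans h1)
  have h3 : (-1 : ℝ) ≤ x := by nlinarith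
  have h4 : (x : ℝ) ≤ (B + 1) * m := by
    have : 1 ≤ (B : ℝ) + 1 := by
      have := S.two_le; have := S.four_mul_le
      have : (0 : ℤ) ≤ B := by omega
      have : (0 : ℝ) ≤ B := by exact_mod_cast this
      linarith
    nlinarith
  refine h y (Finset.mem_Ico.2 ⟨by exact_mod_cast hly, hm⟩) x
    (Finset.mem_Icc.2 ⟨by exact_mod_cast h3, by exact_mod_cast h4⟩) ?_
  have : |x * (x - A * y) * (x - B * y) - y ^ 3| = 1 := by exact_mod_cast hxy
  rwa [Int.abs_eq_natAbs, Nat.cast_eq_one] at this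

namespace BakerDavenport

set_option maxRecDepth 100000 in
set_option exponentiation.threshold 100000 in
theorem forallFib_three :
    (withValue (logTwoApprox 1160 9) fun a => forallFib (indexOk 1160 370 a) 72 3 2 3) = true := by
  decide +kernel

set_option maxRecDepth 100000 in
set_option exponentiation.threshold 100000 in
theorem forallFib_seventyFive :
    (withValue (logTwoApprox 1160 9) fun a => forallFib (indexOk 1160 370 a) 157 75
      2111485077978050 3416454622906707) = true := by
  decide +kernel

set_option maxRecDepth 100000 in
set_option exponentiation.threshold 100000 in
theorem forallFib_twoHundredThirtyTwo :
    (withValue (logTwoApprox 1480 9) fun a => forallFib (indexOk 1480 470 a) 84 232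
      1366619256256991435939546543402365995473880912459
      2211236406303914545699412969744873993387956988653) = true := by
  decide +kernel

end BakerDavenport

set_option maxRecDepth 100000 in
set_option exponentiation.threshold 100000 in
theorem index_ge_of_solution {n : ℕ} (hn : 3 ≤ n) {x y : ℤ} (hy : 2 ≤ |y|)
    (h : |((x * (x - (Nat.fib n : ℤ) * y) * (x - (2 : ℤ) ^ n * y) - y ^ 3 : ℤ) : ℝ)| = 1) :
    316 ≤ n := by
  by_contra! hlt
  obtain ⟨h5, hy'⟩ : n < 5 ∧ |y| < 2 ^ Nat.log2 (Nat.fib n * 2 ^ n) := by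
    rcases lt_or_ge n 75 with h75 | h75
    · exact BakerDavenport.lt_of_forallFib BakerDavenport.forallFib_three (by norm_num)
        (by norm_num) (by decide +kernel) (by decide +kernel) (by norm_num) (by norm_num)
        hn (by omega) (by omega) hy h
    rcases lt_or_ge n 232 with h232 | h232
    · exact BakerDavenport.lt_of_forallFib BakerDavenport.forallFib_seventyFive (by norm_num)
        (by norm_num) (by decide +kernel) (by decide +kernel) (by norm_num) (by norm_num)
        hn (by omega) (by omega) hy h
    · exact BakerDavenport.lt_of_forallFib BakerDavenport.forallFib_twoHundredThirtyTwo (by norm_num)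
        (by norm_num) (by decide +kernel) (by decide +kernel) (by norm_num) (by norm_num)
        hn (by omega) (by omega) hy h
  obtain rfl | rfl : n = 3 ∨ n = 4 := by omega
  · obtain ⟨S⟩ := ThueRoots.nonempty (A := 2) (B := 8) (by norm_num) (by norm_num)
    exact S.abs_ne_one_of_forall (x := x) (l := 8) (m := 2 ^ 4) (by norm_num) (by decide +kernel) hy
      (hy'.trans_le (by decide +kernel)) (by rw [← h]; norm_num [Nat.fib_add_two])
  · obtain ⟨S⟩ := ThueRoots.nonempty (A := 3) (B := 16) (by norm_num) (by norm_num)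
    exact S.abs_ne_one_of_forall (x := x) (l := 24) (m := 2 ^ 5) (by norm_num) (by decide +kernel) hy
      (hy'.trans_le (by decide +kernel)) (by rw [← h]; norm_num [Nat.fib_add_two])

namespace BakerDavenport

/-- The size condition under which `|u N₁ - w N₂| ≤ D` has no nonzero solution with
`|u|, |w| ≤ X`. -/
def denominatorOk (N₁ N₂ X D q : ℕ) : Bool :=
  withValue (Nat.mul q N₁) fun m => withValue (Nat.div m N₂) fun p =>
  withValue (Nat.mod m N₂) fun s =>
  cond (Nat.ble (Nat.mul 2 s) N₂)
    (Nat.blt (Nat.add (Nat.mul X s) (Nat.mul q D)) N₂ && Nat.beq (Nat.gcd p q) 1)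
    (Nat.blt (Nat.add (Nat.mul X (Nat.sub N₂ s)) (Nat.mul q D)) N₂ &&
      Nat.beq (Nat.gcd (Nat.succ p) q) 1)

/-- Search for a suitable denominator among the convergents of `N₁ / N₂`. -/
def homogeneousSearch (N₁ N₂ X D fuel : ℕ) : ℕ → ℕ → ℕ → ℕ → Bool :=
  Nat.rec (motive := fun _ => ℕ → ℕ → ℕ → ℕ → Bool) (fun _ _ _ _ => false)
    (fun _ ih a b q₀ q =>
      cond (Nat.blt X q && denominatorOk N₁ N₂ X D q) true
        (ih b (Nat.mod a b) q (Nat.add q₀ (Nat.mul (Nat.div a b) q)))) fuel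

/-- The forms in `log A`, `log B`, `log (B - A)`, with approximations `a`, `b`, `c` of these, have
no small values for exponents bounded by `X`. -/
def smallFormOk (X D a b c : ℕ) (skip : Bool) : Bool :=
  withValue (natDist b a) fun N₁ => withValue (a + 2 * c) fun N₂ =>
  withValue (natDist c a) fun M₁ => withValue (a + 2 * b) fun M₂ =>
  homogeneousSearch N₁ N₂ X D 600 N₂ N₁ 0 1 && homogeneousSearch M₁ M₂ X D 600 M₂ M₁ 0 1 &&
  cond skip true
    (withValue (2 * a + b) fun L₁ => withValue (2 * a + c) fun L₂ =>
      homogeneousSearch L₁ L₂ X D 600 L₂ L₁ 0 1)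

/-- The absence of small forms for the index `n`, with `A = fib n`, where `a`, `b` approximate
`log A` and `n log 2`. -/
def midIndexOk (P X n A a b : ℕ) : Bool :=
  withValue (2 ^ n) fun B => withValue (2 ^ P) fun U =>
  withValue (B * U) fun M₀ => withValue ((B - A) * U) fun M =>
  withValue (40 * X * U / (A ^ 2 * B) + 1 + 2 * X * (3 * (n * (2 ^ 10 + 2) + 2 ^ 10 + 8))) fun D =>
  withLogNear P b M₀ M fun c =>
  smallFormOk X D a b c (Nat.blt (5 * X * A) B && Nat.blt (40 * X) (A ^ 3))

/-- The check of `midIndexOk` with the logarithm of `A` computed from scratch. -/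
def midIndexOkNat (P N X l n A : ℕ) : Bool :=
  withValue (logNatApprox P N l 0 A) fun a => withValue (n * l) fun b => midIndexOk P X n A a b

/-- The check of `midIndexOk` with the logarithm of `A` computed by Binet's formula. -/
def midIndexOkBinet (P X l g s n A : ℕ) : Bool :=
  withValue (natDist (n * g) s) fun a => withValue (n * l) fun b => midIndexOk P X n A a b

end BakerDavenport

namespace BakerDavenport

theorem eq_zero_of_coprime {N₁ N₂ X D q p R : ℕ} {r : ℤ} (hX : X < q) (hr : |r| = R)
    (he : (q : ℤ) * N₁ = N₂ * p + r) (hlt : X * R + q * D < N₂) (hc : Nat.gcd p q = 1) {u w : ℤ}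
    (hu : |u| ≤ X) (hD : |u * N₁ - w * N₂| ≤ D) : u = 0 ∧ w = 0 := by
  have hq : (0 : ℤ) < q := by omega
  have key : (N₂ : ℤ) * (u * p - q * w) = q * (u * N₁ - w * N₂) - u * r := by
    linear_combination (-u) * he
  have hb : |(N₂ : ℤ) * (u * p - q * w)| < N₂ := by
    rw [key]
    refine (abs_sub _ _).trans_lt ?_
    rw [abs_mul, abs_mul, Nat.abs_cast, hr]
    have h1 := mul_le_mul_of_nonneg_left hD hq.le
    have h2 := mul_le_mul_of_nonneg_right hu (Int.natCast_nonneg R)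
    zify at hlt
    linarith
  have h0 : u * p - q * w = 0 := by
    have hN : (0 : ℤ) < N₂ := by omega
    exact (mul_eq_zero.1 (Int.eq_zero_of_abs_lt_dvd (dvd_mul_right _ _) hb)).resolve_left hN.ne'
  have hdvd : (q : ℤ) ∣ u * p := ⟨w, by linarith⟩
  have hcop : IsCoprime (q : ℤ) p := (Nat.isCoprime_iff_coprime.2 hc).symm
  have hu0 : u = 0 := Int.eq_zero_of_abs_lt_dvd (hcop.dvd_of_dvd_mul_right hdvd) (by omega)
  refine ⟨hu0, ?_⟩
  rw [hu0, zero_mul, zero_sub, neg_eq_zero] at h0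
  exact (mul_eq_zero.1 h0).resolve_left hq.ne'

theorem eq_zero_of_denominatorOk {N₁ N₂ X D q : ℕ} (h : denominatorOk N₁ N₂ X D q = true)
    (hX : X < q) {u w : ℤ} (hu : |u| ≤ X) (hD : |u * N₁ - w * N₂| ≤ D) : u = 0 ∧ w = 0 := by
  simp only [denominatorOk, withValue_eq] at h
  have e : (q : ℤ) * N₁ = N₂ * ((q * N₁ / N₂ : ℕ) : ℤ) + ((q * N₁ % N₂ : ℕ) : ℤ) := by
    exact_mod_cast (Nat.div_add_mod (q * N₁) N₂).symm
  cases hc : Nat.ble (Nat.mul 2 (Nat.mod (Nat.mul q N₁) N₂)) N₂ with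
  | true =>
    rw [hc, cond_true, Bool.and_eq_true] at h
    exact eq_zero_of_coprime hX (Nat.abs_cast _) e (Nat.le_of_ble_eq_true h.1)
      (Nat.eq_of_beq_eq_true h.2) hu hD
  | false =>
    rw [hc, cond_false, Bool.and_eq_true] at h
    have h1 : X * (N₂ - q * N₁ % N₂) + q * D < N₂ := Nat.le_of_ble_eq_true h.1
    have hlt := (Nat.mod_lt (q * N₁) (show 0 < N₂ by omega)).le
    refine eq_zero_of_coprime (p := q * N₁ / N₂ + 1) (r := ((q * N₁ % N₂ : ℕ) : ℤ) - N₂) hX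
      (R := N₂ - q * N₁ % N₂) ?_ ?_ h1 (Nat.eq_of_beq_eq_true h.2) hu hD
    · rw [abs_of_nonpos (by omega), Nat.cast_sub hlt]; ring
    · rw [e]; push_cast; ring

theorem exists_of_homogeneousSearch {N₁ N₂ X D fuel : ℕ} {a b q₀ q : ℕ}
    (h : homogeneousSearch N₁ N₂ X D fuel a b q₀ q = true) :
    ∃ q, X < q ∧ denominatorOk N₁ N₂ X D q = true := by
  induction fuel generalizing a b q₀ q with
  | zero => exact absurd h (by simp [homogeneousSearch])
  | succ k ih =>
    have h : cond (Nat.blt X q && denominatorOk N₁ N₂ X D q) true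
        (homogeneousSearch N₁ N₂ X D k b (Nat.mod a b) q
          (Nat.add q₀ (Nat.mul (Nat.div a b) q))) = true := h
    cases hc : (Nat.blt X q && denominatorOk N₁ N₂ X D q) with
    | true =>
      rw [Bool.and_eq_true] at hc
      exact ⟨q, Nat.le_of_ble_eq_true hc.1, hc.2⟩
    | false =>
      rw [hc, cond_false] at h
      exact ih h

theorem eq_zero_of_homogeneousSearch {P E N₁ N₂ X D fuel a b q₀ q : ℕ}
    (h : homogeneousSearch N₁ N₂ X D fuel a b q₀ q = true) {a₁ a₂ δ : ℝ}
    (h₁ : IsApprox P E N₁ a₁) (h₂ : IsApprox P E N₂ a₂) (hD : 2 ^ P * δ + 2 * X * E ≤ D)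
    {u w : ℤ} (hu : |u| ≤ X) (hw : |w| ≤ X) (hsmall : |u * a₁ - w * a₂| ≤ δ) : u = 0 ∧ w = 0 := by
  obtain ⟨q, hX, hq⟩ := exists_of_homogeneousSearch h
  refine eq_zero_of_denominatorOk hq hX hu ?_
  have hu' : |(u : ℝ)| ≤ X := by exact_mod_cast hu
  have hw' : |(w : ℝ)| ≤ X := by exact_mod_cast hw
  unfold IsApprox at h₁ h₂
  have k₁ := mul_le_mul hu' h₁ (abs_nonneg _) (Nat.cast_nonneg _)
  have k₂ := mul_le_mul hw' h₂ (abs_nonneg _) (Nat.cast_nonneg _)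
  rw [← abs_mul] at k₁ k₂
  have hP : (0 : ℝ) < 2 ^ P := by positivity
  have k₃ := mul_le_mul_of_nonneg_left hsmall hP.le
  rw [← abs_of_pos hP, ← abs_mul, abs_of_pos hP] at k₃
  have : |(u * N₁ - w * N₂ : ℝ)| ≤ D := by
    rw [show (u * N₁ - w * N₂ : ℝ) = 2 ^ P * (u * a₁ - w * a₂) +
      u * (N₁ - 2 ^ P * a₁) - w * (N₂ - 2 ^ P * a₂) by ring]
    rw [abs_le] at k₁ k₂ k₃ ⊢
    constructor <;> linarith
  exact_mod_cast this

end BakerDavenport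

theorem ThueRoots.lt_abs_third_form {A B : ℤ} {V : ℕ} (hA : 2 ≤ A) (hB : 4 * A ≤ B)
    (hVA : 40 * V < A ^ 3) (hVB : 5 * V * A < B) {U W : ℤ} (hne : ¬ (U = 0 ∧ W = 0))
    (hW : |W| ≤ V) :
    40 * V / (A ^ 2 * B) < |U * (2 * Real.log A + Real.log B) -
      W * (2 * Real.log A + Real.log (B - A))| := by
  have hA' : (2 : ℝ) ≤ A := by exact_mod_cast hA
  have hB' : 4 * (A : ℝ) ≤ B := by exact_mod_cast hB
  have hVA' : 40 * (V : ℝ) < A ^ 3 := by exact_mod_cast hVA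
  have hVB' : 5 * (V : ℝ) * A < B := by exact_mod_cast hVB
  have hW' : |(W : ℝ)| ≤ V := by exact_mod_cast hW
  have A0 : (0 : ℝ) < A := by linarith
  have B0 : (0 : ℝ) < B := by linarith
  have hδ : 40 * V / ((A : ℝ) ^ 2 * B) < A / B := by
    rw [div_lt_div_iff₀ (by positivity) B0]
    nlinarith [mul_lt_mul_of_pos_right hVA' B0]
  have hq : 5 * (V * ((A : ℝ) / B)) < 1 := by
    rw [← mul_div_assoc, ← mul_div_assoc, div_lt_one B0]; linarith
  have hq4 : (A : ℝ) / B ≤ 1 / 4 := by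
    rw [div_le_div_iff₀ B0 (by norm_num)]; linarith
  have hc : |Real.log (B - A) - Real.log B| ≤ 2 * (A / B) := by
    refine Real.abs_log_sub_log_le B0 ?_ (hq4.trans (by norm_num))
    rw [sub_sub_cancel_left, abs_neg, abs_of_pos A0]; field_simp; rfl
  have hc' : A / B ≤ Real.log B - Real.log (B - A) := by
    rw [← Real.log_div B0.ne' (by linarith)]
    have := Real.one_sub_inv_le_log_of_pos (show (0 : ℝ) < B / (B - A) from
      div_pos B0 (by linarith))
    refine le_trans (le_of_eq ?_) this
    rw [inv_div]; field_simp; ring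
  have hlA : 0 < Real.log A := Real.log_pos (by linarith)
  have hlB : 2 ≤ Real.log B := by
    have := Real.log_le_log (by norm_num) (show (8 : ℝ) ≤ B by linarith)
    rw [show (8 : ℝ) = 2 ^ 3 by norm_num, Real.log_pow] at this
    have l2 := Real.log_two_gt_d9
    norm_num at this l2; linarith
  have hWc := abs_mul_sub_le hW' hc
  rw [show (V : ℝ) * (2 * (A / B)) = 2 * (V * (A / B)) by ring] at hWc
  generalize (A : ℝ) / B = q at *
  generalize 40 * V / ((A : ℝ) ^ 2 * B) = δ at *
  by_contra! h
  by_cases hUW : U = W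
  · subst hUW
    rw [show (U : ℝ) * (2 * Real.log A + Real.log B) - U * (2 * Real.log A + Real.log (B - A)) =
      U * (Real.log B - Real.log (B - A)) by ring, abs_mul] at h
    have h2 : (1 : ℝ) ≤ |(U : ℝ)| := by
      exact_mod_cast Int.one_le_abs (fun h0 => hne ⟨h0, h0⟩)
    have h3 := le_abs_self (Real.log B - Real.log (B - A))
    nlinarith [abs_nonneg (Real.log B - Real.log (B - A))]
  · have h2 : (1 : ℝ) ≤ |((U - W : ℤ) : ℝ)| := by
      exact_mod_cast Int.one_le_abs (sub_ne_zero.2 hUW)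
    have h3 : |((U - W : ℤ) : ℝ) * (2 * Real.log A + Real.log B)| ≤ 1 := by
      rw [abs_le] at h hWc ⊢
      push_cast
      constructor <;> linarith
    rw [abs_mul, abs_of_pos (by linarith : 0 < 2 * Real.log A + Real.log B)] at h3
    nlinarith

namespace BakerDavenport

theorem not_small_of_smallFormOk {P E X D a b c : ℕ} {s : Bool} {α β γ δ : ℝ}
    (h : smallFormOk X D a b c s = true) (hα : IsApprox P E a α) (hβ : IsApprox P E b β)
    (hγ : IsApprox P E c γ) (hαβ : α ≤ β) (hαγ : α ≤ γ) (hD : 2 ^ P * δ + 2 * X * (3 * E : ℕ) ≤ D)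
    {u w : ℤ} (hne : ¬ (u = 0 ∧ w = 0)) (hu : |u| ≤ X) (hw : |w| ≤ X) :
    δ < |u * (β - α) - w * (α + 2 * γ)| ∧ δ < |u * (γ - α) - w * (α + 2 * β)| ∧
      (s = false → δ < |u * (2 * α + β) - w * (2 * α + γ)|) := by
  simp only [smallFormOk, withValue_eq, Bool.and_eq_true] at h
  obtain ⟨⟨h₁, h₂⟩, h₃⟩ := h
  have d₁ := (hβ.dist hα).mono (show E + E ≤ 3 * E by omega)
  have d₂ := (hγ.dist hα).mono (show E + E ≤ 3 * E by omega)
  rw [abs_of_nonneg (sub_nonneg.2 hαβ)] at d₁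
  rw [abs_of_nonneg (sub_nonneg.2 hαγ)] at d₂
  have s₁ := (hα.add (hγ.nat_mul 2)).mono (show E + 2 * E ≤ 3 * E by omega)
  have s₂ := (hα.add (hβ.nat_mul 2)).mono (show E + 2 * E ≤ 3 * E by omega)
  have t₁ := ((hα.nat_mul 2).add hβ).mono (show 2 * E + E ≤ 3 * E by omega)
  have t₂ := ((hα.nat_mul 2).add hγ).mono (show 2 * E + E ≤ 3 * E by omega)
  push_cast at s₁ s₂ t₁ t₂
  refine ⟨?_, ?_, ?_⟩
  · by_contra! hs
    exact hne (eq_zero_of_homogeneousSearch h₁ d₁ s₁ hD hu hw hs)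
  · by_contra! hs
    exact hne (eq_zero_of_homogeneousSearch h₂ d₂ s₂ hD hu hw hs)
  · rintro rfl
    rw [cond_false] at h₃
    by_contra! hs
    exact hne (eq_zero_of_homogeneousSearch h₃ t₁ t₂ hD hu hw hs)

theorem not_smallForm_of_midIndexOk {P X n A a b : ℕ} (hA : 2 ≤ A) (hB : 4 * A ≤ 2 ^ n)
    (ha : IsApprox P (n * (2 ^ 10 + 2) + 2 ^ 10 + 8) a (Real.log A))
    (hb : IsApprox P (n * (2 ^ 10 + 2)) b (n * Real.log 2)) (h : midIndexOk P X n A a b = true) :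
    ¬ ThueRoots.SmallForm (A : ℤ) (2 ^ n : ℤ) X (40 * X / (A ^ 2 * 2 ^ n)) := by
  simp only [midIndexOk, withValue_eq] at h
  have hA' : (2 : ℝ) ≤ A := by exact_mod_cast hA
  have hB' : 4 * (A : ℝ) ≤ 2 ^ n := by exact_mod_cast hB
  have hP : (0 : ℝ) < 2 ^ P := by positivity
  have hn : (0 : ℝ) < 2 ^ n := by positivity
  rw [← Real.log_pow] at hb
  obtain ⟨-, c, hc, h⟩ := exists_of_withLogNear (E := n * (2 ^ 10 + 2)) (by positivity)
    (by
      push_cast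
      rwa [mul_div_cancel_right₀ _ hP.ne']) h
  push_cast [show A ≤ 2 ^ n by omega] at hc
  rw [mul_div_cancel_right₀ _ hP.ne'] at hc
  rintro ⟨u, w, hne, hu, hw, hform⟩
  push_cast at hform
  obtain ⟨h₁, h₂, h₃⟩ := not_small_of_smallFormOk (δ := 40 * X / (A ^ 2 * 2 ^ n)) h ha
    (hb.mono (by omega)) (hc.mono (by omega)) (Real.log_le_log (by linarith) (by linarith))
    (Real.log_le_log (by linarith) (by linarith))
    (by
      have h1 := Nat.lt_div_mul_add (a := 40 * X * 2 ^ P) (b := A ^ 2 * 2 ^ n) (by positivity)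
      have h2 : ((40 * X * 2 ^ P : ℕ) : ℝ) <
        ((40 * X * 2 ^ P / (A ^ 2 * 2 ^ n) * (A ^ 2 * 2 ^ n) + A ^ 2 * 2 ^ n : ℕ) : ℝ) := by
          exact_mod_cast h1
      push_cast at h2 ⊢
      generalize ((40 * X * 2 ^ P / (A ^ 2 * 2 ^ n) : ℕ) : ℝ) = d at *
      have h3 : (2 : ℝ) ^ P * (40 * X / (A ^ 2 * 2 ^ n)) ≤ d + 1 := by
        rw [← mul_div_assoc, div_le_iff₀ (by positivity)]
        linarith
      linarith) hne hu hw
  rcases hform with hf | hf | hf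
  · exact h₁.not_ge hf
  · exact h₂.not_ge hf
  · cases hs : (Nat.blt (5 * X * A) (2 ^ n) && Nat.blt (40 * X) (A ^ 3)) with
    | false => exact (h₃ hs).not_ge hf
    | true =>
      rw [Bool.and_eq_true] at hs
      have k₁ : 5 * X * A < 2 ^ n := Nat.le_of_ble_eq_true hs.1
      have k₂ : 40 * X < A ^ 3 := Nat.le_of_ble_eq_true hs.2
      have := ThueRoots.lt_abs_third_form (A := (A : ℤ)) (B := 2 ^ n) (V := X)
        (by exact_mod_cast hA) (by exact_mod_cast hB) (by exact_mod_cast k₂) (by exact_mod_cast k₁)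
        hne hw
      push_cast at this
      exact this.not_ge hf

end BakerDavenport

namespace BakerDavenport

/-- The value of `f` at two consecutive Fibonacci numbers, `k` steps after `A`, `A'`. -/
def withFib (f : ℕ → ℕ → Bool) (k : ℕ) : ℕ → ℕ → Bool :=
  Nat.rec (motive := fun _ => ℕ → ℕ → Bool) f
    (fun _ ih A A' => withValue (Nat.add A A') fun A'' => ih A' A'') k

theorem withFib_eq (f : ℕ → ℕ → Bool) (k n : ℕ) :
    withFib f k (Nat.fib n) (Nat.fib (n + 1)) = f (Nat.fib (n + k)) (Nat.fib (n + k + 1)) := by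
  induction k generalizing n with
  | zero => rfl
  | succ k ih =>
    have h := ih (n + 1)
    rw [Nat.fib_add_two, add_right_comm n 1 k] at h
    change (withValue (Nat.add (Nat.fib n) (Nat.fib (n + 1))) fun A'' =>
      withFib f k (Nat.fib (n + 1)) A'') = _
    rw [withValue_eq]
    exact h

/-- The check of `midIndexOkNat` for `k` consecutive indices starting with `m`. -/
def midRangeOkNat (m k : ℕ) : Bool :=
  withValue (logTwoApprox 800 9) fun l => withValue (2 ^ 368) fun X =>
  withFib (forallFib (midIndexOkNat 800 270 X l) k m) m 0 1

/-- The check of `midIndexOkBinet` for `k` consecutive indices starting with `m`. -/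
def midRangeOkBinet (m k : ℕ) : Bool :=
  withValue (newtonSqrt (5 * 4 ^ 800) 20 (2 ^ (800 + 2))) fun r =>
  Nat.ble (r ^ 2) (5 * 4 ^ 800) && Nat.ble (5 * 4 ^ 800) ((r + 1) ^ 2) &&
  withValue (logTwoApprox 800 9) fun l => withValue (logGoldenApprox 800 9 r) fun g =>
  withValue (logSqrtFiveApprox 800 9) fun s => withValue (2 ^ 368) fun X =>
  withFib (forallFib (midIndexOkBinet 800 X l g s) k m) m 0 1

theorem two_pow_le_nine_pow {P L : ℕ} (h : P + 2 ≤ 3 * 2 ^ L) : 2 ^ (P + 2) ≤ 9 ^ 2 ^ L :=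
  calc 2 ^ (P + 2) ≤ 2 ^ (3 * 2 ^ L) := Nat.pow_le_pow_right two_pos h
    _ = 8 ^ 2 ^ L := by rw [pow_mul]; norm_num
    _ ≤ 9 ^ 2 ^ L := Nat.pow_le_pow_left (by norm_num) _

theorem two_pow_succ_le_nine_pow {P N : ℕ} (h : P + 1 ≤ 3 * N) : 2 ^ (P + 1) ≤ 9 ^ N :=
  calc 2 ^ (P + 1) ≤ 2 ^ (3 * N) := Nat.pow_le_pow_right two_pos h
    _ = 8 ^ N := by rw [pow_mul]; norm_num
    _ ≤ 9 ^ N := Nat.pow_le_pow_left (by norm_num) _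

theorem isApprox_log_fib {P E g s n : ℕ} (hg : IsApprox P E g (Real.log Real.goldenRatio))
    (hs : IsApprox P E s (Real.log (√5))) (hn : 3 ≤ n) (hP : P + 1 ≤ n) :
    IsApprox P (n * E + E + 1) (natDist (n * g) s) (Real.log (Nat.fib n)) := by
  have h := (hg.nat_mul n).dist hs
  have h1 := abs_log_fib_sub_le n hn
  have hpos : 0 ≤ n * Real.log Real.goldenRatio - Real.log (√5) := by
    have h3 : Nat.fib 3 ≤ Nat.fib n := Nat.fib_mono hn
    have h4 : (2 : ℝ) ≤ Nat.fib n := by exact_mod_cast h3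
    have h5 := Real.log_le_log two_pos h4
    have h6 : (2 : ℝ) / 2 ^ n ≤ 1 / 4 := by
      rw [div_le_div_iff₀ (by positivity) (by norm_num)]
      have : (2 : ℝ) ^ 3 ≤ 2 ^ n := pow_le_pow_right₀ (by norm_num) hn
      linarith
    have h7 := Real.log_two_gt_d9
    have h8 := (abs_le.1 h1).2
    linarith
  rw [abs_of_nonneg hpos] at h
  have hP' : (2 : ℝ) ^ P * (2 / 2 ^ n) ≤ 1 := by
    rw [← mul_div_assoc, div_le_one (by positivity), ← pow_succ]
    exact pow_le_pow_right₀ (by norm_num) hP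
  have h2 := (mul_le_mul_of_nonneg_left h1 (show (0 : ℝ) ≤ 2 ^ P by positivity)).trans hP'
  rw [← abs_of_pos (show (0 : ℝ) < 2 ^ P by positivity), ← abs_mul] at h2
  unfold IsApprox at *
  push_cast at *
  rw [abs_le] at *
  constructor <;> linarith

theorem not_smallForm_of_midRangeOkNat {m k n : ℕ} (h : midRangeOkNat m k = true) (hn : 3 ≤ n)
    (hm : m ≤ n) (hk : n < m + k) :
    ¬ ThueRoots.SmallForm (Nat.fib n : ℤ) (2 ^ n : ℤ) (2 ^ 368 : ℕ)
      (40 * (2 ^ 368 : ℕ) / (Nat.fib n ^ 2 * 2 ^ n)) := by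
  simp only [midRangeOkNat, withValue_eq] at h
  rw [← Nat.fib_zero, ← Nat.fib_one, ← zero_add 1, withFib_eq] at h
  simp only [zero_add] at h
  have h := of_forallFib h hm hk
  simp only [midIndexOkNat, withValue_eq] at h
  have h4 := Nat.four_mul_fib_le n hn
  have h2 : 2 ≤ Nat.fib n := Nat.fib_mono hn
  have hl := isApprox_logTwo (two_pow_le_nine_pow (P := 800) (L := 9) (by norm_num))
  refine not_smallForm_of_midIndexOk h2 h4 ?_ (hl.nat_mul n) h
  have := (isApprox_logNat (Q := 0) (w := n) (M := Nat.fib n) hl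
    (two_pow_succ_le_nine_pow (N := 270) (by norm_num)) (by rw [pow_zero]; omega)
    (by rw [zero_add]; omega)).mono (show _ ≤ n * (2 ^ 10 + 2) + 2 ^ 10 + 8 by omega)
  simpa using this

theorem not_smallForm_of_midRangeOkBinet {m k n : ℕ} (h : midRangeOkBinet m k = true)
    (hn : 801 ≤ n) (hm : m ≤ n) (hk : n < m + k) :
    ¬ ThueRoots.SmallForm (Nat.fib n : ℤ) (2 ^ n : ℤ) (2 ^ 368 : ℕ)
      (40 * (2 ^ 368 : ℕ) / (Nat.fib n ^ 2 * 2 ^ n)) := by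
  simp only [midRangeOkBinet, withValue_eq, Bool.and_eq_true] at h
  obtain ⟨⟨hr, hr'⟩, h⟩ := h
  have hr := Nat.le_of_ble_eq_true hr
  have hr' := Nat.le_of_ble_eq_true hr'
  rw [← Nat.fib_zero, ← Nat.fib_one, ← zero_add 1, withFib_eq] at h
  simp only [zero_add] at h
  have h := of_forallFib h hm hk
  simp only [midIndexOkBinet, withValue_eq] at h
  have hn3 : 3 ≤ n := by omega
  have h4 := Nat.four_mul_fib_le n hn3
  have h2 : 2 ≤ Nat.fib n := Nat.fib_mono hn3
  have hP := two_pow_le_nine_pow (P := 800) (L := 9) (by norm_num)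
  have hl := isApprox_logTwo hP
  refine not_smallForm_of_midIndexOk h2 h4 ?_ (hl.nat_mul n) h
  exact (isApprox_log_fib (isApprox_logGolden hP hr hr') (isApprox_logSqrtFive hP) hn3 hn).mono
    (by omega)

set_option maxHeartbeats 0 in
set_option maxRecDepth 100000 in
set_option exponentiation.threshold 100000 in
theorem midRangeOkNat_eq_true {i : ℕ} (hi : i < 5) : midRangeOkNat (316 + 97 * i) 97 = true := by
  interval_cases i <;> decide +kernel

set_option maxHeartbeats 0 in
set_option maxRecDepth 100000 in
set_option exponentiation.threshold 100000 in
theorem midRangeOkBinet_eq_true {i : ℕ} (hi : i < 32) :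
    midRangeOkBinet (801 + 99 * i) 99 = true := by
  interval_cases i <;> decide +kernel

end BakerDavenport

set_option exponentiation.threshold 1000 in
theorem not_mem_Ico_of_solution {n : ℕ} (h₁ : 316 ≤ n) (h₂ : n < 3960) {x y : ℤ} (hy : 2 ≤ |y|) :
    |((x * (x - (Nat.fib n : ℤ) * y) * (x - (2 : ℤ) ^ n * y) - y ^ 3 : ℤ) : ℝ)| ≠ 1 := by
  intro h
  have hn : 3 ≤ n := by omega
  have hA : (2 : ℤ) ≤ Nat.fib n := by exact_mod_cast Nat.fib_mono hn
  have hB : 4 * (Nat.fib n : ℤ) ≤ 2 ^ n := by exact_mod_cast Nat.four_mul_fib_le n hn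
  obtain ⟨S⟩ := ThueRoots.nonempty hA hB
  have hlog : 3 * Real.log ((2 ^ n : ℤ) : ℝ) ≤ 52 / 25 * 2 ^ 12 := by
    push_cast
    rw [Real.log_pow]
    have h1 : (n : ℝ) ≤ 4096 := by exact_mod_cast (by omega : n ≤ 4096)
    have h2 := Real.log_two_lt_d9
    have h3 : (0 : ℝ) ≤ n := by positivity
    norm_num at h2 ⊢
    nlinarith
  have hsf := S.smallForm h hy le_rfl hlog (e := 368) (by norm_num)
  have hX : ((2 ^ 368 : ℕ) : ℝ) = 2 ^ 368 := Nat.cast_pow 2 368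
  rcases lt_or_ge n 801 with hlt | hge
  · refine BakerDavenport.not_smallForm_of_midRangeOkNat
      (BakerDavenport.midRangeOkNat_eq_true (i := (n - 316) / 97) (by omega)) hn (by omega) (by omega)
      (by rw [hX]; simpa using hsf)
  · refine BakerDavenport.not_smallForm_of_midRangeOkBinet
      (BakerDavenport.midRangeOkBinet_eq_true (i := (n - 801) / 99) (by omega)) hge (by omega)
      (by omega) (by rw [hX]; simpa using hsf)

theorem mul_sub_mul_sub_ne_two {A B x : ℤ} (hA : 2 ≤ A) (hB : 4 * A ≤ B) :
    x * (x - A) * (x - B) ≠ 2 := by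
  intro h
  have hx : x ∣ 2 := ⟨(x - A) * (x - B), by rw [← h]; ring⟩
  have hle : |x| ≤ 2 := Int.le_of_dvd two_pos ((abs_dvd x 2).2 hx)
  obtain ⟨h1, h2⟩ := abs_le.1 hle
  interval_cases x
  · nlinarith
  · nlinarith
  · simp at h
  · nlinarith
  · rcases hA.eq_or_lt with rfl | hA
    · simp at h
    · nlinarith

/-- For any integer `n ≥ 3`, the Thue equation `x(x - Fₙ y)(x - 2ⁿ y) - y³ = ±1`
has exactly the trivial solutions. -/
theorem thue_fib_pow2_solutions (n : ℕ) (hn : 3 ≤ n) :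
    {p : ℤ × ℤ |
        p.1 * (p.1 - (Nat.fib n : ℤ) * p.2) * (p.1 - 2 ^ n * p.2) - p.2 ^ 3 = 1 ∨
        p.1 * (p.1 - (Nat.fib n : ℤ) * p.2) * (p.1 - 2 ^ n * p.2) - p.2 ^ 3 = -1} =
      {(1, 0), (-1, 0), (0, 1), (0, -1), ((Nat.fib n : ℤ), 1), (-(Nat.fib n : ℤ), -1),
        ((2 : ℤ) ^ n, 1), (-((2 : ℤ) ^ n), -1)} := by
  have hA : (2 : ℤ) ≤ Nat.fib n := by exact_mod_cast Nat.fib_mono hn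
  have hB : 4 * (Nat.fib n : ℤ) ≤ 2 ^ n := by exact_mod_cast Nat.four_mul_fib_le n hn
  ext ⟨x, y⟩
  simp only [Set.mem_ofPred_eq, Set.mem_insert_iff, Set.mem_singleton_iff, Prod.mk.injEq]
  constructor
  · intro h
    have hy : |y| < 2 := by
      by_contra! hy
      have h1 : |((x * (x - (Nat.fib n : ℤ) * y) * (x - (2 : ℤ) ^ n * y) - y ^ 3 : ℤ) : ℝ)| = 1 := by
        rcases h with h | h <;> rw [h] <;> norm_num
      exact not_mem_Ico_of_solution (index_ge_of_solution hn hy h1) (index_lt_of_solution hy h1) hy h1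
    generalize (Nat.fib n : ℤ) = A at *
    generalize (2 : ℤ) ^ n = B at *
    obtain ⟨hy1, hy2⟩ := abs_lt.1 hy
    obtain rfl | rfl | rfl : y = 0 ∨ y = 1 ∨ y = -1 := by omega
    · have h1 : |x| ^ 3 = 1 := by
        rw [← abs_pow, show x ^ 3 = x * (x - A * 0) * (x - B * 0) - 0 ^ 3 by ring]
        rcases h with h | h <;> rw [h] <;> rfl
      have h2 : |x| = 1 := (pow_eq_one_iff_of_nonneg (abs_nonneg x) three_ne_zero).1 h1
      rcases (abs_eq zero_le_one).1 h2 with rfl | rfl <;> simp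
    · rcases h with h | h
      · exact absurd (by linarith) (mul_sub_mul_sub_ne_two (x := x) hA hB)
      · have h0 : x * (x - A) * (x - B) = 0 := by linarith
        rcases mul_eq_zero.1 h0 with h0 | h0
        · rcases mul_eq_zero.1 h0 with h0 | h0
          · simp [h0]
          · simp [sub_eq_zero.1 h0]
        · simp [sub_eq_zero.1 h0]
    · rcases h with h | h
      · have h0 : x * (x + A) * (x + B) = 0 := by linarith
        rcases mul_eq_zero.1 h0 with h0 | h0
        · rcases mul_eq_zero.1 h0 with h0 | h0
          · simp [h0]
          · simp [eq_neg_of_add_eq_zero_left h0]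
        · simp [eq_neg_of_add_eq_zero_left h0]
      · exact absurd (by linarith) (mul_sub_mul_sub_ne_two (x := -x) hA hB)
  · rintro (⟨rfl, rfl⟩ | ⟨rfl, rfl⟩ | ⟨rfl, rfl⟩ | ⟨rfl, rfl⟩ | ⟨rfl, rfl⟩ | ⟨rfl, rfl⟩ |
      ⟨rfl, rfl⟩ | ⟨rfl, rfl⟩) <;> norm_num
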